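/- Fix an integer g ≥ 2 and set μ_g = (g−1)/2 and σ_g² = (g²−1)/12. For every fixed ε > 0 there is a constant C = C(ε, g) such that for all real x ≥ 3 and all integers ℓ ≥ 0 with gcd(ℓ, g−1) = 1, one has | #{primes p ≤ x : s_g(p) = ℓ} − ((g−1)/φ(g−1)) · (π(x)/√(2π σ_g² (log x)/(log g))) · exp(−(ℓ − μ_g (log x)/(log g))² / (2 σ_g² (log x)/(log g))) | ≤ C · ((g−1)/φ(g−1)) · (π(x)/√(2π σ_g² (log x)/(log g))) · (log x)^{−1/2+ε}. -/

import Mathlib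

open Real
set_option linter.all false

open ArithmeticFunction (vonMangoldt vonMangoldt_apply_prime vonMangoldt_le_log vonMangoldt_nonneg)

namespace DMR
open Finset

/-- additive character -/
noncomputable def ee (t : ℝ) : ℂ := Complex.exp ((2 * π * t : ℝ) * Complex.I)

lemma ee_zero : ee 0 = 1 := by simp [ee]
lemma ee_add (s t : ℝ) : ee (s + t) = ee s * ee t := by
  rw [ee, ee, ee, ← Complex.exp_add]; congr 1; push_cast; ring
lemma ee_neg (t : ℝ) : ee (-t) = (starRingEnd ℂ) (ee t) := by
  rw [ee, ee, ← Complex.exp_conj]; congr 1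
  rw [map_mul, Complex.conj_ofReal, Complex.conj_I]; push_cast; ring
lemma ee_sub (s t : ℝ) : ee (s - t) = ee s * (starRingEnd ℂ) (ee t) := by
  rw [sub_eq_add_neg, ee_add, ee_neg]
@[simp] lemma norm_ee (t : ℝ) : ‖ee t‖ = 1 := Complex.norm_exp_ofReal_mul_I _
lemma ee_int (n : ℤ) : ee n = 1 := by
  rw [ee, Complex.exp_eq_one_iff]; exact ⟨n, by push_cast; ring⟩
lemma ee_add_int (t : ℝ) (n : ℤ) : ee (t + n) = ee t := by rw [ee_add, ee_int, mul_one]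
lemma ee_nat_mul (n : ℕ) (t : ℝ) : ee (n * t) = ee t ^ n := by
  rw [ee, ee, ← Complex.exp_nat_mul]; congr 1; push_cast; ring
/-- distance to the nearest integer -/
noncomputable def nd (t : ℝ) : ℝ := |t - round t|

lemma nd_nonneg (t : ℝ) : 0 ≤ nd t := abs_nonneg _
lemma nd_le_half (t : ℝ) : nd t ≤ 1 / 2 := abs_sub_round t
lemma nd_le (t : ℝ) (n : ℤ) : nd t ≤ |t - n| := round_le t n
lemma nd_add_int (t : ℝ) (n : ℤ) : nd (t + n) = nd t := by
  simp [nd, round_add_intCast]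
lemma nd_add_nat (t : ℝ) (n : ℕ) : nd (t + n) = nd t := by exact_mod_cast nd_add_int t n
lemma nd_neg (t : ℝ) : nd (-t) = nd t := by
  apply le_antisymm
  · have := nd_le (-t) (-round t)
    refine this.trans (le_of_eq ?_); unfold nd; rw [← abs_neg]; congr 1; push_cast; ring
  · have := nd_le t (-round (-t))
    refine this.trans (le_of_eq ?_); unfold nd; rw [← abs_neg]; congr 1; push_cast; ring
lemma nd_add_le (s t : ℝ) : nd (s + t) ≤ nd s + nd t := by
  have := nd_le (s + t) (round s + round t)
  refine this.trans ?_
  have h : s + t - ((round s + round t : ℤ) : ℝ) = (s - round s) + (t - round t) := by push_cast; ring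
  rw [h]; exact abs_add_le _ _
lemma nd_sub_le (s t : ℝ) : nd (s - t) ≤ nd s + nd t := by
  rw [sub_eq_add_neg, ← nd_neg t]; exact nd_add_le _ _
lemma nd_nat_mul_le (n : ℕ) (t : ℝ) : nd (n * t) ≤ n * nd t := by
  induction n with
  | zero => simp [nd]
  | succ n ih =>
    have := nd_add_le (n * t) t
    push_cast; rw [add_mul, one_mul, add_mul, one_mul]; linarith
/-- rational lower bound -/
lemma nd_rat_ge (a : ℤ) (D : ℕ) (hD : 0 < D) (h : ¬ (D : ℤ) ∣ a) : 1 / (D : ℝ) ≤ nd ((a : ℝ) / D) := by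
  have hD' : (0 : ℝ) < D := by exact_mod_cast hD
  unfold nd
  set r := round ((a : ℝ) / D)
  have h1 : (a : ℝ) / D - r = ((a - r * D : ℤ) : ℝ) / D := by push_cast; field_simp
  rw [h1, abs_div, abs_of_pos hD']
  apply div_le_div_of_nonneg_right _ hD'.le
  have h2 : a - r * D ≠ 0 := fun h0 => h ⟨r, by linarith [h0]⟩
  exact_mod_cast Int.one_le_abs h2

lemma abs_sin_ge_nd (t : ℝ) : 2 * nd t ≤ |Real.sin (π * t)| := by
  have h1 : |Real.sin (π * t)| = |Real.sin (π * (t - round t))| := by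
    have := Real.sin_sub_int_mul_pi (π * t) (round t)
    rw [show π * (t - round t) = π * t - (round t : ℤ) * π by ring, this, abs_mul]
    simp
  have h2 : |Real.sin (π * (t - round t))| = Real.sin (π * nd t) := by
    have hh := nd_le_half t
    have hn := nd_nonneg t
    have hs : 0 ≤ Real.sin (π * nd t) :=
      Real.sin_nonneg_of_nonneg_of_le_pi (by positivity) (by nlinarith [pi_pos])
    unfold nd at *
    rcases abs_cases (t - round t) with h | h
    · rw [h.1] at hs ⊢; exact abs_of_nonneg hs
    · rw [h.1] at hs ⊢; rw [mul_neg, Real.sin_neg] at hs ⊢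
      rw [abs_of_nonpos (by linarith)]
  rw [h1, h2]
  have := Real.mul_le_sin (x := π * nd t) (by have := nd_nonneg t; positivity)
    (by nlinarith [nd_le_half t, pi_pos])
  calc 2 * nd t = 2 / π * (π * nd t) := by field_simp
    _ ≤ _ := this

lemma norm_one_sub_ee (t : ℝ) : ‖1 - ee t‖ = 2 * |Real.sin (π * t)| := by
  have h : 1 - ee t = -(2 * Complex.I) * Complex.sin ((π * t : ℝ)) * ee (t / 2) := by
    rw [Complex.sin, ee, ee]
    have h1 : Complex.exp (((2 * π * t : ℝ) : ℂ) * Complex.I)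
       = Complex.exp (((π * t : ℝ) : ℂ) * Complex.I) * Complex.exp (((π * t : ℝ) : ℂ) * Complex.I) := by
      rw [← Complex.exp_add]; congr 1; push_cast; ring
    have h2 : Complex.exp (((2 * π * (t / 2) : ℝ) : ℂ) * Complex.I) = Complex.exp (((π * t : ℝ) : ℂ) * Complex.I) := by
      congr 1; push_cast; ring
    have h3 : Complex.exp (-((π * t : ℝ) : ℂ) * Complex.I) * Complex.exp (((π * t : ℝ) : ℂ) * Complex.I) = 1 := by
      rw [← Complex.exp_add]; simp
    rw [h1, h2]
    linear_combination (1 : ℂ) * (-1) * h3 + (Complex.exp (-((π * t : ℝ) : ℂ) * Complex.I) * Complex.exp (((π * t : ℝ) : ℂ) * Complex.I) - Complex.exp (((π * t : ℝ) : ℂ) * Complex.I)* Complex.exp (((π * t : ℝ) : ℂ) * Complex.I)) * Complex.I_sq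
  rw [h, norm_mul, norm_mul, norm_ee, ← Complex.ofReal_sin, Complex.norm_real]
  simp

lemma norm_one_sub_ee_ge (t : ℝ) : 4 * nd t ≤ ‖1 - ee t‖ := by
  rw [norm_one_sub_ee]; linarith [abs_sin_ge_nd t]

lemma norm_one_sub_ee_le (t : ℝ) : ‖1 - ee t‖ ≤ 2 * π * |t| := by
  rw [norm_one_sub_ee]
  have := Real.abs_sin_le_abs (x := π * t)
  rw [abs_mul, abs_of_pos pi_pos] at this
  linarith

/-- kernel bounding geometric sums -/
noncomputable def Ker (M t : ℝ) : ℝ := 2 * M / (1 + 2 * M * nd t)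

lemma Ker_nonneg {M : ℝ} (hM : 0 ≤ M) (t : ℝ) : 0 ≤ Ker M t := by
  have := nd_nonneg t; unfold Ker; positivity
lemma Ker_le {M : ℝ} (hM : 0 ≤ M) (t : ℝ) : Ker M t ≤ 2 * M := by
  have := nd_nonneg t
  unfold Ker
  apply div_le_self (by positivity)
  have : 0 ≤ 2 * M * nd t := by positivity
  linarith
lemma Ker_le_inv {M : ℝ} (hM : 0 ≤ M) {t c : ℝ} (hc : 0 < c) (ht : c ≤ nd t) : Ker M t ≤ 1 / c := by
  have := nd_nonneg t
  unfold Ker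
  have h0 : 0 ≤ 2 * M * nd t := by positivity
  rw [div_le_div_iff₀ (by linarith) hc]
  have : 2 * M * c ≤ 2 * M * nd t := by gcongr
  linarith
lemma Ker_le_of_nd {M D : ℝ} (hM : 0 ≤ M) (hD : 1 ≤ D) {s t : ℝ} (h : nd s ≤ D * nd t) :
    Ker M t ≤ D * Ker M s := by
  have h1 := nd_nonneg s
  have h2 := nd_nonneg t
  unfold Ker
  rw [← mul_div_assoc, div_le_div_iff₀ (by positivity) (by positivity)]
  have : 2 * M * (2 * M * nd s) ≤ 2 * M * (2 * M * (D * nd t)) := by gcongr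
  have : 2 * M ≤ 2 * M * D := by nlinarith
  nlinarith
lemma Ker_add_int (M t : ℝ) (n : ℤ) : Ker M (t + n) = Ker M t := by
  unfold Ker; rw [nd_add_int]
lemma Ker_neg (M t : ℝ) : Ker M (-t) = Ker M t := by
  unfold Ker; rw [nd_neg]

lemma geom_sum_le (θ : ℝ) (a b : ℕ) (M : ℝ) (hM : ((b : ℝ) - a) ≤ M) (hM0 : 0 ≤ M) :
    ‖∑ m ∈ Finset.Ioc a b, ee (m * θ)‖ ≤ Ker M θ := by
  have hn := nd_nonneg θ
  rcases le_total b a with hab | hab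
  · rw [Finset.Ioc_eq_empty (by omega)]; simpa using Ker_nonneg hM0 θ
  have h1 : ‖∑ m ∈ Finset.Ioc a b, ee (m * θ)‖ ≤ M := by
    refine (norm_sum_le _ _).trans ?_
    simp only [norm_ee, sum_const, Nat.card_Ioc, nsmul_eq_mul, mul_one]
    push_cast [Nat.cast_sub hab]; exact hM
  have h2 : ‖∑ m ∈ Finset.Ioc a b, ee (m * θ)‖ * (2 * nd θ) ≤ 1 := by
    have key : (∑ m ∈ Finset.Ioc a b, ee (m * θ)) * (1 - ee θ) = ee ((a + 1 : ℕ) * θ) - ee ((b + 1 : ℕ) * θ) := by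
      induction b, hab using Nat.le_induction with
      | base => simp
      | succ b hab ih =>
        rw [Finset.sum_Ioc_succ_top (by omega), add_mul, ih (by push_cast at hM ⊢; linarith)
          ((norm_sum_le _ _).trans ?_)]
        · have : ee ((b + 1 + 1 : ℕ) * θ) = ee ((b + 1 : ℕ) * θ) * ee θ := by
            rw [← ee_add]; congr 1; push_cast; ring
          rw [this]; ring
        · simp only [norm_ee, sum_const, Nat.card_Ioc, nsmul_eq_mul, mul_one]
          push_cast [Nat.cast_sub hab] at hM ⊢; linarith
    have h3 : ‖∑ m ∈ Finset.Ioc a b, ee (m * θ)‖ * ‖1 - ee θ‖ ≤ 2 := by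
      rw [← norm_mul, key]
      refine (norm_sub_le _ _).trans ?_
      simp only [norm_ee]; norm_num
    have h4 := norm_one_sub_ee_ge θ
    have h5 : ‖∑ m ∈ Finset.Ioc a b, ee (m * θ)‖ * (4 * nd θ) ≤ 2 :=
      (mul_le_mul_of_nonneg_left h4 (norm_nonneg _)).trans h3
    linarith
  set S := ‖∑ m ∈ Finset.Ioc a b, ee (m * θ)‖
  unfold Ker
  rw [le_div_iff₀ (by positivity)]
  nlinarith

/-- sum of a periodic function composed with a coprime multiplication -/
lemma sum_periodic_coprime (D : ℕ) (hD : 0 < D) (a : ℤ) (ha : IsCoprime a (D : ℤ)) (H : ℤ → ℝ)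
    (hH : ∀ n k : ℤ, H (n + k * D) = H n) :
    ∑ k ∈ range D, H (a * k) = ∑ k ∈ range D, H k := by
  haveI : NeZero D := ⟨hD.ne'⟩
  have hmod : ∀ n : ℤ, H n = H ((n : ZMod D).val) := by
    intro n
    have h1 : (((n : ZMod D).val : ℤ) : ZMod D) = (n : ZMod D) := by simp
    rw [ZMod.intCast_eq_intCast_iff_dvd_sub] at h1
    obtain ⟨c, hc⟩ := h1
    rw [show n = ((n : ZMod D).val : ℤ) + c * D by linarith]
    rw [hH]; congr 1; simp
  have hsum : ∀ G : ZMod D → ℝ, ∑ k ∈ range D, G (k : ZMod D) = ∑ z : ZMod D, G z := by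
    intro G
    symm
    apply Finset.sum_bij (fun z _ => z.val)
    · intro z _; exact mem_range.mpr (ZMod.val_lt z)
    · intro z _ z' _ h; exact ZMod.val_injective D h
    · intro k hk; exact ⟨(k : ZMod D), mem_univ _, ZMod.val_cast_of_lt (mem_range.mp hk)⟩
    · intro z _; simp
  have hu : IsUnit (a : ZMod D) := by
    obtain ⟨u, v, huv⟩ := ha
    apply IsUnit.of_mul_eq_one (u : ZMod D)
    have := congrArg (fun z : ℤ => (z : ZMod D)) huv
    push_cast at this; simp at this; rw [mul_comm]; exact this
  obtain ⟨u, hu⟩ := hu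
  calc ∑ k ∈ range D, H (a * k) = ∑ k ∈ range D, (fun z : ZMod D => H (((u : ZMod D) * z).val)) (k : ZMod D) := by
        apply sum_congr rfl; intro k _; rw [hmod]; simp [hu]
    _ = ∑ z : ZMod D, H (((u : ZMod D) * z).val) := hsum (fun z : ZMod D => H (((u : ZMod D) * z).val))
    _ = ∑ z : ZMod D, H (z.val) :=
        Fintype.sum_equiv (Units.mulLeft u) _ _ (fun z => rfl)
    _ = ∑ k ∈ range D, (fun z : ZMod D => H (z.val)) (k : ZMod D) := (hsum (fun z : ZMod D => H (z.val))).symm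
    _ = _ := by apply sum_congr rfl; intro k _; rw [hmod k]; simp

lemma sum_inv_le_log (n : ℕ) : ∑ i ∈ range n, 1 / ((i : ℝ) + 1) ≤ 1 + log n := by
  have h := harmonic_le_one_add_log n
  rw [harmonic] at h
  push_cast at h
  simpa [one_div] using h

lemma block_sum_le (D : ℕ) (hD : 0 < D) (a : ℤ) (ha : IsCoprime a (D : ℤ)) (β M : ℝ) (hM : 0 ≤ M) :
    ∑ k ∈ range D, Ker M ((a : ℝ) * k / D + β) ≤ 4 * M + 2 * D * (1 + log D) := by
  have hD' : (0 : ℝ) < D := by exact_mod_cast hD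
  -- shift β to [0,1/D)
  set c := ⌊β * D⌋
  set β' := β - c / D
  have hβ0 : 0 ≤ β' := by
    have := Int.floor_le (β * D)
    show 0 ≤ β - c / D
    rw [sub_nonneg, div_le_iff₀ hD']; exact this
  have hβ1 : β' < 1 / D := by
    have := Int.lt_floor_add_one (β * D)
    show β - c / D < 1 / D
    rw [sub_lt_iff_lt_add, ← add_div, lt_div_iff₀ hD']; linarith
  have h1 : ∑ k ∈ range D, Ker M ((a : ℝ) * k / D + β) = ∑ k ∈ range D, Ker M ((k : ℝ) / D + β) := by
    have := sum_periodic_coprime D hD a ha (fun n => Ker M ((n : ℝ) / D + β)) (by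
      intro n k
      show Ker M (((n + k * D : ℤ) : ℝ) / D + β) = _
      rw [← Ker_add_int M ((n : ℝ) / D + β) k]; congr 1; push_cast; field_simp; ring)
    simpa using this
  have h2 : ∑ k ∈ range D, Ker M ((k : ℝ) / D + β) = ∑ k ∈ range D, Ker M ((k : ℝ) / D + β') := by
    have hper : ∀ k : ℤ, Ker M (((k + D : ℤ) : ℝ) / D + β') = Ker M ((k : ℝ) / D + β') := by
      intro k
      rw [← Ker_add_int M ((k : ℝ) / D + β') 1]; congr 1; push_cast; field_simp; ring
    have hshift : ∀ c : ℤ, ∑ k ∈ range D, Ker M (((k + (c + 1) : ℤ) : ℝ) / D + β') = ∑ k ∈ range D, Ker M (((k + c : ℤ) : ℝ) / D + β') := by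
      intro c
      have e1 := Finset.sum_range_succ' (fun k : ℕ => Ker M ((((k : ℤ) + c : ℤ) : ℝ) / D + β')) D
      have e2 := Finset.sum_range_succ (fun k : ℕ => Ker M ((((k : ℤ) + c : ℤ) : ℝ) / D + β')) D
      have e3 := hper c
      have e4 : ∑ k ∈ range D, Ker M (((k + (c + 1) : ℤ) : ℝ) / D + β') = ∑ k ∈ range D, Ker M (((((k + 1 : ℕ) : ℤ) + c : ℤ) : ℝ) / D + β') := by
        apply sum_congr rfl; intro k _; congr 3; push_cast; ring
      rw [e4]
      rw [e1] at e2
      have e5 : Ker M (((((0 : ℕ) : ℤ) + c : ℤ) : ℝ) / D + β') = Ker M ((((D : ℤ) + c : ℤ) : ℝ) / D + β') := by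
        rw [show ((D : ℤ) + c) = c + D by ring, hper]; simp
      linarith
    have hall : ∀ c : ℤ, ∑ k ∈ range D, Ker M (((k + c : ℤ) : ℝ) / D + β') = ∑ k ∈ range D, Ker M (((k + 0 : ℤ) : ℝ) / D + β') := by
      intro c
      induction c using Int.induction_on with
      | zero => rfl
      | succ i ih => rw [hshift, ih]
      | pred i ih => rw [← ih, ← hshift]; congr 1; ext k; congr 3; push_cast; ring
    have := hall c
    push_cast at this
    simp only [add_zero] at this
    rw [← this]
    apply sum_congr rfl; intro k _; congr 1; simp only [β']; ring
  rw [h1, h2]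
  -- pointwise bound
  have hpt : ∀ k ∈ range D, Ker M ((k : ℝ) / D + β') ≤
      (if k = 0 then 2 * M else 0) + (if k = D - 1 then 2 * M else 0)
        + (D * (1 / (k : ℝ)) + D * (1 / ((D - 1 - k : ℕ) : ℝ))) := by
    intro k hk
    rw [mem_range] at hk
    have hp1 : (0 : ℝ) ≤ D * (1 / (k : ℝ)) := by positivity
    have hp2 : (0 : ℝ) ≤ D * (1 / ((D - 1 - k : ℕ) : ℝ)) := by positivity
    have hKM := Ker_le hM ((k : ℝ) / D + β')
    by_cases h0 : k = 0
    · rw [if_pos h0]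
      have : (0 : ℝ) ≤ (if k = D - 1 then 2 * M else 0) := by split_ifs <;> positivity
      linarith
    by_cases h3 : k = D - 1
    · rw [if_pos h3, if_neg h0]; linarith
    rw [if_neg h0, if_neg h3]
    have hkpos : (0 : ℝ) < k := by exact_mod_cast Nat.pos_of_ne_zero h0
    have hk2 : (0 : ℝ) < ((D - 1 - k : ℕ) : ℝ) := by
      have : 0 < D - 1 - k := by omega
      exact_mod_cast this
    have hcast : ((D - 1 - k : ℕ) : ℝ) = D - 1 - k := by
      rw [Nat.cast_sub (by omega), Nat.cast_sub (by omega)]; simp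
    set t := (k : ℝ) / D + β'
    have ht1 : (k : ℝ) / D ≤ t := by show (k : ℝ) / D ≤ (k : ℝ) / D + β'; linarith
    have ht2 : t ≤ (k + 1 : ℝ) / D := by
      show (k : ℝ) / D + β' ≤ _
      rw [add_div]; linarith
    have hnd : (k : ℝ) / D ≤ nd t ∨ ((D - 1 - k : ℕ) : ℝ) / D ≤ nd t := by
      unfold nd
      rcases le_or_gt (round t) 0 with hr | hr
      · left
        have : (round t : ℝ) ≤ 0 := by exact_mod_cast hr
        have := le_abs_self (t - round t)
        linarith
      · right
        have : (1 : ℝ) ≤ round t := by exact_mod_cast hr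
        have h5 := neg_le_abs (t - round t)
        rw [hcast]
        have : ((D : ℝ) - 1 - k) / D = 1 - (k + 1) / D := by field_simp; ring
        linarith
    rcases hnd with h | h
    · have := Ker_le_inv hM (by positivity) h
      have e : 1 / ((k : ℝ) / D) = D * (1 / (k : ℝ)) := by field_simp
      linarith
    · have := Ker_le_inv hM (by positivity) h
      have e : 1 / (((D - 1 - k : ℕ) : ℝ) / D) = D * (1 / ((D - 1 - k : ℕ) : ℝ)) := by field_simp
      linarith
  refine (sum_le_sum hpt).trans ?_
  rw [sum_add_distrib, sum_add_distrib, sum_add_distrib, ← mul_sum, ← mul_sum]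
  rw [Finset.sum_ite_eq' , Finset.sum_ite_eq', sum_range_reflect (fun k : ℕ => 1 / (k : ℝ)) D]
  rw [if_pos (mem_range.mpr hD), if_pos (mem_range.mpr (by omega))]
  have hh : ∑ k ∈ range D, 1 / (k : ℝ) ≤ 1 + log D := by
    obtain ⟨E, rfl⟩ : ∃ E, D = E + 1 := ⟨D - 1, by omega⟩
    rw [sum_range_succ']
    have h1 := sum_inv_le_log (E + 1)
    rw [sum_range_succ] at h1
    have h2 : (0 : ℝ) ≤ 1 / ((E : ℝ) + 1) := by positivity
    push_cast at h1 ⊢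
    simp only [div_zero, add_zero]
    linarith
  nlinarith

lemma sum_range_shift_supp {E : Type*} [AddCommMonoid E] (h : ℕ → E) (N L i : ℕ) (hL : N < L)
    (hh : ∀ k, N < k → h k = 0) :
    ∑ j ∈ range (L + i), (if i ≤ j then h (j - i) else 0) = ∑ k ∈ range (N + 1), h k := by
  rw [add_comm L i, sum_range_add]
  have h1 : ∑ x ∈ range i, (if i ≤ x then h (x - i) else 0) = 0 := by
    apply sum_eq_zero; intro x hx; rw [mem_range] at hx; rw [if_neg (by omega)]
  rw [h1, zero_add]
  simp only [le_add_iff_nonneg_right, zero_le, if_true, add_tsub_cancel_left]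
  symm
  apply sum_subset
  · intro x hx; rw [mem_range] at *; omega
  · intro x _ hx; apply hh; rw [mem_range] at hx; omega

/-- van der Corput inequality, averaged over a family. -/
lemma vdc {ι : Type*} (S : Finset ι) (z : ι → ℕ → ℂ) (N R : ℕ) (hR : 1 ≤ R) (hRN : R ≤ N)
    (hz : ∀ m ∈ S, ∀ k, N < k → z m k = 0) :
    ∑ m ∈ S, ‖∑ k ∈ range (N + 1), z m k‖ ^ 2 ≤
      (4 * N + 4 : ℝ) / R * ∑ r ∈ range R, ‖∑ k ∈ range (N + 1), ∑ m ∈ S, z m (k + r) * (starRingEnd ℂ) (z m k)‖ := by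
  set L := N + 1 + R
  set C : ℕ → ℂ := fun r => ∑ k ∈ range (N + 1), ∑ m ∈ S, z m (k + r) * (starRingEnd ℂ) (z m k) with hC
  let w : ι → ℕ → ℂ := fun m j => ∑ i ∈ range R, (if i ≤ j then z m (j - i) else 0)
  have hR0 : (0 : ℝ) < R := by exact_mod_cast hR
  have hw1 : ∀ m ∈ S, ∑ j ∈ range L, w m j = R * ∑ k ∈ range (N + 1), z m k := by
    intro m hm
    simp only [w]
    rw [sum_comm]
    rw [show (R : ℂ) * ∑ k ∈ range (N + 1), z m k = ∑ i ∈ range R, ∑ k ∈ range (N + 1), z m k by simp]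
    apply sum_congr rfl
    intro i hi
    rw [mem_range] at hi
    have := sum_range_shift_supp (z m) N (L - i) i (by omega) (hz m hm)
    rwa [show L - i + i = L by omega] at this
  -- pair sums
  have hpair : ∀ i r, i + r < R → ∑ m ∈ S, ∑ j ∈ range L,
      (if i ≤ j then z m (j - i) else 0) * (starRingEnd ℂ) (if i + r ≤ j then z m (j - (i + r)) else 0) = C r := by
    intro i r hir
    simp only [C]
    rw [sum_comm (s := range (N + 1))]
    apply sum_congr rfl
    intro m hm
    have := sum_range_shift_supp (fun k => z m (k + r) * (starRingEnd ℂ) (z m k)) N (L - (i + r)) (i + r) (by omega)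
      (by intro k hk; simp [hz m hm k hk])
    rw [show L - (i + r) + (i + r) = L by omega] at this
    rw [← this]
    apply sum_congr rfl
    intro j _
    by_cases h : i + r ≤ j
    · rw [if_pos h, if_pos h, if_pos (by omega)]; congr 2; omega
    · simp [if_neg h]
  have hsq : ((∑ m ∈ S, ∑ j ∈ range L, ‖w m j‖ ^ 2 : ℝ) : ℂ) =
      ∑ i ∈ range R, ∑ i' ∈ range R, ∑ m ∈ S, ∑ j ∈ range L,
      (if i ≤ j then z m (j - i) else 0) * (starRingEnd ℂ) (if i' ≤ j then z m (j - i') else 0) := by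
    push_cast
    have : ∀ m j, ((‖w m j‖ : ℂ)) ^ 2 = ∑ i ∈ range R, ∑ i' ∈ range R,
       (if i ≤ j then z m (j - i) else 0) * (starRingEnd ℂ) (if i' ≤ j then z m (j - i') else 0) := by
      intro m j
      rw [← Complex.mul_conj', ← sum_mul_sum, ← map_sum]
    simp_rw [this]
    rw [sum_congr rfl (fun m _ => sum_comm), sum_comm]
    apply sum_congr rfl; intro i _
    rw [sum_congr rfl (fun m _ => sum_comm), sum_comm]
  have hbd : ∑ m ∈ S, ∑ j ∈ range L, ‖w m j‖ ^ 2 ≤ 2 * R * ∑ r ∈ range R, ‖C r‖ := by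
    have h0 : ∑ m ∈ S, ∑ j ∈ range L, ‖w m j‖ ^ 2 = ‖((∑ m ∈ S, ∑ j ∈ range L, ‖w m j‖ ^ 2 : ℝ) : ℂ)‖ := by
      rw [Complex.norm_real, norm_of_nonneg]; positivity
    rw [h0, hsq]
    refine (norm_sum_le _ _).trans ?_
    have : ∀ i ∈ range R, ‖∑ i' ∈ range R, ∑ m ∈ S, ∑ j ∈ range L,
      (if i ≤ j then z m (j - i) else 0) * (starRingEnd ℂ) (if i' ≤ j then z m (j - i') else 0)‖ ≤ 2 * ∑ r ∈ range R, ‖C r‖ := by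
      intro i hi
      rw [mem_range] at hi
      refine (norm_sum_le _ _).trans ?_
      obtain ⟨R', rfl⟩ : ∃ R', R = i + (R' + 1) := ⟨R - i - 1, by omega⟩
      rw [sum_range_add _ i (R' + 1)]
      have h1 : ∑ x ∈ range (R' + 1), ‖∑ m ∈ S, ∑ j ∈ range L,
        (if i ≤ j then z m (j - i) else 0) * (starRingEnd ℂ) (if i + x ≤ j then z m (j - (i + x)) else 0)‖ ≤ ∑ r ∈ range (i + (R' + 1)), ‖C r‖ := by
        calc _ = ∑ x ∈ range (R' + 1), ‖C x‖ := by
              apply sum_congr rfl; intro x hx; rw [mem_range] at hx; rw [hpair i x (by omega)]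
          _ ≤ _ := sum_le_sum_of_subset_of_nonneg (by intro x hx; rw [mem_range] at *; omega) (by intros; positivity)
      have h2 : ∑ x ∈ range i, ‖∑ m ∈ S, ∑ j ∈ range L,
        (if i ≤ j then z m (j - i) else 0) * (starRingEnd ℂ) (if x ≤ j then z m (j - x) else 0)‖ ≤ ∑ r ∈ range (i + (R' + 1)), ‖C r‖ := by
        calc _ = ∑ x ∈ range i, ‖C (i - 1 - x + 1)‖ := by
              apply sum_congr rfl; intro x hx; rw [mem_range] at hx
              rw [← hpair x (i - 1 - x + 1) (by omega), ← Complex.norm_conj]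
              rw [map_sum]
              congr 1; apply sum_congr rfl; intro m _; rw [map_sum]; apply sum_congr rfl; intro j _
              rw [show x + (i - 1 - x + 1) = i by omega, map_mul, Complex.conj_conj, mul_comm]
          _ = ∑ x ∈ range i, ‖C (x + 1)‖ := sum_range_reflect (fun x => ‖C (x + 1)‖) i
          _ ≤ ∑ x ∈ range (i + 1), ‖C x‖ := by
              rw [sum_range_succ']; linarith [norm_nonneg (C 0)]
          _ ≤ _ := sum_le_sum_of_subset_of_nonneg (by intro x hx; rw [mem_range] at *; omega) (by intros; positivity)
      linarith
    refine (sum_le_sum this).trans ?_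
    simp; linarith
  have hcs : ∀ m ∈ S, (R : ℝ) ^ 2 * ‖∑ k ∈ range (N + 1), z m k‖ ^ 2 ≤ L * ∑ j ∈ range L, ‖w m j‖ ^ 2 := by
    intro m hm
    have e : (R : ℝ) ^ 2 * ‖∑ k ∈ range (N + 1), z m k‖ ^ 2 = ‖∑ j ∈ range L, w m j‖ ^ 2 := by
      rw [hw1 m hm, norm_mul, mul_pow]; simp
    rw [e]
    calc ‖∑ j ∈ range L, w m j‖ ^ 2 ≤ (∑ j ∈ range L, ‖w m j‖) ^ 2 := by gcongr; exact norm_sum_le _ _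
      _ ≤ _ := by
        have := sq_sum_le_card_mul_sum_sq (s := range L) (f := fun j => ‖w m j‖)
        simpa using this
  have hfin : (R : ℝ) ^ 2 * ∑ m ∈ S, ‖∑ k ∈ range (N + 1), z m k‖ ^ 2 ≤ L * (2 * R * ∑ r ∈ range R, ‖C r‖) := by
    rw [mul_sum]
    refine (sum_le_sum hcs).trans ?_
    rw [← mul_sum]; gcongr
  have hL : (L : ℝ) ≤ 2 * N + 2 := by
    have : L ≤ 2 * N + 2 := by omega
    exact_mod_cast this
  rw [div_mul_eq_mul_div, le_div_iff₀ hR0]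
  have hp : 0 ≤ ∑ r ∈ range R, ‖C r‖ := by positivity
  have h7 : (R : ℝ) ^ 2 * ∑ m ∈ S, ‖∑ k ∈ range (N + 1), z m k‖ ^ 2 ≤ (2 * N + 2) * (2 * R * ∑ r ∈ range R, ‖C r‖) :=
    hfin.trans (by gcongr)
  have h8 : R * (R * ∑ m ∈ S, ‖∑ k ∈ range (N + 1), z m k‖ ^ 2) ≤ R * ((4 * N + 4) * ∑ r ∈ range R, ‖C r‖) := by nlinarith
  have := le_of_mul_le_mul_left h8 hR0
  linarith

/-- divisor function -/
def tau (n : ℕ) : ℕ := n.divisors.card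

lemma tau_mul_le (a b : ℕ) : tau (a * b) ≤ tau a * tau b := by
  unfold tau
  rw [Nat.divisors_mul]
  exact Finset.card_mul_le

lemma sum_divisorsAntidiagonal_Ioc {E : Type*} [AddCommMonoid E] (X : ℕ) (G : ℕ → ℕ → E) :
    ∑ n ∈ Ioc 0 X, ∑ x ∈ n.divisorsAntidiagonal, G x.1 x.2 = ∑ a ∈ Ioc 0 X, ∑ b ∈ Ioc 0 (X / a), G a b := by
  rw [sum_sigma', sum_sigma']
  apply sum_bij' (fun x _ => (⟨x.2.1, x.2.2⟩ : (_ : ℕ) × ℕ)) (fun y _ => (⟨y.1 * y.2, (y.1, y.2)⟩ : (_ : ℕ) × (ℕ × ℕ)))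
  · rintro ⟨n, a, b⟩ h
    simp only [mem_sigma, mem_Ioc, Nat.mem_divisorsAntidiagonal] at h ⊢
    obtain ⟨⟨h1, h2⟩, rfl, h4⟩ := h
    have ha : 0 < a := Nat.pos_of_mul_pos_right h1 |> fun _ => Nat.pos_of_ne_zero (by rintro rfl; simp at h4)
    have hb : 0 < b := Nat.pos_of_ne_zero (by rintro rfl; simp at h4)
    refine ⟨⟨ha, le_trans (Nat.le_mul_of_pos_right a hb) h2⟩, hb, ?_⟩
    rw [Nat.le_div_iff_mul_le ha]; linarith
  · rintro ⟨a, b⟩ h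
    simp only [mem_sigma, mem_Ioc, Nat.mem_divisorsAntidiagonal] at h ⊢
    obtain ⟨⟨ha, h2⟩, hb, h4⟩ := h
    rw [Nat.le_div_iff_mul_le ha] at h4
    exact ⟨⟨Nat.mul_pos ha hb, by linarith⟩, trivial, (Nat.mul_pos ha hb).ne'⟩
  · rintro ⟨n, a, b⟩ h
    simp only [mem_sigma, mem_Ioc, Nat.mem_divisorsAntidiagonal] at h ⊢
    obtain ⟨_, rfl, _⟩ := h
    rfl
  · rintro ⟨a, b⟩ h; rfl
  · rintro ⟨n, a, b⟩ h; rfl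

lemma one_le_ell {N : ℕ} : (1 : ℝ) ≤ 1 + log N := by
  have := log_natCast_nonneg N; linarith

lemma ell_mono {N X : ℕ} (h : N ≤ X) : 1 + log N ≤ 1 + log X := by
  rcases Nat.eq_zero_or_pos N with rfl | h0
  · simpa using log_natCast_nonneg X
  · have : log N ≤ log X := log_le_log (by exact_mod_cast h0) (by exact_mod_cast h)
    linarith

lemma sum_Ioc_eq_range {E : Type*} [AddCommMonoid E] (N : ℕ) (h : ℕ → E) :
    ∑ k ∈ Ioc 0 N, h k = ∑ k ∈ range N, h (k + 1) := by
  rw [range_eq_Ico, sum_Ico_add' h 0 N 1]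
  apply sum_congr _ (fun _ _ => rfl)
  ext x; simp; omega

lemma tau_moment (j N : ℕ) : ∑ k ∈ Ioc 0 N, (tau k : ℝ) ^ j / k ≤ (1 + log N) ^ (2 ^ j) := by
  induction j with
  | zero =>
    simp only [pow_zero, pow_one]
    rw [sum_Ioc_eq_range]
    have := sum_inv_le_log N
    push_cast; exact this
  | succ j ih =>
    have h1 : ∀ k ∈ Ioc 0 N, (tau k : ℝ) ^ (j + 1) / k ≤ ∑ x ∈ k.divisorsAntidiagonal,
        ((tau x.1 : ℝ) ^ j / x.1) * ((tau x.2 : ℝ) ^ j / x.2) := by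
      intro k hk
      have hcard : (tau k : ℝ) = k.divisorsAntidiagonal.card := by
        rw [tau, ← Nat.map_div_right_divisors, card_map]
      have : (tau k : ℝ) ^ (j + 1) / k = ∑ x ∈ k.divisorsAntidiagonal, (tau k : ℝ) ^ j / k := by
        rw [sum_const, nsmul_eq_mul, ← hcard]; ring
      rw [this]
      apply sum_le_sum
      intro x hx
      rw [Nat.mem_divisorsAntidiagonal] at hx
      rw [div_mul_div_comm, ← mul_pow, ← hx.1]
      push_cast
      gcongr
      exact_mod_cast tau_mul_le _ _
    refine (sum_le_sum h1).trans ?_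
    rw [sum_divisorsAntidiagonal_Ioc N (fun a b => ((tau a : ℝ) ^ j / a) * ((tau b : ℝ) ^ j / b))]
    calc _ ≤ ∑ a ∈ Ioc 0 N, ∑ b ∈ Ioc 0 N, ((tau a : ℝ) ^ j / a) * ((tau b : ℝ) ^ j / b) := by
          apply sum_le_sum; intro a ha
          apply sum_le_sum_of_subset_of_nonneg
          · intro b hb; rw [mem_Ioc] at *; exact ⟨hb.1, hb.2.trans (Nat.div_le_self _ _)⟩
          · intros; positivity
      _ = (∑ k ∈ Ioc 0 N, (tau k : ℝ) ^ j / k) ^ 2 := by rw [sq, sum_mul_sum]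
      _ ≤ ((1 + log N) ^ (2 ^ j)) ^ 2 := by gcongr
      _ = _ := by rw [← pow_mul, pow_succ]

lemma tau_pow_sum (j N X : ℕ) (hX : N ≤ X) :
    ∑ k ∈ Ioc 0 N, (tau k : ℝ) ^ j ≤ N * (1 + log X) ^ (2 ^ j) := by
  calc _ ≤ ∑ k ∈ Ioc 0 N, N * ((tau k : ℝ) ^ j / k) := by
        apply sum_le_sum; intro k hk
        rw [mem_Ioc] at hk
        have hk0 : (0 : ℝ) < k := by exact_mod_cast hk.1
        have hk1 : (k : ℝ) ≤ N := by exact_mod_cast hk.2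
        rw [mul_div_assoc', le_div_iff₀ hk0, mul_comm]
        gcongr
    _ = N * ∑ k ∈ Ioc 0 N, ((tau k : ℝ) ^ j / k) := by rw [mul_sum]
    _ ≤ N * (1 + log N) ^ (2 ^ j) := by gcongr; exact tau_moment j N
    _ ≤ _ := by
      have := @one_le_ell N
      have := ell_mono hX
      gcongr

/-- type II correlation sum -/
noncomputable def TT (f : ℕ → ℂ) (X M M' r : ℕ) : ℝ :=
  ∑ k ∈ Ioc 0 (X / M), ‖∑ m ∈ (Ioc M M').filter (fun m => m * (k + r) ≤ X),
    f (m * (k + r)) * (starRingEnd ℂ) (f (m * k))‖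

lemma TT_nonneg (f : ℕ → ℂ) (X M M' r : ℕ) : 0 ≤ TT f X M M' r := by unfold TT; positivity

lemma TT_inner_le (f : ℕ → ℂ) (hf : ∀ n, ‖f n‖ ≤ 1) (X M M' r k : ℕ) (h2 : M' ≤ 2 * M) :
    ‖∑ m ∈ (Ioc M M').filter (fun m => m * (k + r) ≤ X),
    f (m * (k + r)) * (starRingEnd ℂ) (f (m * k))‖ ≤ M := by
  refine (norm_sum_le _ _).trans ?_
  calc _ ≤ ∑ m ∈ (Ioc M M').filter (fun m => m * (k + r) ≤ X), (1 : ℝ) := by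
        apply sum_le_sum; intro m _
        rw [norm_mul, Complex.norm_conj]
        exact mul_le_one₀ (hf _) (norm_nonneg _) (hf _)
    _ = (((Ioc M M').filter (fun m => m * (k + r) ≤ X)).card : ℝ) := by simp
    _ ≤ ((Ioc M M').card : ℝ) := by exact_mod_cast card_filter_le _ _
    _ ≤ M := by rw [Nat.card_Ioc]; exact_mod_cast (by omega)

lemma TT_le (f : ℕ → ℂ) (hf : ∀ n, ‖f n‖ ≤ 1) (X M M' r : ℕ) (h2 : M' ≤ 2 * M) :
    TT f X M M' r ≤ X := by
  unfold TT
  calc _ ≤ ∑ k ∈ Ioc 0 (X / M), (M : ℝ) := sum_le_sum (fun k _ => TT_inner_le f hf X M M' r k h2)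
    _ = ((X / M * M : ℕ) : ℝ) := by simp
    _ ≤ X := by exact_mod_cast Nat.div_mul_le_self X M

/-- the bilinear block estimate -/
lemma typeII_block (f : ℕ → ℂ) (hf : ∀ n, ‖f n‖ ≤ 1) (X M M' R : ℕ) (hM : 1 ≤ M)
    (h2 : M' ≤ 2 * M) (hMX : M' ≤ X) (hR : 1 ≤ R) (hRN : R ≤ X / M)
    (H δ : ℝ) (hH : 0 ≤ H) (hδ : 0 ≤ δ) (a c : ℕ → ℂ) (ha : ∀ m, ‖a m‖ ≤ H * tau m) (hc : ∀ m, ‖c m‖ ≤ H * tau m)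
    (hRδ : 1 / (R : ℝ) ≤ δ ^ 2) (hT : ∑ r ∈ Ico 1 R, TT f X M M' r ≤ R * X * δ ^ 4) :
    ‖∑ m ∈ Ioc M M', a m * ∑ k ∈ Ioc 0 (X / m), c k * f (m * k)‖ ≤
      6 * H ^ 2 * (1 + log X) ^ 6 * X * δ := by
  classical
  set N := X / M with hN
  set l := 1 + log X with hl
  have hl1 : 1 ≤ l := one_le_ell
  have hR0 : (0 : ℝ) < R := by exact_mod_cast hR
  have hNX : N ≤ X := Nat.div_le_self _ _
  have hMN : (M : ℝ) * N ≤ X := by exact_mod_cast Nat.mul_div_le X M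
  let z : ℕ → ℕ → ℂ := fun m k => if 0 < k ∧ m * k ≤ X then c k * f (m * k) else 0
  have hz : ∀ m ∈ Ioc M M', ∀ k, N < k → z m k = 0 := by
    intro m hm k hk
    rw [mem_Ioc] at hm
    simp only [z]
    rw [if_neg]
    rintro ⟨h0, h1⟩
    have : k ≤ N := by
      rw [hN, Nat.le_div_iff_mul_le (by omega)]
      calc k * M ≤ k * m := by gcongr; omega
        _ ≤ X := by rw [mul_comm]; exact h1
    omega
  have hinner : ∀ m ∈ Ioc M M', ∑ k ∈ Ioc 0 (X / m), c k * f (m * k) = ∑ k ∈ range (N + 1), z m k := by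
    intro m hm
    have hm' := mem_Ioc.mp hm
    simp only [z]
    rw [← sum_filter]
    apply sum_congr _ (fun _ _ => rfl)
    ext k
    simp only [mem_Ioc, mem_filter, mem_range]
    rw [Nat.le_div_iff_mul_le (by omega)]
    constructor
    · rintro ⟨h0, h1⟩
      refine ⟨?_, h0, by linarith⟩
      by_contra hcon
      have := hz m hm k (by omega)
      have : k ≤ N := by
        rw [hN, Nat.le_div_iff_mul_le (by omega)]
        exact le_trans (by gcongr; omega) h1
      omega
    · rintro ⟨_, h0, h1⟩; exact ⟨h0, by linarith⟩
  -- bound for correlations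
  have hτ4 : ∑ k ∈ Ioc 0 N, ‖c k‖ ^ 4 ≤ H ^ 4 * (N * l ^ 16) := by
    calc _ ≤ ∑ k ∈ Ioc 0 N, H ^ 4 * (tau k : ℝ) ^ 4 := by
          apply sum_le_sum; intro k _; rw [← mul_pow]; gcongr; exact hc k
      _ = H ^ 4 * ∑ k ∈ Ioc 0 N, (tau k : ℝ) ^ 4 := by rw [mul_sum]
      _ ≤ _ := by
        have := tau_pow_sum 4 N X hNX
        norm_num at this
        gcongr
  have hτ2 : ∑ m ∈ Ioc M M', ‖a m‖ ^ 2 ≤ H ^ 2 * (2 * M * l ^ 4) := by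
    calc _ ≤ ∑ m ∈ Ioc M M', H ^ 2 * (tau m : ℝ) ^ 2 := by
          apply sum_le_sum; intro k _; rw [← mul_pow]; gcongr; exact ha k
      _ ≤ ∑ m ∈ Ioc 0 M', H ^ 2 * (tau m : ℝ) ^ 2 := by
          apply sum_le_sum_of_subset_of_nonneg
          · intro x hx; rw [mem_Ioc] at *; omega
          · intros; positivity
      _ = H ^ 2 * ∑ k ∈ Ioc 0 M', (tau k : ℝ) ^ 2 := by rw [mul_sum]
      _ ≤ H ^ 2 * (M' * l ^ 4) := by
        have := tau_pow_sum 2 M' X hMX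
        norm_num at this
        gcongr
      _ ≤ _ := by
        have : (M' : ℝ) ≤ 2 * M := by exact_mod_cast h2
        gcongr
  have hC : ∀ r, ‖∑ k ∈ range (N + 1), ∑ m ∈ Ioc M M', z m (k + r) * (starRingEnd ℂ) (z m k)‖ ≤
      H ^ 2 * l ^ 8 * √ X * √ (TT f X M M' r) := by
    intro r
    set W : ℕ → ℝ := fun k => ‖∑ m ∈ (Ioc M M').filter (fun m => m * (k + r) ≤ X),
      f (m * (k + r)) * (starRingEnd ℂ) (f (m * k))‖ with hW
    set c' : ℕ → ℝ := fun k => if k ≤ N then ‖c k‖ else 0 with hc'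
    have h1 : ∀ k, 0 < k → ‖∑ m ∈ Ioc M M', z m (k + r) * (starRingEnd ℂ) (z m k)‖ ≤ c' (k + r) * ‖c k‖ * W k := by
      intro k hk
      have e : ∑ m ∈ Ioc M M', z m (k + r) * (starRingEnd ℂ) (z m k) = (c (k + r) * (starRingEnd ℂ) (c k)) *
          ∑ m ∈ (Ioc M M').filter (fun m => m * (k + r) ≤ X),
            f (m * (k + r)) * (starRingEnd ℂ) (f (m * k)) := by
        rw [mul_sum, sum_filter]
        apply sum_congr rfl
        intro m _
        simp only [z]
        by_cases h : m * (k + r) ≤ X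
        · have h' : m * k ≤ X := le_trans (by gcongr; omega) h
          rw [if_pos ⟨by omega, h⟩, if_pos ⟨hk, h'⟩, if_pos h, map_mul]; ring
        · rw [if_neg (by tauto), if_neg h]; ring
      by_cases hkr : k + r ≤ N
      · rw [e, norm_mul, norm_mul, Complex.norm_conj]
        simp only [c', if_pos hkr, W]; exact le_rfl
      · have : ∑ m ∈ Ioc M M', z m (k + r) * (starRingEnd ℂ) (z m k) = 0 := by
          apply sum_eq_zero; intro m hm; rw [hz m hm (k + r) (by omega), zero_mul]
        rw [this]; simp [c', if_neg hkr]
    have h2' : ‖∑ k ∈ range (N + 1), ∑ m ∈ Ioc M M', z m (k + r) * (starRingEnd ℂ) (z m k)‖ ≤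
        ∑ k ∈ Ioc 0 N, (c' (k + r) * ‖c k‖) * W k := by
      rw [sum_range_succ']
      have : ∑ m ∈ Ioc M M', z m (0 + r) * (starRingEnd ℂ) (z m 0) = 0 := by simp [z]
      rw [this, add_zero, sum_Ioc_eq_range]
      refine (norm_sum_le _ _).trans (sum_le_sum fun k _ => h1 (k + 1) (by omega))
    refine h2'.trans ?_
    have hcs := sum_mul_sq_le_sq_mul_sq (Ioc 0 N) (fun k => c' (k + r) * ‖c k‖) W
    have hA : ∑ k ∈ Ioc 0 N, (c' (k + r) * ‖c k‖) ^ 2 ≤ H ^ 4 * (N * l ^ 16) := by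
      have hsh : ∑ k ∈ Ioc 0 N, (c' (k + r)) ^ 4 ≤ ∑ k ∈ Ioc 0 N, ‖c k‖ ^ 4 := by
        calc _ = ∑ k ∈ (Ioc 0 N).filter (fun k => k + r ≤ N), ‖c (k + r)‖ ^ 4 := by
              rw [sum_filter]; apply sum_congr rfl; intro k _; simp only [c']; split_ifs <;> simp
          _ = ∑ k ∈ ((Ioc 0 N).filter (fun k => k + r ≤ N)).image (fun k => k + r), ‖c k‖ ^ 4 := by
              rw [sum_image]; intro x _ y _ h; simpa using h
          _ ≤ _ := by
              apply sum_le_sum_of_subset_of_nonneg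
              · intro x hx
                simp only [mem_image, mem_filter, mem_Ioc] at *
                obtain ⟨y, hy, rfl⟩ := hx; omega
              · intros; positivity
      have : ∀ k ∈ Ioc 0 N, (c' (k + r) * ‖c k‖) ^ 2 ≤ (1 / 2) * (c' (k + r)) ^ 4 + (1 / 2) * ‖c k‖ ^ 4 := by
        intro k _; nlinarith [sq_nonneg (c' (k + r) ^ 2 - ‖c k‖ ^ 2)]
      have h3 := sum_le_sum this
      rw [sum_add_distrib, ← mul_sum, ← mul_sum] at h3
      linarith
    have hB : ∑ k ∈ Ioc 0 N, W k ^ 2 ≤ M * TT f X M M' r := by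
      unfold TT
      rw [mul_sum]
      apply sum_le_sum; intro k _
      rw [sq]
      exact mul_le_mul_of_nonneg_right (TT_inner_le f hf X M M' r k h2) (norm_nonneg _)
    have hTT := TT_nonneg f X M M' r
    apply le_of_sq_le_sq _ (by positivity) |> fun h => h
    calc (∑ k ∈ Ioc 0 N, (c' (k + r) * ‖c k‖) * W k) ^ 2 ≤ _ := hcs
      _ ≤ (H ^ 4 * (N * l ^ 16)) * (M * TT f X M M' r) := by
        apply mul_le_mul hA hB (by positivity) (by positivity)
      _ = H ^ 4 * l ^ 16 * (M * N) * TT f X M M' r := by ring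
      _ ≤ H ^ 4 * l ^ 16 * X * TT f X M M' r := by gcongr
      _ = (H ^ 2 * l ^ 8 * √ X * √ (TT f X M M' r)) ^ 2 := by
        rw [mul_pow, mul_pow, mul_pow, Real.sq_sqrt hTT, Real.sq_sqrt (by positivity)]; ring
  have hsumT : ∑ r ∈ range R, √ (TT f X M M' r) ≤ 2 * R * √ X * δ ^ 2 := by
    have h0 : √ (TT f X M M' 0) ≤ R * √ X * δ ^ 2 := by
      have h1 : √ (TT f X M M' 0) ≤ √ X := Real.sqrt_le_sqrt (TT_le f hf X M M' 0 h2)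
      have h2 : 1 ≤ R * δ ^ 2 := by rw [div_le_iff₀ hR0] at hRδ; linarith
      have := sqrt_nonneg (X : ℝ)
      nlinarith
    have h1 : ∑ r ∈ Ico 1 R, √ (TT f X M M' r) ≤ R * √ X * δ ^ 2 := by
      apply le_of_sq_le_sq _ (by positivity) |> fun h => h
      have h3 := sq_sum_le_card_mul_sum_sq (s := Ico 1 R) (f := fun r => √ (TT f X M M' r))
      have h4 : ∑ r ∈ Ico 1 R, √ (TT f X M M' r) ^ 2 = ∑ r ∈ Ico 1 R, TT f X M M' r :=
        sum_congr rfl (fun r _ => Real.sq_sqrt (TT_nonneg _ _ _ _ _))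
      rw [h4] at h3
      have h5 : ((Ico 1 R).card : ℝ) ≤ R := by rw [Nat.card_Ico]; exact_mod_cast Nat.sub_le _ _
      have h6 : 0 ≤ ∑ r ∈ Ico 1 R, TT f X M M' r := sum_nonneg (fun r _ => TT_nonneg _ _ _ _ _)
      calc _ ≤ _ := h3
        _ ≤ R * (R * X * δ ^ 4) := by gcongr
        _ = (R * √ X * δ ^ 2) ^ 2 := by
          rw [mul_pow, mul_pow, Real.sq_sqrt (by positivity)]; ring
    have : range R = insert 0 (Ico 1 R) := by ext x; simp; omega
    rw [this, sum_insert (by simp)]; linarith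
  have hv := vdc (Ioc M M') z N R hR hRN hz
  have hv2 : ∑ m ∈ Ioc M M', ‖∑ k ∈ range (N + 1), z m k‖ ^ 2 ≤ 16 * N * H ^ 2 * l ^ 8 * X * δ ^ 2 := by
    refine hv.trans ?_
    calc _ ≤ (4 * N + 4 : ℝ) / R * ∑ r ∈ range R, H ^ 2 * l ^ 8 * √ X * √ (TT f X M M' r) := by
          gcongr with r _; exact hC r
      _ = (4 * N + 4 : ℝ) / R * (H ^ 2 * l ^ 8 * √ X * ∑ r ∈ range R, √ (TT f X M M' r)) := by rw [← mul_sum]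
      _ ≤ (8 * N : ℝ) / R * (H ^ 2 * l ^ 8 * √ X * (2 * R * √ X * δ ^ 2)) := by
          have : (1 : ℝ) ≤ N := by exact_mod_cast hR.trans hRN
          gcongr
          linarith
      _ = 16 * N * H ^ 2 * l ^ 8 * (√ X) ^ 2 * δ ^ 2 := by field_simp; ring
      _ = _ := by rw [Real.sq_sqrt (by positivity)]
  rw [sum_congr rfl (fun m hm => by rw [hinner m hm])]
  apply le_of_sq_le_sq _ (by positivity) |> fun h => h
  calc ‖∑ m ∈ Ioc M M', a m * ∑ k ∈ range (N + 1), z m k‖ ^ 2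
      ≤ (∑ m ∈ Ioc M M', ‖a m‖ * ‖∑ k ∈ range (N + 1), z m k‖) ^ 2 := by
        gcongr; refine (norm_sum_le _ _).trans (le_of_eq ?_); simp only [norm_mul]
    _ ≤ (∑ m ∈ Ioc M M', ‖a m‖ ^ 2) * ∑ m ∈ Ioc M M', ‖∑ k ∈ range (N + 1), z m k‖ ^ 2 :=
        sum_mul_sq_le_sq_mul_sq _ _ _
    _ ≤ (H ^ 2 * (2 * M * l ^ 4)) * (16 * N * H ^ 2 * l ^ 8 * X * δ ^ 2) := by gcongr
    _ = 32 * H ^ 4 * l ^ 12 * (M * N) * X * δ ^ 2 := by ring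
    _ ≤ 36 * H ^ 4 * l ^ 12 * X * X * δ ^ 2 := by gcongr; norm_num
    _ = _ := by ring

lemma abel_mono (h : ℕ → ℝ) (hm : Monotone h) (h0 : 0 ≤ h 1) (c : ℕ → ℂ) (E : ℝ) (Y : ℕ) (hY1 : 1 ≤ Y)
    (hE : ∀ y ≤ Y, ‖∑ n ∈ Ioc 0 y, c n‖ ≤ E) :
    ‖∑ n ∈ Ioc 0 Y, (h n : ℂ) * c n‖ ≤ 2 * h Y * E := by
  have key : ∀ n, 1 ≤ n → ∑ k ∈ Ioc 0 n, (h k : ℂ) * c k = (h n : ℂ) * ∑ k ∈ Ioc 0 n, c k -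
      ∑ k ∈ Ico 1 n, ((h (k + 1) - h k : ℝ) : ℂ) * ∑ i ∈ Ioc 0 k, c i := by
    intro n hn
    induction n, hn using Nat.le_induction with
    | base => simp
    | succ n hn ih =>
      rw [sum_Ioc_succ_top (by omega), ih, sum_Ioc_succ_top (by omega), sum_Ico_succ_top hn]
      push_cast; ring
  have hE0 : 0 ≤ E := (norm_nonneg _).trans (hE 0 (by omega))
  rw [key Y hY1]
  have hsum : ∀ n, 1 ≤ n → ∑ k ∈ Ico 1 n, (h (k + 1) - h k) = h n - h 1 := by
    intro n hn
    exact sum_Ico_sub h hn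
  have hY0 : 0 ≤ h Y := h0.trans (hm hY1)
  refine (norm_sub_le _ _).trans ?_
  have e1 : ‖(h Y : ℂ) * ∑ k ∈ Ioc 0 Y, c k‖ ≤ h Y * E := by
    rw [norm_mul, Complex.norm_real, norm_of_nonneg hY0]; gcongr; exact hE Y le_rfl
  have e2 : ‖∑ k ∈ Ico 1 Y, ((h (k + 1) - h k : ℝ) : ℂ) * ∑ i ∈ Ioc 0 k, c i‖ ≤ (h Y - h 1) * E := by
    rw [← hsum Y hY1, sum_mul]
    refine (norm_sum_le _ _).trans (sum_le_sum ?_)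
    intro k hk
    rw [mem_Ico] at hk
    have : 0 ≤ h (k + 1) - h k := sub_nonneg.mpr (hm (by omega))
    rw [norm_mul, Complex.norm_real, norm_of_nonneg this]; gcongr; exact hE k (by omega)
  nlinarith

open ArithmeticFunction in
noncomputable def lo (U : ℕ) (f : ArithmeticFunction ℝ) : ArithmeticFunction ℝ :=
  ⟨fun n => if n ≤ U then f n else 0, by simp⟩

lemma af_sub_apply (F G : ArithmeticFunction ℝ) (n : ℕ) : (F - G) n = F n - G n := by
  rw [sub_eq_add_neg, ArithmeticFunction.add_apply, sub_eq_add_neg]; rfl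

lemma lo_apply (U : ℕ) (f : ArithmeticFunction ℝ) (n : ℕ) : lo U f n = if n ≤ U then f n else 0 := rfl

open ArithmeticFunction ArithmeticFunction.zeta ArithmeticFunction.Moebius in
lemma vaughan_identity (U : ℕ) :
    (Λ : ArithmeticFunction ℝ) = lo U Λ + lo U (μ : ArithmeticFunction ℝ) * ArithmeticFunction.log
      - (lo U Λ * lo U (μ : ArithmeticFunction ℝ)) * (ζ : ArithmeticFunction ℝ)
      + (Λ - lo U Λ) * ((ζ : ArithmeticFunction ℝ) * ((μ : ArithmeticFunction ℝ) - lo U (μ : ArithmeticFunction ℝ))) := by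
  have h1 : (μ : ArithmeticFunction ℝ) * (ζ : ArithmeticFunction ℝ) = 1 := coe_moebius_mul_coe_zeta
  have h2 : (Λ : ArithmeticFunction ℝ) * (ζ : ArithmeticFunction ℝ) = ArithmeticFunction.log := vonMangoldt_mul_zeta
  rw [← h2]
  linear_combination (-Λ + lo U Λ) * h1

/-- dyadic summation of blocks -/
lemma typeII_dyadic (f : ℕ → ℂ) (hf : ∀ n, ‖f n‖ ≤ 1) (X U : ℕ) (hU : 1 ≤ U) (hX : 1 ≤ X)
    (H δ : ℝ) (hH : 0 ≤ H) (hδ : 0 ≤ δ) (a c : ℕ → ℂ) (ha : ∀ m, ‖a m‖ ≤ H * tau m) (hc : ∀ m, ‖c m‖ ≤ H * tau m)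
    (hII : ∀ M M', U ≤ M → M < M' → M' ≤ 2 * M → M' * M' ≤ X → ∃ R : ℕ, 1 ≤ R ∧ R ≤ X / M ∧
      1 / (R : ℝ) ≤ δ ^ 2 ∧ ∑ r ∈ Ico 1 R, TT f X M M' r ≤ R * X * δ ^ 4) :
    ‖∑ m ∈ Ioc U (Nat.sqrt X), a m * ∑ k ∈ Ioc 0 (X / m), c k * f (m * k)‖ ≤
      12 * H ^ 2 * (1 + Real.log X) ^ 7 * X * δ := by
  set s := Nat.sqrt X
  set B := 6 * H ^ 2 * (1 + Real.log X) ^ 6 * X * δ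
  have hl1 : (1 : ℝ) ≤ 1 + Real.log X := one_le_ell
  have hB : 0 ≤ B := by simp only [B]; positivity
  set t : ℕ → ℂ := fun m => a m * ∑ k ∈ Ioc 0 (X / m), c k * f (m * k)
  have key : ∀ j : ℕ, ‖∑ m ∈ Ioc U (min (2 ^ j * U) s), t m‖ ≤ j * B := by
    intro j
    induction j with
    | zero =>
      rw [Ioc_eq_empty (by simp)]; simp
    | succ j ih =>
      by_cases hlt : 2 ^ j * U < s
      · have e1 : min (2 ^ j * U) s = 2 ^ j * U := min_eq_left hlt.le
        rw [e1] at ih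
        set M := 2 ^ j * U with hMdef
        set M' := min (2 ^ (j + 1) * U) s with hM'
        have hUM : U ≤ M := Nat.le_mul_of_pos_left U (by positivity)
        have h2M : 2 ^ (j + 1) * U = 2 * M := by rw [hMdef]; ring
        have hMM' : M < M' := by rw [hM', h2M]; exact lt_min (by omega) hlt
        have hM2 : M' ≤ 2 * M := by rw [hM', h2M]; exact min_le_left _ _
        have hM's : M' ≤ s := min_le_right _ _
        have hsq : M' * M' ≤ X := (Nat.mul_le_mul hM's hM's).trans (Nat.sqrt_le X)
        obtain ⟨R, hR1, hR2, hR3, hR4⟩ := hII M M' hUM hMM' hM2 hsq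
        have hb := typeII_block f hf X M M' R (hU.trans hUM) hM2 (hM's.trans (Nat.sqrt_le_self X)) hR1 hR2 H δ hH hδ a c ha hc hR3 hR4
        rw [← sum_Ioc_consecutive t hUM hMM'.le]
        refine (norm_add_le _ _).trans ?_
        push_cast
        have : ‖∑ m ∈ Ioc M M', t m‖ ≤ B := hb
        linarith
      · rw [min_eq_right (by rw [pow_succ]; push Not at hlt; nlinarith)]
        rw [min_eq_right (by push Not at hlt; exact hlt)] at ih
        push_cast; linarith
  have h1 := key (Nat.log 2 X + 1)
  rw [min_eq_right] at h1
  · refine h1.trans ?_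
    have hJ : ((Nat.log 2 X + 1 : ℕ) : ℝ) ≤ 2 * (1 + Real.log X) := by
      have hx : ((2 : ℝ) ^ (Nat.log 2 X)) ≤ X := by exact_mod_cast Nat.pow_log_le_self 2 (by omega)
      have := log_le_log (by positivity) hx
      rw [Real.log_pow] at this
      have hl2 := Real.log_two_gt_d9
      have : (0 : ℝ) ≤ Nat.log 2 X := by positivity
      push_cast
      nlinarith
    calc _ ≤ 2 * (1 + Real.log X) * B := by gcongr
      _ = _ := by simp only [B]; ring
  · calc s ≤ X := Nat.sqrt_le_self X
      _ ≤ 2 ^ (Nat.log 2 X + 1) := (Nat.lt_pow_succ_log_self (by norm_num) X).le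
      _ ≤ _ := Nat.le_mul_of_pos_right _ hU

open ArithmeticFunction ArithmeticFunction.zeta ArithmeticFunction.Moebius in
lemma sum_conv (A B : ArithmeticFunction ℝ) (f : ℕ → ℂ) (X : ℕ) :
    ∑ n ∈ Ioc 0 X, (((A * B) n : ℝ) : ℂ) * f n = ∑ a ∈ Ioc 0 X, (A a : ℂ) * ∑ b ∈ Ioc 0 (X / a), (B b : ℂ) * f (a * b) := by
  have := sum_divisorsAntidiagonal_Ioc X (fun a b => (A a : ℂ) * ((B b : ℂ) * f (a * b)))
  simp_rw [mul_sum]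
  rw [← this]
  apply sum_congr rfl
  intro n hn
  rw [ArithmeticFunction.mul_apply]
  push_cast
  rw [sum_mul]
  apply sum_congr rfl
  intro x hx
  rw [Nat.mem_divisorsAntidiagonal] at hx
  rw [hx.1]; ring

open ArithmeticFunction ArithmeticFunction.zeta ArithmeticFunction.Moebius in
theorem vaughan_bound (f : ℕ → ℂ) (hf : ∀ n, ‖f n‖ ≤ 1) (X U : ℕ) (hU : 1 ≤ U) (hX : 1 ≤ X)
    (δ : ℝ) (hδ : 0 ≤ δ) (E : ℕ → ℝ)
    (hE : ∀ m, 1 ≤ m → m ≤ U ^ 2 → ∀ Y, m * Y ≤ X → ‖∑ n ∈ Ioc 0 Y, f (m * n)‖ ≤ E m)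
    (hII : ∀ M M', U ≤ M → M < M' → M' ≤ 2 * M → M' * M' ≤ X → ∃ R : ℕ, 1 ≤ R ∧ R ≤ X / M ∧
      1 / (R : ℝ) ≤ δ ^ 2 ∧ ∑ r ∈ Ico 1 R, TT f X M M' r ≤ R * X * δ ^ 4) :
    ‖∑ n ∈ Ioc 0 X, (Λ n : ℂ) * f n‖ ≤ (1 + Real.log X) * (U + 3 * ∑ m ∈ Ioc 0 (U ^ 2), E m)
      + 24 * (1 + Real.log X) ^ 9 * X * δ := by
  set l := 1 + Real.log X with hl
  have hl1 : (1 : ℝ) ≤ l := one_le_ell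
  have hlog0 : 0 ≤ Real.log X := log_natCast_nonneg X
  have hE0 : ∀ m ∈ Ioc 0 (U ^ 2), 0 ≤ E m := by
    intro m hm
    rw [mem_Ioc] at hm
    have := hE m hm.1 hm.2 0 (by simp)
    simpa using this
  have hΛle : ∀ n ∈ Ioc 0 X, Λ n ≤ Real.log X := by
    intro n hn
    rw [mem_Ioc] at hn
    exact vonMangoldt_le_log.trans (log_le_log (by exact_mod_cast hn.1) (by exact_mod_cast hn.2))
  have hμ : ∀ n, |((μ : ArithmeticFunction ℝ) n)| ≤ 1 := by
    intro n
    rw [intCoe_apply]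
    exact_mod_cast abs_moebius_le_one (n := n)
  have hloμ : ∀ n, |lo U (μ : ArithmeticFunction ℝ) n| ≤ 1 := by
    intro n; rw [lo_apply]; split_ifs
    · exact hμ n
    · simp
  -- four pieces
  have hdec : ∑ n ∈ Ioc 0 X, (Λ n : ℂ) * f n =
      ∑ n ∈ Ioc 0 X, (lo U Λ n : ℂ) * f n
      + ∑ n ∈ Ioc 0 X, (((lo U (μ : ArithmeticFunction ℝ) * ArithmeticFunction.log) n : ℝ) : ℂ) * f n
      - ∑ n ∈ Ioc 0 X, ((((lo U Λ * lo U (μ : ArithmeticFunction ℝ)) * (ζ : ArithmeticFunction ℝ)) n : ℝ) : ℂ) * f n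
      + ∑ n ∈ Ioc 0 X, ((((Λ - lo U Λ) * ((ζ : ArithmeticFunction ℝ) * ((μ : ArithmeticFunction ℝ) - lo U (μ : ArithmeticFunction ℝ)))) n : ℝ) : ℂ) * f n := by
    rw [← sum_add_distrib, ← sum_sub_distrib, ← sum_add_distrib]
    apply sum_congr rfl
    intro n _
    have := congrArg (fun F : ArithmeticFunction ℝ => F n) (vaughan_identity U)
    simp only [ArithmeticFunction.add_apply, af_sub_apply] at this
    rw [this]; push_cast; ring
  -- piece 1
  have p1 : ‖∑ n ∈ Ioc 0 X, (lo U Λ n : ℂ) * f n‖ ≤ l * U := by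
    calc _ ≤ ∑ n ∈ Ioc 0 X, (if n ≤ U then Real.log X else 0) := by
          refine (norm_sum_le _ _).trans (sum_le_sum ?_)
          intro n hn
          rw [norm_mul, Complex.norm_real, lo_apply]
          split_ifs with h
          · rw [norm_of_nonneg vonMangoldt_nonneg]
            calc Λ n * ‖f n‖ ≤ Λ n * 1 := mul_le_mul_of_nonneg_left (hf n) vonMangoldt_nonneg
              _ ≤ _ := by rw [mul_one]; exact hΛle n hn
          · simp
      _ = ∑ n ∈ (Ioc 0 X).filter (fun n => n ≤ U), Real.log X := by rw [sum_filter]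
      _ ≤ ∑ n ∈ Ioc 0 U, Real.log X := by
          apply sum_le_sum_of_subset_of_nonneg
          · intro n hn; simp only [mem_filter, mem_Ioc] at *; omega
          · intros; exact hlog0
      _ = U * Real.log X := by simp
      _ ≤ l * U := by rw [mul_comm]; gcongr; linarith
  have hUU : U ≤ U ^ 2 := by nlinarith
  -- piece 2
  have p2 : ‖∑ n ∈ Ioc 0 X, (((lo U (μ : ArithmeticFunction ℝ) * ArithmeticFunction.log) n : ℝ) : ℂ) * f n‖
      ≤ 2 * l * ∑ m ∈ Ioc 0 (U ^ 2), E m := by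
    rw [sum_conv]
    calc _ ≤ ∑ m ∈ Ioc 0 X, (if m ≤ U then 2 * l * E m else 0) := by
          refine (norm_sum_le _ _).trans (sum_le_sum ?_)
          intro m hm
          rw [mem_Ioc] at hm
          rw [norm_mul, Complex.norm_real]
          split_ifs with h
          · have hY1 : 1 ≤ X / m := (Nat.one_le_div_iff (by omega)).mpr hm.2
            have hab := abel_mono (fun n : ℕ => Real.log (n : ℝ)) (by
                intro i j hij
                simp only
                rcases Nat.eq_zero_or_pos i with rfl | hi
                · simpa using log_natCast_nonneg j
                · exact log_le_log (by exact_mod_cast hi) (by exact_mod_cast hij)) (by simp) (fun n => f (m * n)) (E m) (X / m) hY1 (by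
                intro y hy
                apply hE m (by omega) (h.trans hUU) y
                rw [Nat.le_div_iff_mul_le (by omega)] at hy; linarith)
            have hE1 := hE0 m (by rw [mem_Ioc]; exact ⟨hm.1, h.trans hUU⟩)
            have hlogle : Real.log ((X / m : ℕ) : ℝ) ≤ l := by
              have : Real.log ((X / m : ℕ) : ℝ) ≤ Real.log X :=
                log_le_log (by exact_mod_cast hY1) (by exact_mod_cast Nat.div_le_self X m)
              linarith
            calc _ ≤ 1 * (2 * Real.log ((X / m : ℕ) : ℝ) * E m) := by
                  apply mul_le_mul (hloμ m) hab (norm_nonneg _) zero_le_one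
              _ ≤ _ := by rw [one_mul]; gcongr
          · rw [lo_apply, if_neg h]; simp
      _ = ∑ n ∈ (Ioc 0 X).filter (fun n => n ≤ U), 2 * l * E n := by rw [sum_filter]
      _ ≤ ∑ n ∈ Ioc 0 (U ^ 2), 2 * l * E n := by
          apply sum_le_sum_of_subset_of_nonneg
          · intro n hn; simp only [mem_filter, mem_Ioc] at *; omega
          · intro m hm _; have := hE0 m hm; positivity
      _ = _ := by rw [mul_sum]
  -- piece 3
  have p3 : ‖∑ n ∈ Ioc 0 X, ((((lo U Λ * lo U (μ : ArithmeticFunction ℝ)) * (ζ : ArithmeticFunction ℝ)) n : ℝ) : ℂ) * f n‖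
      ≤ l * ∑ m ∈ Ioc 0 (U ^ 2), E m := by
    rw [sum_conv]
    calc _ ≤ ∑ m ∈ Ioc 0 X, (if m ≤ U ^ 2 then l * E m else 0) := by
          refine (norm_sum_le _ _).trans (sum_le_sum ?_)
          intro m hm
          rw [mem_Ioc] at hm
          rw [norm_mul, Complex.norm_real]
          split_ifs with h
          · have e : ∑ b ∈ Ioc 0 (X / m), (((ζ : ArithmeticFunction ℝ) b : ℝ) : ℂ) * f (m * b) = ∑ b ∈ Ioc 0 (X / m), f (m * b) := by
              apply sum_congr rfl; intro b hb; rw [mem_Ioc] at hb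
              rw [natCoe_apply, zeta_apply_ne (by omega)]; simp
            rw [e]
            have h1 := hE m (by omega) h (X / m) (Nat.mul_div_le X m)
            have h2 : ‖(lo U Λ * lo U (μ : ArithmeticFunction ℝ)) m‖ ≤ l := by
              rw [ArithmeticFunction.mul_apply]
              calc _ ≤ ∑ x ∈ m.divisorsAntidiagonal, Λ x.1 := by
                    refine (norm_sum_le _ _).trans (sum_le_sum ?_)
                    intro x _
                    rw [norm_mul]
                    calc _ ≤ Λ x.1 * 1 := by
                          apply mul_le_mul _ (hloμ _) (abs_nonneg _) vonMangoldt_nonneg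
                          rw [lo_apply]; split_ifs
                          · rw [norm_of_nonneg vonMangoldt_nonneg]
                          · simpa using vonMangoldt_nonneg
                      _ = _ := mul_one _
                _ = ∑ i ∈ m.divisors, Λ i := Nat.sum_divisorsAntidiagonal (fun a _ => Λ a)
                _ = Real.log m := vonMangoldt_sum
                _ ≤ Real.log X := log_le_log (by exact_mod_cast hm.1) (by exact_mod_cast hm.2)
                _ ≤ l := by linarith
            exact mul_le_mul h2 h1 (norm_nonneg _) (by linarith)
          · have : (lo U Λ * lo U (μ : ArithmeticFunction ℝ)) m = 0 := by
              rw [ArithmeticFunction.mul_apply]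
              apply sum_eq_zero
              intro x hx
              rw [Nat.mem_divisorsAntidiagonal] at hx
              rw [lo_apply, lo_apply]
              by_cases h1 : x.1 ≤ U
              · by_cases h2 : x.2 ≤ U
                · exfalso; apply h; rw [← hx.1, sq]; exact Nat.mul_le_mul h1 h2
                · rw [if_neg h2, mul_zero]
              · rw [if_neg h1, zero_mul]
            rw [this]; simp
      _ = ∑ n ∈ (Ioc 0 X).filter (fun n => n ≤ U ^ 2), l * E n := by rw [sum_filter]
      _ ≤ ∑ n ∈ Ioc 0 (U ^ 2), l * E n := by
          apply sum_le_sum_of_subset_of_nonneg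
          · intro n hn; simp only [mem_filter, mem_Ioc] at *; omega
          · intro m hm _; have := hE0 m hm; positivity
      _ = _ := by rw [mul_sum]
  -- piece 4
  have p4 : ‖∑ n ∈ Ioc 0 X, ((((Λ - lo U Λ) * ((ζ : ArithmeticFunction ℝ) * ((μ : ArithmeticFunction ℝ) - lo U (μ : ArithmeticFunction ℝ)))) n : ℝ) : ℂ) * f n‖
      ≤ 24 * l ^ 9 * X * δ := by
    set A := (Λ : ArithmeticFunction ℝ) - lo U Λ with hA
    set B := (ζ : ArithmeticFunction ℝ) * ((μ : ArithmeticFunction ℝ) - lo U (μ : ArithmeticFunction ℝ)) with hB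
    have hA0 : ∀ n, n ≤ U → A n = 0 := by
      intro n hn; rw [hA, af_sub_apply, lo_apply, if_pos hn, sub_self]
    have hAn : ∀ n ∈ Ioc 0 X, |A n| ≤ l := by
      intro n hn
      rw [hA, af_sub_apply, lo_apply]
      have := hΛle n hn
      have h0 : 0 ≤ Λ n := vonMangoldt_nonneg
      split_ifs
      · simp; linarith
      · rw [sub_zero, abs_of_nonneg h0]; linarith
    have hBsum : ∀ n, B n = ∑ d ∈ n.divisors, ((μ : ArithmeticFunction ℝ) - lo U (μ : ArithmeticFunction ℝ)) d := by
      intro n; rw [hB, coe_zeta_mul_apply]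
    have hB0 : ∀ n, n ≤ U → B n = 0 := by
      intro n hn
      rw [hBsum]
      apply sum_eq_zero; intro d hd
      have : d ≤ U := (Nat.divisor_le hd).trans hn
      rw [af_sub_apply, lo_apply, if_pos this, sub_self]
    have hBn : ∀ n, |B n| ≤ tau n := by
      intro n
      rw [hBsum]
      refine (abs_sum_le_sum_abs _ _).trans ?_
      calc _ ≤ ∑ d ∈ n.divisors, (1 : ℝ) := by
            apply sum_le_sum; intro d _
            rw [af_sub_apply, lo_apply]; split_ifs
            · simp
            · rw [sub_zero]; exact hμ d
        _ = _ := by simp [tau]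
    have htau : ∀ n, 1 ≤ n → (1 : ℝ) ≤ tau n := by
      intro n hn
      have : 0 < tau n := by unfold tau; rw [card_pos]; exact ⟨1, Nat.one_mem_divisors.mpr (by omega)⟩
      exact_mod_cast this
    set s := Nat.sqrt X
    have hsX : s ≤ X := Nat.sqrt_le_self X
    -- coefficient sequences
    set a1 : ℕ → ℂ := fun m => if m ∈ Ioc 0 X then (A m : ℂ) else 0 with ha1
    set c2 : ℕ → ℂ := fun m => if m ∈ Ioc s X then (A m : ℂ) else 0 with hc2
    set b1 : ℕ → ℂ := fun m => (B m : ℂ) with hb1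
    have ha1n : ∀ m, ‖a1 m‖ ≤ l * tau m := by
      intro m; simp only [a1]; split_ifs with h
      · rw [Complex.norm_real]
        calc _ ≤ l * 1 := by rw [mul_one]; exact hAn m h
          _ ≤ _ := by gcongr; exact htau m (by rw [mem_Ioc] at h; omega)
      · simp; positivity
    have hc2n : ∀ m, ‖c2 m‖ ≤ l * tau m := by
      intro m; simp only [c2]; split_ifs with h
      · rw [mem_Ioc] at h
        rw [Complex.norm_real]
        calc _ ≤ l * 1 := by rw [mul_one]; exact hAn m (by rw [mem_Ioc]; omega)
          _ ≤ _ := by gcongr; exact htau m (by omega)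
      · simp; positivity
    have hb1n : ∀ m, ‖b1 m‖ ≤ l * tau m := by
      intro m; simp only [b1]; rw [Complex.norm_real]
      calc _ ≤ (tau m : ℝ) := hBn m
        _ ≤ _ := by nlinarith [(Nat.cast_nonneg (tau m) : (0 : ℝ) ≤ _)]
    have d1 := typeII_dyadic f hf X U hU hX l δ (by linarith) hδ a1 b1 ha1n hb1n hII
    have d2 := typeII_dyadic f hf X U hU hX l δ (by linarith) hδ b1 c2 hb1n hc2n hII
    have hsplit : ∑ n ∈ Ioc 0 X, (((A * B) n : ℝ) : ℂ) * f n =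
        (∑ m ∈ Ioc U s, a1 m * ∑ k ∈ Ioc 0 (X / m), b1 k * f (m * k))
        + ∑ m ∈ Ioc U s, b1 m * ∑ k ∈ Ioc 0 (X / m), c2 k * f (m * k) := by
      rw [sum_conv]
      have e1 : ∑ a ∈ Ioc 0 X, (A a : ℂ) * ∑ b ∈ Ioc 0 (X / a), (B b : ℂ) * f (a * b) =
          ∑ a ∈ Ioc 0 s, (A a : ℂ) * ∑ b ∈ Ioc 0 (X / a), (B b : ℂ) * f (a * b) +
          ∑ a ∈ Ioc s X, (A a : ℂ) * ∑ b ∈ Ioc 0 (X / a), (B b : ℂ) * f (a * b) :=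
        (sum_Ioc_consecutive _ (Nat.zero_le _) hsX).symm
      rw [e1]
      congr 1
      · symm
        have hsub : Ioc U s ⊆ Ioc 0 s := by intro x hx; rw [mem_Ioc] at *; omega
        rw [← sum_subset hsub]
        · apply sum_congr rfl; intro m hm; rw [mem_Ioc] at hm
          simp only [a1, b1]; rw [if_pos (by rw [mem_Ioc]; omega)]
        · intro x hx hx'
          rw [mem_Ioc] at *
          rw [hA0 x (by omega)]; simp
      · calc ∑ a ∈ Ioc s X, (A a : ℂ) * ∑ b ∈ Ioc 0 (X / a), (B b : ℂ) * f (a * b)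
            = ∑ a ∈ Ioc 0 X, ∑ b ∈ Ioc 0 (X / a), c2 a * (b1 b * f (a * b)) := by
              have hsub : Ioc s X ⊆ Ioc 0 X := by intro x hx; rw [mem_Ioc] at *; omega
              rw [← sum_subset hsub]
              · apply sum_congr rfl; intro m hm
                simp only [c2, b1]; rw [if_pos hm, mul_sum]
              · intro x hx hx'
                simp only [c2]; rw [if_neg hx']; simp
          _ = ∑ n ∈ Ioc 0 X, ∑ x ∈ n.divisorsAntidiagonal, c2 x.1 * (b1 x.2 * f (x.1 * x.2)) :=
              (sum_divisorsAntidiagonal_Ioc X (fun a b => c2 a * (b1 b * f (a * b)))).symm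
          _ = ∑ n ∈ Ioc 0 X, ∑ x ∈ n.divisorsAntidiagonal, b1 x.1 * (c2 x.2 * f (x.1 * x.2)) := by
              apply sum_congr rfl; intro n _
              apply Finset.sum_nbij' Prod.swap Prod.swap
              · intro x hx; rw [Nat.mem_divisorsAntidiagonal] at *; simpa [mul_comm] using hx
              · intro x hx; rw [Nat.mem_divisorsAntidiagonal] at *; simpa [mul_comm] using hx
              · intro x _; simp
              · intro x _; simp
              · intro x _; simp only [Prod.fst_swap, Prod.snd_swap]; rw [mul_comm x.2 x.1]; ring
          _ = ∑ a ∈ Ioc 0 X, ∑ b ∈ Ioc 0 (X / a), b1 a * (c2 b * f (a * b)) :=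
              sum_divisorsAntidiagonal_Ioc X (fun a b => b1 a * (c2 b * f (a * b)))
          _ = _ := by
              have hsub : Ioc U s ⊆ Ioc 0 X := by intro x hx; rw [mem_Ioc] at *; omega
              rw [← sum_subset hsub]
              · apply sum_congr rfl; intro m hm; rw [mul_sum]
              · intro x hx hx'
                rw [mem_Ioc] at *
                by_cases hxU : x ≤ U
                · simp only [b1]; rw [hB0 x hxU]; simp
                · have hxs : s < x := by omega
                  apply sum_eq_zero
                  intro b hb
                  rw [mem_Ioc] at hb
                  have : ¬ (b ∈ Ioc s X) := by
                    intro hb2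
                    rw [mem_Ioc] at hb2
                    have h3 := (Nat.le_div_iff_mul_le (by omega)).mp hb.2
                    have h4 : X < (s + 1) * (s + 1) := Nat.lt_succ_sqrt X
                    have h5 : (s + 1) * (s + 1) ≤ b * x := Nat.mul_le_mul (by omega) (by omega)
                    omega
                  simp only [c2]; rw [if_neg this]; simp
    rw [hsplit]
    refine (norm_add_le _ _).trans ?_
    have : 12 * l ^ 2 * l ^ 7 * X * δ = 12 * l ^ 9 * X * δ := by ring
    linarith
  rw [hdec]
  have n1 := norm_add_le (∑ n ∈ Ioc 0 X, (lo U Λ n : ℂ) * f n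
      + ∑ n ∈ Ioc 0 X, (((lo U (μ : ArithmeticFunction ℝ) * ArithmeticFunction.log) n : ℝ) : ℂ) * f n
      - ∑ n ∈ Ioc 0 X, ((((lo U Λ * lo U (μ : ArithmeticFunction ℝ)) * (ζ : ArithmeticFunction ℝ)) n : ℝ) : ℂ) * f n)
      (∑ n ∈ Ioc 0 X, ((((Λ - lo U Λ) * ((ζ : ArithmeticFunction ℝ) * ((μ : ArithmeticFunction ℝ) - lo U (μ : ArithmeticFunction ℝ)))) n : ℝ) : ℂ) * f n)
  have n2 := norm_sub_le (∑ n ∈ Ioc 0 X, (lo U Λ n : ℂ) * f n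
      + ∑ n ∈ Ioc 0 X, (((lo U (μ : ArithmeticFunction ℝ) * ArithmeticFunction.log) n : ℝ) : ℂ) * f n)
      (∑ n ∈ Ioc 0 X, ((((lo U Λ * lo U (μ : ArithmeticFunction ℝ)) * (ζ : ArithmeticFunction ℝ)) n : ℝ) : ℂ) * f n)
  have n3 := norm_add_le (∑ n ∈ Ioc 0 X, (lo U Λ n : ℂ) * f n)
      (∑ n ∈ Ioc 0 X, (((lo U (μ : ArithmeticFunction ℝ) * ArithmeticFunction.log) n : ℝ) : ℂ) * f n)
  linarith

lemma ker_sum_le (D : ℕ) (hD : 0 < D) (a : ℤ) (ha : IsCoprime a (D : ℤ)) (β M : ℝ) (hM : 0 ≤ M) (N : ℕ) :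
    ∑ k ∈ range N, Ker M ((a : ℝ) * k / D + β) ≤ ((N : ℝ) / D + 1) * (4 * M + 2 * D * (1 + Real.log D)) := by
  have hD' : (0 : ℝ) < D := by exact_mod_cast hD
  have hl : (1 : ℝ) ≤ 1 + Real.log D := one_le_ell
  have key : ∀ J : ℕ, ∑ k ∈ range (J * D), Ker M ((a : ℝ) * k / D + β) ≤ J * (4 * M + 2 * D * (1 + Real.log D)) := by
    intro J
    induction J with
    | zero => simp
    | succ J ih =>
      rw [add_mul, one_mul, sum_range_add]
      have e : ∑ x ∈ range D, Ker M ((a : ℝ) * ((J * D + x : ℕ) : ℝ) / D + β) = ∑ x ∈ range D, Ker M ((a : ℝ) * x / D + β) := by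
        apply sum_congr rfl; intro x _
        rw [← Ker_add_int M ((a : ℝ) * x / D + β) (a * J)]
        congr 1; push_cast; field_simp; ring
      rw [e]
      have := block_sum_le D hD a ha β M hM
      push_cast; linarith
  have h1 : ∑ k ∈ range N, Ker M ((a : ℝ) * k / D + β) ≤ ∑ k ∈ range ((N / D + 1) * D), Ker M ((a : ℝ) * k / D + β) := by
    apply sum_le_sum_of_subset_of_nonneg
    · intro k hk; rw [mem_range] at *
      have := Nat.lt_div_mul_add hD (a := N)
      rw [add_mul, one_mul]; omega
    · intros; exact Ker_nonneg hM _
  refine h1.trans ((key _).trans ?_)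
  have : ((N / D + 1 : ℕ) : ℝ) ≤ (N : ℝ) / D + 1 := by push_cast; gcongr; exact Nat.cast_div_le
  gcongr

open ArithmeticFunction in
theorem vinogradov (X U D : ℕ) (a : ℤ) (hU : 2 ≤ U) (hUD : U ^ 4 ≤ D) (hDX : U ^ 4 * D ≤ X)
    (ha : IsCoprime a (D : ℤ)) :
    ‖∑ n ∈ Ioc 0 X, (vonMangoldt n : ℂ) * ee (n * ((a : ℝ) / D))‖ ≤
      60 * (1 + Real.log X) ^ 10 * X * (U : ℝ) ^ (-(1 / 4) : ℝ) := by
  set l := 1 + Real.log X with hl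
  have hl1 : (1 : ℝ) ≤ l := one_le_ell
  set θ := (a : ℝ) / D with hθ
  have hU4 : 16 ≤ U ^ 4 := by calc 16 = 2 ^ 4 := by norm_num
    _ ≤ U ^ 4 := Nat.pow_le_pow_left hU 4
  have hD0 : 0 < D := by omega
  have hDr : (0 : ℝ) < D := by exact_mod_cast hD0
  have hX1 : 1 ≤ X := le_trans (Nat.mul_pos (by omega) hD0) hDX
  have hXr : (0 : ℝ) < X := by exact_mod_cast hX1
  have hDleX : D ≤ X := le_trans (Nat.le_mul_of_pos_left D (by omega)) hDX
  have hUr : (2 : ℝ) ≤ U := by exact_mod_cast hU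
  have hlD : 1 + Real.log D ≤ l := ell_mono hDleX
  have hlD1 : (1 : ℝ) ≤ 1 + Real.log D := one_le_ell
  have hUD' : (U : ℝ) ^ 4 ≤ D := by exact_mod_cast hUD
  have hDX' : (U : ℝ) ^ 4 * D ≤ X := by exact_mod_cast hDX
  set δ : ℝ := (12 * l / U) ^ (1 / 4 : ℝ) with hδ
  have hbase : 0 < 12 * l / U := by positivity
  have hδ0 : 0 < δ := rpow_pos_of_pos hbase _
  have hδ4 : δ ^ 4 = 12 * l / U := by
    rw [hδ, ← rpow_natCast, ← rpow_mul hbase.le]; norm_num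
  have hvb := vaughan_bound (fun n => ee (n * θ)) (fun n => by simp) X U (by omega) hX1 δ hδ0.le
    (fun m => (D : ℝ)) ?_ ?_
  · refine hvb.trans ?_
    simp only [sum_const, Nat.card_Ioc, nsmul_eq_mul, tsub_zero]
    have hq : δ ≤ 2 * l * (U : ℝ) ^ (-(1 / 4) : ℝ) := by
      rw [hδ, Real.div_rpow (by positivity) (by positivity), rpow_neg (by positivity), ← div_eq_mul_inv]
      gcongr
      have : 12 * l ≤ (2 * l) ^ (4 : ℝ) := by
        have e : (2 * l) ^ (4 : ℝ) = 16 * l ^ 4 := by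
          rw [show (4 : ℝ) = ((4 : ℕ) : ℝ) by norm_num, rpow_natCast]; ring
        rw [e]
        have : l ≤ l ^ 4 := le_self_pow₀ hl1 (by norm_num)
        nlinarith
      calc (12 * l) ^ (1 / 4 : ℝ) ≤ ((2 * l) ^ (4 : ℝ)) ^ (1 / 4 : ℝ) := by gcongr
        _ = 2 * l := by rw [← rpow_mul (by positivity)]; norm_num
    set W : ℝ := (U : ℝ) ^ (-(1 / 4) : ℝ) with hW
    have hW0 : 0 < W := rpow_pos_of_pos (by linarith) _
    have hinv : 1 / (U : ℝ) ≤ W := by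
      rw [hW, one_div, ← rpow_neg_one]
      apply rpow_le_rpow_of_exponent_le (by linarith) (by norm_num)
    have hXU : (X : ℝ) / U ≤ X * W := by rw [div_eq_mul_one_div]; gcongr
    have t1 : (U : ℝ) ≤ X * W := by
      refine le_trans ?_ hXU
      rw [le_div_iff₀ (by linarith)]
      have : (U : ℝ) * U ≤ U ^ 4 * 1 := by nlinarith [pow_pos (by linarith : (0:ℝ) < U) 2, sq_nonneg ((U:ℝ)^2 - 1)]
      have h1 : (1 : ℝ) ≤ D := by exact_mod_cast hD0
      have : (U : ℝ) ^ 4 * 1 ≤ U ^ 4 * D := by gcongr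
      linarith
    have t2 : ((U ^ 2 : ℕ) : ℝ) * D ≤ X * W := by
      refine le_trans ?_ hXU
      rw [le_div_iff₀ (by linarith)]
      push_cast
      calc (U : ℝ) ^ 2 * D * U = (U : ℝ) ^ 3 * (D : ℝ) := by ring
        _ ≤ (U : ℝ) ^ 4 * (D : ℝ) := by
          apply mul_le_mul_of_nonneg_right _ hDr.le
          exact pow_le_pow_right₀ (by linarith) (by norm_num)
        _ ≤ (X : ℝ) := hDX'
    have hl10 : l ≤ l ^ 10 := le_self_pow₀ hl1 (by norm_num)
    have hXW : 0 < X * W := by positivity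
    calc l * (U + 3 * (((U ^ 2 : ℕ) : ℝ) * D)) + 24 * l ^ 9 * X * δ
        ≤ l * (X * W + 3 * (X * W)) + 24 * l ^ 9 * X * (2 * l * W) := by gcongr
      _ = 4 * (l * (X * W)) + 48 * l ^ 10 * (X * W) := by ring
      _ ≤ 4 * (l ^ 10 * (X * W)) + 48 * l ^ 10 * (X * W) := by gcongr
      _ ≤ _ := by nlinarith [mul_pos (pow_pos (by linarith : 0 < l) 10) hXW]
  · intro m hm1 hm2 Y hY
    have hmD : m < D := by
      have : U ^ 2 < U ^ 4 := Nat.pow_lt_pow_right (by omega) (by norm_num)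
      omega
    have h1 := geom_sum_le (m * θ) 0 Y Y (by simp) (by positivity)
    have e : ∀ n : ℕ, ee (((m * n : ℕ) : ℝ) * θ) = ee (n * (m * θ)) := by
      intro n; congr 1; push_cast; ring
    simp only [e]
    refine h1.trans ?_
    have hnd : 1 / (D : ℝ) ≤ nd (m * θ) := by
      have := nd_rat_ge (a * m) D hD0 ?_
      · convert this using 2; rw [hθ]; push_cast; ring
      · intro hdvd
        have h2 := ha.symm.dvd_of_dvd_mul_left hdvd
        have h3 : D ∣ m := by exact_mod_cast h2
        have := Nat.le_of_dvd (by omega) h3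
        omega
    have := Ker_le_inv (M := (Y : ℝ)) (by positivity) (by positivity) hnd
    simpa using this
  · intro M M' hUM hMM' hM2 hMX
    have hM0 : 0 < M := by omega
    set N := X / M with hN
    have hMN : M' ≤ N := by
      rw [hN, Nat.le_div_iff_mul_le hM0]
      exact le_trans (Nat.mul_le_mul_left _ hMM'.le) hMX
    have hMNX : (M : ℝ) * N ≤ X := by exact_mod_cast Nat.mul_div_le X M
    have hUN : U ≤ N := by omega
    have hUN' : (U : ℝ) ≤ N := by exact_mod_cast hUN
    have hUM' : (U : ℝ) ≤ M := by exact_mod_cast hUM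
    have hMNle : (M : ℝ) ≤ N := by exact_mod_cast (by omega : M ≤ N)
    refine ⟨N, by omega, le_rfl, ?_, ?_⟩
    · have h1 : 1 / (N : ℝ) ≤ 1 / U := by gcongr
      refine h1.trans ?_
      apply le_of_sq_le_sq _ (by positivity) |> fun h => h
      rw [← pow_mul, hδ4, div_pow]
      rw [div_le_div_iff₀ (by positivity) (by positivity)]
      nlinarith
    · have hTT : ∀ r, TT (fun n => ee (n * θ)) X M M' r ≤ N * Ker M (r * θ) := by
        intro r
        unfold TT
        calc _ ≤ ∑ k ∈ Ioc 0 (X / M), Ker M (r * θ) := by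
              apply sum_le_sum; intro k hk
              rw [mem_Ioc] at hk
              have hset : (Ioc M M').filter (fun m => m * (k + r) ≤ X) = Ioc M (min M' (X / (k + r))) := by
                ext m
                simp only [mem_filter, mem_Ioc, le_min_iff]
                rw [Nat.le_div_iff_mul_le (by omega)]; tauto
              rw [hset]
              have e : ∀ m : ℕ, ee (((m * (k + r) : ℕ) : ℝ) * θ) * (starRingEnd ℂ) (ee (((m * k : ℕ) : ℝ) * θ)) = ee (m * (r * θ)) := by
                intro m; rw [← ee_sub]; congr 1; push_cast; ring
              simp only [e]
              apply geom_sum_le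
              · have : ((min M' (X / (k + r)) : ℕ) : ℝ) ≤ 2 * M := by exact_mod_cast (min_le_left _ _).trans hM2
                linarith
              · positivity
          _ = _ := by simp [hN]
      calc ∑ r ∈ Ico 1 N, TT (fun n => ee (n * θ)) X M M' r ≤ ∑ r ∈ Ico 1 N, N * Ker M (r * θ) := sum_le_sum fun r _ => hTT r
        _ ≤ ∑ r ∈ range N, N * Ker M (r * θ) := by
            apply sum_le_sum_of_subset_of_nonneg
            · intro x hx; simp only [mem_Ico, mem_range] at *; omega
            · intros
              exact mul_nonneg (by positivity) (Ker_nonneg (by positivity) _)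
        _ = N * ∑ r ∈ range N, Ker M ((a : ℝ) * r / D + 0) := by
            rw [mul_sum]; apply sum_congr rfl; intro r _; congr 2; rw [hθ]; ring
        _ ≤ N * (((N : ℝ) / D + 1) * (4 * M + 2 * D * (1 + Real.log D))) := by
            gcongr; exact ker_sum_le D hD0 a ha 0 M (by positivity) N
        _ ≤ N * (((N : ℝ) / D + 1) * (4 * M + 2 * D * l)) := by gcongr
        _ ≤ N * (X * (12 * l / U)) := by
            apply mul_le_mul_of_nonneg_left _ (by positivity)
            have e : ((N : ℝ) / D + 1) * (4 * M + 2 * D * l) = 4 * (M * N) / D + 2 * N * l + 4 * M + 2 * D * l := by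
              field_simp; ring
            rw [e]
            have hN1 : (N : ℝ) ≤ X / U := by
              rw [le_div_iff₀ (by linarith)]
              calc (N : ℝ) * U ≤ N * M := by gcongr
                _ ≤ X := by linarith
            have hM1 : (M : ℝ) ≤ X / U := hMNle.trans hN1
            have hUle : (U : ℝ) ≤ U ^ 4 := le_self_pow₀ (by linarith) (by norm_num)
            have hD1 : (D : ℝ) ≤ X / U := by
              rw [le_div_iff₀ (by linarith)]
              calc (D : ℝ) * U ≤ U ^ 4 * D := by rw [mul_comm]; gcongr
                _ ≤ X := hDX'
            have hX1 : 4 * ((M:ℝ) * N) / D ≤ 4 * ((X:ℝ) / U) := by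
              have : (U:ℝ) ≤ D := by linarith
              rw [mul_div_assoc]; gcongr
            have hXU0 : 0 ≤ (X : ℝ) / U := by positivity
            calc _ ≤ 4 * (X / U) + 2 * (X / U) * l + 4 * (X / U) + 2 * (X / U) * l := by gcongr
              _ ≤ 12 * ((X / U) * l) := by nlinarith
              _ = _ := by ring
        _ = N * X * δ ^ 4 := by rw [hδ4]; ring

lemma sum_range_mul' {E : Type*} [AddCommMonoid E] (h : ℕ → E) (b N : ℕ) :
    ∑ n ∈ range (b * N), h n = ∑ j ∈ range N, ∑ d ∈ range b, h (b * j + d) := by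
  induction N with
  | zero => simp
  | succ N ih => rw [Nat.mul_succ, sum_range_add, ih, sum_range_succ]

/-- `b`-multiplicative functions -/
def BM (b : ℕ) (f : ℕ → ℂ) : Prop := ∀ n d, d < b → f (b * n + d) = f d * f n

lemma BM_pow {b : ℕ} {f : ℕ → ℂ} (hb : 0 < b) (h : BM b f) (h0 : f 0 = 1) (l : ℕ) : BM (b ^ l) f := by
  induction l with
  | zero => intro n d hd; simp at hd; simp [hd, h0]
  | succ l ih =>
    intro n d hd
    have hd1 : d % b ^ l < b ^ l := Nat.mod_lt _ (by positivity)
    have hd2 : d / b ^ l < b := by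
      rw [Nat.div_lt_iff_lt_mul (by positivity)]; rw [pow_succ, mul_comm] at hd; exact hd
    have e1 : b ^ (l + 1) * n + d = b ^ l * (b * n + d / b ^ l) + d % b ^ l := by
      conv_lhs => rw [← Nat.div_add_mod d (b ^ l)]
      ring
    have e2 : f d = f (d % b ^ l) * f (d / b ^ l) := by
      rw [← ih _ _ hd1, Nat.div_add_mod]
    rw [e1, ih _ _ hd1, h _ _ hd2, e2]; ring

noncomputable def FF (f : ℕ → ℂ) (N : ℕ) (θ : ℝ) : ℂ := (∑ n ∈ range N, f n * ee (n * θ)) / N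

lemma FF_mul {b : ℕ} {f : ℕ → ℂ} (h : BM b f) (N : ℕ) (θ : ℝ) :
    FF f (b * N) θ = FF f b θ * FF f N (b * θ) := by
  unfold FF
  rw [sum_range_mul', div_mul_div_comm, sum_mul_sum, Nat.cast_mul, sum_comm]
  congr 1
  apply sum_congr rfl; intro d hd
  apply sum_congr rfl; intro n hn
  rw [h _ _ (mem_range.mp hd)]
  push_cast
  rw [add_mul, ee_add, mul_assoc (b : ℝ), mul_left_comm (b : ℝ)]; ring

lemma FF_norm_le {f : ℕ → ℂ} (hf : ∀ n, ‖f n‖ = 1) (N : ℕ) (θ : ℝ) : ‖FF f N θ‖ ≤ 1 := by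
  unfold FF
  rw [norm_div, Complex.norm_natCast]
  apply div_le_one_of_le₀ _ (by positivity)
  refine (norm_sum_le _ _).trans ?_
  simp [hf]

lemma FF_add_int (f : ℕ → ℂ) (N : ℕ) (θ : ℝ) (k : ℤ) : FF f N (θ + k) = FF f N θ := by
  unfold FF
  congr 1; apply sum_congr rfl; intro n _
  have : (n : ℝ) * (θ + k) = n * θ + ((n * k : ℤ) : ℝ) := by push_cast; ring
  rw [this, ee_add_int]

lemma sum_ee_range (N : ℕ) (hN : 0 < N) (a : ℤ) :
    ∑ k ∈ range N, ee ((a : ℝ) * k / N) = if (N : ℤ) ∣ a then (N : ℂ) else 0 := by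
  have hN' : (N : ℝ) ≠ 0 := by positivity
  have h1 : ∀ k : ℕ, ee ((a : ℝ) * k / N) = ee ((a : ℝ) / N) ^ k := by
    intro k; rw [← ee_nat_mul]; congr 1; ring
  simp only [h1]
  split_ifs with h
  · obtain ⟨c, rfl⟩ := h
    have : ee (((N * c : ℤ) : ℝ) / N) = 1 := by
      rw [← ee_int c]; congr 1; push_cast; field_simp
    rw [this]; simp
  · have hne : ee ((a : ℝ) / N) ≠ 1 := by
      intro h2
      have h3 := norm_one_sub_ee_ge ((a : ℝ) / N)
      rw [h2, sub_self, norm_zero] at h3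
      have h4 := nd_rat_ge a N hN h
      have : (0 : ℝ) < 1 / N := by positivity
      linarith
    rw [geom_sum_eq hne, ← ee_nat_mul]
    have : (N : ℝ) * (a / N) = (a : ℤ) := by field_simp
    rw [this, ee_int]; simp

lemma range_dvd_sub {N m n : ℕ} (hm : m < N) (hn : n < N) : (N : ℤ) ∣ (m : ℤ) - n ↔ m = n := by
  constructor
  · intro h
    have := Int.eq_zero_of_abs_lt_dvd h (by rw [abs_lt]; constructor <;> omega)
    omega
  · rintro rfl; simp

/-- correlation form -/
lemma FF_normSq (f : ℕ → ℂ) (N : ℕ) (θ : ℝ) :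
    ((‖FF f N θ‖ ^ 2 : ℝ) : ℂ) = (∑ n ∈ range N, ∑ m ∈ range N,
      f n * (starRingEnd ℂ) (f m) * ee (((n : ℝ) - m) * θ)) / N ^ 2 := by
  rw [Complex.ofReal_pow, ← Complex.mul_conj']
  unfold FF
  rw [map_div₀, div_mul_div_comm, map_sum, sum_mul_sum]
  congr 1
  · apply sum_congr rfl; intro n _; apply sum_congr rfl; intro m _
    rw [map_mul, sub_mul, ee_sub]; ring
  · simp; ring

/-- Fourier coefficient of `|FF|^2` along shifts -/
lemma FF_sq_fourier (f : ℕ → ℂ) (N : ℕ) (hN : 0 < N) (θ : ℝ) (c : ℤ) :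
    ∑ v ∈ range N, ((‖FF f N (θ + v / N)‖ ^ 2 : ℝ) : ℂ) * ee (-(c * v / N)) =
      (∑ n ∈ range N, ∑ m ∈ range N, if (N : ℤ) ∣ ((n : ℤ) - m - c) then
      f n * (starRingEnd ℂ) (f m) * ee (((n : ℝ) - m) * θ) else 0) / N := by
  have hN' : (N : ℂ) ≠ 0 := by exact_mod_cast hN.ne'
  simp only [FF_normSq, div_mul_eq_mul_div, sum_mul]
  rw [← sum_div, sum_comm]
  rw [div_eq_div_iff (by positivity) hN', sum_mul, sum_mul]
  apply sum_congr rfl; intro n _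
  rw [sum_comm, sum_mul, sum_mul]
  apply sum_congr rfl; intro m _
  have h1 : ∀ v : ℕ, f n * (starRingEnd ℂ) (f m) * ee (((n : ℝ) - m) * (θ + v / N)) * ee (-(c * v / N))
     = f n * (starRingEnd ℂ) (f m) * ee (((n : ℝ) - m) * θ) * ee ((((n : ℤ) - m - c : ℤ) : ℝ) * v / N) := by
    intro v
    rw [mul_assoc, ← ee_add, mul_assoc, mul_assoc, mul_assoc, ← ee_add]
    congr 3; push_cast; ring
  simp only [h1]
  rw [← mul_sum, sum_ee_range N hN]
  split_ifs
  · ring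
  · simp

lemma FF_parseval {f : ℕ → ℂ} (hf : ∀ n, ‖f n‖ = 1) (N : ℕ) (hN : 0 < N) (θ : ℝ) :
    ∑ v ∈ range N, ‖FF f N (θ + v / N)‖ ^ 2 = 1 := by
  have h := FF_sq_fourier f N hN θ 0
  have hN' : (N : ℂ) ≠ 0 := by exact_mod_cast hN.ne'
  have e : ∑ n ∈ range N, ∑ m ∈ range N, (if (N : ℤ) ∣ ((n : ℤ) - m - 0) then
      f n * (starRingEnd ℂ) (f m) * ee (((n : ℝ) - m) * θ) else 0) = N := by
    rw [sum_congr rfl (g := fun _ => (1 : ℂ))]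
    · simp
    intro n hn
    rw [sum_congr rfl (g := fun m => if n = m then (1 : ℂ) else 0)]
    · simp [mem_range.mp hn]
    intro m hm
    rw [sub_zero]
    simp only [range_dvd_sub (mem_range.mp hn) (mem_range.mp hm)]
    split_ifs with h
    · subst h
      rw [Complex.mul_conj', hf]; simp [ee_zero]
    · rfl
  rw [e, div_self hN'] at h
  simp only [Int.cast_zero, zero_mul, zero_div, neg_zero, ee_zero, mul_one] at h
  exact_mod_cast h

lemma coeff_one (f : ℕ → ℂ) (B : ℕ) (hB : 1 ≤ B) (θ : ℝ) :
    ∑ v ∈ range (B + 1), ((‖FF f (B + 1) (θ + v / (B + 1 : ℕ))‖ ^ 2 : ℝ) : ℂ) * ee (-((1 : ℤ) * v / (B + 1 : ℕ))) =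
      ((∑ m ∈ range B, f (m + 1) * (starRingEnd ℂ) (f m)) * ee θ + f 0 * (starRingEnd ℂ) (f B) * ee (-(B * θ))) / (B + 1 : ℕ) := by
  rw [FF_sq_fourier f (B + 1) (by omega) θ 1, sum_comm, sum_range_succ]
  congr 2
  · rw [sum_mul]
    apply sum_congr rfl; intro m hm
    rw [mem_range] at hm
    rw [sum_eq_single (m + 1)]
    · rw [if_pos (by push_cast; simp)]; congr 2; push_cast; ring
    · intro n hn hne
      rw [mem_range] at hn
      rw [if_neg]
      intro h
      have : ((B + 1 : ℕ) : ℤ) ∣ ((n : ℤ) - (m + 1 : ℕ)) := by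
        convert h using 1; push_cast; ring
      rw [range_dvd_sub hn (by omega)] at this
      exact hne this
    · intro h; exact absurd (mem_range.mpr (by omega)) h
  · rw [sum_eq_single 0]
    · rw [if_pos ⟨-1, by push_cast; ring⟩]; congr 2; push_cast; ring
    · intro n hn hne
      rw [mem_range] at hn
      rw [if_neg]
      intro h
      have : ((B + 1 : ℕ) : ℤ) ∣ ((n : ℤ) - (0 : ℕ)) := by
        have h2 := h.add (dvd_refl ((B + 1 : ℕ) : ℤ))
        have e : (n : ℤ) - (0 : ℕ) = (n : ℤ) - (B : ℕ) - 1 + ((B + 1 : ℕ) : ℤ) := by push_cast; ring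
        rw [e]; exact h2
      rw [range_dvd_sub hn (by omega)] at this
      exact hne this
    · intro h; exact absurd (mem_range.mpr (by omega)) h

/-- one step kernel gain -/
lemma pair_kernel (f : ℕ → ℂ) (hf : ∀ n, ‖f n‖ = 1) (b : ℕ) (hb : 2 ≤ b)
    (hA : ∀ w : ℂ, ‖w‖ = 1 → 1 ≤ ‖∑ m ∈ range (b - 1), f (m + 1) * (starRingEnd ℂ) (f m) + w‖)
    (x y κ : ℝ) (z : ℤ) (hz : b * κ = z) (hz' : ¬ (b : ℤ) ∣ z) :
    ∑ d ∈ range b, ‖FF f b (x + d / b)‖ * ‖FF f b (y + d / b)‖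
     + ∑ d ∈ range b, ‖FF f b (x + d / b)‖ * ‖FF f b (y + κ + d / b)‖ ≤ 2 * (1 - 1 / (2 * (b : ℝ) ^ 4)) := by
  have hb' : (0 : ℝ) < b := by positivity
  have hκ : κ = z / b := by field_simp; linarith
  have hndk : 1 / (b : ℝ) ≤ nd κ := by rw [hκ]; exact nd_rat_ge z b (by omega) hz'
  obtain ⟨B, rfl⟩ : ∃ B, b = B + 1 := ⟨b - 1, by omega⟩
  have h1 := coeff_one f B (by omega) y
  have h2 := coeff_one f B (by omega) (y + κ)
  set S := ∑ m ∈ range B, f (m + 1) * (starRingEnd ℂ) (f m) with hS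
  set X : ℕ → ℝ := fun d => ‖FF f (B + 1) (x + d / (B + 1 : ℕ))‖ with hX
  set Y : ℕ → ℝ := fun d => ‖FF f (B + 1) (y + d / (B + 1 : ℕ))‖ with hY
  set Z : ℕ → ℝ := fun d => ‖FF f (B + 1) (y + κ + d / (B + 1 : ℕ))‖ with hZ
  have hX1 : ∑ d ∈ range (B + 1), X d ^ 2 = 1 := FF_parseval hf (B + 1) (by omega) x
  have hY1 : ∑ d ∈ range (B + 1), Y d ^ 2 = 1 := FF_parseval hf (B + 1) (by omega) y
  have hZ1 : ∑ d ∈ range (B + 1), Z d ^ 2 = 1 := FF_parseval hf (B + 1) (by omega) (y + κ)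
  set Q := ∑ d ∈ range (B + 1), (Y d - Z d) ^ 2 with hQ
  set P := ∑ d ∈ range (B + 1), (Y d + Z d) ^ 2 with hP
  have hPQ : P + Q = 4 := by
    rw [hP, hQ, ← sum_add_distrib]
    have : ∀ d ∈ range (B + 1), (Y d + Z d) ^ 2 + (Y d - Z d) ^ 2 = 2 * Y d ^ 2 + 2 * Z d ^ 2 := by
      intro d _; ring
    rw [sum_congr rfl this, sum_add_distrib, ← mul_sum, ← mul_sum, hY1, hZ1]; norm_num
  have hQ0 : 0 ≤ Q := sum_nonneg fun _ _ => sq_nonneg _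
  have hP0 : 0 ≤ P := sum_nonneg fun _ _ => sq_nonneg _
  have hdiff : 4 / ((B + 1 : ℕ) : ℝ) ^ 2 ≤ ∑ d ∈ range (B + 1), |Y d ^ 2 - Z d ^ 2| := by
    have e1 : ee (-(B * (y + κ))) = ee (-(B * y)) * ee κ := by
      rw [← ee_add, ← ee_add_int (-(B * y) + κ) (-z)]; congr 1; push_cast at hz ⊢; linarith
    have e2 : ee (-(B * y)) = ee (-((B + 1 : ℕ) * y)) * ee y := by
      rw [← ee_add]; congr 1; push_cast; ring
    have key : ∑ v ∈ range (B + 1), (((Y v ^ 2 - Z v ^ 2 : ℝ)) : ℂ) * ee (-((1 : ℤ) * v / (B + 1 : ℕ)))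
       = (S + f 0 * (starRingEnd ℂ) (f B) * ee (-((B + 1 : ℕ) * y))) * ee y * (1 - ee κ) / (B + 1 : ℕ) := by
      simp only [Complex.ofReal_sub, sub_mul, sum_sub_distrib]
      rw [h1, h2, e1, ee_add y κ, e2]; ring
    have hn : ‖(S + f 0 * (starRingEnd ℂ) (f B) * ee (-((B + 1 : ℕ) * y))) * ee y * (1 - ee κ) / (B + 1 : ℕ)‖ ≥ 4 / ((B + 1 : ℕ) : ℝ) ^ 2 := by
      rw [norm_div, norm_mul, norm_mul, norm_ee, Complex.norm_natCast]
      have ha := hA (f 0 * (starRingEnd ℂ) (f B) * ee (-((B + 1 : ℕ) * y))) (by simp [hf])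
      rw [Nat.add_sub_cancel] at ha
      have hk := norm_one_sub_ee_ge κ
      rw [ge_iff_le, sq, ← div_div]
      apply div_le_div_of_nonneg_right _ hb'.le
      calc 4 / ((B + 1 : ℕ) : ℝ) = 1 * 1 * (4 * (1 / ((B + 1 : ℕ) : ℝ))) := by ring
        _ ≤ _ := by gcongr; linarith
    rw [← key] at hn
    refine hn.trans ((norm_sum_le _ _).trans (le_of_eq ?_))
    apply sum_congr rfl; intro d _
    rw [norm_mul, norm_ee, mul_one, Complex.norm_real, norm_eq_abs]
  have hCS : (∑ d ∈ range (B + 1), |Y d ^ 2 - Z d ^ 2|) ^ 2 ≤ Q * P := by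
    have := sum_mul_sq_le_sq_mul_sq (range (B + 1)) (fun d => |Y d - Z d|) (fun d => Y d + Z d)
    simp only [sq_abs] at this
    refine le_trans (le_of_eq ?_) this
    congr 1; apply sum_congr rfl; intro d _
    rw [show Y d ^ 2 - Z d ^ 2 = (Y d - Z d) * (Y d + Z d) by ring, abs_mul]
    congr 1; exact abs_of_nonneg (add_nonneg (norm_nonneg _) (norm_nonneg _))
  have hQge : 4 / ((B + 1 : ℕ) : ℝ) ^ 4 ≤ Q := by
    have h3 : (4 / ((B + 1 : ℕ) : ℝ) ^ 2) ^ 2 ≤ Q * P := le_trans (by gcongr) hCS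
    have h4 : (4 / ((B + 1 : ℕ) : ℝ) ^ 2) ^ 2 = 4 * (4 / ((B + 1 : ℕ) : ℝ) ^ 4) := by
      field_simp
    nlinarith
  have hfin : ∑ d ∈ range (B + 1), X d * Y d + ∑ d ∈ range (B + 1), X d * Z d ≤ 1 + P / 4 := by
    rw [← sum_add_distrib, ← hX1, hP, sum_div, ← sum_add_distrib]
    apply sum_le_sum; intro d _
    nlinarith [sq_nonneg (X d - (Y d + Z d) / 2)]
  refine hfin.trans ?_
  have : 1 / (2 * ((B + 1 : ℕ) : ℝ) ^ 4) = (4 / ((B + 1 : ℕ) : ℝ) ^ 4) / 8 := by field_simp; norm_num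
  rw [this]; linarith

lemma sum_range_periodic_shift (D : ℕ) (h : ℕ → ℝ) (hp : ∀ t, h (t + D) = h t) (k : ℕ) :
    ∑ t ∈ range D, h (t + k) = ∑ t ∈ range D, h t := by
  induction k with
  | zero => rfl
  | succ k ih =>
    rw [← ih]
    have e1 := sum_range_succ' (fun t => h (t + k)) D
    have e2 := sum_range_succ (fun t => h (t + k)) D
    have e3 : h (D + k) = h (0 + k) := by rw [add_comm D k, zero_add, hp]
    have e4 : ∑ t ∈ range D, h (t + (k + 1)) = ∑ t ∈ range D, h (t + 1 + k) := by
      apply sum_congr rfl; intro t _; congr 1; ring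
    rw [e4]; linarith

lemma pair_lemma (f : ℕ → ℂ) (hf : ∀ n, ‖f n‖ = 1) (b : ℕ) (hb : 2 ≤ b) (hbm : BM b f)
    (hA : ∀ w : ℂ, ‖w‖ = 1 → 1 ≤ ‖∑ m ∈ range (b - 1), f (m + 1) * (starRingEnd ℂ) (f m) + w‖)
    (D : ℕ) (hD : 0 < D) (j : ℕ) : ∀ (l u : ℕ) (θ θ' : ℝ), j ≤ l → (∃ k, D ∣ u * b ^ k) →
      (∀ i < j, ¬ D ∣ u * b ^ i) →
      ∑ t ∈ range D, ∑ v ∈ range (b ^ l), ‖FF f (b ^ l) (θ + v / (b ^ l : ℕ))‖ *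
        ‖FF f (b ^ l) (θ' + u * t / D + v / (b ^ l : ℕ))‖ ≤ D * (1 - 1 / (2 * (b : ℝ) ^ 4)) ^ j := by
  have hD' : (0 : ℝ) < D := by exact_mod_cast hD
  have hb0 : (0 : ℝ) < b := by positivity
  have hρ0 : 0 ≤ 1 - 1 / (2 * (b : ℝ) ^ 4) := by
    rw [sub_nonneg, div_le_one (by positivity)]
    have : (1 : ℝ) ≤ b ^ 4 := one_le_pow₀ (by exact_mod_cast (by omega : 1 ≤ b))
    linarith
  induction j with
  | zero =>
    intro l u θ θ' _ _ _
    rw [pow_zero, mul_one]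
    calc _ ≤ ∑ t ∈ range D, (1 : ℝ) := by
          apply sum_le_sum; intro t _
          have h1 := FF_parseval hf (b ^ l) (by positivity) θ
          have h2 := FF_parseval hf (b ^ l) (by positivity) (θ' + u * t / D)
          calc _ ≤ ∑ v ∈ range (b ^ l), (‖FF f (b ^ l) (θ + v / (b ^ l : ℕ))‖ ^ 2 / 2 +
                ‖FF f (b ^ l) (θ' + u * t / D + v / (b ^ l : ℕ))‖ ^ 2 / 2) := by
                apply sum_le_sum; intro v _
                nlinarith [sq_nonneg (‖FF f (b ^ l) (θ + v / (b ^ l : ℕ))‖ - ‖FF f (b ^ l) (θ' + u * t / D + v / (b ^ l : ℕ))‖)]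
            _ = 1 := by
                rw [sum_add_distrib, ← sum_div, ← sum_div, h1, h2]; norm_num
      _ = D := by simp
  | succ j ih =>
    intro l u θ θ' hjl hex hnd
    obtain ⟨l, rfl⟩ : ∃ l', l = l' + 1 := ⟨l - 1, by omega⟩
    have hih := ih l (b * u) (b * θ) (b * θ') (by omega) (by
      obtain ⟨k, hk⟩ := hex
      exact ⟨k, by rw [mul_assoc]; exact hk.mul_left b⟩) (by
      intro i hi h
      apply hnd (i + 1) (by omega)
      rw [pow_succ]; convert h using 1; ring)
    -- the shift
    classical
    set k0 := Nat.find hex with hk0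
    have hk0s : D ∣ u * b ^ k0 := Nat.find_spec hex
    have hk0pos : k0 ≠ 0 := by
      intro h; rw [h] at hk0s; exact hnd 0 (by omega) hk0s
    have hk1 : ¬ D ∣ u * b ^ (k0 - 1) := Nat.find_min hex (by omega)
    set k := b ^ (k0 - 1) with hk
    have hbk : D ∣ u * (b * k) := by
      have : b * k = b ^ k0 := by rw [hk, ← pow_succ']; congr 1; omega
      rw [this]; exact hk0s
    obtain ⟨z, hz⟩ := hbk
    set N := b ^ l with hN
    have hN0 : (0 : ℝ) < (N : ℕ) := by rw [hN]; positivity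
    -- rewriting
    set K : ℕ → ℕ → ℝ := fun v t => ∑ d ∈ range b, ‖FF f b (θ + v / (N * b : ℕ) + d / b)‖ *
      ‖FF f b (θ' + v / (N * b : ℕ) + u * t / D + d / b)‖ with hK
    set H : ℕ → ℕ → ℝ := fun v t => ‖FF f N (b * θ + v / N)‖ * ‖FF f N (b * θ' + (b * u : ℕ) * t / D + v / N)‖ with hH
    have hK0 : ∀ v t, 0 ≤ K v t := fun v t => sum_nonneg fun _ _ => by positivity
    have hH0 : ∀ v t, 0 ≤ H v t := fun v t => by positivity
    have hrw : ∑ t ∈ range D, ∑ v ∈ range (b ^ (l + 1)), ‖FF f (b ^ (l + 1)) (θ + v / (b ^ (l + 1) : ℕ))‖ *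
        ‖FF f (b ^ (l + 1)) (θ' + u * t / D + v / (b ^ (l + 1) : ℕ))‖ = ∑ v ∈ range N, ∑ t ∈ range D, K v t * H v t := by
      rw [sum_comm (s := range N)]
      apply sum_congr rfl; intro t _
      rw [pow_succ, ← hN, sum_range_mul', sum_comm]
      apply sum_congr rfl; intro v _
      rw [hK, hH]; simp only
      rw [sum_mul]
      apply sum_congr rfl; intro d _
      have hmul := FF_mul hbm N
      rw [mul_comm b N] at hmul
      rw [hmul, hmul, norm_mul, norm_mul]
      have a1 : θ + ((N * d + v : ℕ) : ℝ) / (N * b : ℕ) = θ + v / (N * b : ℕ) + d / b := by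
        push_cast; field_simp; ring
      have a2 : θ' + u * t / D + ((N * d + v : ℕ) : ℝ) / (N * b : ℕ) = θ' + v / (N * b : ℕ) + u * t / D + d / b := by
        push_cast; field_simp; ring
      have a3 : (b : ℝ) * (θ + v / (N * b : ℕ) + d / b) = b * θ + v / N + (d : ℤ) := by
        push_cast; field_simp
      have a4 : (b : ℝ) * (θ' + v / (N * b : ℕ) + u * t / D + d / b) = b * θ' + (b * u : ℕ) * t / D + v / N + (d : ℤ) := by
        push_cast; field_simp; ring
      rw [a1, a2, a3, a4, FF_add_int, FF_add_int]; ring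
    have hperK : ∀ v t, K v (t + D) = K v t := by
      intro v t; rw [hK]; simp only
      apply sum_congr rfl; intro d _
      have : θ' + (v : ℝ) / (N * b : ℕ) + u * (t + D : ℕ) / D + d / b = θ' + v / (N * b : ℕ) + u * t / D + d / b + (u : ℤ) := by
        push_cast; field_simp; ring
      rw [this, FF_add_int]
    have hperH : ∀ v t, H v (t + D) = H v t := by
      intro v t; rw [hH]; simp only
      have : b * θ' + (b * u : ℕ) * (t + D : ℕ) / D + (v : ℝ) / N = b * θ' + (b * u : ℕ) * t / D + v / N + ((b * u : ℕ) : ℤ) := by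
        push_cast; field_simp; ring
      rw [this, FF_add_int]
    have hshiftH : ∀ v t, H v (t + k) = H v t := by
      intro v t; rw [hH]; simp only
      have : b * θ' + (b * u : ℕ) * (t + k : ℕ) / D + (v : ℝ) / N = b * θ' + (b * u : ℕ) * t / D + v / N + (z : ℤ) := by
        have hz' : (u : ℝ) * (b * k) = D * z := by exact_mod_cast hz
        have : (b * u : ℕ) * ((t + k : ℕ) : ℝ) / D = (b * u : ℕ) * t / D + z := by
          push_cast; field_simp; linarith
        rw [this]; push_cast; ring
      rw [this, FF_add_int]
    have hgain : ∀ v t, K v t + K v (t + k) ≤ 2 * (1 - 1 / (2 * (b : ℝ) ^ 4)) := by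
      intro v t
      have hz' : (u : ℝ) * (b * k) = D * z := by exact_mod_cast hz
      have := pair_kernel f hf b hb hA (θ + v / (N * b : ℕ)) (θ' + v / (N * b : ℕ) + u * t / D) (u * k / D) z
        (by push_cast; field_simp; linarith) (by
          rintro ⟨c, hc⟩
          apply hk1
          have hcn : z = b * c.natAbs := by
            have := congrArg Int.natAbs hc
            rw [Int.natAbs_mul] at this; simpa using this
          refine ⟨c.natAbs, ?_⟩
          rw [hcn] at hz
          have : b * (u * k) = b * (D * c.natAbs) := by linarith
          exact Nat.eq_of_mul_eq_mul_left (by omega) this)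
      refine le_trans (le_of_eq ?_) this
      rw [hK]; simp only
      congr 1
      apply sum_congr rfl; intro d _
      congr 3; push_cast; ring
    rw [hrw]
    have hv : ∀ v ∈ range N, ∑ t ∈ range D, K v t * H v t ≤ (1 - 1 / (2 * (b : ℝ) ^ 4)) * ∑ t ∈ range D, H v t := by
      intro v _
      have e1 := sum_range_periodic_shift D (fun t => K v t * H v t) (by intro t; simp only [hperK, hperH]) k
      have e2 : ∑ t ∈ range D, K v t * H v t + ∑ t ∈ range D, K v (t + k) * H v (t + k) ≤
          ∑ t ∈ range D, 2 * (1 - 1 / (2 * (b : ℝ) ^ 4)) * H v t := by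
        rw [← sum_add_distrib]
        apply sum_le_sum; intro t _
        rw [hshiftH, ← add_mul]
        exact mul_le_mul_of_nonneg_right (hgain v t) (hH0 v t)
      rw [← mul_sum] at e2
      linarith
    refine (sum_le_sum hv).trans ?_
    rw [← mul_sum, sum_comm, pow_succ]
    calc _ ≤ (1 - 1 / (2 * (b : ℝ) ^ 4)) * (D * (1 - 1 / (2 * (b : ℝ) ^ 4)) ^ j) := by
          apply mul_le_mul_of_nonneg_left hih hρ0
      _ = _ := by ring

lemma inv_dft (f : ℕ → ℂ) (G : ℕ) (hG : 0 < G) (n : ℕ) :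
    f (n % G) = ∑ h ∈ range G, FF f G ((h : ℝ) / G) * ee (-((h : ℝ) * n / G)) := by
  have hG' : (G : ℂ) ≠ 0 := by exact_mod_cast hG.ne'
  have h1 : ∀ h ∈ range G, FF f G ((h : ℝ) / G) * ee (-((h : ℝ) * n / G)) =
      ∑ m ∈ range G, f m * ee ((((m : ℤ) - n : ℤ) : ℝ) * h / G) / G := by
    intro h _
    unfold FF
    rw [sum_div, sum_mul]
    apply sum_congr rfl; intro m _
    rw [div_mul_eq_mul_div, mul_assoc, ← ee_add]
    congr 3; push_cast; ring
  rw [sum_congr rfl h1, sum_comm]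
  have h2 : ∀ m ∈ range G, ∑ h ∈ range G, f m * ee ((((m : ℤ) - n : ℤ) : ℝ) * h / G) / G = if m = n % G then f m else 0 := by
    intro m hm
    rw [← sum_div, ← mul_sum, sum_ee_range G hG]
    have : (G : ℤ) ∣ (m : ℤ) - n ↔ m = n % G := by
      rw [← range_dvd_sub (mem_range.mp hm) (Nat.mod_lt n hG)]
      have : (G : ℤ) ∣ (n : ℤ) - (n % G : ℕ) := ⟨(n / G : ℕ), by
        have := Nat.div_add_mod n G
        have h3 : (G : ℤ) * ((n / G : ℕ) : ℤ) + ((n % G : ℕ) : ℤ) = n := by exact_mod_cast this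
        linarith⟩
      constructor
      · intro h
        have := h.add this; simpa using this
      · intro h
        have := h.sub this; simpa using this
    simp only [this]
    split_ifs
    · field_simp
    · simp
  rw [sum_congr rfl h2, sum_ite_eq' , if_pos (mem_range.mpr (Nat.mod_lt n hG))]

lemma carry_count (G X N m r : ℕ) (hG : 0 < G) (hm : 0 < m) :
    ((Ioc 0 N).filter (fun k => m * (k + r) ≤ X ∧ m * k / G ≠ m * (k + r) / G)).card ≤ (X / G) * r := by
  classical
  have hsub : (Ioc 0 N).filter (fun k => m * (k + r) ≤ X ∧ m * k / G ≠ m * (k + r) / G) ⊆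
      (Ioc 0 (X / G)).biUnion (fun j => Ico ((j * G + (m - 1)) / m - r) ((j * G + (m - 1)) / m)) := by
    intro k hk
    rw [mem_filter] at hk
    obtain ⟨_, hX, hne⟩ := hk
    rw [mem_biUnion]
    have hlt : m * k / G < m * (k + r) / G := by
      apply lt_of_le_of_ne _ hne
      exact Nat.div_le_div_right (Nat.mul_le_mul_left _ (by omega))
    refine ⟨m * (k + r) / G, ?_, ?_⟩
    · rw [mem_Ioc]
      exact ⟨lt_of_le_of_lt (Nat.zero_le _) hlt, Nat.div_le_div_right hX⟩
    · have h1 : m * (k + r) / G * G ≤ m * (k + r) := Nat.div_mul_le_self _ _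
      have h2 : m * k < m * (k + r) / G * G := by rw [Nat.div_lt_iff_lt_mul hG] at hlt; exact hlt
      set J := m * (k + r) / G * G
      rw [mem_Ico]
      constructor
      · have : (J + (m - 1)) / m ≤ k + r := by
          rw [← Nat.lt_add_one_iff, Nat.div_lt_iff_lt_mul hm]
          have : (k + r + 1) * m = m * (k + r) + m := by ring
          omega
        omega
      · rw [← Nat.add_one_le_iff, Nat.le_div_iff_mul_le hm]
        have : (k + 1) * m = m * k + m := by ring
        omega
  refine (card_le_card hsub).trans (card_biUnion_le.trans ?_)
  calc _ ≤ ∑ j ∈ Ioc 0 (X / G), r := by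
        apply sum_le_sum; intro j _; rw [Nat.card_Ico]; omega
    _ = _ := by simp

lemma carry_total (f : ℕ → ℂ) (hf : ∀ n, ‖f n‖ = 1) (G : ℕ) (hG : 0 < G) (hbm : BM G f)
    (X M M' r : ℕ) (hM : 1 ≤ M) (h2 : M' ≤ 2 * M) :
    TT f X M M' r ≤ 2 * (M * ((X / G : ℕ) * r)) +
      ∑ k ∈ Ioc 0 (X / M), ‖∑ m ∈ (Ioc M M').filter (fun m => m * (k + r) ≤ X),
        f (m * (k + r) % G) * (starRingEnd ℂ) (f (m * k % G))‖ := by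
  classical
  have hsplit : ∀ n, f n = f (n % G) * f (n / G) := by
    intro n
    conv_lhs => rw [← Nat.div_add_mod n G]
    exact hbm _ _ (Nat.mod_lt _ hG)
  have hpt : ∀ k m, m ∈ (Ioc M M').filter (fun m => m * (k + r) ≤ X) → ‖f (m * (k + r)) * (starRingEnd ℂ) (f (m * k))
      - f (m * (k + r) % G) * (starRingEnd ℂ) (f (m * k % G))‖ ≤ 2 * (if m * (k + r) ≤ X ∧ m * k / G ≠ m * (k + r) / G then 1 else 0) := by
    intro k m hm
    rw [mem_filter] at hm
    split_ifs with h
    · refine (norm_sub_le _ _).trans ?_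
      simp only [norm_mul, Complex.norm_conj, hf]; norm_num
    · have heq : m * k / G = m * (k + r) / G := by
        by_contra h3; exact h ⟨hm.2, h3⟩
      rw [hsplit (m * (k + r)), hsplit (m * k), heq, map_mul]
      have : f (m * (k + r) / G) * (starRingEnd ℂ) (f (m * (k + r) / G)) = 1 := by
        rw [Complex.mul_conj', hf]; simp
      rw [show f (m * (k + r) % G) * f (m * (k + r) / G) * ((starRingEnd ℂ) (f (m * k % G)) * (starRingEnd ℂ) (f (m * (k + r) / G)))
        = f (m * (k + r) % G) * (starRingEnd ℂ) (f (m * k % G)) * (f (m * (k + r) / G) * (starRingEnd ℂ) (f (m * (k + r) / G))) by ring, this]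
      simp
  have hstep : ∀ k, ‖∑ m ∈ (Ioc M M').filter (fun m => m * (k + r) ≤ X), f (m * (k + r)) * (starRingEnd ℂ) (f (m * k))‖
      ≤ ∑ m ∈ Ioc M M', 2 * (if m * (k + r) ≤ X ∧ m * k / G ≠ m * (k + r) / G then (1 : ℝ) else 0) +
      ‖∑ m ∈ (Ioc M M').filter (fun m => m * (k + r) ≤ X), f (m * (k + r) % G) * (starRingEnd ℂ) (f (m * k % G))‖ := by
    intro k
    set A := ∑ m ∈ (Ioc M M').filter (fun m => m * (k + r) ≤ X), f (m * (k + r)) * (starRingEnd ℂ) (f (m * k))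
    set B := ∑ m ∈ (Ioc M M').filter (fun m => m * (k + r) ≤ X), f (m * (k + r) % G) * (starRingEnd ℂ) (f (m * k % G))
    have h1 : ‖A‖ ≤ ‖A - B‖ + ‖B‖ := by
      have := norm_add_le (A - B) B; simpa using this
    have h3 : ‖A - B‖ ≤ ∑ m ∈ Ioc M M', 2 * (if m * (k + r) ≤ X ∧ m * k / G ≠ m * (k + r) / G then (1 : ℝ) else 0) := by
      rw [← sum_sub_distrib]
      refine (norm_sum_le _ _).trans ((sum_le_sum (hpt k)).trans ?_)
      apply sum_le_sum_of_subset_of_nonneg (filter_subset _ _)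
      intros; positivity
    linarith
  unfold TT
  refine (sum_le_sum (fun k _ => hstep k)).trans ?_
  rw [sum_add_distrib]
  apply add_le_add_left
  rw [sum_comm]
  calc _ ≤ ∑ m ∈ Ioc M M', 2 * (((X / G : ℕ) : ℝ) * r) := by
        apply sum_le_sum; intro m hm
        rw [mem_Ioc] at hm
        rw [← mul_sum, ← sum_filter, sum_const, nsmul_eq_mul, mul_one]
        have := carry_count G X (X / M) m r hG (by omega)
        apply mul_le_mul_of_nonneg_left _ (by norm_num)
        exact_mod_cast this
    _ = ((M' - M : ℕ) : ℝ) * (2 * (((X / G : ℕ) : ℝ) * r)) := by simp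
    _ ≤ M * (2 * (((X / G : ℕ) : ℝ) * r)) := by
        gcongr; omega
    _ = _ := by ring

/-- Fourier expansion of inner sums -/
lemma inner_fourier (f : ℕ → ℂ) (G : ℕ) (hG : 0 < G) (X M M' r k : ℕ) (h2 : M' ≤ 2 * M) (hk : 0 < k) :
    ‖∑ m ∈ (Ioc M M').filter (fun m => m * (k + r) ≤ X), f (m * (k + r) % G) * (starRingEnd ℂ) (f (m * k % G))‖ ≤
    ∑ s ∈ range G, ∑ h ∈ range G, ‖FF f G ((h : ℝ) / G)‖ * ‖FF f G ((s : ℝ) / G + h / G)‖ * Ker M (((s : ℝ) * k - h * r) / G) := by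
  have hG' : (G : ℝ) ≠ 0 := by positivity
  have hset : (Ioc M M').filter (fun m => m * (k + r) ≤ X) = Ioc M (min M' (X / (k + r))) := by
    ext m
    rw [mem_filter, mem_Ioc, mem_Ioc, le_min_iff, Nat.le_div_iff_mul_le (by omega)]
    tauto
  have e1 : ∑ m ∈ (Ioc M M').filter (fun m => m * (k + r) ≤ X), f (m * (k + r) % G) * (starRingEnd ℂ) (f (m * k % G))
     = ∑ h ∈ range G, ∑ h' ∈ range G, FF f G ((h : ℝ) / G) * (starRingEnd ℂ) (FF f G ((h' : ℝ) / G)) *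
        ∑ m ∈ Ioc M (min M' (X / (k + r))), ee (m * (((h' : ℝ) * k - h * (k + r)) / G)) := by
    rw [hset]
    have hm : ∀ m ∈ Ioc M (min M' (X / (k + r))), f (m * (k + r) % G) * (starRingEnd ℂ) (f (m * k % G)) =
        ∑ h ∈ range G, ∑ h' ∈ range G, FF f G ((h : ℝ) / G) * (starRingEnd ℂ) (FF f G ((h' : ℝ) / G)) *
          ee (m * (((h' : ℝ) * k - h * (k + r)) / G)) := by
      intro m _
      rw [inv_dft f G hG (m * (k + r)), inv_dft f G hG (m * k), map_sum, sum_mul_sum]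
      apply sum_congr rfl; intro h _
      apply sum_congr rfl; intro h' _
      rw [map_mul, ← ee_neg, neg_neg]
      have : ee ((m : ℝ) * (((h' : ℝ) * k - h * (k + r)) / G)) = ee (-((h : ℝ) * (m * (k + r) : ℕ) / G)) * ee ((h' : ℝ) * (m * k : ℕ) / G) := by
        rw [← ee_add]; congr 1; push_cast; ring
      rw [this]; ring
    rw [sum_congr rfl hm, sum_comm]
    apply sum_congr rfl; intro h _
    rw [sum_comm]
    apply sum_congr rfl; intro h' _
    rw [mul_sum]
  rw [e1]
  have e2 : ∀ h ∈ range G, ‖∑ h' ∈ range G, FF f G ((h : ℝ) / G) * (starRingEnd ℂ) (FF f G ((h' : ℝ) / G)) *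
        ∑ m ∈ Ioc M (min M' (X / (k + r))), ee (m * (((h' : ℝ) * k - h * (k + r)) / G))‖ ≤
      ∑ s ∈ range G, ‖FF f G ((h : ℝ) / G)‖ * ‖FF f G ((s : ℝ) / G + h / G)‖ * Ker M (((s : ℝ) * k - h * r) / G) := by
    intro h _
    have e3 := sum_range_periodic_shift G (fun h' => ‖FF f G ((h : ℝ) / G)‖ * ‖FF f G ((h' : ℝ) / G)‖ * Ker M (((h' : ℝ) * k - h * (k + r)) / G)) (by
      intro t
      have a1 : ((t + G : ℕ) : ℝ) / G = t / G + (1 : ℤ) := by push_cast; field_simp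
      have a2 : (((t + G : ℕ) : ℝ) * k - h * (k + r)) / G = ((t : ℝ) * k - h * (k + r)) / G + (k : ℤ) := by push_cast; field_simp; ring
      simp only [a1, a2, FF_add_int, Ker_add_int]) h
    have e4 : ∑ s ∈ range G, ‖FF f G ((h : ℝ) / G)‖ * ‖FF f G ((s : ℝ) / G + h / G)‖ * Ker M (((s : ℝ) * k - h * r) / G)
       = ∑ t ∈ range G, ‖FF f G ((h : ℝ) / G)‖ * ‖FF f G (((t + h : ℕ) : ℝ) / G)‖ * Ker M ((((t + h : ℕ) : ℝ) * k - h * (k + r)) / G) := by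
      apply sum_congr rfl; intro t _
      have a2 : ((t : ℝ) * k - h * r) / G = (((t + h : ℕ) : ℝ) * k - h * (k + r)) / G := by push_cast; ring
      have a3 : (t : ℝ) / G + h / G = ((t + h : ℕ) : ℝ) / G := by push_cast; ring
      rw [a2, a3]
    rw [e4, e3]
    refine (norm_sum_le _ _).trans (sum_le_sum ?_)
    intro h' _
    rw [norm_mul, norm_mul, Complex.norm_conj]
    apply mul_le_mul_of_nonneg_left _ (by positivity)
    apply geom_sum_le _ _ _ _ _ (by positivity)
    have : (((min M' (X / (k + r)) : ℕ)) : ℝ) ≤ 2 * M := by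
      exact_mod_cast (min_le_left _ _).trans h2
    linarith
  refine (norm_sum_le _ _).trans ((sum_le_sum e2).trans (le_of_eq ?_))
  rw [sum_comm]

lemma gcd_split (G s : ℕ) (hG : 0 < G) : ∃ a : ℤ, IsCoprime a ((G / Nat.gcd s G : ℕ) : ℤ) ∧
    (s : ℝ) / G = (a : ℝ) / (G / Nat.gcd s G : ℕ) ∧ 0 < G / Nat.gcd s G := by
  have hd : 0 < Nat.gcd s G := Nat.gcd_pos_of_pos_right _ hG
  have hD : 0 < G / Nat.gcd s G := Nat.div_pos (Nat.gcd_le_right _ hG) hd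
  refine ⟨(s / Nat.gcd s G : ℕ), ?_, ?_, hD⟩
  · rw [Nat.isCoprime_iff_coprime]; exact Nat.coprime_div_gcd_div_gcd hd
  · have h1 : (s : ℝ) = (s / Nat.gcd s G : ℕ) * (Nat.gcd s G : ℕ) := by
      exact_mod_cast (Nat.div_mul_cancel (Nat.gcd_dvd_left s G)).symm
    have h2 : (G : ℝ) = (G / Nat.gcd s G : ℕ) * (Nat.gcd s G : ℕ) := by
      exact_mod_cast (Nat.div_mul_cancel (Nat.gcd_dvd_right s G)).symm
    have hd' : (0 : ℝ) < (Nat.gcd s G : ℕ) := by exact_mod_cast hd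
    have hD' : (0 : ℝ) < (G / Nat.gcd s G : ℕ) := by exact_mod_cast hD
    rw [h2]; nth_rewrite 1 [h1]
    rw [Int.cast_natCast, mul_div_mul_right _ _ hd'.ne']

lemma ksum1 (G s N : ℕ) (hG : 0 < G) (M β : ℝ) (hM : 0 ≤ M) :
    ∑ k ∈ Ioc 0 N, Ker M (((s : ℝ) * k - β) / G) ≤
      ((N : ℝ) / (G / Nat.gcd s G : ℕ) + 1) * (4 * M + 2 * (G / Nat.gcd s G : ℕ) * (1 + log (G / Nat.gcd s G : ℕ))) := by
  obtain ⟨a, ha, hs, hD⟩ := gcd_split G s hG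
  rw [sum_Ioc_eq_range]
  have h := ker_sum_le _ hD a ha ((s : ℝ) / G - β / G) M hM N
  refine le_trans (le_of_eq ?_) h
  apply sum_congr rfl; intro k _
  congr 1
  rw [mul_div_right_comm, ← hs]; push_cast; ring

lemma ksum2 (G s N : ℕ) (hG : 0 < G) (M β : ℝ) (hM : 0 ≤ M) :
    ∑ k ∈ Ioc 0 N, Ker M (((s : ℝ) * k - β) / G) ≤
      N * ((G / Nat.gcd s G : ℕ) * Ker M ((G / Nat.gcd s G : ℕ) * β / G)) := by
  obtain ⟨a, ha, hs, hD⟩ := gcd_split G s hG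
  set D := G / Nat.gcd s G
  have hD' : (0 : ℝ) < D := by exact_mod_cast hD
  calc _ ≤ ∑ k ∈ Ioc 0 N, (D * Ker M (D * β / G)) := by
        apply sum_le_sum; intro k _
        apply Ker_le_of_nd hM (by exact_mod_cast hD)
        have e : (D : ℝ) * (((s : ℝ) * k - β) / G) = -(D * β / G) + ((a * k : ℤ) : ℝ) := by
          rw [sub_div, mul_div_right_comm, hs]; push_cast; field_simp; ring
        calc nd (D * β / G) = nd (D * (((s : ℝ) * k - β) / G)) := by rw [e, nd_add_int, nd_neg]
          _ ≤ _ := nd_nat_mul_le _ _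
    _ = _ := by simp

lemma gcd_group (G : ℕ) (hG : 0 < G) (Ψ : ℕ → ℝ) :
    ∑ s ∈ range G, Ψ s = ∑ d ∈ G.divisors, ∑ s ∈ (range G).filter (fun s => Nat.gcd s G = d), Ψ s := by
  rw [sum_fiberwise_of_maps_to]
  intro s _
  rw [Nat.mem_divisors]; exact ⟨Nat.gcd_dvd_right _ _, hG.ne'⟩

lemma gcd_class (G d : ℕ) (hG : 0 < G) (hd : d ∣ G) (Ψ : ℕ → ℝ) (hΨ : ∀ s, 0 ≤ Ψ s) :
    ∑ s ∈ (range G).filter (fun s => Nat.gcd s G = d), Ψ s ≤ ∑ t ∈ range (G / d), Ψ (d * t) := by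
  have hd0 : 0 < d := Nat.pos_of_dvd_of_pos hd hG
  have : ∑ t ∈ range (G / d), Ψ (d * t) = ∑ s ∈ (range (G / d)).image (fun t => d * t), Ψ s := by
    rw [sum_image]; intro x _ y _ h; exact Nat.eq_of_mul_eq_mul_left hd0 h
  rw [this]
  apply sum_le_sum_of_subset_of_nonneg _ (fun _ _ _ => hΨ _)
  intro s hs
  rw [mem_filter, mem_range] at hs
  rw [mem_image]
  have hds : d ∣ s := hs.2 ▸ Nat.gcd_dvd_left s G
  refine ⟨s / d, ?_, Nat.mul_div_cancel' hds⟩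
  rw [mem_range]; exact Nat.div_lt_div_of_lt_of_dvd hd hs.1

lemma divisors_pow_card (b l : ℕ) (hb : 0 < b) : ((b ^ l).divisors.card : ℝ) ≤ ((b : ℝ) * l + 1) ^ b := by
  rw [Nat.card_divisors (by positivity)]
  push_cast
  have h1 : ∏ p ∈ (b ^ l).primeFactors, ((((b ^ l).factorization p : ℕ) : ℝ) + 1) ≤ ∏ p ∈ (b ^ l).primeFactors, ((b : ℝ) * l + 1) := by
    apply prod_le_prod
    · intros; positivity
    · intro p _
      rw [Nat.factorization_pow]
      simp only [Finsupp.coe_smul, Pi.smul_apply, smul_eq_mul, Nat.cast_mul]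
      have : ((b.factorization p : ℕ) : ℝ) ≤ b := by exact_mod_cast (Nat.factorization_lt p hb.ne').le
      nlinarith [(Nat.cast_nonneg l : (0 : ℝ) ≤ l)]
  refine h1.trans ?_
  rw [prod_const]
  apply pow_le_pow_right₀
  · have : (0 : ℝ) ≤ b * l := by positivity
    linarith
  · calc _ ≤ b.primeFactors.card := card_le_card (by
        rcases Nat.eq_zero_or_pos l with rfl | hl
        · simp
        · rw [Nat.primeFactors_pow _ hl.ne'])
      _ ≤ (Ioc 0 b).card := by
        apply card_le_card
        intro p hp
        rw [mem_Ioc]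
        exact ⟨Nat.pos_of_mem_primeFactors hp, Nat.le_of_mem_primeFactors hp⟩
      _ = b := by simp

set_option maxHeartbeats 1600000 in
theorem typeII_digit (f : ℕ → ℂ) (hf : ∀ n, ‖f n‖ = 1) (b : ℕ) (hb : 2 ≤ b) (hbm : BM b f) (h0 : f 0 = 1)
    (hA : ∀ w : ℂ, ‖w‖ = 1 → 1 ≤ ‖∑ m ∈ range (b - 1), f (m + 1) * (starRingEnd ℂ) (f m) + w‖)
    (l X M M' r R : ℕ) (σ : ℝ) (hσ : ∀ θ, ‖FF f (b ^ l) θ‖ ≤ σ) (hM : 1 ≤ M) (h2 : M' ≤ 2 * M)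
    (hMX : M * M ≤ X) (hr : 1 ≤ r) (hrR : r < R) (hG1 : M * R ^ 2 ≤ b ^ l) (hG2 : b ^ l ≤ b * M * R ^ 2) :
    TT f X M M' r ≤ X * (2 / R + 4 * ((b : ℝ) * l + 1) ^ b * (1 - 1 / (2 * (b : ℝ) ^ 4)) ^ (Nat.log b R + 1)
      + 8 * b ^ 2 * R ^ 4 * (1 + log (b ^ l : ℕ)) * (1 - 1 / (2 * (b : ℝ) ^ 4)) ^ l
      + 12 * b * R ^ 5 * σ ^ 2 * (1 + log (b ^ l : ℕ))) := by
  have hb0 : (0 : ℝ) < b := by positivity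
  have hb1 : (1 : ℝ) ≤ b := by exact_mod_cast (by omega : 1 ≤ b)
  set ρ := 1 - 1 / (2 * (b : ℝ) ^ 4) with hρ
  have hρ0 : 0 ≤ ρ := by
    rw [hρ, sub_nonneg, div_le_one (by positivity)]
    have : (1 : ℝ) ≤ b ^ 4 := one_le_pow₀ hb1
    linarith
  have hσ0 : 0 ≤ σ := (norm_nonneg _).trans (hσ 0)
  have hpair := pair_lemma f hf b hb hbm hA
  have hcarry := carry_total f hf (b ^ l) (by positivity) (BM_pow (by omega) hbm h0 l) X M M' r hM h2
  have hcard := divisors_pow_card b l (by omega)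
  have hpairG := hpair (b ^ l) (by positivity) l l 1 0 0 le_rfl ⟨l, by simp⟩ (by
    intro i hi h
    rw [one_mul] at h
    have := Nat.le_of_dvd (by positivity) h
    exact absurd this (by rw [not_le]; exact Nat.pow_lt_pow_right (by omega) hi))
  have hpairD : ∀ D, D ∣ b ^ l → R < D → ∑ t ∈ range D, ∑ v ∈ range (b ^ l), ‖FF f (b ^ l) (0 + v / (b ^ l : ℕ))‖ *
        ‖FF f (b ^ l) (0 + (1 : ℕ) * t / D + v / (b ^ l : ℕ))‖ ≤ D * ρ ^ (Nat.log b R + 1) := by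
    intro D hD hRD
    apply hpair D (by omega) (Nat.log b R + 1) l 1 0 0 _ ⟨l, by simpa using hD⟩
    · intro i hi h
      rw [one_mul] at h
      have h3 := Nat.le_of_dvd (by positivity) h
      have h4 : b ^ i ≤ b ^ Nat.log b R := Nat.pow_le_pow_right (by omega) (by omega)
      have h5 := Nat.pow_log_le_self b (x := R) (by omega)
      omega
    · have h3 := Nat.le_of_dvd (by positivity) hD
      have h5 := Nat.pow_log_le_self b (x := R) (by omega)
      have : b ^ Nat.log b R < b ^ l := by omega
      exact (Nat.pow_lt_pow_iff_right (by omega)).mp this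
  set G := b ^ l with hG
  have hG0 : 0 < G := by rw [hG]; positivity
  have hG0' : (0 : ℝ) < G := by exact_mod_cast hG0
  set ℓ := 1 + log G with hℓ
  have hℓ1 : 1 ≤ ℓ := one_le_ell
  set N := X / M with hN
  have hNM : (N : ℝ) * M ≤ X := by exact_mod_cast Nat.div_mul_le_self X M
  have hM1 : (1 : ℝ) ≤ M := by exact_mod_cast hM
  have hR1 : (1 : ℝ) ≤ R := by exact_mod_cast (by omega : 1 ≤ R)
  have hMX' : (M : ℝ) * M ≤ X := by exact_mod_cast hMX
  have hG1' : (M : ℝ) * R ^ 2 ≤ G := by exact_mod_cast hG1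
  have hG2' : (G : ℝ) ≤ b * M * R ^ 2 := by exact_mod_cast hG2
  have hrR' : (r : ℝ) ≤ R := by exact_mod_cast hrR.le
  set A : ℕ → ℝ := fun s => ∑ h ∈ range G, ‖FF f G ((h : ℝ) / G)‖ * ‖FF f G ((s : ℝ) / G + h / G)‖ with hAdef
  have hA0 : ∀ s, 0 ≤ A s := fun s => sum_nonneg fun _ _ => by positivity
  set D : ℕ → ℕ := fun s => G / Nat.gcd s G with hD
  have hDpos : ∀ s, 0 < D s := fun s => (gcd_split G s hG0).choose_spec.2.2
  -- the sum over h of Ker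
  have hker : ∀ E : ℕ, 0 < E → E ≤ R → ∑ h ∈ range G, Ker M ((E : ℝ) * (h * r) / G) ≤ 12 * G * ℓ := by
    intro E hE hER
    obtain ⟨a, ha, hs, hE'⟩ := gcd_split G (E * r) hG0
    have hk := ker_sum_le _ hE' a ha 0 M (by positivity) G
    have e1 : ∑ h ∈ range G, Ker M ((E : ℝ) * (h * r) / G) = ∑ k ∈ range G, Ker M ((a : ℝ) * k / (G / Nat.gcd (E * r) G : ℕ) + 0) := by
      apply sum_congr rfl; intro h _
      congr 1
      rw [add_zero, mul_div_right_comm (a : ℝ), ← hs]; push_cast; ring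
    rw [e1]
    refine hk.trans ?_
    set G' := G / Nat.gcd (E * r) G with hG'
    have hG'0 : (0 : ℝ) < G' := by exact_mod_cast hE'
    have hG'le : (G' : ℝ) ≤ G := by exact_mod_cast Nat.div_le_self _ _
    have hgle : (Nat.gcd (E * r) G : ℝ) ≤ R ^ 2 := by
      have h3 : Nat.gcd (E * r) G ≤ E * r := Nat.gcd_le_left _ (by positivity)
      have h4 : E * r ≤ R ^ 2 := by rw [sq]; exact Nat.mul_le_mul hER hrR.le
      exact_mod_cast h3.trans h4
    have hquot : (G : ℝ) / G' = Nat.gcd (E * r) G := by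
      rw [div_eq_iff hG'0.ne']
      exact_mod_cast (Nat.mul_div_cancel' (Nat.gcd_dvd_right (E * r) G)).symm
    have hlog : 1 + log G' ≤ ℓ := ell_mono (by exact_mod_cast hG'le)
    have hl0 : (1 : ℝ) ≤ 1 + log G' := one_le_ell
    have hR2 : (1 : ℝ) ≤ (R : ℝ) ^ 2 := one_le_pow₀ hR1
    calc ((G : ℝ) / G' + 1) * (4 * M + 2 * G' * (1 + log G'))
        = ((G : ℝ) / G' + 1) * (4 * M) + 2 * (G + G') * (1 + log G') := by field_simp
      _ ≤ (R ^ 2 + R ^ 2) * (4 * M) + 2 * (G + G) * ℓ := by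
          rw [hquot]; gcongr
      _ = 8 * (M * R ^ 2) * 1 + 4 * G * ℓ := by ring
      _ ≤ 8 * G * ℓ + 4 * G * ℓ := by gcongr
      _ = _ := by ring
  have hcs : ∀ s : ℕ, ∑ h ∈ range G, ‖FF f G ((h : ℝ) / G)‖ * ‖FF f G ((s : ℝ) / G + h / G)‖ *
      ∑ k ∈ Ioc 0 N, Ker M (((s : ℝ) * k - h * r) / G) ≤ A s * (4 * M + 2 * (N + G) * ℓ) +
      (if R < D s then A s * (4 * M * N / D s) else 0) + (if D s ≤ R then σ ^ 2 * N * D s * (12 * G * ℓ) else 0) := by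
    intro s
    have hDs : (0 : ℝ) < D s := by exact_mod_cast hDpos s
    rcases lt_or_ge R (D s) with hc | hc
    · rw [if_pos hc, if_neg (by omega), add_zero, ← mul_add, hAdef]
      simp only
      rw [sum_mul]
      apply sum_le_sum; intro h _
      apply mul_le_mul_of_nonneg_left _ (by positivity)
      refine (ksum1 G s N hG0 M (h * r) (by positivity)).trans ?_
      have hDle : (D s : ℝ) ≤ G := by exact_mod_cast Nat.div_le_self _ _
      have hlog : 1 + log (D s) ≤ ℓ := ell_mono (by exact_mod_cast hDle)
      have hl0 : (1 : ℝ) ≤ 1 + log (D s) := one_le_ell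
      show ((N : ℝ) / D s + 1) * (4 * M + 2 * D s * (1 + log (D s))) ≤ _
      calc ((N : ℝ) / D s + 1) * (4 * M + 2 * D s * (1 + log (D s))) = 4 * M + 2 * (N + D s) * (1 + log (D s)) + 4 * M * N / D s := by
            field_simp; ring
        _ ≤ _ := by gcongr
    · rw [if_neg (by omega), if_pos hc, add_zero]
      have : 0 ≤ A s * (4 * M + 2 * (N + G) * ℓ) := by have := hA0 s; positivity
      refine le_trans ?_ (le_add_of_nonneg_left this)
      calc _ ≤ ∑ h ∈ range G, σ ^ 2 * (N * (D s * Ker M (D s * (h * r) / G))) := by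
            apply sum_le_sum; intro h _
            have hk0 : 0 ≤ ∑ k ∈ Ioc 0 N, Ker M (((s : ℝ) * k - h * r) / G) := sum_nonneg fun _ _ => Ker_nonneg (by positivity) _
            apply mul_le_mul _ (ksum2 G s N hG0 M (h * r) (by positivity)) hk0 (by positivity)
            rw [sq]; exact mul_le_mul (hσ _) (hσ _) (norm_nonneg _) hσ0
        _ = σ ^ 2 * N * D s * ∑ h ∈ range G, Ker M (D s * (h * r) / G) := by
            rw [mul_sum]; apply sum_congr rfl; intro h _; ring
        _ ≤ _ := by
            apply mul_le_mul_of_nonneg_left (hker _ (hDpos s) hc) (by positivity)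
  -- main: sum over k, swap
  have hmain : ∑ k ∈ Ioc 0 N, ‖∑ m ∈ (Ioc M M').filter (fun m => m * (k + r) ≤ X),
        f (m * (k + r) % G) * (starRingEnd ℂ) (f (m * k % G))‖ ≤ ∑ s ∈ range G, (A s * (4 * M + 2 * (N + G) * ℓ) +
      (if R < D s then A s * (4 * M * N / D s) else 0) + (if D s ≤ R then σ ^ 2 * N * D s * (12 * G * ℓ) else 0)) := by
    calc _ ≤ ∑ k ∈ Ioc 0 N, ∑ s ∈ range G, ∑ h ∈ range G, ‖FF f G ((h : ℝ) / G)‖ * ‖FF f G ((s : ℝ) / G + h / G)‖ * Ker M (((s : ℝ) * k - h * r) / G) := by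
          apply sum_le_sum; intro k hk
          exact inner_fourier f G hG0 X M M' r k h2 (mem_Ioc.mp hk).1
      _ = ∑ s ∈ range G, ∑ h ∈ range G, ‖FF f G ((h : ℝ) / G)‖ * ‖FF f G ((s : ℝ) / G + h / G)‖ *
      ∑ k ∈ Ioc 0 N, Ker M (((s : ℝ) * k - h * r) / G) := by
          rw [sum_comm]; apply sum_congr rfl; intro s _
          rw [sum_comm]; apply sum_congr rfl; intro h _
          rw [mul_sum]
      _ ≤ _ := sum_le_sum fun s _ => hcs s
  rw [sum_add_distrib, sum_add_distrib, ← sum_mul] at hmain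
  have hS1 : ∑ s ∈ range G, A s ≤ G * ρ ^ l := by
    refine le_trans (le_of_eq ?_) hpairG
    apply sum_congr rfl; intro s _
    apply sum_congr rfl; intro h _
    congr 3 <;> (push_cast; ring)
  have hS2 : ∑ s ∈ range G, (if R < D s then A s * (4 * M * N / D s) else 0) ≤ ((b : ℝ) * l + 1) ^ b * (4 * M * N * ρ ^ (Nat.log b R + 1)) := by
    rw [gcd_group G hG0]
    calc _ ≤ ∑ d ∈ G.divisors, (4 * M * N * ρ ^ (Nat.log b R + 1)) := by
          apply sum_le_sum; intro d hd
          rw [Nat.mem_divisors] at hd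
          have hd0 : 0 < d := Nat.pos_of_dvd_of_pos hd.1 hG0
          have e1 : ∑ s ∈ (range G).filter (fun s => Nat.gcd s G = d), (if R < D s then A s * (4 * M * N / D s) else 0)
            = ∑ s ∈ (range G).filter (fun s => Nat.gcd s G = d), (if R < G / d then A s * (4 * M * N / (G / d : ℕ)) else 0) := by
            apply sum_congr rfl; intro s hs
            rw [mem_filter] at hs
            have : D s = G / d := by rw [hD]; simp only; rw [hs.2]
            rw [this]
          rw [e1]
          split_ifs with hc
          · rw [← sum_mul]
            have h3 : ∑ s ∈ (range G).filter (fun s => Nat.gcd s G = d), A s ≤ (G / d : ℕ) * ρ ^ (Nat.log b R + 1) := by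
              refine (gcd_class G d hG0 hd.1 A hA0).trans ?_
              refine le_trans (le_of_eq ?_) (hpairD (G / d) (Nat.div_dvd_of_dvd hd.1) hc)
              apply sum_congr rfl; intro t _
              apply sum_congr rfl; intro h _
              have : ((d * t : ℕ) : ℝ) / G = (1 : ℕ) * t / (G / d : ℕ) := by
                rw [Nat.cast_div hd.1 (by positivity)]; push_cast; field_simp
              rw [this, zero_add, zero_add]
            have hq : (0 : ℝ) < (G / d : ℕ) := by exact_mod_cast (by omega : 0 < G / d)
            calc _ ≤ (G / d : ℕ) * ρ ^ (Nat.log b R + 1) * (4 * M * N / (G / d : ℕ)) := by gcongr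
              _ = _ := by field_simp
          · rw [sum_const_zero]; positivity
      _ = (G.divisors.card : ℝ) * (4 * M * N * ρ ^ (Nat.log b R + 1)) := by simp
      _ ≤ _ := by gcongr
  have hS3 : ∑ s ∈ range G, (if D s ≤ R then σ ^ 2 * N * D s * (12 * G * ℓ) else 0) ≤ R ^ 3 * (σ ^ 2 * N * (12 * G * ℓ)) := by
    rw [gcd_group G hG0]
    calc _ ≤ ∑ d ∈ G.divisors, (fun E : ℕ => if E ≤ R then (R : ℝ) ^ 2 * (σ ^ 2 * N * (12 * G * ℓ)) else 0) (G / d) := by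
          apply sum_le_sum; intro d hd
          rw [Nat.mem_divisors] at hd
          have hd0 : 0 < d := Nat.pos_of_dvd_of_pos hd.1 hG0
          simp only
          have e1 : ∑ s ∈ (range G).filter (fun s => Nat.gcd s G = d), (if D s ≤ R then σ ^ 2 * N * D s * (12 * G * ℓ) else 0)
            = ∑ s ∈ (range G).filter (fun s => Nat.gcd s G = d), (if G / d ≤ R then σ ^ 2 * N * (G / d : ℕ) * (12 * G * ℓ) else 0) := by
            apply sum_congr rfl; intro s hs
            rw [mem_filter] at hs
            have : D s = G / d := by rw [hD]; simp only; rw [hs.2]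
            rw [this]
          rw [e1]
          split_ifs with hc
          · refine (gcd_class G d hG0 hd.1 (fun _ => σ ^ 2 * N * (G / d : ℕ) * (12 * G * ℓ)) (fun _ => by positivity)).trans ?_
            rw [sum_const, card_range, nsmul_eq_mul]
            have hc' : ((G / d : ℕ) : ℝ) ≤ R := by exact_mod_cast hc
            calc ((G / d : ℕ) : ℝ) * (σ ^ 2 * N * (G / d : ℕ) * (12 * G * ℓ)) = ((G / d : ℕ) : ℝ) ^ 2 * (σ ^ 2 * N * (12 * G * ℓ)) := by ring
              _ ≤ _ := by gcongr
          · simp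
      _ = ∑ E ∈ G.divisors, (if E ≤ R then (R : ℝ) ^ 2 * (σ ^ 2 * N * (12 * G * ℓ)) else 0) := Nat.sum_div_divisors G (fun E : ℕ => if E ≤ R then (R : ℝ) ^ 2 * (σ ^ 2 * N * (12 * G * ℓ)) else 0)
      _ = ∑ E ∈ G.divisors.filter (fun E => E ≤ R), (R : ℝ) ^ 2 * (σ ^ 2 * N * (12 * G * ℓ)) := by rw [sum_filter]
      _ ≤ ∑ E ∈ Ioc 0 R, (R : ℝ) ^ 2 * (σ ^ 2 * N * (12 * G * ℓ)) := by
          apply sum_le_sum_of_subset_of_nonneg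
          · intro E hE
            rw [mem_filter] at hE
            exact mem_Ioc.mpr ⟨Nat.pos_of_mem_divisors hE.1, hE.2⟩
          · intros; positivity
      _ = _ := by simp; ring
  refine hcarry.trans ((add_le_add_right (hmain.trans (add_le_add_three (mul_le_mul_of_nonneg_right hS1 (by positivity)) hS2 hS3)) _).trans ?_)
  have t1 : 2 * ((M : ℝ) * (((X / G : ℕ) : ℝ) * r)) ≤ X * (2 / R) := by
    have h3 : ((X / G : ℕ) : ℝ) ≤ X / G := Nat.cast_div_le
    calc 2 * ((M : ℝ) * (((X / G : ℕ) : ℝ) * r)) ≤ 2 * ((M : ℝ) * ((X / G) * R)) := by gcongr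
      _ = X * (2 * (M * R / G)) := by ring
      _ ≤ X * (2 * (1 / R)) := by
          gcongr ?_ * (2 * ?_)
          rw [div_le_div_iff₀ hG0' (by linarith)]
          calc (M : ℝ) * R * R = M * R ^ 2 := by ring
            _ ≤ 1 * G := by linarith
      _ = _ := by ring
  have t2 : G * ρ ^ l * (4 * M + 2 * (N + G) * ℓ) ≤ X * (8 * b ^ 2 * R ^ 4 * ℓ * ρ ^ l) := by
    have h3 : G * (4 * M + 2 * (N + G) * ℓ) ≤ X * (8 * b ^ 2 * R ^ 4 * ℓ) := by
      have hR4 : (R : ℝ) ^ 2 ≤ R ^ 4 := pow_le_pow_right₀ hR1 (by norm_num)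
      have hbb : (b : ℝ) ≤ b ^ 2 := le_self_pow₀ hb1 (by norm_num)
      calc G * (4 * M + 2 * (N + G) * ℓ) ≤ G * (4 * M * ℓ + 2 * (N + G) * ℓ) := by
            have : 4 * (M : ℝ) ≤ 4 * M * ℓ := le_mul_of_one_le_right (by positivity) hℓ1
            apply mul_le_mul_of_nonneg_left _ hG0'.le
            linarith
        _ = ℓ * (4 * (G * M) + 2 * (N * G) + 2 * (G * G)) := by ring
        _ ≤ ℓ * (4 * ((b * M * R ^ 2) * M) + 2 * (N * (b * M * R ^ 2)) + 2 * ((b * M * R ^ 2) * (b * M * R ^ 2))) := by gcongr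
        _ = ℓ * (4 * (b * R ^ 2) * (M * M) + 2 * (b * R ^ 2) * (N * M) + 2 * (b ^ 2 * R ^ 4) * (M * M)) := by ring
        _ ≤ ℓ * (4 * (b ^ 2 * R ^ 4) * X + 2 * (b ^ 2 * R ^ 4) * X + 2 * (b ^ 2 * R ^ 4) * X) := by gcongr
        _ = _ := by ring
    calc G * ρ ^ l * (4 * M + 2 * (N + G) * ℓ) = G * (4 * M + 2 * (N + G) * ℓ) * ρ ^ l := by ring
      _ ≤ X * (8 * b ^ 2 * R ^ 4 * ℓ) * ρ ^ l := by gcongr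
      _ = _ := by ring
  have t3 : ((b : ℝ) * l + 1) ^ b * (4 * M * N * ρ ^ (Nat.log b R + 1)) ≤ X * (4 * ((b : ℝ) * l + 1) ^ b * ρ ^ (Nat.log b R + 1)) := by
    calc ((b : ℝ) * l + 1) ^ b * (4 * M * N * ρ ^ (Nat.log b R + 1)) = (N * M) * (4 * ((b : ℝ) * l + 1) ^ b * ρ ^ (Nat.log b R + 1)) := by ring
      _ ≤ _ := by gcongr
  have t4 : R ^ 3 * (σ ^ 2 * N * (12 * G * ℓ)) ≤ X * (12 * b * R ^ 5 * σ ^ 2 * ℓ) := by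
    calc R ^ 3 * (σ ^ 2 * N * (12 * G * ℓ)) ≤ R ^ 3 * (σ ^ 2 * N * (12 * (b * M * R ^ 2) * ℓ)) := by gcongr
      _ = (N * M) * (12 * b * R ^ 5 * σ ^ 2 * ℓ) := by ring
      _ ≤ _ := by gcongr
  linarith

/-- digit sum -/
def sg (g n : ℕ) : ℕ := (Nat.digits g n).sum

lemma sg_add (g : ℕ) (hg : 2 ≤ g) (n d : ℕ) (hd : d < g) : sg g (g * n + d) = d + sg g n := by
  unfold sg
  by_cases h : d ≠ 0 ∨ n ≠ 0
  · rw [add_comm, Nat.digits_add g (by omega) d n hd h]; simp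
  · push Not at h
    rw [h.1, h.2]; simp

lemma sg_lt (g : ℕ) (hg : 2 ≤ g) (d : ℕ) (hd : d < g) : sg g d = d := by
  have := sg_add g hg 0 d hd
  simpa [sg] using this

noncomputable def fa (g : ℕ) (α : ℝ) (n : ℕ) : ℂ := ee (α * sg g n)

lemma fa_norm (g : ℕ) (α : ℝ) (n : ℕ) : ‖fa g α n‖ = 1 := norm_ee _
lemma fa_zero (g : ℕ) (α : ℝ) : fa g α 0 = 1 := by simp [fa, sg, ee_zero]
lemma fa_BM (g : ℕ) (hg : 2 ≤ g) (α : ℝ) : BM g (fa g α) := by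
  intro n d hd
  unfold fa
  rw [sg_add g hg n d hd, sg_lt g hg d hd, ← ee_add]; congr 1; push_cast; ring

lemma sum_fa_two (α : ℝ) : ∑ m ∈ range 7, fa 2 α (m + 1) * (starRingEnd ℂ) (fa 2 α m) = 4 * ee α + 2 + ee (-α) := by
  have h : ∀ m, fa 2 α (m + 1) * (starRingEnd ℂ) (fa 2 α m) = ee (α * ((sg 2 (m + 1) : ℝ) - sg 2 m)) := by
    intro m; unfold fa; rw [mul_sub, ee_sub]
  simp only [h, sum_range_succ, sum_range_zero]
  simp [sg]
  norm_num [ee_zero]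
  ring

lemma exists_block (g : ℕ) (hg : 2 ≤ g) : ∃ k, 1 ≤ k ∧ ∀ (α : ℝ) (w : ℂ), ‖w‖ = 1 →
    1 ≤ ‖∑ m ∈ range (g ^ k - 1), fa g α (m + 1) * (starRingEnd ℂ) (fa g α m) + w‖ := by
  rcases Nat.lt_or_ge g 3 with h | h
  · obtain rfl : g = 2 := by omega
    refine ⟨3, by norm_num, ?_⟩
    intro α w hw
    have h7 : 2 ^ 3 - 1 = 7 := by norm_num
    rw [h7, sum_fa_two]
    have h2 : 2 ≤ ‖4 * ee α + 2 + ee (-α)‖ := by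
      have hc : ee α = Complex.mk (Real.cos (2 * π * α)) (Real.sin (2 * π * α)) := by
        unfold ee
        apply Complex.ext
        · exact Complex.exp_ofReal_mul_I_re _
        · exact Complex.exp_ofReal_mul_I_im _
      rw [ee_neg, hc]
      set c := Real.cos (2 * π * α)
      set s := Real.sin (2 * π * α)
      have hcs : s ^ 2 + c ^ 2 = 1 := Real.sin_sq_add_cos_sq _
      have : (2 : ℝ) ^ 2 ≤ ‖4 * Complex.mk c s + 2 + (starRingEnd ℂ) (Complex.mk c s)‖ ^ 2 := by
        rw [← Complex.normSq_eq_norm_sq, Complex.normSq_apply]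
        simp
        nlinarith [sq_nonneg (8 * c + 5)]
      exact le_of_sq_le_sq this (norm_nonneg _) |> fun h => h
    have := norm_sub_norm_le (4 * ee α + 2 + ee (-α)) (-w)
    rw [norm_neg, hw, sub_neg_eq_add] at this
    linarith
  · refine ⟨1, le_rfl, ?_⟩
    intro α w hw
    rw [pow_one]
    have h1 : ∑ m ∈ range (g - 1), fa g α (m + 1) * (starRingEnd ℂ) (fa g α m) = ((g - 1 : ℕ) : ℂ) * ee α := by
      rw [sum_congr rfl (g := fun _ => ee α)]
      · simp
      intro m hm
      rw [mem_range] at hm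
      unfold fa
      rw [sg_lt g hg m (by omega), sg_lt g hg (m + 1) (by omega), ← ee_sub]
      congr 1; push_cast; ring
    rw [h1]
    have := norm_sub_norm_le (((g - 1 : ℕ) : ℂ) * ee α) (-w)
    rw [norm_neg, hw, sub_neg_eq_add, norm_mul, norm_ee, Complex.norm_natCast, mul_one] at this
    have h3 : (2 : ℝ) ≤ (g - 1 : ℕ) := by exact_mod_cast (by omega : 2 ≤ g - 1)
    linarith

lemma norm_one_add_le (t : ℝ) : ‖1 + ee t‖ ≤ 2 - 4 * nd t ^ 2 := by
  have h1 := parallelogram_law_with_norm ℝ (1 : ℂ) (ee t)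
  rw [norm_ee, norm_one] at h1
  have h2 := norm_one_sub_ee_ge t
  have h3 := nd_nonneg t
  have h4 := nd_le_half t
  have h5 : ‖1 + ee t‖ ^ 2 ≤ 4 - 16 * nd t ^ 2 := by nlinarith
  have h6 : 0 ≤ 2 - 4 * nd t ^ 2 := by nlinarith
  apply le_of_sq_le_sq _ h6 |> fun h => h
  nlinarith [sq_nonneg (nd t ^ 2)]

lemma FF_digit_le (g : ℕ) (hg : 2 ≤ g) (α θ : ℝ) : ‖FF (fa g α) g θ‖ ≤ 1 - 4 * nd (α + θ) ^ 2 / g := by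
  have hg0 : (0 : ℝ) < g := by positivity
  unfold FF
  rw [norm_div, Complex.norm_natCast, div_le_iff₀ hg0]
  have e : ∑ n ∈ range g, fa g α n * ee (n * θ) = ∑ n ∈ range g, ee (n * (α + θ)) := by
    apply sum_congr rfl; intro n hn
    unfold fa
    rw [sg_lt g hg n (mem_range.mp hn), ← ee_add]; congr 1; ring
  rw [e]
  obtain ⟨g', rfl⟩ : ∃ g', g = g' + 2 := ⟨g - 2, by omega⟩
  rw [sum_range_succ', sum_range_succ']
  have h1 := norm_one_add_le (α + θ)
  have h2 : ‖∑ k ∈ range g', ee (((k + 1 + 1 : ℕ) : ℝ) * (α + θ))‖ ≤ g' := by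
    refine (norm_sum_le _ _).trans ?_
    simp
  simp only [Nat.cast_zero, zero_mul, ee_zero, zero_add, Nat.cast_one, one_mul]
  have h3 := norm_add_le (∑ k ∈ range g', ee (((k + 1 + 1 : ℕ) : ℝ) * (α + θ))) (1 + ee (α + θ))
  rw [← add_assoc, add_right_comm] at h3
  calc _ ≤ _ := h3
    _ ≤ g' + (2 - 4 * nd (α + θ) ^ 2) := add_le_add h2 h1
    _ = _ := by push_cast; field_simp; ring

lemma FF_two_digit_le (g : ℕ) (hg : 2 ≤ g) (α θ : ℝ) :
    ‖FF (fa g α) g θ‖ * ‖FF (fa g α) g (g * θ)‖ ≤ 1 - 4 / (g * (g + 1) ^ 2) * nd ((g - 1 : ℝ) * α) ^ 2 := by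
  have hg0 : (0 : ℝ) < g := by positivity
  have h1 := FF_digit_le g hg α θ
  have h2 := FF_digit_le g hg α (g * θ)
  have n1 := FF_norm_le (fa_norm g α) g θ
  have n2 := FF_norm_le (fa_norm g α) g (g * θ)
  have z1 := norm_nonneg (FF (fa g α) g θ)
  have z2 := norm_nonneg (FF (fa g α) g (g * θ))
  set δ := nd ((g - 1 : ℝ) * α) with hδ
  have hδ0 : 0 ≤ δ := nd_nonneg _
  have h3 : δ ≤ g * nd (α + θ) + nd (α + g * θ) := by
    have e : (g - 1 : ℝ) * α = g * (α + θ) - (α + g * θ) := by ring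
    rw [hδ, e]
    exact (nd_sub_le _ _).trans (add_le_add (nd_nat_mul_le g _) le_rfl)
  have key : ∀ y : ℝ, δ / (g + 1) ≤ y → 1 - 4 * y ^ 2 / g ≤ 1 - 4 / (g * (g + 1) ^ 2) * δ ^ 2 := by
    intro y hy
    have : (δ / (g + 1)) ^ 2 ≤ y ^ 2 := by gcongr
    have e : 4 / (g * (g + 1) ^ 2) * δ ^ 2 = 4 * (δ / (g + 1)) ^ 2 / g := by field_simp
    rw [e]; gcongr
  by_cases h4 : δ / (g + 1) ≤ nd (α + θ)
  · calc _ ≤ ‖FF (fa g α) g θ‖ * 1 := by gcongr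
      _ ≤ _ := by rw [mul_one]; exact h1.trans (key _ h4)
  · push Not at h4
    have h5 : δ / (g + 1) ≤ nd (α + g * θ) := by
      have : g * nd (α + θ) ≤ g * (δ / (g + 1)) := by gcongr
      have e : δ = g * (δ / (g + 1)) + δ / (g + 1) := by field_simp
      linarith
    calc _ ≤ 1 * ‖FF (fa g α) g (g * θ)‖ := by gcongr
      _ ≤ _ := by rw [one_mul]; exact h2.trans (key _ h5)

lemma FF_sup (g : ℕ) (hg : 2 ≤ g) (α : ℝ) (l : ℕ) : ∀ θ : ℝ,
    ‖FF (fa g α) (g ^ l) θ‖ ≤ 2 * exp (-(2 / (g * (g + 1) ^ 2) * nd ((g - 1 : ℝ) * α) ^ 2 * l)) := by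
  have hg0 : (2 : ℝ) ≤ g := by exact_mod_cast hg
  set c := 2 / (g * (g + 1 : ℝ) ^ 2) * nd ((g - 1 : ℝ) * α) ^ 2 with hc
  have hc0 : 0 ≤ c := by positivity
  have hc1 : c ≤ 1 / 2 := by
    have h1 : 2 / (g * (g + 1 : ℝ) ^ 2) ≤ 1 := by
      rw [div_le_one (by positivity)]; nlinarith
    have h2 : nd ((g - 1 : ℝ) * α) ^ 2 ≤ 1 / 2 := by
      have := nd_le_half ((g - 1 : ℝ) * α); have := nd_nonneg ((g - 1 : ℝ) * α); nlinarith
    rw [hc]; nlinarith [sq_nonneg (nd ((g - 1 : ℝ) * α))]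
  have h2d : ∀ θ, ‖FF (fa g α) g θ‖ * ‖FF (fa g α) g (g * θ)‖ ≤ exp (-(2 * c)) := by
    intro θ
    refine (FF_two_digit_le g hg α θ).trans ?_
    have := Real.add_one_le_exp (-(2 * c))
    have e : 4 / (g * (g + 1 : ℝ) ^ 2) * nd ((g - 1 : ℝ) * α) ^ 2 = 2 * c := by rw [hc]; ring
    linarith
  induction l using Nat.strong_induction_on with
  | _ l ih =>
    intro θ
    rcases Nat.lt_or_ge l 2 with h | h
    · refine (FF_norm_le (fa_norm g α) _ θ).trans ?_
      have h1 : -(1 / 2 : ℝ) ≤ -(c * l) := by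
        have : (l : ℝ) ≤ 1 := by exact_mod_cast (by omega : l ≤ 1)
        nlinarith [(Nat.cast_nonneg l : (0 : ℝ) ≤ l)]
      have := Real.add_one_le_exp (-(c * l))
      linarith
    · obtain ⟨m, rfl⟩ : ∃ m, l = m + 2 := ⟨l - 2, by omega⟩
      have e : g ^ (m + 2) = g * (g * g ^ m) := by ring
      rw [e, FF_mul (fa_BM g hg α), FF_mul (fa_BM g hg α), norm_mul, norm_mul, ← mul_assoc]
      calc _ ≤ exp (-(2 * c)) * (2 * exp (-(c * m))) :=
            mul_le_mul (h2d θ) (ih m (by omega) _) (norm_nonneg _) (exp_pos _).le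
        _ = _ := by
            rw [mul_left_comm, ← exp_add]; congr 2; push_cast; ring

lemma duality {ι : Type*} (I : Finset ι) (c θ : ι → ℝ) (f : ℕ → ℂ) (hf : ∀ n, ‖f n‖ = 1) (N : ℕ) (hN : 0 < N) :
    (∑ i ∈ I, c i * ‖FF f N (θ i)‖) ^ 2 ≤ (∑ i ∈ I, ∑ j ∈ I, |c i| * |c j| * ‖∑ n ∈ range N, ee (n * (θ i - θ j))‖) / N := by
  have hN' : (0 : ℝ) < N := by exact_mod_cast hN
  have hξ : ∀ z : ℂ, ∃ ξ : ℂ, ‖ξ‖ ≤ 1 ∧ ξ * z = ‖z‖ := by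
    intro z
    by_cases hz : z = 0
    · exact ⟨1, by simp, by simp [hz]⟩
    · refine ⟨(‖z‖ : ℂ) / z, by rw [norm_div]; simp [hz], by field_simp⟩
  choose ξ hξ1 hξ2 using hξ
  set x : ι → ℂ := fun i => ξ (FF f N (θ i)) * (c i : ℂ) with hx
  set Q : ℕ → ℂ := fun n => ∑ i ∈ I, x i * ee (n * θ i) with hQ
  have hT : ((∑ i ∈ I, c i * ‖FF f N (θ i)‖ : ℝ) : ℂ) = (∑ n ∈ range N, f n * Q n) / N := by
    push_cast
    have : ∀ i ∈ I, (c i : ℂ) * (‖FF f N (θ i)‖ : ℂ) = ∑ n ∈ range N, f n * (x i * ee (n * θ i)) / N := by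
      intro i _
      rw [← hξ2, hx]
      simp only
      generalize ξ (FF f N (θ i)) = y
      unfold FF
      rw [← sum_div, mul_div_assoc', mul_div_assoc', mul_sum, mul_sum]
      congr 1
      apply sum_congr rfl; intro n _; ring
    rw [sum_congr rfl this, sum_comm, sum_div]
    apply sum_congr rfl; intro n _
    rw [hQ]; simp only
    rw [mul_sum, sum_div]
  have hT2 : |∑ i ∈ I, c i * ‖FF f N (θ i)‖| ≤ (∑ n ∈ range N, ‖Q n‖) / N := by
    rw [← norm_eq_abs, ← Complex.norm_real, hT, norm_div, Complex.norm_natCast]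
    gcongr
    refine (norm_sum_le _ _).trans (le_of_eq ?_)
    apply sum_congr rfl; intro n _; rw [norm_mul, hf, one_mul]
  have hCS : (∑ n ∈ range N, ‖Q n‖) ^ 2 ≤ N * ∑ n ∈ range N, ‖Q n‖ ^ 2 := by
    have := sq_sum_le_card_mul_sum_sq (s := range N) (f := fun n => ‖Q n‖)
    simpa using this
  have hQ2 : ∑ n ∈ range N, ‖Q n‖ ^ 2 ≤ ∑ i ∈ I, ∑ j ∈ I, |c i| * |c j| * ‖∑ n ∈ range N, ee (n * (θ i - θ j))‖ := by
    have e : ((∑ n ∈ range N, ‖Q n‖ ^ 2 : ℝ) : ℂ) = ∑ i ∈ I, ∑ j ∈ I, x i * (starRingEnd ℂ) (x j) * ∑ n ∈ range N, ee (n * (θ i - θ j)) := by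
      push_cast
      simp only [mul_sum]
      have hpt : ∀ n ∈ range N, ((‖Q n‖ : ℂ)) ^ 2 = ∑ i ∈ I, ∑ j ∈ I, x i * (starRingEnd ℂ) (x j) * ee (n * (θ i - θ j)) := by
       intro n _
       rw [← Complex.mul_conj', hQ]; simp only
       rw [map_sum, sum_mul_sum]
       apply sum_congr rfl; intro i _; apply sum_congr rfl; intro j _
       rw [map_mul, mul_sub, ee_sub]; ring
      rw [sum_congr rfl hpt, sum_comm]
      apply sum_congr rfl; intro i _
      exact sum_comm
    have h0 : 0 ≤ ∑ n ∈ range N, ‖Q n‖ ^ 2 := sum_nonneg fun _ _ => by positivity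
    rw [← abs_of_nonneg h0, ← norm_eq_abs, ← Complex.norm_real, e]
    refine (norm_sum_le _ _).trans (sum_le_sum fun i _ => (norm_sum_le _ _).trans (sum_le_sum fun j _ => ?_))
    have hxi : ∀ i, ‖x i‖ ≤ |c i| := by
      intro i; rw [hx]; simp only
      rw [norm_mul, Complex.norm_real, norm_eq_abs]
      exact mul_le_of_le_one_left (abs_nonneg _) (hξ1 _)
    rw [norm_mul, norm_mul, Complex.norm_conj]
    gcongr
    · exact hxi i
    · exact hxi j
  rw [← sq_abs]
  calc _ ≤ ((∑ n ∈ range N, ‖Q n‖) / N) ^ 2 := by gcongr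
    _ = (∑ n ∈ range N, ‖Q n‖) ^ 2 / N ^ 2 := by ring
    _ ≤ (N * ∑ n ∈ range N, ‖Q n‖ ^ 2) / N ^ 2 := by gcongr
    _ = (∑ n ∈ range N, ‖Q n‖ ^ 2) / N := by field_simp
    _ ≤ _ := by gcongr

lemma pair_eq_card (m m' : ℕ) (hm : 0 < m) (hm' : 0 < m') :
    (((range m) ×ˢ (range m')).filter (fun p => p.1 * m' = p.2 * m)).card ≤ Nat.gcd m m' := by
  set h := Nat.gcd m m' with hh
  have hpos : 0 < h := Nat.gcd_pos_of_pos_left _ hm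
  obtain ⟨a, ha⟩ : h ∣ m := Nat.gcd_dvd_left _ _
  obtain ⟨b, hb⟩ : h ∣ m' := Nat.gcd_dvd_right _ _
  have ha0 : 0 < a := Nat.pos_of_ne_zero (by rintro rfl; omega)
  have hb0 : 0 < b := Nat.pos_of_ne_zero (by rintro rfl; omega)
  have hcop : Nat.Coprime a b := by
    have := Nat.coprime_div_gcd_div_gcd (m := m) (n := m') hpos
    rw [← hh] at this
    rwa [ha, hb, Nat.mul_div_cancel_left _ hpos, Nat.mul_div_cancel_left _ hpos] at this
  have key : ∀ k k' : ℕ, k * m' = k' * m → ∃ t, k = a * t ∧ k' = b * t := by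
    intro k k' e
    have e1 : k * b = k' * a := by
      have : h * (k * b) = h * (k' * a) := by
        calc h * (k * b) = k * (h * b) := by ring
          _ = k' * (h * a) := by rw [← ha, ← hb, e]
          _ = _ := by ring
      exact Nat.eq_of_mul_eq_mul_left hpos this
    have h1 : a ∣ k := hcop.dvd_of_dvd_mul_right (by rw [e1]; exact dvd_mul_left _ _)
    obtain ⟨t, rfl⟩ := h1
    refine ⟨t, rfl, ?_⟩
    have : a * k' = a * (b * t) := by linarith [e1, mul_comm k' a, mul_assoc a t b, mul_comm t b, mul_assoc a b t]
    exact Nat.eq_of_mul_eq_mul_left ha0 this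
  calc _ ≤ (range h).card := by
        apply card_le_card_of_injOn (fun p => p.1 / a)
        · intro p hp
          simp only [coe_filter, mem_product, mem_range, Set.mem_setOf_eq] at hp
          obtain ⟨t, h1, h2⟩ := key _ _ hp.2
          simp only [coe_range, Set.mem_Iio]
          rw [h1, Nat.mul_div_cancel_left _ ha0]
          have : a * t < a * h := by rw [← h1, mul_comm a h, ← ha]; exact hp.1.1
          exact Nat.lt_of_mul_lt_mul_left this
        · intro p hp p' hp' e
          simp only [coe_filter, mem_product, mem_range, Set.mem_setOf_eq] at hp hp'
          obtain ⟨t, h1, h2⟩ := key _ _ hp.2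
          obtain ⟨t', h1', h2'⟩ := key _ _ hp'.2
          simp only at e
          rw [h1, h1', Nat.mul_div_cancel_left _ ha0, Nat.mul_div_cancel_left _ ha0] at e
          subst e
          exact Prod.ext (by rw [h1, h1']) (by rw [h2, h2'])
    _ = h := card_range h

lemma sum_inv_dvd (V d : ℕ) (hd : 0 < d) :
    ∑ m ∈ (Ioc 0 V).filter (fun m => d ∣ m), 1 / (m : ℝ) ≤ (1 + log V) / d := by
  have hd' : (0 : ℝ) < d := by exact_mod_cast hd
  calc _ = ∑ e ∈ range (V / d), 1 / ((d : ℝ) * (e + 1)) := by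
        symm
        apply sum_bij (fun e _ => d * (e + 1))
        · intro e he
          rw [mem_range] at he
          simp only [mem_filter, mem_Ioc, dvd_mul_right, and_true]
          refine ⟨by positivity, ?_⟩
          calc d * (e + 1) ≤ d * (V / d) := by gcongr; omega
            _ ≤ V := Nat.mul_div_le _ _
        · intro a _ b _ h
          have := Nat.eq_of_mul_eq_mul_left hd h
          omega
        · intro m hm
          simp only [mem_filter, mem_Ioc] at hm
          obtain ⟨⟨h1, h2⟩, e, rfl⟩ := hm
          have he : 0 < e := Nat.pos_of_ne_zero (by rintro rfl; omega)
          refine ⟨e - 1, ?_, ?_⟩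
          · rw [mem_range]
            have : e ≤ V / d := by rw [Nat.le_div_iff_mul_le hd, mul_comm]; exact h2
            omega
          · congr 1; omega
        · intro e _; push_cast; rfl
    _ = (∑ e ∈ range (V / d), 1 / ((e : ℝ) + 1)) / d := by
        rw [sum_div]; apply sum_congr rfl; intro e _; field_simp
    _ ≤ _ := by
        gcongr
        exact (sum_inv_le_log _).trans (ell_mono (Nat.div_le_self _ _))

lemma gcd_sum_le (V : ℕ) : ∑ m ∈ Ioc 0 V, ∑ m' ∈ Ioc 0 V, (Nat.gcd m m' : ℝ) / (m * m') ≤ (1 + log V) ^ 3 := by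
  have hl : (1 : ℝ) ≤ 1 + log V := one_le_ell
  calc _ ≤ ∑ m ∈ Ioc 0 V, ∑ m' ∈ Ioc 0 V, ∑ d ∈ Ioc 0 V,
        (if d ∣ m then 1 / (m : ℝ) else 0) * (if d ∣ m' then 1 / (m' : ℝ) else 0) * d := by
        apply sum_le_sum; intro m hm; apply sum_le_sum; intro m' hm'
        rw [mem_Ioc] at hm hm'
        have h1 : Nat.gcd m m' ∈ Ioc 0 V := by
          rw [mem_Ioc]
          exact ⟨Nat.gcd_pos_of_pos_left _ hm.1, (Nat.gcd_le_left _ hm.1).trans hm.2⟩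
        refine le_trans (le_of_eq ?_) (single_le_sum (f := fun d : ℕ => (if d ∣ m then 1 / (m : ℝ) else 0) * (if d ∣ m' then 1 / (m' : ℝ) else 0) * d) (fun d _ => ?_) h1)
        · simp only [Nat.gcd_dvd_left, Nat.gcd_dvd_right, if_true]
          field_simp
        · positivity
    _ = ∑ d ∈ Ioc 0 V, (∑ m ∈ (Ioc 0 V).filter (fun m => d ∣ m), 1 / (m : ℝ)) ^ 2 * d := by
        have : ∀ m ∈ Ioc 0 V, ∑ m' ∈ Ioc 0 V, ∑ d ∈ Ioc 0 V,
          (if d ∣ m then 1 / (m : ℝ) else 0) * (if d ∣ m' then 1 / (m' : ℝ) else 0) * d =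
          ∑ d ∈ Ioc 0 V, ∑ m' ∈ Ioc 0 V, (if d ∣ m then 1 / (m : ℝ) else 0) * (if d ∣ m' then 1 / (m' : ℝ) else 0) * d :=
          fun m _ => sum_comm
        rw [sum_congr rfl this, sum_comm]
        apply sum_congr rfl; intro d _
        rw [sum_filter, sq, sum_mul_sum, sum_mul]
        apply sum_congr rfl; intro m _
        rw [sum_mul]
    _ ≤ ∑ d ∈ Ioc 0 V, ((1 + log V) / d) ^ 2 * d := by
        apply sum_le_sum; intro d hd
        rw [mem_Ioc] at hd
        gcongr
        exact sum_inv_dvd V d hd.1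
    _ = (1 + log V) ^ 2 * ∑ d ∈ (Ioc 0 V).filter (fun m => 1 ∣ m), 1 / (d : ℝ) := by
        rw [filter_true_of_mem (fun d _ => one_dvd d), mul_sum]
        apply sum_congr rfl; intro d hd
        rw [mem_Ioc] at hd
        have : (d : ℝ) ≠ 0 := by have := hd.1; positivity
        field_simp
    _ ≤ (1 + log V) ^ 2 * ((1 + log V) / (1 : ℕ)) := by
        gcongr; exact sum_inv_dvd V 1 one_pos
    _ = _ := by simp; ring

lemma pt_sum_le (N m m' k k' : ℕ) (hm : 0 < m) (hm' : 0 < m') (hk : k < m) (hk' : k' < m') :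
    ‖∑ n ∈ range N, ee (n * ((k : ℝ) / m - (k' : ℝ) / m'))‖ ≤ (if k * m' = k' * m then (N : ℝ) else 0) + 2 * m * m' := by
  split_ifs with h
  · refine le_trans (norm_sum_le _ _) ?_
    simp only [norm_ee, sum_const, card_range, nsmul_eq_mul, mul_one]
    have : (0 : ℝ) ≤ 2 * m * m' := by positivity
    linarith
  · have hD : ¬ (((m * m' : ℕ)) : ℤ) ∣ ((k : ℤ) * m' - k' * m) := by
      intro hd
      have h1 : (k * m' : ℕ) < m * m' := by nlinarith
      have h2 : (k' * m : ℕ) < m * m' := by nlinarith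
      have := (range_dvd_sub h1 h2).mp (by push_cast at hd ⊢; exact hd)
      exact h this
    have hn := nd_rat_ge _ (m * m') (by positivity) hD
    have m0 : (m : ℝ) ≠ 0 := by positivity
    have m0' : (m' : ℝ) ≠ 0 := by positivity
    have e : (((k : ℤ) * m' - k' * m : ℤ) : ℝ) / ((m * m' : ℕ) : ℝ) = (k : ℝ) / m - (k' : ℝ) / m' := by
      push_cast; field_simp
    rw [e] at hn
    set θ := (k : ℝ) / m - (k' : ℝ) / m'
    have hg := geom_sum_le θ 0 (N - 1) (N : ℝ) (by
      rcases N with _ | N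
      · simp
      · simp) (by positivity)
    have hK := Ker_le_inv (M := (N : ℝ)) (by positivity) (c := 1 / ((m * m' : ℕ) : ℝ)) (by positivity) hn
    rw [one_div_one_div] at hK
    have hb : ‖∑ n ∈ range N, ee (n * θ)‖ ≤ 1 + ‖∑ m ∈ Finset.Ioc 0 (N - 1), ee (m * θ)‖ := by
      rcases N with _ | N
      · simp
      · rw [sum_range_succ', ← sum_Ioc_eq_range N (fun n => ee ((n : ℝ) * θ))]
        refine (norm_add_le _ _).trans ?_
        simp [ee_zero]; linarith
    have h1 : (1 : ℝ) ≤ m * m' := by exact_mod_cast Nat.mul_pos hm hm'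
    push_cast at hK
    linarith

lemma typeI_avg (f : ℕ → ℂ) (hf : ∀ n, ‖f n‖ = 1) (V N : ℕ) (hN : 0 < N) (hV : 2 * V ^ 4 ≤ N) :
    ∑ m ∈ Ioc 0 V, 1 / (m : ℝ) * ∑ k ∈ range m, ‖FF f N ((k : ℝ) / m)‖ ≤ 2 * (1 + log V) ^ 2 := by
  have hl : (1 : ℝ) ≤ 1 + log V := one_le_ell
  have hN' : (0 : ℝ) < N := by exact_mod_cast hN
  have hd := duality ((Ioc 0 V).sigma (fun m => range m)) (fun i => 1 / (i.1 : ℝ)) (fun i => (i.2 : ℝ) / i.1) f hf N hN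
  simp only [sum_sigma] at hd
  have e : ∑ m ∈ Ioc 0 V, 1 / (m : ℝ) * ∑ k ∈ range m, ‖FF f N ((k : ℝ) / m)‖ =
    ∑ m ∈ Ioc 0 V, ∑ k ∈ range m, 1 / (m : ℝ) * ‖FF f N ((k : ℝ) / m)‖ := by
    apply sum_congr rfl; intro m _; rw [mul_sum]
  rw [← e] at hd
  set T := ∑ m ∈ Ioc 0 V, 1 / (m : ℝ) * ∑ k ∈ range m, ‖FF f N ((k : ℝ) / m)‖
  have hb : (∑ m ∈ Ioc 0 V, ∑ k ∈ range m, ∑ m' ∈ Ioc 0 V, ∑ k' ∈ range m', |1 / (m : ℝ)| * |1 / (m' : ℝ)| *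
      ‖∑ n ∈ range N, ee (n * ((k : ℝ) / m - (k' : ℝ) / m'))‖) ≤
      ∑ m ∈ Ioc 0 V, ∑ m' ∈ Ioc 0 V, (N * ((Nat.gcd m m' : ℝ) / (m * m')) + 2 * V ^ 2) := by
    apply sum_le_sum; intro m hm
    rw [sum_comm]
    apply sum_le_sum; intro m' hm'
    rw [mem_Ioc] at hm hm'
    have m0 : (0 : ℝ) < m := by exact_mod_cast hm.1
    have m0' : (0 : ℝ) < m' := by exact_mod_cast hm'.1
    calc _ ≤ ∑ k ∈ range m, ∑ k' ∈ range m', 1 / ((m : ℝ) * m') * ((if k * m' = k' * m then (N : ℝ) else 0) + 2 * m * m') := by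
          apply sum_le_sum; intro k hk; apply sum_le_sum; intro k' hk'
          rw [abs_of_pos (by positivity), abs_of_pos (by positivity), ← one_div_mul_one_div]
          gcongr
          exact pt_sum_le N m m' k k' hm.1 hm'.1 (mem_range.mp hk) (mem_range.mp hk')
      _ = N / (m * m') * (((range m) ×ˢ (range m')).filter (fun p => p.1 * m' = p.2 * m)).card + 2 * m * m' := by
          rw [card_filter, sum_product]
          push_cast
          simp only [mul_add, sum_add_distrib, mul_sum]
          congr 1
          · apply sum_congr rfl; intro k _; apply sum_congr rfl; intro k' _
            split_ifs <;> ring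
          · simp; field_simp
      _ ≤ N / (m * m') * (Nat.gcd m m' : ℝ) + 2 * V * V := by
          have h1 := pair_eq_card m m' hm.1 hm'.1
          have h2 := hm.2
          have h3 := hm'.2
          gcongr
      _ = _ := by ring
  have hb2 : ∑ m ∈ Ioc 0 V, ∑ m' ∈ Ioc 0 V, (N * ((Nat.gcd m m' : ℝ) / (m * m')) + 2 * V ^ 2) ≤ N * (1 + log V) ^ 3 + N := by
    simp only [sum_add_distrib, ← mul_sum]
    have h1 := gcd_sum_le V
    have h2 : (2 : ℝ) * V ^ 4 ≤ N := by exact_mod_cast hV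
    simp only [sum_const, Nat.card_Ioc, nsmul_eq_mul, Nat.sub_zero]
    have : N * ∑ m ∈ Ioc 0 V, ∑ m' ∈ Ioc 0 V, (Nat.gcd m m' : ℝ) / (m * m') ≤ N * (1 + log V) ^ 3 := by gcongr
    nlinarith
  have h3 : T ^ 2 ≤ (1 + log V) ^ 3 + 1 := by
    refine hd.trans ?_
    rw [div_le_iff₀ hN']
    refine (hb.trans hb2).trans (le_of_eq (by ring))
  apply le_of_sq_le_sq _ (by positivity) |> fun h => h
  set l := 1 + log V
  have : 1 ≤ l ^ 3 := one_le_pow₀ hl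
  have h4 : l ^ 3 ≤ l ^ 4 := pow_le_pow_right₀ hl (by norm_num)
  nlinarith

lemma block_bound (f : ℕ → ℂ) (hf : ∀ n, ‖f n‖ = 1) (G : ℕ) (hG : 0 < G) (hB : BM G f) (Y : ℕ) (θ : ℝ) :
    ‖∑ n ∈ range Y, f n * ee (n * θ)‖ ≤ G + Y * ‖FF f G θ‖ := by
  have hG' : (0 : ℝ) < G := by exact_mod_cast hG
  have h1 : Y = G * (Y / G) + Y % G := (Nat.div_add_mod Y G).symm
  set q := Y / G
  set r := Y % G with hr
  have hrG : r < G := Nat.mod_lt _ hG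
  rw [h1, sum_range_add]
  have hA : ∑ n ∈ range (G * q), f n * ee (n * θ) = (∑ j ∈ range q, f j * ee (j * (G * θ))) * (G * FF f G θ) := by
    have e : (G : ℂ) * FF f G θ = ∑ n ∈ range G, f n * ee (n * θ) := by
      unfold FF; rw [mul_div_cancel₀]; exact_mod_cast hG.ne'
    rw [e, sum_range_mul', sum_mul_sum]
    apply sum_congr rfl; intro j _; apply sum_congr rfl; intro d hd
    rw [hB j d (mem_range.mp hd)]
    have : (((G * j + d : ℕ)) : ℝ) * θ = j * (G * θ) + d * θ := by push_cast; ring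
    rw [this, ee_add]; ring
  refine (norm_add_le _ _).trans ?_
  rw [hA, norm_mul, norm_mul, Complex.norm_natCast]
  have h2 : ‖∑ j ∈ range q, f j * ee (j * (G * θ))‖ ≤ q := by
    refine (norm_sum_le _ _).trans ?_
    simp [hf, norm_ee]
  have h3 : ‖∑ x ∈ range r, f (G * q + x) * ee (((G * q + x : ℕ) : ℝ) * θ)‖ ≤ r := by
    refine (norm_sum_le _ _).trans ?_
    simp [hf, norm_ee]
  have h4 : (r : ℝ) ≤ G := by exact_mod_cast hrG.le
  have h5 : ‖∑ j ∈ range q, f j * ee (j * (G * θ))‖ * (G * ‖FF f G θ‖) ≤ q * (G * ‖FF f G θ‖) := by gcongr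
  have h6 : (0 : ℝ) ≤ r * ‖FF f G θ‖ := by positivity
  push_cast at h3 ⊢
  nlinarith

lemma typeI_bound (f : ℕ → ℂ) (hf : ∀ n, ‖f n‖ = 1) (G : ℕ) (hG : 0 < G) (hB : BM G f) (X m Y : ℕ) (hm : 1 ≤ m) (hmX : m ≤ X)
    (hY : m * Y ≤ X) : ‖∑ n ∈ Ioc 0 Y, f (m * n)‖ ≤ 1 + G + 2 * X * (1 / (m : ℝ) * ∑ k ∈ range m, ‖FF f G ((k : ℝ) / m)‖) := by
  have hm' : (0 : ℝ) < m := by exact_mod_cast hm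
  have hmc : (m : ℂ) ≠ 0 := by exact_mod_cast (by omega : m ≠ 0)
  have h1 : ∑ n ∈ range (Y + 1), f (m * n) = (∑ k ∈ range m, ∑ n ∈ range (m * (Y + 1)), f n * ee (n * ((k : ℝ) / m))) / m := by
    rw [sum_comm]
    have : ∀ n ∈ range (m * (Y + 1)), ∑ k ∈ range m, f n * ee (n * ((k : ℝ) / m)) = f n * (if m ∣ n then (m : ℂ) else 0) := by
      intro n _
      rw [← mul_sum]
      congr 1
      have := sum_ee_range m (by omega) (n : ℤ)
      simp only [Int.natCast_dvd_natCast] at this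
      rw [← this]; apply sum_congr rfl; intro k _; congr 1; push_cast; ring
    rw [sum_congr rfl this, sum_range_mul', sum_div]
    apply sum_congr rfl; intro j _
    rw [sum_eq_single 0]
    · simp; field_simp
    · intro d hd hd0
      rw [mem_range] at hd
      have : ¬ m ∣ m * j + d := by
        rw [Nat.dvd_add_right (dvd_mul_right _ _)]
        exact Nat.not_dvd_of_pos_of_lt (by omega) hd
      simp [this]
    · intro h; exact absurd (mem_range.mpr (by omega)) h
  have h2 : ‖∑ n ∈ Ioc 0 Y, f (m * n)‖ ≤ 1 + ‖∑ n ∈ range (Y + 1), f (m * n)‖ := by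
    have : ∑ n ∈ Ioc 0 Y, f (m * n) = ∑ n ∈ range (Y + 1), f (m * n) - f (m * 0) := by
      rw [sum_range_succ', sum_Ioc_eq_range Y (fun n => f (m * n))]; simp
    rw [this]
    refine (norm_sub_le _ _).trans ?_
    rw [hf]; linarith
  refine h2.trans ?_
  rw [add_assoc]
  gcongr
  rw [h1, norm_div, Complex.norm_natCast, div_le_iff₀ hm']
  have hXY : ((m * (Y + 1) : ℕ) : ℝ) ≤ 2 * X := by
    have : m * (Y + 1) ≤ 2 * X := by rw [mul_add]; omega
    exact_mod_cast this
  calc _ ≤ ∑ k ∈ range m, (G + 2 * (X : ℝ) * ‖FF f G ((k : ℝ) / m)‖) := by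
        refine (norm_sum_le _ _).trans (sum_le_sum fun k _ => ?_)
        refine (block_bound f hf G hG hB _ _).trans ?_
        gcongr
    _ = _ := by
        rw [sum_add_distrib, ← mul_sum]; simp; field_simp

lemma delta_nonneg (α : ℝ) (X : ℕ) : 0 ≤ nd α ^ 2 * log X :=
  mul_nonneg (sq_nonneg _) (log_natCast_nonneg X)

lemma delta_le (α : ℝ) (X : ℕ) : nd α ^ 2 * log X ≤ log X / 4 := by
  have h1 := nd_nonneg α
  have h2 := nd_le_half α
  have h3 := log_natCast_nonneg X
  have : nd α ^ 2 ≤ 1 / 4 := by nlinarith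
  nlinarith

set_option maxHeartbeats 1600000 in
lemma typeII_param (g : ℕ) (hg : 2 ≤ g) (k : ℕ) (hk : 1 ≤ k) (hbl : ∀ (α : ℝ) (w : ℂ), ‖w‖ = 1 →
    1 ≤ ‖∑ m ∈ range (g ^ k - 1), fa g α (m + 1) * (starRingEnd ℂ) (fa g α m) + w‖) :
    ∃ c1 c5 C : ℝ, 0 < c1 ∧ 0 < c5 ∧ 1 ≤ C ∧ c5 ≤ c1 ∧ c1 ≤ 1 ∧
      (c5 ≤ 1 / (20 * (g * (g + 1) ^ 2) * log g)) ∧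
      ∀ (α : ℝ) (X M M' r R : ℕ) (Δ : ℝ), Δ = nd ((g - 1 : ℝ) * α) ^ 2 * log X → X ≤ M ^ 80 → 1 ≤ M →
        M' ≤ 2 * M → M * M ≤ X → 1 ≤ r → r < R → R * M ≤ X → exp (c1 * Δ) ≤ R → (R : ℝ) ≤ 2 * exp (c1 * Δ) →
        TT (fa g α) X M M' r ≤ X * (C * (1 + log X) ^ (g ^ k + 1) * exp (-(c5 * Δ))) := by
  set b := g ^ k with hb
  have hb2 : 2 ≤ b := hg.trans (by rw [hb]; exact Nat.le_self_pow (by omega) g)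
  have hbR : (2 : ℝ) ≤ b := by exact_mod_cast hb2
  have hgR : (2 : ℝ) ≤ g := by exact_mod_cast hg
  set ρ : ℝ := 1 - 1 / (2 * (b : ℝ) ^ 4) with hρ
  have hb4 : (1 : ℝ) ≤ (b : ℝ) ^ 4 := one_le_pow₀ (by linarith)
  have hρ0 : 0 < ρ := by
    have : 1 / (2 * (b : ℝ) ^ 4) ≤ 1 / 2 := by apply one_div_le_one_div_of_le <;> linarith
    rw [hρ]; linarith
  have hρ1 : ρ < 1 := by
    have : 0 < 1 / (2 * (b : ℝ) ^ 4) := by positivity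
    rw [hρ]; linarith
  have hlb : 0 < log b := log_pos (by linarith)
  have hlg : 0 < log g := log_pos (by linarith)
  set c0 := -log ρ / log b with hc0
  have hc0p : 0 < c0 := div_pos (neg_pos.mpr (Real.log_neg hρ0 hρ1)) hlb
  have hρpow : ∀ n : ℕ, ρ ^ n = exp (-(c0 * log ((b ^ n : ℕ) : ℝ))) := by
    intro n
    push_cast
    rw [Real.log_pow, hc0]
    have : -(-log ρ / log b * (n * log b)) = n * log ρ := by field_simp
    rw [this, mul_comm, Real.exp_mul, Real.exp_log hρ0, rpow_natCast]
  set c2 := 1 / (20 * (g * (g + 1 : ℝ) ^ 2) * log g) with hc2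
  have hc2p : 0 < c2 := by positivity
  set c1 := min 1 (min (c0 / 160) (c2 / 10)) with hc1
  have hc1p : 0 < c1 := by rw [hc1]; positivity
  have hc11 : c1 ≤ 1 := min_le_left _ _
  have hc12 : c1 ≤ c0 / 160 := (min_le_right _ _).trans (min_le_left _ _)
  have hc13 : c1 ≤ c2 / 10 := (min_le_right _ _).trans (min_le_right _ _)
  set c5 := c1 * min 1 c0 with hc5
  have hc5p : 0 < c5 := by rw [hc5]; positivity
  have hc51 : c5 ≤ c1 := by rw [hc5]; exact mul_le_of_le_one_right hc1p.le (min_le_left _ _)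
  have hc52 : c5 ≤ c1 * c0 := by rw [hc5]; gcongr; exact min_le_right _ _
  set B : ℝ := 3 + b with hB
  set C : ℝ := 2 + 4 * (2 * b * B + 1) ^ b + 8 * b ^ 2 * 16 * B + 12 * b * 32 * 4 * B with hC
  have hC1 : 1 ≤ C := by
    have : 0 ≤ 4 * (2 * b * B + 1) ^ b + 8 * b ^ 2 * 16 * B + 12 * b * 32 * 4 * B := by rw [hB]; positivity
    rw [hC]; linarith
  refine ⟨c1, c5, C, hc1p, hc5p, hC1, hc51, hc11, by linarith, ?_⟩
  intro α X M M' r R Δ hΔ hXM hM h2 hMX hr hrR hRM hR1 hR2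
  have hΔ0 : 0 ≤ Δ := by rw [hΔ]; exact delta_nonneg _ _
  have hΔ1 : Δ ≤ log X / 4 := by rw [hΔ]; exact delta_le _ _
  set ℓ := 1 + log X with hℓ
  have hℓ1 : 1 ≤ ℓ := one_le_ell
  set l := Nat.clog b (M * R ^ 2) with hl
  have hR0 : 1 ≤ R := by omega
  have hX1 : 1 ≤ X := le_trans (Nat.mul_le_mul hM hM) hMX
  have hG1 : M * R ^ 2 ≤ b ^ l := Nat.le_pow_clog (by omega) _
  have hG2 : b ^ l ≤ b * M * R ^ 2 := by
    rcases Nat.eq_zero_or_pos l with h0 | h0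
    · rw [h0, pow_zero];
      have : 1 ≤ b * M * R ^ 2 := by apply Nat.one_le_iff_ne_zero.mpr; positivity
      exact this
    · obtain ⟨l', hl'⟩ : ∃ l', l = l' + 1 := ⟨l - 1, by omega⟩
      have : b ^ l' < M * R ^ 2 := by
        rw [← not_le, ← Nat.clog_le_iff_le_pow (by omega), ← hl]; omega
      rw [hl', pow_succ, mul_comm, mul_assoc]
      exact Nat.mul_le_mul le_rfl this.le
  have hM0 : (1 : ℝ) ≤ M := by exact_mod_cast hM
  have hlogM : log X / 80 ≤ log M := by
    have : log X ≤ log ((M ^ 80 : ℕ) : ℝ) := log_le_log (by exact_mod_cast hX1) (by exact_mod_cast hXM)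
    push_cast at this
    rw [Real.log_pow] at this
    push_cast at this; linarith
  have hMG : (M : ℝ) ≤ ((b ^ l : ℕ) : ℝ) := by
    have : M ≤ b ^ l := le_trans (Nat.le_mul_of_pos_right _ (by positivity)) hG1
    exact_mod_cast this
  have hlogG : log X / 80 ≤ log ((b ^ l : ℕ) : ℝ) := hlogM.trans (log_le_log (by linarith) hMG)
  have hlogG2 : 1 + log ((b ^ l : ℕ) : ℝ) ≤ B * ℓ := by
    have h1 : b ^ l ≤ b * X ^ 2 := by
      refine hG2.trans ?_
      rw [mul_assoc]
      apply Nat.mul_le_mul le_rfl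
      calc M * R ^ 2 ≤ (M * R ^ 2) * M := Nat.le_mul_of_pos_right _ (by omega)
        _ = (R * M) ^ 2 := by ring
        _ ≤ X ^ 2 := by gcongr
    have h2 : log ((b ^ l : ℕ) : ℝ) ≤ log ((b * X ^ 2 : ℕ) : ℝ) :=
      log_le_log (by positivity) (by exact_mod_cast h1)
    have hX0 : (X : ℝ) ≠ 0 := by positivity
    have e : log ((b * X ^ 2 : ℕ) : ℝ) = log b + 2 * log X := by
      push_cast
      rw [Real.log_mul (by positivity) (by positivity), Real.log_pow]; push_cast; ring
    rw [e] at h2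
    have h3 : log b ≤ b := (Real.log_le_sub_one_of_pos (by linarith)).trans (by linarith)
    have h4 := log_natCast_nonneg X
    have h5 : B * ℓ = 3 + b + 3 * log X + b * log X := by rw [hB, hℓ]; ring
    have h6 : 0 ≤ b * log X := by positivity
    linarith
  have hl2 : (l : ℝ) ≤ 2 * B * ℓ := by
    have h1 : log ((b ^ l : ℕ) : ℝ) = l * log b := by push_cast; rw [Real.log_pow]
    have h2 : (1 / 2 : ℝ) ≤ log b := by
      have := Real.log_two_gt_d9
      have := log_le_log (by norm_num) hbR
      linarith
    have h3 : (0 : ℝ) ≤ l := by positivity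
    have := mul_le_mul_of_nonneg_left h2 h3
    linarith
  set σ : ℝ := 2 * exp (-(2 / (g * (g + 1 : ℝ) ^ 2) * nd ((g - 1 : ℝ) * α) ^ 2 * ((k * l : ℕ) : ℝ))) with hσ
  have hσs : ∀ θ, ‖FF (fa g α) (b ^ l) θ‖ ≤ σ := by
    intro θ
    rw [hb, ← pow_mul]; exact FF_sup g hg α (k * l) θ
  have hmain := typeII_digit (fa g α) (fa_norm g α) b hb2 (BM_pow (by omega) (fa_BM g hg α) (fa_zero g α) k)
    (fa_zero g α) (hbl α) l X M M' r R σ hσs hM h2 hMX hr hrR hG1 hG2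
  refine hmain.trans ?_
  gcongr
  rw [← hρ]
  set E := exp (-(c5 * Δ)) with hE
  have hE0 : 0 < E := exp_pos _
  have hRp : (0 : ℝ) < R := by exact_mod_cast hR0
  have hBp : 0 < B := by rw [hB]; positivity
  have hℓn : ∀ n, 1 ≤ ℓ ^ n := fun n => one_le_pow₀ hℓ1
  -- term 1
  have t1 : 2 / (R : ℝ) ≤ 2 * ℓ ^ (b + 1) * E := by
    have h1 : 1 / (R : ℝ) ≤ E := by
      rw [div_le_iff₀ hRp]
      calc (1 : ℝ) = E * exp (c5 * Δ) := by rw [hE, ← exp_add]; simp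
        _ ≤ E * exp (c1 * Δ) := by gcongr
        _ ≤ E * R := by gcongr
    calc 2 / (R : ℝ) = 2 * 1 * (1 / R) := by ring
      _ ≤ _ := by gcongr; exact hℓn _
  have t2 : 4 * ((b : ℝ) * l + 1) ^ b * ρ ^ (Nat.log b R + 1) ≤ 4 * (2 * b * B + 1) ^ b * ℓ ^ (b + 1) * E := by
    have h1 : ρ ^ (Nat.log b R + 1) ≤ E := by
      rw [hρpow, hE, exp_le_exp]
      have h2 : c1 * Δ ≤ log R := by rw [Real.le_log_iff_exp_le hRp]; exact hR1
      have h3 : log R ≤ log ((b ^ (Nat.log b R + 1) : ℕ) : ℝ) := by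
        apply log_le_log hRp
        exact_mod_cast (Nat.lt_pow_succ_log_self (by omega) R).le
      have h4 : c5 * Δ ≤ c0 * (c1 * Δ) := by
        have := mul_le_mul_of_nonneg_right hc52 hΔ0
        linarith
      have h5 := mul_le_mul_of_nonneg_left (h2.trans h3) hc0p.le
      linarith
    have h2 : (b : ℝ) * l + 1 ≤ (2 * b * B + 1) * ℓ := by
      have := mul_le_mul_of_nonneg_left hl2 (by positivity : (0 : ℝ) ≤ b)
      linarith
    calc _ ≤ 4 * ((2 * b * B + 1) * ℓ) ^ b * E := by gcongr
      _ = 4 * (2 * b * B + 1) ^ b * ℓ ^ b * E := by rw [mul_pow]; ring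
      _ ≤ _ := by gcongr <;> first | exact hℓ1 | omega
  have t3 : 8 * (b : ℝ) ^ 2 * R ^ 4 * (1 + log ((b ^ l : ℕ) : ℝ)) * ρ ^ l ≤ 8 * b ^ 2 * 16 * B * ℓ ^ (b + 1) * E := by
    have h1 : (R : ℝ) ^ 4 * ρ ^ l ≤ 16 * E := by
      calc (R : ℝ) ^ 4 * ρ ^ l ≤ (2 * exp (c1 * Δ)) ^ 4 * exp (-(c0 * (Δ / 20))) := by
            rw [hρpow]
            gcongr
            linarith
        _ = 16 * exp (4 * (c1 * Δ) + -(c0 * (Δ / 20))) := by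
            rw [exp_add, mul_pow, ← Real.exp_nat_mul]; push_cast; ring
        _ ≤ _ := by
            rw [hE]; gcongr
            have i1 := mul_le_mul_of_nonneg_right hc12 hΔ0
            have i3 := mul_nonneg hc0p.le hΔ0
            have i2 := mul_le_mul_of_nonneg_right hc51 hΔ0
            linarith
    calc _ = 8 * (b : ℝ) ^ 2 * ((R : ℝ) ^ 4 * ρ ^ l) * (1 + log ((b ^ l : ℕ) : ℝ)) := by ring
      _ ≤ 8 * (b : ℝ) ^ 2 * (16 * E) * (B * ℓ ^ (b + 1)) := by
          gcongr
          refine hlogG2.trans ?_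
          gcongr
          exact le_self_pow₀ hℓ1 (by omega)
      _ = _ := by ring
  have t4 : 12 * (b : ℝ) * R ^ 5 * σ ^ 2 * (1 + log ((b ^ l : ℕ) : ℝ)) ≤ 12 * b * 32 * 4 * B * ℓ ^ (b + 1) * E := by
    have hs : σ ^ 2 ≤ 4 * exp (-(c2 * Δ)) := by
      rw [hσ, mul_pow, ← Real.exp_nat_mul]
      norm_num
      have h1 : log ((b ^ l : ℕ) : ℝ) = ((k * l : ℕ) : ℝ) * log g := by
        rw [hb]; push_cast; rw [← pow_mul, Real.log_pow]; push_cast; ring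
      rw [h1] at hlogG
      have h2 : log X / (80 * log g) ≤ k * l := by
        rw [div_le_iff₀ (by positivity)]; push_cast at hlogG; linarith
      rw [hΔ, hc2]
      calc 1 / (20 * (g * (g + 1 : ℝ) ^ 2) * log g) * (nd ((g - 1 : ℝ) * α) ^ 2 * log X)
          = 2 * (2 / (g * (g + 1 : ℝ) ^ 2) * nd ((g - 1 : ℝ) * α) ^ 2 * (log X / (80 * log g))) := by
            field_simp; ring
        _ ≤ _ := by gcongr
    have h1 : (R : ℝ) ^ 5 * σ ^ 2 ≤ 32 * 4 * E := by
      calc (R : ℝ) ^ 5 * σ ^ 2 ≤ (2 * exp (c1 * Δ)) ^ 5 * (4 * exp (-(c2 * Δ))) := by gcongr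
        _ = 32 * 4 * exp (5 * (c1 * Δ) + -(c2 * Δ)) := by
            rw [exp_add, mul_pow, ← Real.exp_nat_mul]; push_cast; ring
        _ ≤ _ := by
            rw [hE]; gcongr
            have i1 := mul_le_mul_of_nonneg_right hc13 hΔ0
            have i2 := mul_le_mul_of_nonneg_right hc51 hΔ0
            have i3 := mul_nonneg hc2p.le hΔ0
            linarith
    calc _ = 12 * (b : ℝ) * ((R : ℝ) ^ 5 * σ ^ 2) * (1 + log ((b ^ l : ℕ) : ℝ)) := by ring
      _ ≤ 12 * (b : ℝ) * (32 * 4 * E) * (B * ℓ ^ (b + 1)) := by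
          gcongr
          refine hlogG2.trans ?_
          gcongr
          exact le_self_pow₀ hℓ1 (by omega)
      _ = _ := by ring
  calc _ ≤ _ := add_le_add (add_le_add (add_le_add t1 t2) t3) t4
    _ = _ := by rw [hC]; ring

lemma psi_sum (X : ℕ) : ∑ n ∈ Ioc 0 X, vonMangoldt n ≤ 6 * X := by
  have h := Chebyshev.psi_le_const_mul_self (x := (X : ℝ)) (by positivity)
  rw [Chebyshev.psi, Nat.floor_natCast] at h
  have h4 : log 4 ≤ 2 := by
    have : (4 : ℝ) = 2 ^ 2 := by norm_num
    rw [this, Real.log_pow]; have := Real.log_two_lt_d9; push_cast; linarith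
  refine h.trans ?_
  gcongr; linarith

lemma lambda_sum_triv (f : ℕ → ℂ) (hf : ∀ n, ‖f n‖ ≤ 1) (X : ℕ) :
    ‖∑ n ∈ Ioc 0 X, (vonMangoldt n : ℂ) * f n‖ ≤ 6 * X := by
  refine (norm_sum_le _ _).trans (le_trans (sum_le_sum fun n _ => ?_) (psi_sum X))
  rw [norm_mul, Complex.norm_real, norm_eq_abs, abs_of_nonneg vonMangoldt_nonneg]
  exact mul_le_of_le_one_right vonMangoldt_nonneg (hf n)

lemma exists_U (X : ℕ) (hX : 2 ^ 40 ≤ X) : ∃ U : ℕ, 2 ≤ U ∧ U ^ 40 ≤ X ∧ X ≤ U ^ 80 := by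
  have hex : ∃ n, X < (n + 1) ^ 40 := ⟨X, by
    calc X < X + 1 := by omega
      _ ≤ (X + 1) ^ 40 := Nat.le_self_pow (by norm_num) _⟩
  set U := Nat.find hex with hU
  have h1 : X < (U + 1) ^ 40 := Nat.find_spec hex
  have h2 : 2 ≤ U := by
    by_contra h
    push Not at h
    have : (U + 1) ^ 40 ≤ 2 ^ 40 := by gcongr; omega
    omega
  refine ⟨U, h2, ?_, ?_⟩
  · have := Nat.find_min hex (m := U - 1) (by omega)
    rw [Nat.sub_add_cancel (by omega)] at this
    omega
  · refine h1.le.trans ?_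
    rw [show (80 : ℕ) = 2 * 40 by norm_num, pow_mul]
    gcongr
    nlinarith

set_option maxHeartbeats 1600000 in
theorem mauduit_rivat (g : ℕ) (hg : 2 ≤ g) : ∃ (C c : ℝ) (A : ℕ), 0 < C ∧ 0 < c ∧ ∀ (α : ℝ) (X : ℕ), 1 ≤ X →
    ‖∑ n ∈ Ioc 0 X, (vonMangoldt n : ℂ) * fa g α n‖ ≤
      C * (1 + log X) ^ A * X * exp (-(c * (nd ((g - 1 : ℝ) * α) ^ 2 * log X))) := by
  obtain ⟨k, hk, hbl⟩ := exists_block g hg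
  obtain ⟨c1, c5, C0, hc1, hc5, hC0, hc51, hc11, hc52, hII⟩ := typeII_param g hg k hk hbl
  set b := g ^ k with hb
  have hb2 : 2 ≤ b := hg.trans (by rw [hb]; exact Nat.le_self_pow (by omega) g)
  have hbR : (2 : ℝ) ≤ b := by exact_mod_cast hb2
  have hgR : (2 : ℝ) ≤ g := by exact_mod_cast hg
  have hlg : 0 < log g := log_pos (by linarith)
  set C : ℝ := 1 + 15 * b ^ 2 + 24 + 24 * C0 + 6 * exp 7 with hC
  refine ⟨C, c5 / 4, b + 10, by rw [hC]; positivity, by positivity, ?_⟩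
  intro α X hX
  set ℓ := 1 + log X with hℓ
  have hℓ1 : 1 ≤ ℓ := one_le_ell
  have hX0 : (0 : ℝ) < X := by exact_mod_cast hX
  set Δ := nd ((g - 1 : ℝ) * α) ^ 2 * log X with hΔ
  have hΔ0 : 0 ≤ Δ := delta_nonneg _ _
  have hΔ1 : Δ ≤ log X / 4 := delta_le _ _
  have hℓn : ∀ n, 1 ≤ ℓ ^ n := fun n => one_le_pow₀ hℓ1
  set E := exp (-(c5 / 4 * Δ)) with hE
  have hE0 : 0 < E := exp_pos _
  rcases Nat.lt_or_ge X (2 ^ 40) with hsm | hbig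
  · refine (lambda_sum_triv _ (fun n => (fa_norm g α n).le) X).trans ?_
    have h1 : exp (-7) ≤ E := by
      rw [hE, exp_le_exp]
      have h2 : log X ≤ 28 := by
        have : log X ≤ log ((2 : ℝ) ^ 40) := log_le_log hX0 (by exact_mod_cast hsm.le)
        rw [Real.log_pow] at this
        have := Real.log_two_lt_d9; push_cast at *; linarith
      have : c5 / 4 * Δ ≤ 1 * Δ := by gcongr; linarith
      linarith
    calc (6 : ℝ) * X = (6 * exp 7) * 1 * X * exp (-7) := by
          have : exp 7 * exp (-7) = 1 := by rw [← exp_add]; simp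
          linear_combination (-6 * (X : ℝ)) * this
      _ ≤ C * ℓ ^ (b + 10) * X * E := by
          gcongr
          · rw [hC]; have : 0 ≤ 1 + 15 * (b : ℝ) ^ 2 + 24 + 24 * C0 := by positivity
            linarith
          · exact hℓn _
  obtain ⟨U, hU2, hU40, hU80⟩ := exists_U X hbig
  have hU0 : (2 : ℝ) ≤ U := by exact_mod_cast hU2
  have hlogU : log X / 80 ≤ log U := by
    have : log X ≤ log ((U ^ 80 : ℕ) : ℝ) := log_le_log hX0 (by exact_mod_cast hU80)
    push_cast at this
    rw [Real.log_pow] at this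
    push_cast at this; linarith
  -- type I block
  set l := Nat.clog b (2 * U ^ 8) with hl
  have hG1 : 2 * U ^ 8 ≤ b ^ l := Nat.le_pow_clog (by omega) _
  have hG2 : b ^ l ≤ b * (2 * U ^ 8) := by
    have h1 : 1 < 2 * U ^ 8 := by have := Nat.one_le_pow 8 U (by omega); omega
    have h0 : 0 < l := Nat.clog_pos (by omega) h1
    obtain ⟨l', hl'⟩ : ∃ l', l = l' + 1 := ⟨l - 1, by omega⟩
    have : b ^ l' < 2 * U ^ 8 := by
      rw [← not_le, ← Nat.clog_le_iff_le_pow (by omega), ← hl]; omega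
    rw [hl', pow_succ, mul_comm]
    exact Nat.mul_le_mul le_rfl this.le
  set G := b ^ l * b ^ l with hG
  have hBM : ∀ j, BM (b ^ j) (fa g α) := fun j =>
    BM_pow (by omega) (BM_pow (by omega) (fa_BM g hg α) (fa_zero g α) k) (fa_zero g α) j
  have hBG : BM G (fa g α) := by rw [hG, ← pow_add]; exact hBM _
  set σ : ℝ := 2 * exp (-(2 / (g * (g + 1 : ℝ) ^ 2) * nd ((g - 1 : ℝ) * α) ^ 2 * ((k * l : ℕ) : ℝ))) with hσ
  have hσs : ∀ θ, ‖FF (fa g α) (b ^ l) θ‖ ≤ σ := by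
    intro θ
    rw [hb, ← pow_mul]; exact FF_sup g hg α (k * l) θ
  have hσE : σ ≤ 2 * E := by
    rw [hσ, hE]
    apply mul_le_mul_of_nonneg_left _ (by norm_num)
    rw [exp_le_exp]
    have hlogG : log X / 80 ≤ ((k * l : ℕ) : ℝ) * log g := by
      have h1 : log ((b ^ l : ℕ) : ℝ) = ((k * l : ℕ) : ℝ) * log g := by
        rw [hb]; push_cast; rw [← pow_mul, Real.log_pow]; push_cast; ring
      rw [← h1]
      refine hlogU.trans (log_le_log (by linarith) ?_)
      have : U ≤ b ^ l := by
        have := Nat.le_self_pow (n := 8) (by norm_num) U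
        omega
      exact_mod_cast this
    have h2 : log X / (80 * log g) ≤ ((k * l : ℕ) : ℝ) := by
      rw [div_le_iff₀ (by positivity)]; linarith
    have hc2 : 0 ≤ 1 / (20 * (g * (g + 1 : ℝ) ^ 2) * log g) * Δ := by positivity
    have hc5' := mul_le_mul_of_nonneg_right hc52 hΔ0
    have h3 : 1 / (20 * (g * (g + 1 : ℝ) ^ 2) * log g) * Δ / 2 =
        2 / (g * (g + 1 : ℝ) ^ 2) * nd ((g - 1 : ℝ) * α) ^ 2 * (log X / (80 * log g)) := by
      rw [hΔ]; field_simp; ring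
    have h4 : 2 / (g * (g + 1 : ℝ) ^ 2) * nd ((g - 1 : ℝ) * α) ^ 2 * (log X / (80 * log g)) ≤
        2 / (g * (g + 1 : ℝ) ^ 2) * nd ((g - 1 : ℝ) * α) ^ 2 * ((k * l : ℕ) : ℝ) := by gcongr
    linarith
  set Ef : ℕ → ℝ := fun m => 1 + G + 2 * X * (σ * (1 / (m : ℝ) * ∑ j ∈ range m, ‖FF (fa g α) (b ^ l) ((j : ℝ) / m)‖)) with hEf
  have hU2X : U ^ 2 ≤ X := le_trans (Nat.pow_le_pow_right (by omega) (by norm_num)) hU40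
  have hEI : ∀ m, 1 ≤ m → m ≤ U ^ 2 → ∀ Y, m * Y ≤ X → ‖∑ n ∈ Ioc 0 Y, fa g α (m * n)‖ ≤ Ef m := by
    intro m hm hmU Y hY
    refine (typeI_bound (fa g α) (fa_norm g α) G (by rw [hG]; positivity) hBG X m Y hm (hmU.trans hU2X) hY).trans ?_
    rw [hEf]
    simp only
    have hs : ∑ j ∈ range m, ‖FF (fa g α) G ((j : ℝ) / m)‖ ≤ σ * ∑ j ∈ range m, ‖FF (fa g α) (b ^ l) ((j : ℝ) / m)‖ := by
      rw [mul_sum]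
      apply sum_le_sum; intro j _
      rw [hG, FF_mul (hBM l), norm_mul, mul_comm]
      gcongr
      exact hσs _
    have h1 : 1 / (m : ℝ) * ∑ j ∈ range m, ‖FF (fa g α) G ((j : ℝ) / m)‖ ≤
        1 / (m : ℝ) * (σ * ∑ j ∈ range m, ‖FF (fa g α) (b ^ l) ((j : ℝ) / m)‖) := by gcongr
    have h2 : 2 * (X : ℝ) * (1 / (m : ℝ) * ∑ j ∈ range m, ‖FF (fa g α) G ((j : ℝ) / m)‖) ≤
       2 * (X : ℝ) * (1 / (m : ℝ) * (σ * ∑ j ∈ range m, ‖FF (fa g α) (b ^ l) ((j : ℝ) / m)‖)) := by gcongr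
    calc _ ≤ 1 + (G : ℝ) + 2 * (X : ℝ) * (1 / (m : ℝ) * (σ * ∑ j ∈ range m, ‖FF (fa g α) (b ^ l) ((j : ℝ) / m)‖)) := by linarith
      _ = _ := by ring
  -- root X
  have hU20 : (U : ℝ) ^ 20 ≤ X * E := by
    have h1 : ((U : ℝ) ^ 20) ≤ exp (log X / 2) := by
      have : log ((U : ℝ) ^ 40) ≤ log X := log_le_log (by positivity) (by exact_mod_cast hU40)
      rw [Real.log_pow] at this
      rw [← Real.log_le_iff_le_exp (by positivity), Real.log_pow]
      push_cast at *; linarith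
    have h2 : (X : ℝ) = exp (log X) := (Real.exp_log hX0).symm
    refine h1.trans ?_
    rw [hE]
    nth_rewrite 2 [h2]
    rw [← exp_add, exp_le_exp]
    have : c5 / 4 * Δ ≤ 1 * Δ := by gcongr; linarith
    have := log_natCast_nonneg X
    linarith
  have hsumE : ∑ m ∈ Ioc 0 (U ^ 2), Ef m ≤ 5 * b ^ 2 * (X * E) + 8 * ℓ ^ 2 * (X * E) := by
    rw [hEf]
    simp only [sum_add_distrib, ← mul_sum]
    have h1 := typeI_avg (fa g α) (fa_norm g α) (U ^ 2) (b ^ l) (by positivity) (by rw [← pow_mul]; exact hG1)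
    have h2 : 1 + log ((U ^ 2 : ℕ) : ℝ) ≤ ℓ := ell_mono hU2X
    have h3 : (1 : ℝ) ≤ 1 + log ((U ^ 2 : ℕ) : ℝ) := one_le_ell
    have h4 : ∑ m ∈ Ioc 0 (U ^ 2), 1 / (m : ℝ) * ∑ j ∈ range m, ‖FF (fa g α) (b ^ l) ((j : ℝ) / m)‖ ≤ 2 * ℓ ^ 2 := by
      refine h1.trans ?_
      gcongr
    have h5 : 2 * (X : ℝ) * (σ * ∑ m ∈ Ioc 0 (U ^ 2), 1 / (m : ℝ) * ∑ j ∈ range m, ‖FF (fa g α) (b ^ l) ((j : ℝ) / m)‖) ≤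
        2 * X * ((2 * E) * (2 * ℓ ^ 2)) := by gcongr
    have h6 : (G : ℝ) ≤ 4 * b ^ 2 * U ^ 16 := by
      have : G ≤ 4 * b ^ 2 * U ^ 16 := by
        rw [hG]
        calc b ^ l * b ^ l ≤ (b * (2 * U ^ 8)) * (b * (2 * U ^ 8)) := Nat.mul_le_mul hG2 hG2
          _ = _ := by ring
      exact_mod_cast this
    have h7 : (U : ℝ) ^ 2 * (1 + G) ≤ 5 * b ^ 2 * (X * E) := by
      have hU1 : (1 : ℝ) ≤ U := by linarith
      have hb1 : (1 : ℝ) ≤ (b : ℝ) ^ 2 := one_le_pow₀ (by linarith)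
      have hp : (1 : ℝ) ≤ (U : ℝ) ^ 16 := one_le_pow₀ hU1
      calc (U : ℝ) ^ 2 * (1 + G) ≤ (U : ℝ) ^ 2 * ((b : ℝ) ^ 2 * (U : ℝ) ^ 16 + 4 * (b : ℝ) ^ 2 * (U : ℝ) ^ 16) := by
            gcongr
            nlinarith
        _ = 5 * (b : ℝ) ^ 2 * (U : ℝ) ^ 18 := by ring
        _ ≤ 5 * (b : ℝ) ^ 2 * (U : ℝ) ^ 20 := by gcongr <;> first | exact hU1 | norm_num
        _ ≤ _ := by gcongr
    simp only [sum_const, Nat.card_Ioc, nsmul_eq_mul, Nat.sub_zero]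
    push_cast at h5 ⊢
    linarith
  -- type II
  set R := ⌊exp (c1 * Δ)⌋₊ + 1 with hR
  have hexp1 : 1 ≤ exp (c1 * Δ) := Real.one_le_exp (by positivity)
  have hR1 : exp (c1 * Δ) ≤ R := by rw [hR]; push_cast; exact (Nat.lt_floor_add_one _).le
  have hR2 : (R : ℝ) ≤ 2 * exp (c1 * Δ) := by
    rw [hR]; push_cast
    have := Nat.floor_le (by positivity : 0 ≤ exp (c1 * Δ))
    linarith
  set δ := C0 * ℓ ^ (b + 1) * E with hδ
  have hδ0 : 0 ≤ δ := by positivity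
  have hE4 : E ^ 4 = exp (-(c5 * Δ)) := by rw [hE, ← Real.exp_nat_mul]; congr 1; push_cast; ring
  have hCl : 1 ≤ C0 * ℓ ^ (b + 1) := by nlinarith [hℓn (b + 1)]
  have hR3 : ((R : ℝ)) ^ 2 ≤ X := by
    have h2 : (X : ℝ) = exp (log X) := (Real.exp_log hX0).symm
    have h3 : (4 : ℝ) ≤ exp (log X / 2) := by
      rw [← Real.log_le_iff_le_exp (by norm_num)]
      have : log ((2 : ℝ) ^ 40) ≤ log X := log_le_log (by positivity) (by exact_mod_cast hbig)
      rw [Real.log_pow] at this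
      have h4 : log 4 = 2 * log 2 := by
        rw [show (4 : ℝ) = 2 ^ 2 by norm_num, Real.log_pow]; push_cast; ring
      have := Real.log_two_gt_d9
      push_cast at *; linarith
    calc ((R : ℝ)) ^ 2 ≤ (2 * exp (c1 * Δ)) ^ 2 := by gcongr
      _ = 4 * exp (2 * (c1 * Δ)) := by rw [mul_pow, ← Real.exp_nat_mul]; push_cast; ring
      _ ≤ exp (log X / 2) * exp (log X / 2) := by
          gcongr
          have : c1 * Δ ≤ 1 * Δ := by gcongr
          linarith
      _ = X := by rw [← exp_add, add_halves, Real.exp_log hX0]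
  have hR3' : R ^ 2 ≤ X := by exact_mod_cast hR3
  have key := vaughan_bound (fa g α) (fun n => (fa_norm g α n).le) X U (by omega) hX δ hδ0 Ef hEI (by
    intro M M' hUM hMM' h2 hM'X
    have hMX : M * M ≤ X := le_trans (Nat.mul_le_mul hMM'.le hMM'.le) hM'X
    have hRM : R * M ≤ X := by
      by_contra h
      push Not at h
      have h1 : X * X < (R * M) * (R * M) := Nat.mul_lt_mul'' h h
      have h3 : (R * M) * (R * M) = R ^ 2 * (M * M) := by ring
      have h4 : R ^ 2 * (M * M) ≤ X * X := Nat.mul_le_mul hR3' hMX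
      omega
    refine ⟨R, by omega, ?_, ?_, ?_⟩
    · rw [Nat.le_div_iff_mul_le (by omega)]; exact hRM
    · have hRp : (0 : ℝ) < R := by linarith
      rw [div_le_iff₀ hRp]
      calc (1 : ℝ) ≤ (C0 * ℓ ^ (b + 1)) ^ 2 := one_le_pow₀ hCl
        _ = (C0 * ℓ ^ (b + 1)) ^ 2 * (E ^ 2 * exp (c5 / 2 * Δ)) := by
            have : E ^ 2 * exp (c5 / 2 * Δ) = 1 := by
              rw [hE, ← Real.exp_nat_mul, ← exp_add]; push_cast
              rw [Real.exp_eq_one_iff]; ring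
            rw [this, mul_one]
        _ ≤ (C0 * ℓ ^ (b + 1)) ^ 2 * (E ^ 2 * exp (c1 * Δ)) := by gcongr; linarith
        _ ≤ (C0 * ℓ ^ (b + 1)) ^ 2 * (E ^ 2 * R) := by gcongr
        _ = δ ^ 2 * R := by rw [hδ]; ring
    · calc ∑ r ∈ Ico 1 R, TT (fa g α) X M M' r ≤ ∑ r ∈ Ico 1 R, X * (C0 * ℓ ^ (b + 1) * E ^ 4) := by
            apply sum_le_sum; intro r hr
            rw [mem_Ico] at hr
            rw [hE4]
            exact hII α X M M' r R Δ hΔ (hU80.trans (Nat.pow_le_pow_left hUM 80)) (by omega) h2 hMX hr.1 hr.2 hRM hR1 hR2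
        _ = ((R - 1 : ℕ) : ℝ) * (X * (C0 * ℓ ^ (b + 1) * E ^ 4)) := by simp
        _ ≤ R * (X * ((C0 * ℓ ^ (b + 1)) ^ 4 * E ^ 4)) := by
            gcongr
            · omega
            · exact le_self_pow₀ hCl (by norm_num)
        _ = _ := by rw [hδ]; ring)
  refine key.trans ?_
  have hUXE : (U : ℝ) ≤ X * E := le_trans (le_self_pow₀ (by linarith) (by norm_num)) hU20
  have hXE : 0 < X * E := by positivity
  have p1 : ℓ ≤ ℓ ^ (b + 10) := le_self_pow₀ hℓ1 (by omega)
  have p3 : ℓ ^ 3 ≤ ℓ ^ (b + 10) := pow_le_pow_right₀ hℓ1 (by omega)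
  set P := ℓ ^ (b + 10) with hP
  have q : ℓ ^ 9 * ℓ ^ (b + 1) = P := by rw [hP, ← pow_add]; congr 1; omega
  calc _ ≤ ℓ * (X * E + 3 * (5 * b ^ 2 * (X * E) + 8 * ℓ ^ 2 * (X * E))) + 24 * ℓ ^ 9 * X * δ := by gcongr
    _ = (1 + 15 * b ^ 2) * ℓ * (X * E) + 24 * ℓ ^ 3 * (X * E) + 24 * C0 * (ℓ ^ 9 * ℓ ^ (b + 1)) * (X * E) := by rw [hδ]; ring
    _ ≤ (1 + 15 * b ^ 2) * P * (X * E) + 24 * P * (X * E) + 24 * C0 * P * (X * E) := by rw [q]; gcongr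
    _ = (1 + 15 * b ^ 2 + 24 + 24 * C0) * P * (X * E) := by ring
    _ ≤ C * P * (X * E) := by
        gcongr
        rw [hC]; have := exp_pos 7; linarith
    _ = _ := by ring

/-! ### Weak prime number theorem in progressions: bounds for L-series -/

lemma log_pow_le_rpow (j : ℕ) (δ : ℝ) (hδ : 0 < δ) : ∃ K : ℝ, 0 < K ∧ ∀ x : ℝ, 1 ≤ x →
    (1 + log (x+1))^j ≤ K * x ^ δ := by
  have he : 0 < δ / (j+1) := by positivity
  set e := δ / (j+1) with he'
  refine ⟨(1 + 2^e/e)^j, by positivity, fun x hx => ?_⟩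
  have h0 : (0:ℝ) ≤ log (x+1) := Real.log_nonneg (by linarith)
  have h1 : 1 + log (x+1) ≤ (1 + 2^e/e) * x^e := by
    have h2 : log (x+1) ≤ (x+1)^e/e := Real.log_le_rpow_div (by linarith) he
    have h3 : (x+1)^e ≤ 2^e * x^e := by
      rw [← Real.mul_rpow (by norm_num) (by linarith)]
      exact rpow_le_rpow (by linarith) (by linarith) he.le
    have h4 : (1:ℝ) ≤ x^e := Real.one_le_rpow hx he.le
    have h5 : (x+1)^e/e ≤ 2^e * x^e / e := by gcongr
    calc 1 + log (x+1) ≤ x^e + 2^e * x^e / e := by linarith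
      _ = _ := by ring
  calc (1 + log (x+1))^j ≤ ((1 + 2^e/e) * x^e)^j := by gcongr
    _ = (1 + 2^e/e)^j * x^(e*j) := by
        rw [mul_pow, ← rpow_natCast (x^e) j, ← rpow_mul (by linarith)]
    _ ≤ _ := by
        refine mul_le_mul_of_nonneg_left (rpow_le_rpow_of_exponent_le hx ?_) (by positivity)
        rw [he', div_mul_eq_mul_div, div_le_iff₀ (by positivity)]; nlinarith

/-- the summand function `log^j y * y^{-s}` -/
noncomputable def hj (j : ℕ) (s : ℂ) (y : ℝ) : ℂ := ((log y : ℝ) : ℂ)^j * (y:ℂ)^(-s)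

lemma hj_hasDerivAt (j : ℕ) (s : ℂ) (y : ℝ) (hy : 0 < y) :
    HasDerivAt (hj j s) ((j * ((log y : ℝ):ℂ)^(j-1) - s * ((log y : ℝ):ℂ)^j) * (y:ℂ)^(-s-1)) y := by
  have h1 : HasDerivAt (fun y : ℝ => ((log y : ℝ) : ℂ)) ((y⁻¹ : ℝ) : ℂ) y :=
    (Real.hasDerivAt_log hy.ne').ofReal_comp
  have h3 : HasDerivAt (fun y : ℝ => (y:ℂ)^(-s)) (-s * (y:ℂ)^(-s-1)) y := by
    have := ((hasDerivAt_id (y:ℂ)).cpow_const (c := -s) (by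
      left; simpa using hy)).comp_ofReal
    simpa using this
  have h4 := (h1.pow j).mul h3
  refine h4.congr_deriv ?_
  have hy' : (y:ℂ) ≠ 0 := by exact_mod_cast hy.ne'
  have : (y:ℂ)^(-s) = y * (y:ℂ)^(-s-1) := by
    rw [Complex.cpow_sub _ _ hy', Complex.cpow_one]; field_simp
  simp only [Pi.pow_apply]
  rw [this]; push_cast; field_simp; ring

lemma norm_cpow_le (s : ℂ) (n y : ℝ) (hn : 1 ≤ n) (hy : n ≤ y) (hs : 1 < s.re) : ‖(y:ℂ)^(-s)‖ ≤ 1/n := by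
  rw [Complex.norm_cpow_eq_rpow_re_of_pos (by linarith), Complex.neg_re, rpow_neg (by linarith), one_div]
  apply inv_anti₀ (by linarith)
  calc n ≤ y := hy
    _ = y^(1:ℝ) := (rpow_one y).symm
    _ ≤ _ := rpow_le_rpow_of_exponent_le (by linarith) hs.le

lemma hj_norm_le (j : ℕ) (s : ℂ) (n y : ℝ) (hn : 1 ≤ n) (hy : n ≤ y) (hy2 : y ≤ n+1) (hs : 1 < s.re) :
    ‖hj j s y‖ ≤ (1 + log (n+1))^j / n := by
  rw [hj, norm_mul, norm_pow, Complex.norm_real, norm_of_nonneg (Real.log_nonneg (by linarith))]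
  have h1 := norm_cpow_le s n y hn hy hs
  have h2 : log y ≤ 1 + log (n+1) := by
    have := log_le_log (by linarith) hy2; linarith
  have h3 : 0 ≤ log y := Real.log_nonneg (by linarith)
  calc log y ^ j * ‖(y:ℂ)^(-s)‖ ≤ (1 + log (n+1))^j * (1/n) := by
        have : 0 ≤ 1 + log (n+1) := by linarith
        gcongr
    _ = _ := by ring

lemma hj_deriv_norm_le (j : ℕ) (s : ℂ) (n y : ℝ) (hn : 1 ≤ n) (hy : n ≤ y) (hy2 : y ≤ n+1) (hs : 1 < s.re) :
    ‖((j * ((log y : ℝ):ℂ)^(j-1) - s * ((log y : ℝ):ℂ)^j) * (y:ℂ)^(-s-1))‖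
      ≤ (‖s‖ + j) * (1 + log (n+1))^j / n^2 := by
  have hy0 : 0 < y := by linarith
  have hy' : (y:ℂ) ≠ 0 := by exact_mod_cast hy0.ne'
  have h3 : 0 ≤ log y := Real.log_nonneg (by linarith)
  have h2 : log y ≤ 1 + log (n+1) := by
    have := log_le_log (by linarith) hy2; linarith
  have hL : 1 ≤ 1 + log (n+1) := by
    have := Real.log_nonneg (show (1:ℝ) ≤ n+1 by linarith); linarith
  rw [Complex.cpow_sub _ _ hy', Complex.cpow_one, norm_mul, norm_div]
  have h1 := norm_cpow_le s n y hn hy hs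
  have h4 : ‖(y:ℂ)‖ = y := by rw [Complex.norm_real, norm_of_nonneg hy0.le]
  have h5 : ‖(j * ((log y : ℝ):ℂ)^(j-1) - s * ((log y : ℝ):ℂ)^j)‖ ≤ (‖s‖ + j) * (1 + log (n+1))^j := by
    refine (norm_sub_le _ _).trans ?_
    rw [norm_mul, norm_mul, norm_pow, norm_pow, Complex.norm_real, norm_of_nonneg h3, Complex.norm_natCast]
    have a1 : log y ^ (j-1) ≤ (1 + log (n+1))^j :=
      (pow_le_pow_left₀ h3 h2 _).trans (pow_le_pow_right₀ hL (by omega))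
    have a2 : log y ^ j ≤ (1 + log (n+1))^j := pow_le_pow_left₀ h3 h2 _
    have := mul_le_mul_of_nonneg_left a1 (Nat.cast_nonneg (α := ℝ) j)
    have := mul_le_mul_of_nonneg_left a2 (norm_nonneg s)
    linarith
  have h6 : ‖(y:ℂ)^(-s)‖ / ‖(y:ℂ)‖ ≤ 1/n/n := by rw [h4]; gcongr
  calc _ ≤ ((‖s‖ + j) * (1 + log (n+1))^j) * (1/n/n) := by gcongr
    _ = _ := by field_simp

lemma hj_diff_le (j : ℕ) (s : ℂ) (n y : ℝ) (hn : 1 ≤ n) (hy : n ≤ y) (hy2 : y ≤ n+1) (hs : 1 < s.re)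
    (hs2 : s.re ≤ 2) (hj3 : j ≤ 3) (δ : ℝ) (hδ : 0 < δ) (hδ1 : δ ≤ 1) :
    ‖hj j s y - hj j s n‖ ≤ 2 * (|s.im|+3)^δ * (1 + log (n+1))^j / n^(1+δ) := by
  have hn0 : 0 < n := by linarith
  set L := (1 + log (n+1))^j with hL
  have hL0 : 0 ≤ L := by
    have := Real.log_nonneg (show (1:ℝ) ≤ n+1 by linarith); positivity
  have h1 : ‖hj j s y - hj j s n‖ ≤ 2 * L / n := by
    have a1 := hj_norm_le j s n y hn hy hy2 hs
    have a2 := hj_norm_le j s n n hn le_rfl (by linarith) hs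
    refine (norm_sub_le _ _).trans ?_
    rw [← hL] at a1 a2
    have : 2 * L / n = L/n + L/n := by ring
    linarith
  have h2 : ‖hj j s y - hj j s n‖ ≤ (2*(|s.im|+3)) * L / n^2 := by
    have := Convex.norm_image_sub_le_of_norm_hasDerivWithin_le (f := hj j s) (s := Set.Icc n (n+1))
      (f' := fun y => ((j * ((log y : ℝ):ℂ)^(j-1) - s * ((log y : ℝ):ℂ)^j) * (y:ℂ)^(-s-1)))
      (C := (‖s‖ + j) * L / n^2)
      (fun z hz => (hj_hasDerivAt j s z (by linarith [hz.1])).hasDerivWithinAt)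
      (fun z hz => hj_deriv_norm_le j s n z hn hz.1 hz.2 hs) (convex_Icc _ _)
      (show n ∈ Set.Icc n (n+1) by constructor <;> linarith) (show y ∈ Set.Icc n (n+1) from ⟨hy, hy2⟩)
    refine this.trans ?_
    have a1 : ‖y - n‖ ≤ 1 := by rw [norm_eq_abs, abs_le]; constructor <;> linarith
    have a2 : ‖s‖ + j ≤ 2*(|s.im|+3) := by
      have := Complex.norm_le_abs_re_add_abs_im s
      rw [abs_of_pos (by linarith : 0 < s.re)] at this
      have : (j:ℝ) ≤ 3 := by exact_mod_cast hj3
      have := abs_nonneg s.im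
      linarith
    calc _ ≤ (‖s‖ + j) * L / n^2 * 1 := by gcongr
      _ ≤ _ := by rw [mul_one]; gcongr
  have hT : 0 < |s.im| + 3 := by positivity
  set D := ‖hj j s y - hj j s n‖ with hD
  have hD0 : 0 ≤ D := norm_nonneg _
  calc D = D^(1-δ) * D^δ := by
        rw [← rpow_add' hD0 (by norm_num)]; simp
    _ ≤ (2 * L / n)^(1-δ) * ((2*(|s.im|+3)) * L / n^2)^δ := by gcongr
    _ = (2*L/n)^(1-δ) * ((2*L/n)^δ * ((|s.im|+3)/n)^δ) := by
        rw [← Real.mul_rpow (by positivity) (by positivity)]; congr 2; field_simp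
    _ = 2*L/n * ((|s.im|+3)/n)^δ := by
        rw [← mul_assoc, ← rpow_add' (by positivity) (by norm_num)]; simp
    _ = _ := by
        rw [Real.div_rpow hT.le hn0.le, rpow_add hn0, rpow_one]; field_simp

lemma hj_bound_summable (j : ℕ) (δ : ℝ) (hδ : 0 < δ) :
    Summable (fun k : ℕ => (1 + log (((k:ℝ)+1)+1))^j / ((k:ℝ)+1)^(1+δ)) := by
  obtain ⟨K, hK, h⟩ := log_pow_le_rpow j (δ/2) (by linarith)
  have h1 : Summable (fun k : ℕ => K * (1 / ((k+1:ℕ):ℝ)^(1+δ/2))) :=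
    ((summable_nat_add_iff 1).2 (Real.summable_one_div_nat_rpow.2 (by linarith : 1 < 1 + δ/2))).mul_left K
  refine Summable.of_nonneg_of_le (fun k => ?_) (fun k => ?_) h1
  · have := Real.log_nonneg (show (1:ℝ) ≤ (k:ℝ)+1+1 by have := Nat.cast_nonneg (α := ℝ) k; linarith)
    positivity
  · have hk : (1:ℝ) ≤ (k:ℝ)+1 := by have := Nat.cast_nonneg (α := ℝ) k; linarith
    have hk0 : (0:ℝ) < (k:ℝ)+1 := by linarith
    have := h _ hk
    push_cast
    rw [div_le_iff₀ (by positivity)]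
    refine this.trans (le_of_eq ?_)
    rw [show (1:ℝ)+δ = (1+δ/2) + δ/2 by ring, rpow_add hk0 (1+δ/2) (δ/2)]
    field_simp

lemma abel_tsum (w h : ℕ → ℂ) (B : ℕ → ℝ) (q : ℝ) (hw : ∀ n, ‖∑ m ∈ range n, w m‖ ≤ q)
    (hsum : Summable (fun n => w n * h n)) (hB : ∀ n, ‖h (n+1) - h n‖ ≤ B n) (hBs : Summable B)
    (h0 : Filter.Tendsto h Filter.atTop (nhds 0)) :
    ‖∑' n, w n * h n‖ ≤ q * ∑' n, B n := by
  have hq : 0 ≤ q := (norm_nonneg _).trans (hw 0)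
  have hBn : ∀ n, 0 ≤ B n := fun n => (norm_nonneg _).trans (hB n)
  have key : ∀ N, ‖∑ n ∈ range (N+1), w n * h n‖ ≤ q * ‖h N‖ + q * ∑' n, B n := by
    intro N
    have e : ∑ n ∈ range (N+1), w n * h n = (∑ m ∈ range (N+1), w m) * h N
        - ∑ n ∈ range N, (∑ m ∈ range (n+1), w m) * (h (n+1) - h n) := by
      induction N with
      | zero => simp
      | succ N ih =>
        rw [sum_range_succ, ih, sum_range_succ w (N+1),
          sum_range_succ (fun n => (∑ m ∈ range (n+1), w m) * (h (n+1) - h n)) N]; ring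
    rw [e]
    refine (norm_sub_le _ _).trans (add_le_add ?_ ?_)
    · rw [norm_mul]; exact mul_le_mul_of_nonneg_right (hw _) (norm_nonneg _)
    · refine (norm_sum_le _ _).trans ?_
      calc _ ≤ ∑ n ∈ range N, q * B n := by
            apply sum_le_sum; intro n _; rw [norm_mul]
            exact mul_le_mul (hw _) (hB n) (norm_nonneg _) hq
        _ = q * ∑ n ∈ range N, B n := by rw [mul_sum]
        _ ≤ _ := mul_le_mul_of_nonneg_left (hBs.sum_le_tsum _ (fun n _ => hBn n)) hq
  have t1 := ((hsum.hasSum.tendsto_sum_nat).comp (Filter.tendsto_add_atTop_nat 1)).norm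
  have t2 : Filter.Tendsto (fun N => q * ‖h N‖ + q * ∑' n, B n) Filter.atTop (nhds (q * ‖(0:ℂ)‖ + q * ∑' n, B n)) :=
    (h0.norm.const_mul q).add_const _
  have := le_of_tendsto_of_tendsto' t1 t2 key
  simpa using this

noncomputable def LJ (w : ℕ → ℂ) (j : ℕ) (s : ℂ) : ℂ := ∑' k : ℕ, w (k+1) * hj j s ((k:ℝ)+1)

lemma logMul_iter (f : ℕ → ℂ) (j n : ℕ) : (LSeries.logMul^[j] f) n = (Complex.log n)^j * f n := by
  induction j generalizing f with
  | zero => simp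
  | succ j ih => rw [Function.iterate_succ_apply, ih, LSeries.logMul]; ring

lemma term_eq_hj (f : ℕ → ℂ) (j k : ℕ) (s : ℂ) :
    LSeries.term (LSeries.logMul^[j] f) s (k+1) = f (k+1) * hj j s ((k:ℝ)+1) := by
  rw [LSeries.term_of_ne_zero (by omega), logMul_iter, hj, Complex.cpow_neg]
  have : Complex.log ((k+1:ℕ):ℂ) = ((log ((k:ℝ)+1) : ℝ):ℂ) := by
    rw [Complex.ofReal_log (by positivity)]; push_cast; rfl
  rw [this]; push_cast; field_simp

lemma LSeries_eq_LJ (f : ℕ → ℂ) (j : ℕ) (s : ℂ) (h : LSeriesSummable (LSeries.logMul^[j] f) s) :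
    LSeries (LSeries.logMul^[j] f) s = LJ f j s := by
  rw [LSeries, h.tsum_eq_zero_add, LSeries.term_zero, zero_add, LJ]
  exact tsum_congr (fun k => term_eq_hj f j k s)

lemma absc_iter (f : ℕ → ℂ) (j : ℕ) :
    LSeries.abscissaOfAbsConv (LSeries.logMul^[j] f) = LSeries.abscissaOfAbsConv f := by
  induction j generalizing f with
  | zero => simp
  | succ j ih => rw [Function.iterate_succ_apply, ih, LSeries.abscissaOfAbsConv_logMul]

lemma summable_iter (f : ℕ → ℂ) (j : ℕ) (s : ℂ) (h : LSeries.abscissaOfAbsConv f < s.re) :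
    LSeriesSummable (LSeries.logMul^[j] f) s :=
  LSeriesSummable_of_abscissaOfAbsConv_lt_re (by rw [absc_iter]; exact h)

lemma LJ_summable (f : ℕ → ℂ) (j : ℕ) (s : ℂ) (h : LSeries.abscissaOfAbsConv f < s.re) :
    Summable (fun k : ℕ => f (k+1) * hj j s ((k:ℝ)+1)) := by
  have := (summable_nat_add_iff 1).2 (summable_iter f j s h)
  exact this.congr (fun k => term_eq_hj f j k s)

lemma absc_bdd (f : ℕ → ℂ) (M : ℝ) (hf : ∀ n, ‖f n‖ ≤ M) (s : ℂ) (hs : 1 < s.re) :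
    LSeries.abscissaOfAbsConv f < s.re := by
  have h1 : LSeries.abscissaOfAbsConv f ≤ 1 :=
    LSeries.abscissaOfAbsConv_le_of_le_const ⟨M, fun n _ => hf n⟩
  exact lt_of_le_of_lt h1 (by exact_mod_cast hs)

lemma hj_tendsto (j : ℕ) (s : ℂ) (hs : 1 < s.re) :
    Filter.Tendsto (fun k : ℕ => hj j s ((k:ℝ)+1)) Filter.atTop (nhds 0) := by
  have := LJ_summable (fun _ => 1) j s (absc_bdd _ 1 (by simp) s hs)
  simpa using this.tendsto_atTop_zero

noncomputable def Kj (j : ℕ) (δ : ℝ) : ℝ := ∑' k : ℕ, (1 + log (((k:ℝ)+1)+1))^j / ((k:ℝ)+1)^(1+δ)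

lemma Kj_nonneg (j : ℕ) (δ : ℝ) : 0 ≤ Kj j δ := tsum_nonneg (fun k => by
  have := Real.log_nonneg (show (1:ℝ) ≤ (k:ℝ)+1+1 by have := Nat.cast_nonneg (α := ℝ) k; linarith)
  positivity)

lemma LJ_bound (w : ℕ → ℂ) (M Q : ℝ) (hw : ∀ n, ‖w n‖ ≤ M) (hQ : ∀ n, ‖∑ m ∈ range n, w (m+1)‖ ≤ Q)
    (j : ℕ) (hj3 : j ≤ 3) (δ : ℝ) (hδ : 0 < δ) (hδ1 : δ ≤ 1) (s : ℂ) (hs : 1 < s.re) (hs2 : s.re ≤ 2) :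
    ‖LJ w j s‖ ≤ Q * (2 * Kj j δ) * (|s.im|+3)^δ := by
  have h := abel_tsum (fun n => w (n+1)) (fun k => hj j s ((k:ℝ)+1))
    (fun k => (2 * (|s.im|+3)^δ) * ((1 + log (((k:ℝ)+1)+1))^j / ((k:ℝ)+1)^(1+δ))) Q hQ
    (LJ_summable w j s (absc_bdd w M hw s hs)) (fun n => ?_)
    ((hj_bound_summable j δ hδ).mul_left _) (hj_tendsto j s hs)
  · rw [LJ]; refine h.trans (le_of_eq ?_)
    rw [tsum_mul_left, Kj]; ring
  · have := hj_diff_le j s ((n:ℝ)+1) ((n:ℝ)+1+1) (by have := Nat.cast_nonneg (α := ℝ) n; linarith)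
      (by linarith) le_rfl hs hs2 hj3 δ hδ hδ1
    push_cast
    refine this.trans (le_of_eq (by ring))

lemma periodic_partial (q : ℕ) (hq : 0 < q) (w : ℕ → ℂ) (M : ℝ) (hw : ∀ n, ‖w n‖ ≤ M)
    (hper : ∀ n, w (n+q) = w n) (h0 : ∑ m ∈ range q, w m = 0) (n : ℕ) :
    ‖∑ m ∈ range n, w m‖ ≤ q * M := by
  have hM : 0 ≤ M := (norm_nonneg _).trans (hw 0)
  have h1 : ∀ a r, ∑ m ∈ range (a*q+r), w m = ∑ m ∈ range r, w m := by
    intro a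
    induction a with
    | zero => simp
    | succ a ih =>
      intro r
      rw [show (a+1)*q + r = a*q + (q+r) by ring, ih, sum_range_add, h0, zero_add]
      exact sum_congr rfl (fun x _ => by rw [add_comm, hper])
  rw [← Nat.div_add_mod' n q, h1]
  refine (norm_sum_le_of_le _ (fun m _ => hw m)).trans ?_
  rw [sum_const, card_range, nsmul_eq_mul]
  have : ((n % q : ℕ):ℝ) ≤ q := by exact_mod_cast (Nat.mod_lt n hq).le
  gcongr

lemma periodic_partial' (q : ℕ) (hq : 0 < q) (w : ℕ → ℂ) (M : ℝ) (hw : ∀ n, ‖w n‖ ≤ M)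
    (hper : ∀ n, w (n+q) = w n) (h0 : ∑ m ∈ range q, w m = 0) (n : ℕ) :
    ‖∑ m ∈ range n, w (m+1)‖ ≤ q * M := by
  refine periodic_partial q hq (fun m => w (m+1)) M (fun m => hw _) (fun m => ?_) ?_ n
  · show w (m+q+1) = w (m+1)
    rw [← hper (m+1)]; congr 1; ring
  · have := sum_range_succ' w q
    have h2 := sum_range_succ w q
    rw [h0, zero_add, ← zero_add q, hper 0] at h2
    rw [zero_add] at h2
    rw [h2] at this
    simpa using this.symm

lemma char_sum_range (q : ℕ) [NeZero q] (f : ZMod q → ℂ) : ∑ m ∈ range q, f (m : ZMod q) = ∑ a : ZMod q, f a := by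
  symm
  refine sum_bij' (fun a _ => a.val) (fun m _ => (m : ZMod q)) (fun a _ => by simpa using a.val_lt)
    (fun m _ => mem_univ _) (fun a _ => by simp) (fun m hm => ?_) (fun a _ => by simp)
  exact ZMod.val_natCast_of_lt (by simpa using hm)

lemma char_partial (q : ℕ) [NeZero q] (χ : DirichletCharacter ℂ q) (hχ : χ ≠ 1) (n : ℕ) :
    ‖∑ m ∈ range n, χ ((m+1 : ℕ) : ZMod q)‖ ≤ q * 1 := by
  refine periodic_partial' q (Nat.pos_of_ne_zero (NeZero.ne q)) (fun m => χ (m : ZMod q)) 1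
    (fun n => χ.norm_le_one _) (fun n => by simp) ?_ n
  rw [char_sum_range q (fun a => χ a)]
  exact MulChar.sum_eq_zero_of_ne_one hχ

lemma zeta_bound (δ : ℝ) (hδ : 0 < δ) (hδ1 : δ ≤ 1) (s : ℂ) (hs : 1 < s.re) (hs2 : s.re ≤ 2) :
    ‖LJ (fun _ => 1) 0 s‖ ≤ 1/‖s-1‖ + 2 * Kj 0 δ * (|s.im|+3)^δ := by
  have hs1 : s - 1 ≠ 0 := by
    intro h; have := congrArg Complex.re h; simp at this; linarith
  set ph : ℝ → ℂ := fun y => hj 0 (s-1) y / (s-1) with hph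
  have hphd : ∀ y : ℝ, 0 < y → HasDerivAt ph (-hj 0 s y) y := by
    intro y hy
    have := (hj_hasDerivAt 0 (s-1) y hy).div_const (s-1)
    refine this.congr_deriv ?_
    simp only [hj]
    rw [show -(s-1)-1 = -s by ring]; field_simp; simp; ring
  have ht : Filter.Tendsto (fun k : ℕ => ph ((k:ℝ)+1)) Filter.atTop (nhds 0) := by
    have : Filter.Tendsto (fun k : ℕ => hj 0 (s-1) ((k:ℝ)+1)) Filter.atTop (nhds 0) := by
      rw [tendsto_zero_iff_norm_tendsto_zero]
      have h1 : Filter.Tendsto (fun k : ℕ => ((k:ℝ)+1)^(-(s.re-1))) Filter.atTop (nhds 0) :=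
        (tendsto_rpow_neg_atTop (by linarith : 0 < s.re-1)).comp
          (Filter.tendsto_atTop_add_const_right _ _ tendsto_natCast_atTop_atTop)
      refine h1.congr (fun k => ?_)
      rw [hj, pow_zero, one_mul, Complex.norm_cpow_eq_rpow_re_of_pos (by positivity)]; simp
    have := this.div_const (s-1)
    simpa [hph] using this
  have hd : ∀ k : ℕ, ‖hj 0 s ((k:ℝ)+1) - (ph ((k:ℝ)+1) - ph ((k:ℝ)+1+1))‖ ≤
      (2 * (|s.im|+3)^δ) * ((1 + log (((k:ℝ)+1)+1))^0 / ((k:ℝ)+1)^(1+δ)) := by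
    intro k
    set n := (k:ℝ)+1 with hn
    have hn1 : 1 ≤ n := by have := Nat.cast_nonneg (α := ℝ) k; linarith
    have := Convex.norm_image_sub_le_of_norm_hasDerivWithin_le (f := fun y => ph y + (y:ℂ) * hj 0 s n) (s := Set.Icc n (n+1))
      (f' := fun y => -hj 0 s y + 1 * hj 0 s n)
      (C := (2 * (|s.im|+3)^δ) * ((1 + log (n+1))^0 / n^(1+δ)))
      (fun z hz => ((hphd z (by linarith [hz.1])).add
        ((Complex.ofRealCLM.hasDerivAt (x := z)).mul_const (hj 0 s n))).hasDerivWithinAt)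
      (fun z hz => ?_) (convex_Icc _ _)
      (show n ∈ Set.Icc n (n+1) by constructor <;> linarith) (show n+1 ∈ Set.Icc n (n+1) by constructor <;> linarith)
    · have e1 : ‖n+1-n‖ = 1 := by simp
      rw [e1, mul_one] at this
      refine le_trans (le_of_eq ?_) this
      congr 1; push_cast; ring
    · have := hj_diff_le 0 s n z hn1 hz.1 hz.2 hs hs2 (by omega) δ hδ hδ1
      rw [norm_sub_rev] at this
      refine le_trans (le_of_eq ?_) (this.trans (le_of_eq ?_))
      · congr 1; ring
      · ring
  have hsm : Summable (fun k : ℕ => hj 0 s ((k:ℝ)+1)) := by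
    simpa using LJ_summable (fun _ => 1) 0 s (absc_bdd _ 1 (by simp) s hs)
  have hbs := (hj_bound_summable 0 δ hδ).mul_left (2 * (|s.im|+3)^δ)
  have hds := Summable.of_norm_bounded hbs hd
  have hvs : Summable (fun k : ℕ => ph ((k:ℝ)+1) - ph ((k:ℝ)+1+1)) := by
    refine (hsm.sub hds).congr (fun k => by ring)
  have hve : ∑' k : ℕ, (ph ((k:ℝ)+1) - ph ((k:ℝ)+1+1)) = 1/(s-1) := by
    have t1 := hvs.hasSum.tendsto_sum_nat
    have t2 : Filter.Tendsto (fun N : ℕ => ∑ k ∈ range N, (ph ((k:ℝ)+1) - ph ((k:ℝ)+1+1))) Filter.atTop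
        (nhds (ph 1 - 0)) := by
      refine (tendsto_const_nhds.sub ht).congr (fun N => ?_)
      have := sum_range_sub' (fun k : ℕ => ph ((k:ℝ)+1)) N
      simp only [Nat.cast_add, Nat.cast_one, Nat.cast_zero, zero_add] at this
      exact this.symm
    rw [tendsto_nhds_unique t1 t2, sub_zero]
    simp [hph, hj]
  have e : LJ (fun _ => 1) 0 s = 1/(s-1) + ∑' k : ℕ, (hj 0 s ((k:ℝ)+1) - (ph ((k:ℝ)+1) - ph ((k:ℝ)+1+1))) := by
    rw [← hve, ← hvs.tsum_add hds, LJ]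
    exact tsum_congr (fun k => by ring)
  rw [e]
  refine (norm_add_le _ _).trans (add_le_add (by rw [norm_div, norm_one]) ?_)
  refine (tsum_of_norm_bounded hbs.hasSum hd).trans (le_of_eq ?_)
  rw [tsum_mul_left, Kj]; ring

lemma triv_bound (q : ℕ) [NeZero q] (δ : ℝ) (hδ : 0 < δ) (hδ1 : δ ≤ 1) : ∃ C : ℝ, 0 < C ∧
    ∀ (χ : DirichletCharacter ℂ q) (s : ℂ), 1 < s.re → s.re ≤ 2 →
    ‖LSeries (fun n => χ (n : ZMod q)) s‖ ≤ 1/‖s-1‖ + C * (|s.im|+3)^δ := by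
  have hqp : 0 < q := Nat.pos_of_ne_zero (NeZero.ne q)
  refine ⟨q * 2 * (2 * Kj 0 δ) + 2 * Kj 0 δ + 1, by have := Kj_nonneg 0 δ; positivity, fun χ s hs hs2 => ?_⟩
  have hT : 0 < (|s.im|+3)^δ := by positivity
  have hK := Kj_nonneg 0 δ
  have e0 : LSeries (fun n => χ (n : ZMod q)) s = LJ (fun n => χ (n : ZMod q)) 0 s :=
    LSeries_eq_LJ (fun n => χ (n : ZMod q)) 0 s (summable_iter _ 0 s (absc_bdd _ 1 (fun n => χ.norm_le_one _) s hs))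
  rw [e0]
  by_cases hχ : χ = 1
  · set S : ℂ := ∑ a : ZMod q, χ a with hS
    set m : ℂ := S / q with hm
    have hm1 : ‖m‖ ≤ 1 := by
      rw [hm, norm_div, Complex.norm_natCast, div_le_one (by exact_mod_cast hqp)]
      refine (norm_sum_le_of_le _ (fun a _ => χ.norm_le_one a)).trans ?_
      simp [ZMod.card]
    set w : ℕ → ℂ := fun n => χ (n : ZMod q) - m with hw
    have hwn : ∀ n, ‖w n‖ ≤ 2 := fun n => by
      refine (norm_sub_le _ _).trans ?_
      have := χ.norm_le_one (n : ZMod q); linarith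
    have hq := periodic_partial' q hqp w 2 hwn (fun n => by simp [hw]) (by
      rw [hw, sum_sub_distrib, char_sum_range q (fun a => χ a), sum_const, card_range, nsmul_eq_mul, hm, hS]
      field_simp; simp)
    have h1 := LJ_bound w 2 _ hwn hq 0 (by omega) δ hδ hδ1 s hs hs2
    have h2 := zeta_bound δ hδ hδ1 s hs hs2
    have e : LJ (fun n => χ (n : ZMod q)) 0 s = LJ w 0 s + m * LJ (fun _ => 1) 0 s := by
      rw [LJ, LJ, LJ, ← tsum_mul_left, ← (LJ_summable w 0 s (absc_bdd w 2 hwn s hs)).tsum_add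
        ((LJ_summable (fun _ => 1) 0 s (absc_bdd _ 1 (by simp) s hs)).mul_left m)]
      exact tsum_congr (fun k => by simp only [hw]; ring)
    rw [e]
    refine (norm_add_le _ _).trans ?_
    rw [norm_mul]
    have h3 : ‖m‖ * ‖LJ (fun _ => 1) 0 s‖ ≤ 1 * ‖LJ (fun _ => 1) 0 s‖ := by gcongr
    linarith
  · have h1 := LJ_bound (fun n => χ (n : ZMod q)) 1 _ (fun n => χ.norm_le_one _) (char_partial q χ hχ) 0 (by omega) δ hδ hδ1 s hs hs2
    refine h1.trans ?_
    have : 0 ≤ 1/‖s-1‖ := by positivity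
    have h4 : q * 1 * (2 * Kj 0 δ) ≤ q * 2 * (2 * Kj 0 δ) + 2 * Kj 0 δ + 1 := by nlinarith [Nat.cast_nonneg (α := ℝ) q, mul_nonneg (Nat.cast_nonneg (α := ℝ) q) hK]
    have := mul_le_mul_of_nonneg_right h4 hT.le
    linarith

noncomputable def tq (t : ℝ) : ℝ := (|t|+3)^(-(1/40):ℝ)

lemma tq_pos (t : ℝ) : 0 < tq t := by unfold tq; positivity
lemma tq_le_one (t : ℝ) : tq t ≤ 1 := by
  unfold tq; apply rpow_le_one_of_one_le_of_nonpos
  · have := abs_nonneg t; linarith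
  · norm_num
lemma tq_inv (t : ℝ) : (|t|+3)^((1/40):ℝ) = (tq t)⁻¹ := by
  unfold tq; rw [rpow_neg (by positivity), inv_inv]

/-- the character as a sequence -/
noncomputable def chf {q : ℕ} (χ : DirichletCharacter ℂ q) : ℕ → ℂ := fun n => χ (n : ZMod q)

lemma chf_absc {q : ℕ} (χ : DirichletCharacter ℂ q) (s : ℂ) (hs : 1 < s.re) :
    LSeries.abscissaOfAbsConv (chf χ) < s.re := absc_bdd _ 1 (fun n => χ.norm_le_one _) s hs

lemma Lj_bound {q : ℕ} [NeZero q] (χ : DirichletCharacter ℂ q) (hχ : χ ≠ 1) : ∃ C : ℝ, 0 < C ∧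
    ∀ j ≤ 3, ∀ s : ℂ, 1 < s.re → s.re ≤ 2 →
    ‖LSeries (LSeries.logMul^[j] (chf χ)) s‖ ≤ C * (tq s.im)⁻¹ := by
  refine ⟨∑ j ∈ range 4, (q * 1 * (2 * Kj j (1/40)) + 1), ?_, fun j hj s hs hs2 => ?_⟩
  · refine sum_pos (fun j _ => ?_) (by simp)
    have := Kj_nonneg j (1/40); positivity
  · rw [LSeries_eq_LJ _ j s (summable_iter _ j s (chf_absc χ s hs))]
    have := LJ_bound (chf χ) 1 _ (fun n => χ.norm_le_one _) (char_partial q χ hχ) j hj (1/40) (by norm_num) (by norm_num) s hs hs2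
    rw [tq_inv] at this
    refine this.trans (mul_le_mul_of_nonneg_right ?_ (inv_nonneg.2 (tq_pos _).le))
    have h2 := single_le_sum (f := fun j => ((q:ℝ) * 1 * (2 * Kj j (1/40)) + 1)) (s := range 4)
      (fun j _ => by have := Kj_nonneg j (1/40); positivity) (mem_range.2 (show j < 4 by omega))
    linarith [h2]

lemma three_four_one {q : ℕ} [NeZero q] (χ : DirichletCharacter ℂ q) : ∃ e : ℝ, 0 < e ∧
    ∀ x t : ℝ, 0 < x → x ≤ 1 → 1 ≤ |t| → e^4 * (x^3 * tq t) ≤ ‖LSeries (chf χ) (1 + x + Complex.I * t)‖^4 := by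
  obtain ⟨C, hC, h⟩ := triv_bound q (1/40) (by norm_num) (by norm_num)
  set D := (1 + 2*C)^3 * (1 + 2*C) with hD
  have hDp : 0 < D := by positivity
  refine ⟨(1/D)^(1/4:ℝ), by positivity, fun x t hx hx1 ht => ?_⟩
  have he : ((1/D)^(1/4:ℝ))^4 = 1/D := by
    rw [← rpow_natCast, ← rpow_mul (by positivity)]; norm_num
  rw [he]
  have h341 := DirichletCharacter.norm_LSeries_product_ge_one χ hx t
  rw [norm_mul, norm_mul, norm_pow, norm_pow] at h341
  have b1 := h 1 (1+x) (by simp [hx]) (by simp; linarith)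
  have b2 := h (χ^2) (1 + x + 2*Complex.I*t) (by simp [hx]) (by simp; linarith)
  have c1 : 1/‖(1:ℂ)+x-1‖ = 1/x := by
    rw [add_sub_cancel_left, Complex.norm_real, norm_of_nonneg hx.le]
  have c2 : (|((1:ℂ)+x).im|+3)^((1/40):ℝ) ≤ 2 := by
    have e : ((1:ℂ)+x).im = 0 := by simp
    rw [e, abs_zero, zero_add]
    calc (3:ℝ)^((1/40):ℝ) ≤ (2^40)^((1/40):ℝ) := by gcongr; norm_num
      _ = 2 := by rw [← rpow_natCast, ← rpow_mul (by norm_num)]; norm_num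
  have c3 : (1/‖(1:ℂ)+x+2*Complex.I*t-1‖) ≤ 1 := by
    rw [div_le_one_iff]; left
    have : |((1:ℂ)+x+2*Complex.I*t-1).im| ≤ _ := Complex.abs_im_le_norm _
    have e : ((1:ℂ)+x+2*Complex.I*t-1).im = 2*t := by simp
    rw [e, abs_mul, abs_two] at this
    constructor <;> linarith
  have c4 : (|((1:ℂ)+x+2*Complex.I*t).im|+3)^((1/40):ℝ) ≤ 2 * (tq t)⁻¹ := by
    have e : ((1:ℂ)+x+2*Complex.I*t).im = 2*t := by simp
    rw [e, abs_mul, abs_two, ← tq_inv]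
    calc (2*|t|+3)^((1/40):ℝ) ≤ (2^40*(|t|+3))^((1/40):ℝ) := by gcongr; have := abs_nonneg t; linarith
      _ = _ := by
        rw [Real.mul_rpow (by positivity) (by positivity), ← rpow_natCast, ← rpow_mul (by norm_num)]; norm_num
  have ht1 : 1 ≤ (tq t)⁻¹ := (one_le_inv₀ (tq_pos t)).2 (tq_le_one t)
  have hix : 1 ≤ 1/x := by rw [le_div_iff₀ hx]; linarith
  rw [c1] at b1
  have d1 : ‖LSeries (fun n => (1 : DirichletCharacter ℂ q) (n : ZMod q)) (1+x)‖ ≤ (1+2*C) * (1/x) := by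
    refine b1.trans ?_
    have : C * (|((1:ℂ)+x).im|+3)^((1/40):ℝ) ≤ C * 2 := by gcongr
    nlinarith
  have d2 : ‖LSeries (fun n => (χ^2) (n : ZMod q)) (1 + x + 2*Complex.I*t)‖ ≤ (1+2*C) * (tq t)⁻¹ := by
    refine b2.trans ?_
    have : C * (|((1:ℂ)+x+2*Complex.I*t).im|+3)^((1/40):ℝ) ≤ C * (2 * (tq t)⁻¹) := by gcongr
    nlinarith
  set A := ‖LSeries (fun n => (1 : DirichletCharacter ℂ q) (n : ZMod q)) (1+x)‖
  set B := ‖LSeries (fun n => (χ^2) (n : ZMod q)) (1 + x + 2*Complex.I*t)‖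
  set Z := ‖LSeries (chf χ) (1 + x + Complex.I * t)‖ with hZ
  have f : (1:ℝ) ≤ A^3 * Z^4 * B := h341
  have f2 : A^3 * Z^4 * B ≤ ((1+2*C) * (1/x))^3 * Z^4 * ((1+2*C) * (tq t)⁻¹) := by gcongr
  have f3 : ((1+2*C) * (1/x))^3 * Z^4 * ((1+2*C) * (tq t)⁻¹) = D * Z^4 / (x^3 * tq t) := by
    have := (tq_pos t).ne'
    rw [hD]; field_simp
  have htp := tq_pos t
  have f4 : 1 ≤ D * Z^4 / (x^3 * tq t) := by linarith
  rw [le_div_iff₀ (by positivity)] at f4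
  rw [div_mul_eq_mul_div, div_le_iff₀ hDp]; linarith

lemma L_lower {q : ℕ} [NeZero q] (χ : DirichletCharacter ℂ q) (hχ : χ ≠ 1) : ∃ c : ℝ, 0 < c ∧
    ∀ s : ℂ, 1 < s.re → s.re ≤ 2 → c * (tq s.im)^4 ≤ ‖LSeries (chf χ) s‖ := by
  obtain ⟨C, hC, hL⟩ := Lj_bound χ hχ
  obtain ⟨e, he, h3⟩ := three_four_one χ
  -- compact part
  obtain ⟨c1, hc1, hcomp⟩ : ∃ c1 : ℝ, 0 < c1 ∧ ∀ s : ℂ, s ∈ (Set.Icc (1:ℝ) 2 ×ℂ Set.Icc (-1:ℝ) 1) →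
      c1 ≤ ‖DirichletCharacter.LFunction χ s‖ := by
    have hK : IsCompact (Set.Icc (1:ℝ) 2 ×ℂ Set.Icc (-1:ℝ) 1) := isCompact_Icc.reProdIm isCompact_Icc
    have hne : (Set.Icc (1:ℝ) 2 ×ℂ Set.Icc (-1:ℝ) 1).Nonempty := ⟨1, by simp [Complex.mem_reProdIm]⟩
    have hcont : ContinuousOn (fun s => ‖DirichletCharacter.LFunction χ s‖) (Set.Icc (1:ℝ) 2 ×ℂ Set.Icc (-1:ℝ) 1) :=
      (DirichletCharacter.differentiable_LFunction hχ).continuous.norm.continuousOn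
    obtain ⟨z, hz, hm⟩ := hK.exists_isMinOn hne hcont
    refine ⟨‖DirichletCharacter.LFunction χ z‖, ?_, fun s hs => hm hs⟩
    rw [norm_pos_iff]
    exact DirichletCharacter.LFunction_ne_zero_of_one_le_re χ (Or.inl hχ) (by
      rw [Complex.mem_reProdIm] at hz; exact hz.1.1)
  set d := min 1 (e/(2*C)) with hd
  have hd0 : 0 < d := by rw [hd]; positivity
  have hd1 : d ≤ 1 := min_le_left _ _
  have hd2 : C * d ≤ e/2 := by
    have : d ≤ e/(2*C) := min_le_right _ _
    calc C * d ≤ C * (e/(2*C)) := by gcongr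
      _ = _ := by field_simp
  refine ⟨min c1 (e*d^3/2), by positivity, fun s hs hs2 => ?_⟩
  have htp := tq_pos s.im
  have ht1 := tq_le_one s.im
  by_cases him : |s.im| ≤ 1
  · have h1 := hcomp s (by rw [Complex.mem_reProdIm]; exact ⟨⟨hs.le, hs2⟩, abs_le.1 him⟩)
    rw [DirichletCharacter.LFunction_eq_LSeries χ hs] at h1
    calc _ ≤ c1 * 1 := mul_le_mul (min_le_left _ _) (pow_le_one₀ htp.le ht1) (by positivity) hc1.le
      _ ≤ _ := by rw [mul_one]; exact h1
  · push Not at him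
    set t := s.im with ht
    set τ := tq t with hτ
    have hse : ∀ x : ℝ, ((1:ℂ) + x + Complex.I * t) = ⟨1+x, t⟩ := fun x => by
      apply Complex.ext <;> simp
    have hbig : ∀ x : ℝ, d^4*τ^5 ≤ x → x ≤ 1 → e*d^3*τ^4 ≤ ‖LSeries (chf χ) (1 + x + Complex.I * t)‖ := by
      intro x hx hx1
      have := h3 x t (lt_of_lt_of_le (by positivity) hx) hx1 him.le
      refine le_of_pow_le_pow_left₀ (n := 4) (by norm_num) (norm_nonneg _) (le_trans ?_ this)
      calc (e*d^3*τ^4)^4 = e^4 * ((d^4*τ^5)^3 * τ) := by ring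
        _ ≤ _ := by gcongr
    have hsx : s = 1 + ((s.re-1 : ℝ):ℂ) + Complex.I * t := by
      apply Complex.ext <;> simp [ht]
    have hmin : min c1 (e*d^3/2) * τ^4 ≤ e*d^3/2 * τ^4 := by gcongr; exact min_le_right _ _
    have hp : 0 < e*d^3*τ^4 := by positivity
    refine hmin.trans ?_
    by_cases hx : d^4*τ^5 ≤ s.re - 1
    · have := hbig (s.re-1) hx (by linarith)
      rw [← hsx] at this
      linarith
    · push Not at hx
      set x1 := d^4*τ^5 with hx1
      have hx1p : 0 < x1 := by positivity
      have hx1' : x1 ≤ 1 := by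
        rw [hx1]; exact mul_le_one₀ (pow_le_one₀ hd0.le hd1) (by positivity) (pow_le_one₀ htp.le ht1)
      have h5 := hbig x1 le_rfl hx1'
      have hdiff : ‖LSeries (chf χ) (1 + x1 + Complex.I * t) - LSeries (chf χ) s‖ ≤ C * τ⁻¹ * x1 := by
        have hder : ∀ x ∈ Set.Icc (s.re-1) x1, HasDerivWithinAt (fun x : ℝ => LSeries (chf χ) (1 + x + Complex.I * t))
            (-LSeries (LSeries.logMul (chf χ)) (1 + x + Complex.I * t)) (Set.Icc (s.re-1) x1) x := by
          intro x hxx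
          have hd1 := LSeries_hasDerivAt (chf_absc χ (1 + x + Complex.I * t) (by simp; linarith [hxx.1]))
          have hd2 : HasDerivAt (fun x : ℝ => ((1:ℂ) + x + Complex.I * t)) 1 x :=
            ((Complex.ofRealCLM.hasDerivAt (x := x)).const_add 1).add_const _
          have := hd1.comp (h := fun x : ℝ => ((1:ℂ) + x + Complex.I * t)) x hd2
          simpa [Function.comp_def] using this.hasDerivWithinAt
        have := Convex.norm_image_sub_le_of_norm_hasDerivWithin_le (C := C * τ⁻¹) hder (fun x hxx => by
            rw [norm_neg]
            have := hL 1 (by norm_num) (1 + x + Complex.I * t) (by simp; linarith [hxx.1]) (by simp; linarith [hxx.2])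
            have e1 : ((1:ℂ) + x + Complex.I * t).im = t := by simp
            rw [e1] at this
            exact this)
          (convex_Icc _ _) (Set.left_mem_Icc.2 hx.le) (Set.right_mem_Icc.2 hx.le)
        rw [← hsx] at this
        refine this.trans ?_
        rw [norm_of_nonneg (by linarith)]
        gcongr; linarith
      have h6 : C * τ⁻¹ * x1 ≤ e*d^3*τ^4/2 := by
        have : C * τ⁻¹ * x1 = (C*d)*(d^3*τ^4) := by rw [hx1]; field_simp
        rw [this]
        have := mul_le_mul_of_nonneg_right hd2 (show 0 ≤ d^3*τ^4 by positivity)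
        linarith
      have h7 := norm_sub_norm_le (LSeries (chf χ) (1 + x1 + Complex.I * t)) (LSeries (chf χ) s)
      linarith

/-- character times von Mangoldt -/
noncomputable def chL {q : ℕ} (χ : DirichletCharacter ℂ q) : ℕ → ℂ :=
  fun n => χ (n : ZMod q) * (vonMangoldt n : ℂ)

lemma chL_absc {q : ℕ} (χ : DirichletCharacter ℂ q) (s : ℂ) (hs : 1 < s.re) :
    LSeries.abscissaOfAbsConv (chL χ) < s.re := by
  set r := (1 + s.re)/2 with hr
  have h : LSeriesSummable (chL χ) (r:ℂ) := DirichletCharacter.LSeriesSummable_twist_vonMangoldt χ (by simp [hr]; linarith)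
  refine lt_of_le_of_lt h.abscissaOfAbsConv_le ?_
  simp only [Complex.ofReal_re]
  exact_mod_cast (by rw [hr]; linarith)

lemma P2_bound {q : ℕ} [NeZero q] (χ : DirichletCharacter ℂ q) (hχ : χ ≠ 1) : ∃ C : ℝ, 0 < C ∧
    ∀ s : ℂ, 1 < s.re → s.re ≤ 2 → ‖LSeries (LSeries.logMul^[2] (chL χ)) s‖ ≤ C * (|s.im|+3)^((3/8):ℝ) := by
  obtain ⟨C, hC, hL⟩ := Lj_bound χ hχ
  obtain ⟨c, hc, hlow⟩ := L_lower χ hχ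
  have hopen : IsOpen {s : ℂ | 1 < s.re} := isOpen_lt continuous_const Complex.continuous_re
  have hdL : ∀ (j : ℕ) (s : ℂ), 1 < s.re → HasDerivAt (LSeries (LSeries.logMul^[j] (chf χ))) (-LSeries (LSeries.logMul^[j+1] (chf χ)) s) s := by
    intro j s hs
    rw [Function.iterate_succ_apply']
    exact LSeries_hasDerivAt (by rw [absc_iter]; exact chf_absc χ s hs)
  have hdP : ∀ (j : ℕ) (s : ℂ), 1 < s.re → HasDerivAt (LSeries (LSeries.logMul^[j] (chL χ))) (-LSeries (LSeries.logMul^[j+1] (chL χ)) s) s := by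
    intro j s hs
    rw [Function.iterate_succ_apply']
    exact LSeries_hasDerivAt (by rw [absc_iter]; exact chL_absc χ s hs)
  set L : ℕ → ℂ → ℂ := fun j => LSeries (LSeries.logMul^[j] (chf χ)) with hLd
  set P : ℕ → ℂ → ℂ := fun j => LSeries (LSeries.logMul^[j] (chL χ)) with hPd
  have hne : ∀ s : ℂ, 1 < s.re → L 0 s ≠ 0 := fun s hs =>
    DirichletCharacter.LSeries_ne_zero_of_one_lt_re χ hs
  have e0 : ∀ s : ℂ, 1 < s.re → P 0 s * L 0 s = L 1 s := by
    intro s hs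
    have := DirichletCharacter.LSeries_twist_vonMangoldt_eq χ hs
    have h1 : P 0 s = -deriv (L 0) s / L 0 s := this
    rw [h1, div_mul_cancel₀ _ (hne s hs), (hdL 0 s hs).deriv, neg_neg]
  have deq : ∀ (f h : ℂ → ℂ), (∀ s : ℂ, 1 < s.re → f s = h s) → ∀ (s : ℂ), 1 < s.re → ∀ f' h' : ℂ,
      HasDerivAt f f' s → HasDerivAt h h' s → f' = h' := by
    intro f h hfh s hs f' h' hf hh
    have : f =ᶠ[nhds s] h := Filter.eventually_of_mem (hopen.mem_nhds hs) (fun z hz => hfh z hz)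
    exact hf.unique (hh.congr_of_eventuallyEq this)
  have e1 : ∀ s : ℂ, 1 < s.re → P 1 s * L 0 s + P 0 s * L 1 s = L 2 s := by
    intro s hs
    have := deq _ _ e0 s hs _ _ ((hdP 0 s hs).mul (hdL 0 s hs)) (hdL 1 s hs)
    have := congrArg Neg.neg this
    rw [neg_neg] at this
    show P (0+1) s * L 0 s + P 0 s * L (0+1) s = L (1+1) s
    rw [← show _ = L (1+1) s from this]; ring
  have e2 : ∀ s : ℂ, 1 < s.re → P 2 s * L 0 s + 2 * (P 1 s * L 1 s) + P 0 s * L 2 s = L 3 s := by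
    intro s hs
    have := deq _ _ e1 s hs _ _ (((hdP 1 s hs).mul (hdL 0 s hs)).add ((hdP 0 s hs).mul (hdL 1 s hs))) (hdL 2 s hs)
    have := congrArg Neg.neg this
    rw [neg_neg] at this
    show P (1+1) s * L 0 s + 2 * (P (0+1) s * L (0+1) s) + P 0 s * L (1+1) s = L (2+1) s
    rw [← show _ = L (2+1) s from this]
    show _ = -(-P (1+1) s * L 0 s + P (0+1) s * (-L (0+1) s) + (-P (0+1) s * L (0+1) s + P 0 s * (-L (1+1) s)))
    ring
  set C0 := C / c with hC0
  set C1 := (C + C0 * C)/c with hC1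
  set C2 := (C + 2 * (C1*C) + C0 * C)/c with hC2
  have hC0p : 0 < C0 := by positivity
  have hC1p : 0 < C1 := by positivity
  refine ⟨C2, by positivity, fun s hs hs2 => ?_⟩
  set τ := tq s.im with hτ
  have htp : 0 < τ := tq_pos _
  have ht1 : 1 ≤ τ⁻¹ := (one_le_inv₀ htp).2 (tq_le_one _)
  set u := τ⁻¹ with hu
  have hup : 0 < u := by positivity
  have l0 : c ≤ ‖L 0 s‖ * u^4 := by
    have := hlow s hs hs2
    have h2 : c * τ^4 * u^4 ≤ ‖L 0 s‖ * u^4 := by gcongr; exact this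
    have h3 : τ * u = 1 := by rw [hu]; field_simp
    have : c * τ^4 * u^4 = c := by rw [mul_assoc, ← mul_pow, h3]; ring
    linarith
  have l1 := hL 1 (by norm_num) s hs hs2
  have l2 := hL 2 (by norm_num) s hs hs2
  have l3 := hL 3 (by norm_num) s hs hs2
  have hl0p : 0 < ‖L 0 s‖ := norm_pos_iff.2 (hne s hs)
  have gen : ∀ (p : ℂ) (b : ℝ), ‖p * L 0 s‖ ≤ b → ‖p‖ ≤ b * u^4 / c := by
    intro p b hb
    rw [norm_mul] at hb
    rw [le_div_iff₀ hc]
    calc ‖p‖ * c ≤ ‖p‖ * (‖L 0 s‖ * u^4) := by gcongr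
      _ = (‖p‖ * ‖L 0 s‖) * u^4 := by ring
      _ ≤ _ := by gcongr
  have p0 : ‖P 0 s‖ ≤ C0 * u^5 := by
    refine (gen (P 0 s) (C*u) (by rw [e0 s hs]; exact l1)).trans (le_of_eq ?_)
    rw [hC0]; ring
  have up : ∀ a b : ℕ, a ≤ b → u^a ≤ u^b := fun a b h => pow_le_pow_right₀ ht1 h
  have p1 : ‖P 1 s‖ ≤ C1 * u^10 := by
    refine (gen (P 1 s) ((C + C0*C)*u^6) ?_).trans (le_of_eq ?_)
    · have : P 1 s * L 0 s = L 2 s - P 0 s * L 1 s := by rw [← e1 s hs]; ring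
      rw [this]
      refine (norm_sub_le _ _).trans ?_
      rw [norm_mul]
      have a1 : ‖P 0 s‖ * ‖L 1 s‖ ≤ (C0*u^5)*(C*u) := by gcongr
      have a2 : C * u^1 ≤ C * u^6 := mul_le_mul_of_nonneg_left (up 1 6 (by norm_num)) (by positivity)
      have a3 : ‖L 2 s‖ ≤ C * u := l2
      rw [pow_one] at a2
      calc _ ≤ C * u^6 + (C0*u^5)*(C*u) := by linarith
        _ = _ := by ring
    · rw [hC1]; ring
  have p2 : ‖P 2 s‖ ≤ C2 * u^15 := by
    refine (gen (P 2 s) ((C + 2 * (C1*C) + C0 * C)*u^11) ?_).trans (le_of_eq ?_)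
    · have : P 2 s * L 0 s = L 3 s - (2 * (P 1 s * L 1 s) + P 0 s * L 2 s) := by rw [← e2 s hs]; ring
      rw [this]
      refine (norm_sub_le _ _).trans ?_
      have a0 := norm_add_le (2 * (P 1 s * L 1 s)) (P 0 s * L 2 s)
      rw [norm_mul, norm_mul, norm_mul, Complex.norm_ofNat] at a0
      have a1 : ‖P 0 s‖ * ‖L 2 s‖ ≤ (C0*u^5)*(C*u) := by gcongr
      have a4 : ‖P 1 s‖ * ‖L 1 s‖ ≤ (C1*u^10)*(C*u) := by gcongr
      have a2 : C * u^1 ≤ C * u^11 := mul_le_mul_of_nonneg_left (up 1 11 (by norm_num)) (by positivity)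
      have a5 : (C0*C) * u^6 ≤ (C0*C) * u^11 := mul_le_mul_of_nonneg_left (up 6 11 (by norm_num)) (by positivity)
      have a3 : ‖L 3 s‖ ≤ C * u := l3
      rw [pow_one] at a2
      have a6 : (C0*u^5)*(C*u) = (C0*C)*u^6 := by ring
      have a7 : (C1*u^10)*(C*u) = C1*C*u^11 := by ring
      calc _ ≤ C * u^11 + (2*(C1*C*u^11) + C0*C*u^11) := by linarith
        _ = _ := by ring
    · rw [hC2]; ring
  refine p2.trans (le_of_eq ?_)
  rw [hu, hτ, ← tq_inv, ← rpow_natCast, ← rpow_mul (by positivity)]; norm_num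
end DMR

namespace DMR
open Finset MeasureTheory

noncomputable def rz (x : ℝ) : ℂ := ((max (1-x) 0 : ℝ) : ℂ)

lemma rz_mellin (s : ℂ) (hs : 0 < s.re) : HasMellin rz s (1/s - 1/(s+1)) := by
  have h1 := hasMellin_one_Ioc hs
  have h2 := hasMellin_cpow_Ioc (1:ℂ) (s := s) (by simp; linarith)
  have h3 := hasMellin_sub h1.1 h2.1
  rw [h1.2, h2.2] at h3
  have hcongr : Set.EqOn (fun t : ℝ => (t:ℂ)^(s-1) • ((Set.indicator (Set.Ioc (0:ℝ) 1) (fun _ => (1:ℂ)) t) -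
      (Set.indicator (Set.Ioc (0:ℝ) 1) (fun t : ℝ => (t:ℂ)^(1:ℂ)) t))) (fun t : ℝ => (t:ℂ)^(s-1) • rz t) (Set.Ioi 0) := by
    intro t ht
    have ht' : 0 < t := ht
    simp only
    congr 1
    by_cases h : t ≤ 1
    · rw [Set.indicator_of_mem (show t ∈ Set.Ioc (0:ℝ) 1 from ⟨ht', h⟩), Set.indicator_of_mem (show t ∈ Set.Ioc (0:ℝ) 1 from ⟨ht', h⟩), rz, max_eq_left (by linarith)]
      simp
    · rw [Set.indicator_of_notMem (fun h' => h h'.2), Set.indicator_of_notMem (fun h' => h h'.2), rz, max_eq_right (by linarith)]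
      simp
  constructor
  · exact h3.1.congr_fun hcongr measurableSet_Ioi
  · rw [← h3.2]
    exact (setIntegral_congr_fun measurableSet_Ioi hcongr).symm

noncomputable def rzF (σ y : ℝ) : ℂ := 1/((σ:ℂ) + y*Complex.I) - 1/((σ:ℂ) + y*Complex.I+1)

lemma rzF_le (σ y : ℝ) (hσ : 1 ≤ σ) : ‖rzF σ y‖ ≤ 2 * (1+‖y‖)^(-2:ℝ) := by
  have hre : ((σ:ℂ) + y*Complex.I).re = σ := by simp
  set s := (σ:ℂ) + y*Complex.I with hs
  have h0 : s ≠ 0 := by intro h; rw [h] at hre; simp at hre; linarith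
  have h1 : s + 1 ≠ 0 := by intro h; have := congrArg Complex.re h; simp [hre] at this; linarith
  have e : rzF σ y = 1/(s*(s+1)) := by rw [rzF, ← hs]; field_simp; ring
  have im1 : s.im = y := by simp [hs]
  have n1 : (1+|y|)^2/2 ≤ ‖s‖*‖s+1‖ := by
    have a1 : 1 + y^2 ≤ ‖s‖^2 := by
      rw [← Complex.normSq_eq_norm_sq, Complex.normSq_apply, hre, im1]; nlinarith
    have a2 : ‖s‖ ≤ ‖s+1‖ := by
      apply le_of_sq_le_sq _ (norm_nonneg _) |> fun h => h
      rw [← Complex.normSq_eq_norm_sq, ← Complex.normSq_eq_norm_sq, Complex.normSq_apply, Complex.normSq_apply]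
      simp only [Complex.add_re, Complex.one_re, Complex.add_im, Complex.one_im, hre]; nlinarith
    have a3 : (1+|y|)^2/2 ≤ 1 + y^2 := by
      have := sq_abs y; nlinarith [sq_nonneg (1-|y|)]
    nlinarith [norm_nonneg s]
  rw [e, norm_div, norm_one, norm_mul, rpow_neg (by positivity), norm_eq_abs,
    show (2:ℝ) = ((2:ℕ):ℝ) by norm_num, rpow_natCast]
  rw [div_le_iff₀ (by positivity)]
  have : 0 < (1+|y|)^2 := by positivity
  push_cast
  rw [mul_assoc, mul_comm, mul_assoc]
  have : (((1+|y|)^2)⁻¹ * (‖s‖*‖s+1‖)) ≥ ((1+|y|)^2)⁻¹ * ((1+|y|)^2/2) := by gcongr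
  have e2 : ((1+|y|)^2)⁻¹ * ((1+|y|)^2/2) = 1/2 := by field_simp
  nlinarith

lemma rzF_cont (σ : ℝ) (hσ : 1 ≤ σ) : Continuous (fun y => rzF σ y) := by
  unfold rzF
  refine Continuous.sub (Continuous.div continuous_const (by fun_prop) ?_) (Continuous.div continuous_const (by fun_prop) ?_)
  · intro y h; have := congrArg Complex.re h; simp at this; linarith
  · intro y h; have := congrArg Complex.re h; simp at this; linarith

lemma rz_inv (σ x : ℝ) (hσ : 1 ≤ σ) (hx : 0 < x) :
    rz x = (1/(2*π) : ℝ) • ∫ y : ℝ, (x:ℂ)^(-((σ:ℂ) + y*Complex.I)) * rzF σ y := by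
  have hm : ∀ y : ℝ, mellin rz ((σ:ℂ) + y*Complex.I) = rzF σ y := fun y =>
    (rz_mellin ((σ:ℂ) + y*Complex.I) (by simp; linarith)).2
  have := mellinInv_mellin_eq σ rz hx (rz_mellin (σ:ℂ) (by simp; linarith)).1 ?_ ?_
  · rw [← this, mellinInv]
    simp only [hm, smul_eq_mul]
  · rw [Complex.VerticalIntegrable]
    simp only [hm]
    refine Integrable.mono' ((integrable_one_add_norm (E := ℝ) (μ := volume) (r := 2) (by simp)).const_mul 2)
      (rzF_cont σ hσ).aestronglyMeasurable (Filter.Eventually.of_forall (fun y => rzF_le σ y hσ))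
  · unfold rz; fun_prop

lemma riesz_bound (a : ℕ → ℂ) (C : ℝ) (hC : 0 < C) (h0 : a 0 = 0)
    (hsum : ∀ s : ℂ, 1 < s.re → LSeriesSummable a s)
    (hb : ∀ s : ℂ, 1 < s.re → s.re ≤ 2 → ‖LSeries a s‖ ≤ C * (|s.im|+3)^((3/8):ℝ)) :
    ∃ D : ℝ, 0 < D ∧ ∀ u : ℝ, 3 ≤ u → ‖∑ n ∈ Ioc 0 ⌊u⌋₊, a n * ((u:ℂ) - n)‖ ≤ D * u^2 := by
  set I0 := ∫ y : ℝ, (1+‖y‖)^(-(13/8):ℝ) with hI0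
  have hin : Integrable (fun y : ℝ => (1+‖y‖)^(-(13/8):ℝ)) :=
    integrable_one_add_norm (E := ℝ) (μ := volume) (r := 13/8) (by simp; norm_num)
  have hI0n : 0 ≤ I0 := integral_nonneg (fun y => by positivity)
  refine ⟨C * 6 * exp 1 * I0 + 1, by positivity, fun u hu => ?_⟩
  have hlog : 1 ≤ log u := by
    rw [Real.le_log_iff_exp_le (by linarith)]
    have := Real.exp_one_lt_d9; linarith
  set σ := 1 + 1/log u with hσ
  have hσ1 : 1 < σ := by rw [hσ]; have : 0 < 1/log u := by positivity
                         linarith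
  have hσ2 : σ ≤ 2 := by
    rw [hσ]; have : 1/log u ≤ 1 := by rw [div_le_one (by linarith)]; exact hlog
    linarith
  have hu0 : 0 < u := by linarith
  have huσ : u^σ = exp 1 * u := by
    rw [hσ, rpow_add hu0, rpow_one, rpow_def_of_pos hu0, mul_one_div_cancel (by linarith)]; ring
  -- integrand
  set S : ℝ → ℂ := fun y => (σ:ℂ) + y*Complex.I with hS
  have hSre : ∀ y, (S y).re = σ := fun y => by simp [hS]
  have hSim : ∀ y, (S y).im = y := fun y => by simp [hS]
  set F : ℕ → ℝ → ℂ := fun n y => LSeries.term a (S y) n * ((u:ℂ)^(S y) * rzF σ y) with hF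
  have hcontS : Continuous S := by fun_prop
  have hcu : Continuous (fun y => (u:ℂ)^(S y)) :=
    Continuous.const_cpow hcontS (Or.inl (by exact_mod_cast hu0.ne'))
  have hnu : ∀ y, ‖(u:ℂ)^(S y)‖ = u^σ := fun y => by
    rw [Complex.norm_cpow_eq_rpow_re_of_pos hu0, hSre]
  have hterm : ∀ n y, ‖LSeries.term a (S y) n‖ = ‖LSeries.term a (σ:ℂ) n‖ := fun n y => by
    rw [LSeries.norm_term_eq, LSeries.norm_term_eq, hSre, Complex.ofReal_re]
  have hFc : ∀ n, Continuous (F n) := by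
    intro n
    refine Continuous.mul ?_ (hcu.mul (rzF_cont σ hσ1.le))
    rcases Nat.eq_zero_or_pos n with rfl | hn
    · simp only [LSeries.term_zero]; exact continuous_const
    · simp only [LSeries.term_of_ne_zero hn.ne']
      refine Continuous.div continuous_const (Continuous.const_cpow hcontS (Or.inl (by exact_mod_cast hn.ne'))) (fun y => ?_)
      rw [Complex.cpow_ne_zero_iff]; left; exact_mod_cast hn.ne'
  have h2i : Integrable (fun y : ℝ => (1+‖y‖)^(-2:ℝ)) := integrable_one_add_norm (E := ℝ) (μ := volume) (r := 2) (by simp)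
  have hFn : ∀ n y, ‖F n y‖ ≤ ‖LSeries.term a (σ:ℂ) n‖ * (u^σ * (2 * (1+‖y‖)^(-2:ℝ))) := by
    intro n y
    rw [hF]; simp only
    rw [norm_mul, norm_mul, hterm, hnu]
    have := rzF_le σ y hσ1.le
    gcongr
  have hFi : ∀ n, Integrable (F n) := fun n =>
    Integrable.mono' (((h2i.const_mul 2).const_mul _).const_mul _) (hFc n).aestronglyMeasurable
      (Filter.Eventually.of_forall (hFn n))
  have hsσ : Summable (fun n => ‖LSeries.term a (σ:ℂ) n‖) := (hsum (σ:ℂ) (by simpa using hσ1)).norm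
  have hFs : Summable (fun n => ∫ y, ‖F n y‖) := by
    refine Summable.of_nonneg_of_le (fun n => integral_nonneg (fun y => norm_nonneg _)) (fun n => ?_)
      (hsσ.mul_right (∫ y : ℝ, (u^σ * (2 * (1+‖y‖)^(-2:ℝ)))))
    rw [← integral_const_mul]
    exact integral_mono (hFi n).norm (((h2i.const_mul 2).const_mul _).const_mul _) (hFn n)
  have hex := integral_tsum_of_summable_integral_norm hFi hFs
  -- each integral
  have heach : ∀ n, ∫ y, F n y = (2*π : ℝ) • (a n * rz (n/u)) := by
    intro n
    rcases Nat.eq_zero_or_pos n with rfl | hn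
    · simp [hF, LSeries.term_zero, h0]
    · have hn' : (0:ℝ) < n := by exact_mod_cast hn
      have hnc : (n:ℂ) ≠ 0 := by exact_mod_cast hn.ne'
      have huc : (u:ℂ) ≠ 0 := by exact_mod_cast hu0.ne'
      rw [rz_inv σ (n/u) hσ1.le (by positivity), mul_smul_comm, smul_smul, ← integral_const_mul,
        mul_one_div_cancel (by positivity), one_smul]
      congr 1; ext y
      rw [hF]; simp only
      rw [LSeries.term_of_ne_zero hn.ne', Complex.ofReal_div, div_eq_mul_inv ((n:ℝ):ℂ)]
      have : ((u:ℂ)⁻¹) = ((u⁻¹ : ℝ):ℂ) := by push_cast; rfl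
      rw [this, Complex.mul_cpow_ofReal_nonneg hn'.le (by positivity), Complex.cpow_neg, Complex.ofReal_inv, Complex.inv_cpow _ _ (by
        rw [Complex.arg_ofReal_of_nonneg hu0.le]; exact pi_pos.ne), Complex.cpow_neg, inv_inv]
      simp only [Complex.ofReal_natCast]
      ring
  have hL : ∀ y, ∑' n, F n y = LSeries a (S y) * ((u:ℂ)^(S y) * rzF σ y) := fun y => by
    rw [hF]; simp only; rw [tsum_mul_right]; rfl
  simp only [heach, hL] at hex
  have hfin : ∑' n : ℕ, (2*π : ℝ) • (a n * rz (n/u)) = (2*π:ℝ) • ∑ n ∈ Ioc 0 ⌊u⌋₊, a n * rz (n/u) := by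
    rw [smul_sum]
    refine tsum_eq_sum (fun n hn => ?_)
    rcases Nat.eq_zero_or_pos n with rfl | hn'
    · simp [h0]
    · have : ⌊u⌋₊ < n := by
        by_contra h; push Not at h; exact hn (mem_Ioc.2 ⟨hn', h⟩)
      have h2 : u < n := (Nat.floor_lt hu0.le).1 this
      rw [rz, max_eq_right (by rw [sub_nonpos, le_div_iff₀ hu0]; linarith)]; simp
  rw [hfin] at hex
  have hbound : ‖∫ y, LSeries a (S y) * ((u:ℂ)^(S y) * rzF σ y)‖ ≤ C * 6 * (exp 1 * u) * I0 := by
    rw [hI0, ← integral_const_mul]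
    refine norm_integral_le_of_norm_le (hin.const_mul _) (Filter.Eventually.of_forall (fun y => ?_))
    rw [norm_mul, norm_mul, hnu, huσ]
    have b1 := hb (S y) (by rw [hSre]; exact hσ1) (by rw [hSre]; exact hσ2)
    rw [hSim] at b1
    have b2 := rzF_le σ y hσ1.le
    have b3 : (|y|+3)^((3/8):ℝ) ≤ 3 * (1+‖y‖)^((3/8):ℝ) := by
      calc (|y|+3)^((3/8):ℝ) ≤ (3*(1+‖y‖))^((3/8):ℝ) := by
            gcongr; rw [norm_eq_abs]; have := abs_nonneg y; linarith
        _ = 3^((3/8):ℝ) * (1+‖y‖)^((3/8):ℝ) := Real.mul_rpow (by norm_num) (by positivity)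
        _ ≤ 3^(1:ℝ) * (1+‖y‖)^((3/8):ℝ) := by gcongr <;> norm_num
        _ = _ := by rw [rpow_one]
    calc ‖LSeries a (S y)‖ * (exp 1 * u * ‖rzF σ y‖)
        ≤ (C * (3 * (1+‖y‖)^((3/8):ℝ))) * (exp 1 * u * (2 * (1+‖y‖)^(-2:ℝ))) := by
          refine mul_le_mul (b1.trans ?_) ?_ (by positivity) (by positivity)
          · gcongr
          · gcongr
      _ = C * 6 * (exp 1 * u) * ((1+‖y‖)^((3/8):ℝ) * (1+‖y‖)^(-2:ℝ)) := by ring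
      _ = _ := by rw [← rpow_add (by positivity)]; norm_num
  rw [← hex, norm_smul, norm_of_nonneg (by positivity)] at hbound
  have hfe : ∑ n ∈ Ioc 0 ⌊u⌋₊, a n * ((u:ℂ) - n) = u * ∑ n ∈ Ioc 0 ⌊u⌋₊, a n * rz (n/u) := by
    rw [mul_sum]
    refine sum_congr rfl (fun n hn => ?_)
    have h2 : (n:ℝ) ≤ u := (Nat.le_floor_iff hu0.le).1 (mem_Ioc.1 hn).2
    have huc : (u:ℂ) ≠ 0 := by exact_mod_cast hu0.ne'
    rw [rz, max_eq_left (by rw [sub_nonneg, div_le_one hu0]; exact h2)]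
    push_cast; field_simp
  rw [hfe, norm_mul, Complex.norm_real, norm_of_nonneg hu0.le]
  set Z := ‖∑ n ∈ Ioc 0 ⌊u⌋₊, a n * rz (n/u)‖ with hZ
  have hZ0 : 0 ≤ Z := norm_nonneg _
  have h6 : 1 ≤ 2 * π := by have := Real.pi_gt_three; linarith
  have h7 : Z ≤ C * 6 * (exp 1 * u) * I0 := by nlinarith
  calc u * Z ≤ u * (C * 6 * (exp 1 * u) * I0) := by gcongr
    _ = (C * 6 * exp 1 * I0) * u^2 := by ring
    _ ≤ _ := by gcongr; linarith

lemma log_ge_one (X : ℕ) (hX : 3 ≤ X) : 1 ≤ log X := by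
  have : (3:ℝ) ≤ X := by exact_mod_cast hX
  rw [Real.le_log_iff_exp_le (by linarith)]
  have := Real.exp_one_lt_d9; linarith

/-- `∑ Λ(n) log (X/n) ≤ 6 X` -/
lemma sum_lambda_log (X : ℕ) : ∑ n ∈ Ioc 0 X, vonMangoldt n * (log X - log n) ≤ 6 * X := by
  induction X with
  | zero => simp
  | succ X ih =>
    rw [sum_Ioc_succ_top (by omega), sub_self, mul_zero, add_zero]
    rcases Nat.eq_zero_or_pos X with rfl | hX
    · simp
    have hX' : (0:ℝ) < X := by exact_mod_cast hX
    have h1 : log ((X+1:ℕ):ℝ) - log X ≤ 1/X := by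
      rw [← Real.log_div (by positivity) (by positivity)]
      refine (Real.log_le_sub_one_of_pos (by positivity)).trans (le_of_eq ?_)
      push_cast; field_simp; ring
    calc ∑ n ∈ Ioc 0 X, vonMangoldt n * (log ((X+1:ℕ):ℝ) - log n)
        ≤ ∑ n ∈ Ioc 0 X, (vonMangoldt n * (log X - log n) + vonMangoldt n * (1/X)) := by
          refine sum_le_sum (fun n _ => ?_)
          rw [← mul_add]
          exact mul_le_mul_of_nonneg_left (by linarith) vonMangoldt_nonneg
      _ = ∑ n ∈ Ioc 0 X, vonMangoldt n * (log X - log n) + (∑ n ∈ Ioc 0 X, vonMangoldt n) * (1/X) := by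
          rw [sum_add_distrib, sum_mul]
      _ ≤ 6 * X + (6 * X) * (1/X) := by gcongr; exact psi_sum X
      _ = _ := by push_cast; field_simp

lemma chL_norm_le {q : ℕ} (χ : DirichletCharacter ℂ q) (n : ℕ) : ‖chL χ n‖ ≤ vonMangoldt n := by
  rw [chL, norm_mul, Complex.norm_real, norm_of_nonneg vonMangoldt_nonneg]
  have := mul_le_mul_of_nonneg_right (χ.norm_le_one (n : ZMod q)) (vonMangoldt_nonneg (n := n))
  linarith

lemma chL_log2 {q : ℕ} (χ : DirichletCharacter ℂ q) (n : ℕ) :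
    (LSeries.logMul^[2] (chL χ)) n = ((log n)^2 : ℝ) * chL χ n := by
  rw [logMul_iter]; push_cast; rfl

set_option maxHeartbeats 1600000 in
lemma T2_bound {q : ℕ} [NeZero q] (χ : DirichletCharacter ℂ q) (hχ : χ ≠ 1) : ∃ C : ℝ, 0 < C ∧
    ∀ X : ℕ, 3 ≤ X → ‖∑ n ∈ Ioc 0 X, (LSeries.logMul^[2] (chL χ)) n‖ ≤ C * X * (log X)^(3/2:ℝ) := by
  obtain ⟨C, hC, hP⟩ := P2_bound χ hχ
  set a := LSeries.logMul^[2] (chL χ) with ha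
  have ha0 : a 0 = 0 := by rw [ha, chL_log2]; simp
  obtain ⟨D, hD, hR⟩ := riesz_bound a C hC ha0 (fun s hs => summable_iter _ 2 s (chL_absc χ s hs)) hP
  have hR' : ∀ X : ℕ, 3 ≤ X → ‖∑ n ∈ Ioc 0 X, a n * ((X:ℂ) - n)‖ ≤ D * X^2 := by
    intro X hX
    have := hR X (by exact_mod_cast hX)
    rw [Nat.floor_natCast] at this
    simpa using this
  have han : ∀ n, ‖a n‖ ≤ (log n)^3 := by
    intro n
    rw [ha, chL_log2, norm_mul, Complex.norm_real, norm_of_nonneg (by positivity)]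
    have h1 := (chL_norm_le χ n).trans vonMangoldt_le_log
    calc _ ≤ (log n)^2 * log n := by gcongr
      _ = _ := by ring
  refine ⟨5*D + 80, by positivity, fun X hX => ?_⟩
  have hL1 := log_ge_one X hX
  set L := log X with hL
  have hX' : (3:ℝ) ≤ X := by exact_mod_cast hX
  set W := L^(3/2:ℝ) with hW
  have hW1 : 1 ≤ W := Real.one_le_rpow hL1 (by norm_num)
  have hWW : W*W = L^3 := by
    rw [hW, ← rpow_add (by linarith), ← rpow_natCast]; norm_num
  have hWX : W ≤ 9*X := by
    have h1 : W^2 ≤ (9*(X:ℝ))^2 := by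
      rw [pow_two, hWW]
      have h2 : L ≤ 3 * (X:ℝ)^(1/3:ℝ) := by
        have := Real.log_le_rpow_div (x := (X:ℝ)) (ε := 1/3) (by positivity) (by norm_num)
        rw [hL]; linarith
      have h3 : ((X:ℝ)^(1/3:ℝ))^3 = X := by rw [← rpow_natCast, ← rpow_mul (by positivity)]; norm_num
      calc L^3 ≤ (3 * (X:ℝ)^(1/3:ℝ))^3 := by gcongr
        _ = 27 * (X:ℝ) := by rw [mul_pow, h3]; norm_num
        _ ≤ (9*(X:ℝ))^2 := by nlinarith
    exact le_of_sq_le_sq h1 (by positivity) |> fun h => h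
  have hW0 : 0 < W := by linarith
  set h := ⌈(X:ℝ)/W⌉₊ with hh
  have hh1 : (X:ℝ)/W ≤ h := Nat.le_ceil _
  have hh2 : (h:ℝ) ≤ 10 * (X/W) := by
    have := (Nat.ceil_lt_add_one (show 0 ≤ (X:ℝ)/W by positivity)).le
    have h9 : 1 ≤ 9 * (X/W) := by rw [← mul_div_assoc, le_div_iff₀ hW0]; linarith
    rw [← hh] at this; linarith
  have hhX : h ≤ X := by
    rw [hh]; apply Nat.ceil_le.2
    rw [div_le_iff₀ hW0]; nlinarith
  have hhXr : (h:ℝ) ≤ X := by exact_mod_cast hhX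
  have hh0 : 0 < (h:ℝ) := lt_of_lt_of_le (by positivity) hh1
  set T := ∑ n ∈ Ioc 0 X, a n with hT
  have hid : (h:ℂ) * T = (∑ n ∈ Ioc 0 (X+h), a n * (((X+h:ℕ):ℂ) - n)) - (∑ n ∈ Ioc 0 X, a n * ((X:ℂ) - n))
      - ∑ n ∈ Ioc X (X+h), a n * (((X+h:ℕ):ℂ) - n) := by
    rw [← sum_Ioc_consecutive _ (Nat.zero_le X) (Nat.le_add_right X h), hT, mul_sum]
    rw [add_sub_right_comm, add_sub_cancel_right, ← sum_sub_distrib]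
    refine sum_congr rfl (fun n _ => ?_)
    push_cast; ring
  have r1 := hR' (X+h) (by omega)
  have r2 := hR' X hX
  have hlog2 : log (((X+h:ℕ)):ℝ) ≤ 2*L := by
    have h1 : ((X+h:ℕ):ℝ) ≤ (X:ℝ)^2 := by push_cast; nlinarith
    have := log_le_log (by push_cast; linarith) h1
    rw [Real.log_pow] at this; push_cast at this ⊢; linarith
  have r3 : ‖∑ n ∈ Ioc X (X+h), a n * (((X+h:ℕ):ℂ) - n)‖ ≤ h * ((2*L)^3 * h) := by
    refine (norm_sum_le_of_le (f := fun n => a n * (((X+h:ℕ):ℂ) - n)) (Ioc X (X+h)) (n := fun _ => (2*L)^3 * h) (fun n hn => ?_)).trans ?_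
    · rw [mem_Ioc] at hn
      rw [norm_mul]
      have hnp : (0:ℝ) < n := by exact_mod_cast (by omega : 0 < n)
      have h1 : ‖a n‖ ≤ (2*L)^3 := by
        refine (han n).trans ?_
        have := log_le_log hnp (show (n:ℝ) ≤ ((X+h:ℕ):ℝ) by exact_mod_cast hn.2)
        have h0 : 0 ≤ log n := log_natCast_nonneg n
        gcongr; linarith
      have h2 : ‖((X+h:ℕ):ℂ) - n‖ ≤ h := by
        rw [← Nat.cast_sub hn.2, Complex.norm_natCast]; exact_mod_cast (by omega)
      gcongr
    · rw [sum_const, Nat.card_Ioc, nsmul_eq_mul]; simp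
  have h5 : h * ‖T‖ ≤ 5*D*X^2 + h * ((2*L)^3 * h) := by
    have e : ‖(h:ℂ) * T‖ = h * ‖T‖ := by rw [norm_mul, Complex.norm_natCast]
    rw [← e, hid]
    refine (norm_sub_le _ _).trans (add_le_add ((norm_sub_le _ _).trans ?_) r3)
    have : D * ((X+h:ℕ):ℝ)^2 ≤ D * (2*X)^2 := by gcongr; push_cast; linarith
    linarith
  have h6 : ‖T‖ ≤ 5*D*X^2/h + (2*L)^3 * h := by
    have : 5*D*X^2/h + (2*L)^3 * h = (5*D*X^2 + h * ((2*L)^3 * h))/h := by field_simp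
    rw [this, le_div_iff₀ hh0]; linarith
  have h7 : 5*D*X^2/h ≤ 5*D*X*W := by
    calc 5*D*(X:ℝ)^2/h ≤ 5*D*(X:ℝ)^2/(X/W) := by gcongr
      _ = _ := by field_simp
  have h8 : (2*L)^3 * h ≤ 80 * X * W := by
    calc (2*L)^3 * (h:ℝ) ≤ (2*L)^3 * (10 * (X/W)) := by gcongr
      _ = 80 * (W*W) * (X/W) := by rw [hWW]; ring
      _ = _ := by field_simp
  calc ‖T‖ ≤ 5*D*X*W + 80*X*W := by linarith
    _ = _ := by ring

lemma char_psi {q : ℕ} [NeZero q] (χ : DirichletCharacter ℂ q) (hχ : χ ≠ 1) : ∃ C : ℝ, 0 < C ∧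
    ∀ X : ℕ, 3 ≤ X → ‖∑ n ∈ Ioc 0 X, chL χ n‖ ≤ C * (X * (log X)^(-(1/2):ℝ)) := by
  obtain ⟨C, hC, hT⟩ := T2_bound χ hχ
  refine ⟨C + 12, by positivity, fun X hX => ?_⟩
  have hL1 := log_ge_one X hX
  have h1 := hT X hX
  have hX' : (3:ℝ) ≤ X := by exact_mod_cast hX
  set L := log X with hL
  have hL0 : 0 < L := by linarith
  set T := ∑ n ∈ Ioc 0 X, (LSeries.logMul^[2] (chL χ)) n with hTd
  set S := ∑ n ∈ Ioc 0 X, chL χ n with hS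
  have hd : ‖((L^2:ℝ):ℂ) * S - T‖ ≤ 2*L*(6*X) := by
    rw [hS, hTd, mul_sum, ← sum_sub_distrib]
    calc _ ≤ ∑ n ∈ Ioc 0 X, 2*L*(vonMangoldt n * (L - log n)) := by
          refine norm_sum_le_of_le _ (fun n hn => ?_)
          rw [mem_Ioc] at hn
          rw [chL_log2, ← sub_mul, norm_mul, ← Complex.ofReal_sub, Complex.norm_real]
          have hn0 : (0:ℝ) < n := by exact_mod_cast hn.1
          have hl0 : 0 ≤ log n := log_natCast_nonneg n
          have hl1 : log n ≤ L := log_le_log hn0 (by exact_mod_cast hn.2)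
          have e : L^2 - (log n)^2 = (L + log n) * (L - log n) := by ring
          rw [e, norm_of_nonneg (mul_nonneg (by linarith) (by linarith))]
          have := chL_norm_le χ n
          calc _ ≤ (2*L) * (L - log n) * vonMangoldt n := by
                apply mul_le_mul _ this (norm_nonneg _) (mul_nonneg (by linarith) (by linarith))
                apply mul_le_mul_of_nonneg_right <;> linarith
            _ = _ := by ring
      _ = 2*L*∑ n ∈ Ioc 0 X, (vonMangoldt n * (L - log n)) := by rw [mul_sum]
      _ ≤ _ := by gcongr; exact sum_lambda_log X
  have h2 : L^2 * ‖S‖ ≤ C * X * L^(3/2:ℝ) + 12*L*X := by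
    have e : ‖((L^2:ℝ):ℂ) * S‖ = L^2 * ‖S‖ := by rw [norm_mul, Complex.norm_real, norm_of_nonneg (by positivity)]
    have := norm_sub_norm_le (((L^2:ℝ):ℂ) * S) T
    rw [e] at this; linarith
  have h3 : L ≤ L^(3/2:ℝ) := by
    calc L = L^(1:ℝ) := (rpow_one L).symm
      _ ≤ _ := rpow_le_rpow_of_exponent_le hL1 (by norm_num)
  have h4 : L^2 * ‖S‖ ≤ L^2 * ((C+12) * (X * L^(-(1/2):ℝ))) := by
    have e : L^2 * ((C+12) * (X * L^(-(1/2):ℝ))) = (C+12)*X*(L^2 * L^(-(1/2):ℝ)) := by ring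
    have e2 : L^2 * L^(-(1/2):ℝ) = L^(3/2:ℝ) := by
      rw [← rpow_natCast, ← rpow_add hL0]; norm_num
    rw [e, e2]
    have : 12*X*L ≤ 12*X*L^(3/2:ℝ) := by gcongr
    linarith
  exact le_of_mul_le_mul_left h4 (by positivity)

/-- von Mangoldt mass on non-primes -/
lemma nonprime_mass (X : ℕ) (hX : 1 ≤ X) :
    ∑ n ∈ (Ioc 0 X).filter (fun n => ¬ n.Prime), vonMangoldt n ≤ 2 * √ X * log X := by
  have h := Chebyshev.psi_sub_theta_le (x := (X:ℝ)) (by exact_mod_cast hX)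
  rw [Chebyshev.psi_sub_theta_eq_sum_not_prime, Nat.floor_natCast] at h
  exact h

lemma sqrt_log_le (X : ℕ) (hX : 3 ≤ X) : √ X * log X ≤ 9 * (X * (log X)^(-(1/2):ℝ)) := by
  have hL1 := log_ge_one X hX
  have hX' : (3:ℝ) ≤ X := by exact_mod_cast hX
  set L := log X with hL
  have h2 : L ≤ 4 * (X:ℝ)^(1/4:ℝ) := by
    have := Real.log_le_rpow_div (x := (X:ℝ)) (ε := 1/4) (by positivity) (by norm_num)
    rw [hL]; linarith
  have e2 : L = L^(3/2:ℝ) * L^(-(1/2):ℝ) := by rw [← rpow_add (by linarith)]; norm_num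
  have h3 : L^(3/2:ℝ) ≤ 9 * √ X := by
    have e : L^(3/2:ℝ) = (L^3)^(1/2:ℝ) := by rw [← rpow_natCast, ← rpow_mul (by linarith)]; norm_num
    rw [e, ← Real.sqrt_eq_rpow, show (9:ℝ) = √ (9^2) by rw [Real.sqrt_sq]; norm_num, ← Real.sqrt_mul (by positivity)]
    apply Real.sqrt_le_sqrt
    have h2 : L ≤ 3 * (X:ℝ)^(1/3:ℝ) := by
      have := Real.log_le_rpow_div (x := (X:ℝ)) (ε := 1/3) (by positivity) (by norm_num)
      rw [hL]; linarith
    have h3 : ((X:ℝ)^(1/3:ℝ))^3 = X := by rw [← rpow_natCast, ← rpow_mul (by positivity)]; norm_num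
    calc L^3 ≤ (3 * (X:ℝ)^(1/3:ℝ))^3 := by gcongr
      _ = 27 * (X:ℝ) := by rw [mul_pow, h3]; norm_num
      _ ≤ _ := by linarith
  have hp : 0 < L^(-(1/2):ℝ) := by positivity
  calc √ X * L = √ X * (L^(3/2:ℝ) * L^(-(1/2):ℝ)) := by rw [← e2]
    _ ≤ √ X * ((9 * √ X) * L^(-(1/2):ℝ)) := by gcongr
    _ = 9 * ((√ X * √ X) * L^(-(1/2):ℝ)) := by ring
    _ = _ := by rw [Real.mul_self_sqrt (by positivity)]

/-- Weak prime number theorem in arithmetic progressions. -/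
theorem pnt_ap (q : ℕ) (hq : 0 < q) : ∃ C : ℝ, 0 < C ∧ ∀ (a X : ℕ), Nat.Coprime a q → 3 ≤ X →
    |(q.totient : ℝ) * ∑ n ∈ (Ioc 0 X).filter (fun n => n ≡ a [MOD q]), vonMangoldt n -
      ∑ n ∈ Ioc 0 X, vonMangoldt n| ≤ C * (X * (log X)^(-(1/2):ℝ)) := by
  haveI : NeZero q := ⟨hq.ne'⟩
  have hex : ∀ χ : DirichletCharacter ℂ q, ∃ C : ℝ, 0 ≤ C ∧ (χ ≠ 1 → ∀ X : ℕ, 3 ≤ X →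
      ‖∑ n ∈ Ioc 0 X, chL χ n‖ ≤ C * (X * (log X)^(-(1/2):ℝ))) := by
    intro χ
    by_cases h : χ = 1
    · exact ⟨0, le_rfl, fun h' => absurd h h'⟩
    · obtain ⟨C, hC, hb⟩ := char_psi χ h
      exact ⟨C, hC.le, fun _ => hb⟩
  choose Cχ hC0 hCb using hex
  set B := ∑ p ∈ q.primeFactors, log p with hB
  have hB0 : 0 ≤ B := sum_nonneg (fun p _ => log_natCast_nonneg p)
  refine ⟨∑ χ : DirichletCharacter ℂ q, Cχ χ + (18 + 9*B) + 1, by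
    have := sum_nonneg (fun χ (_ : χ ∈ (univ : Finset (DirichletCharacter ℂ q))) => hC0 χ); linarith, fun a X ha hX => ?_⟩
  set E := (X:ℝ) * (log X)^(-(1/2):ℝ) with hE
  have hL1 := log_ge_one X hX
  have hE0 : 0 < E := by have : (3:ℝ) ≤ X := by exact_mod_cast hX
                         positivity
  have hau : IsUnit (a : ZMod q) := (ZMod.isUnit_iff_coprime a q).2 ha
  -- orthogonality
  have horth : ((q.totient : ℝ) * ∑ n ∈ (Ioc 0 X).filter (fun n => n ≡ a [MOD q]), vonMangoldt n : ℝ)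
      = ∑ χ : DirichletCharacter ℂ q, χ (a : ZMod q)⁻¹ * ∑ n ∈ Ioc 0 X, chL χ n := by
    simp_rw [mul_sum]
    rw [sum_comm, sum_filter]
    push_cast
    refine sum_congr rfl (fun n _ => ?_)
    have := DirichletCharacter.sum_char_inv_mul_char_eq ℂ hau (n : ZMod q)
    have e : ∑ χ : DirichletCharacter ℂ q, χ (a : ZMod q)⁻¹ * chL χ n =
        (∑ χ : DirichletCharacter ℂ q, χ (a : ZMod q)⁻¹ * χ (n : ZMod q)) * (vonMangoldt n : ℂ) := by
      rw [sum_mul]; refine sum_congr rfl (fun χ _ => ?_); rw [chL]; ring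
    rw [e, this]
    by_cases hn : n ≡ a [MOD q]
    · rw [if_pos hn, if_pos ((ZMod.natCast_eq_natCast_iff _ _ _).2 hn.symm)]; simp
    · rw [if_neg hn, if_neg (fun h => hn ((ZMod.natCast_eq_natCast_iff _ _ _).1 h).symm)]; simp
  -- principal character
  have hprin : ‖∑ n ∈ Ioc 0 X, chL (1 : DirichletCharacter ℂ q) n - ∑ n ∈ Ioc 0 X, (vonMangoldt n : ℂ)‖ ≤ (18 + 9*B) * E := by
    rw [← sum_sub_distrib]
    have hs1 : ∀ n, ‖chL (1 : DirichletCharacter ℂ q) n - (vonMangoldt n : ℂ)‖ ≤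
        (if ¬ n.Prime then vonMangoldt n else 0) + (if n ∈ q.primeFactors then log n else 0) := by
      intro n
      have hl := vonMangoldt_nonneg (n := n)
      have hg := log_natCast_nonneg n
      by_cases hu : IsUnit (n : ZMod q)
      · rw [chL, MulChar.one_apply hu, one_mul, sub_self, norm_zero]
        apply add_nonneg <;> split_ifs <;> linarith
      · rw [chL, MulChar.map_nonunit _ hu, zero_mul, zero_sub, norm_neg, Complex.norm_real, norm_of_nonneg hl]
        by_cases hp : n.Prime
        · have : n ∈ q.primeFactors := by
            rw [Nat.mem_primeFactors]
            refine ⟨hp, ?_, hq.ne'⟩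
            by_contra hd
            exact hu ((ZMod.isUnit_iff_coprime n q).2 ((Nat.Prime.coprime_iff_not_dvd hp).2 hd))
          rw [if_neg (by simpa using hp), if_pos this, zero_add, vonMangoldt_apply_prime hp]
        · rw [if_pos hp]
          have : 0 ≤ (if n ∈ q.primeFactors then log n else 0) := by split_ifs <;> linarith
          linarith
    refine (norm_sum_le_of_le _ (fun n _ => hs1 n)).trans ?_
    rw [sum_add_distrib, ← sum_filter, ← sum_filter]
    have b1 := nonprime_mass X (by omega)
    have b2 : ∑ n ∈ (Ioc 0 X).filter (fun n => n ∈ q.primeFactors), log n ≤ B := by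
      refine sum_le_sum_of_subset_of_nonneg (fun n hn => (mem_filter.1 hn).2) (fun n _ _ => log_natCast_nonneg n)
    have b3 := sqrt_log_le X hX
    have b4 : 1 ≤ √ X * log X := by
      have : 1 ≤ √ X := Real.one_le_sqrt.2 (by exact_mod_cast (by omega : 1 ≤ X))
      nlinarith
    have b5 : B ≤ B * (9 * E) := by nlinarith
    linarith
  have hmain : ‖((((q.totient : ℝ) * ∑ n ∈ (Ioc 0 X).filter (fun n => n ≡ a [MOD q]), vonMangoldt n -
      ∑ n ∈ Ioc 0 X, vonMangoldt n : ℝ)) : ℂ)‖ ≤ (∑ χ : DirichletCharacter ℂ q, Cχ χ + (18 + 9*B)) * E := by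
    rw [Complex.ofReal_sub, horth, ← add_sum_erase univ _ (mem_univ (1 : DirichletCharacter ℂ q))]
    have hau' : IsUnit (a : ZMod q)⁻¹ := by
      obtain ⟨u, hu⟩ := hau; rw [← hu, ZMod.inv_coe_unit]; exact Units.isUnit _
    rw [MulChar.one_apply hau', one_mul, add_sub_right_comm]
    have h3 : ‖∑ χ ∈ univ.erase (1 : DirichletCharacter ℂ q), χ (a : ZMod q)⁻¹ * ∑ n ∈ Ioc 0 X, chL χ n‖ ≤ (∑ χ : DirichletCharacter ℂ q, Cχ χ) * E := by
      rw [sum_mul]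
      calc _ ≤ ∑ χ ∈ univ.erase (1 : DirichletCharacter ℂ q), Cχ χ * E := by
            refine norm_sum_le_of_le _ (fun χ hχ => ?_)
            rw [norm_mul]
            have h1 := hCb χ (ne_of_mem_erase hχ) X hX
            have h2 := χ.norm_le_one (a : ZMod q)⁻¹
            calc _ ≤ 1 * (Cχ χ * E) := by gcongr
              _ = _ := one_mul _
        _ ≤ _ := sum_le_sum_of_subset_of_nonneg (erase_subset _ _) (fun χ _ _ => mul_nonneg (hC0 χ) hE0.le)
    push_cast
    refine (norm_add_le _ _).trans ?_
    linarith
  rw [Complex.norm_real] at hmain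
  rw [← norm_eq_abs]
  refine hmain.trans ?_
  nlinarith

/-- Wiener-norm bound, in dual form. -/
def WN (G : ℕ) (F : ℕ → ℂ) (A : ℝ) : Prop :=
  ∀ (T : (ℕ → ℂ) →ₗ[ℂ] ℂ) (B : ℝ), 0 ≤ B → (∀ h : ℤ, ‖T (fun n => ee (n * ((h : ℝ) / G)))‖ ≤ B) →
    ‖T F‖ ≤ A * B

lemma WN_ee (G : ℕ) (h : ℤ) : WN G (fun n => ee (n * ((h : ℝ) / G))) 1 := by
  intro T B hB hT; rw [one_mul]; exact hT h

lemma WN_mono {G : ℕ} {F : ℕ → ℂ} {A A' : ℝ} (h : WN G F A) (hA : A ≤ A') : WN G F A' := by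
  intro T B hB hT
  exact (h T B hB hT).trans (mul_le_mul_of_nonneg_right hA hB)

lemma WN_smul {G : ℕ} {F : ℕ → ℂ} {A : ℝ} (c : ℂ) (h : WN G F A) : WN G (c • F) (‖c‖ * A) := by
  intro T B hB hT
  rw [map_smul, smul_eq_mul, norm_mul, mul_assoc]
  exact mul_le_mul_of_nonneg_left (h T B hB hT) (norm_nonneg _)

lemma WN_sum {G : ℕ} {ι : Type} (s : Finset ι) (F : ι → ℕ → ℂ) (A : ι → ℝ) (h : ∀ i ∈ s, WN G (F i) (A i)) :
    WN G (∑ i ∈ s, F i) (∑ i ∈ s, A i) := by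
  intro T B hB hT
  rw [map_sum, sum_mul]
  exact (norm_sum_le _ _).trans (sum_le_sum fun i hi => h i hi T B hB hT)

lemma WN_add {G : ℕ} {F F' : ℕ → ℂ} {A A' : ℝ} (h : WN G F A) (h' : WN G F' A') : WN G (F + F') (A + A') := by
  intro T B hB hT
  rw [map_add, add_mul]
  exact (norm_add_le _ _).trans (add_le_add (h T B hB hT) (h' T B hB hT))

lemma WN_nonneg {G : ℕ} {F : ℕ → ℂ} {A : ℝ} (h : WN G F A) : 0 ≤ A := by
  have := h 0 1 (by norm_num) (fun _ => by simp)
  simpa using this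

lemma WN_mul {G : ℕ} {F F' : ℕ → ℂ} {A A' : ℝ} (h : WN G F A) (h' : WN G F' A') : WN G (F * F') (A * A') := by
  intro T B hB hT
  have key := h (T.comp (LinearMap.mulRight ℂ F')) (A' * B) (mul_nonneg (WN_nonneg h') hB) ?_
  · simpa [mul_assoc] using key
  · intro k
    have := h' (T.comp (LinearMap.mulRight ℂ (fun n => ee (n * ((k : ℝ) / G))))) B hB ?_
    · convert this using 2
      simp only [LinearMap.comp_apply, LinearMap.mulRight_apply]
      rw [mul_comm]
    · intro k'
      have h2 := hT (k' + k)
      convert h2 using 2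
      simp only [LinearMap.comp_apply, LinearMap.mulRight_apply]
      congr 1
      funext n
      simp only [Pi.mul_apply]
      rw [← ee_add]; congr 1; push_cast; ring

lemma WN_one (G : ℕ) : WN G 1 1 := by
  have := WN_ee G 0
  convert this using 1
  funext n; simp [ee_zero]

lemma WN_pow {G : ℕ} {F : ℕ → ℂ} {A : ℝ} (h : WN G F A) (k : ℕ) : WN G (F ^ k) (A ^ k) := by
  induction k with
  | zero => simpa using WN_one G
  | succ k ih => rw [pow_succ, pow_succ]; exact WN_mul ih h

/-- Wiener norm of a digit -/
lemma WN_digit (g : ℕ) (hg : 2 ≤ g) (b j : ℕ) (hj : j < b) :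
    WN (g ^ b) (fun n => ((n / g ^ j % g : ℕ) : ℂ)) (6 * g ^ 3 * (1 + b)) := by
  set H := g ^ (j + 1) with hH
  have hgpos : 0 < g := by omega
  have hHpos : 0 < H := by positivity
  have hHr : (0 : ℝ) < H := by exact_mod_cast hHpos
  set u : ℕ → ℕ := fun n => n / g ^ j % g with hu
  set c : ℕ → ℂ := fun h => (∑ r ∈ range H, (u r : ℂ) * ee (-(r * ((h : ℝ) / H)))) / H with hc
  have hper : ∀ n, u (n % H) = u n := by
    intro n; simp only [hu, hH, pow_succ]
    rw [Nat.mod_mul_right_div_self, Nat.mod_mod]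
  have hexp : (fun n => ((u n : ℕ) : ℂ)) = ∑ h ∈ range H, c h • (fun n : ℕ => ee (n * ((((h * g ^ (b - j - 1) : ℕ) : ℤ) : ℝ) / ((g ^ b : ℕ) : ℝ)))) := by
    funext n
    rw [Finset.sum_apply]
    have hfr : ∀ h : ℕ, ((((h * g ^ (b - j - 1) : ℕ) : ℤ) : ℝ) / ((g ^ b : ℕ) : ℝ)) = (h : ℝ) / H := by
      intro h
      have : g ^ b = H * g ^ (b - j - 1) := by rw [hH, ← pow_add]; congr 1; omega
      rw [this]; push_cast
      have : (g : ℝ) ≠ 0 := by positivity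
      field_simp
    simp only [Pi.smul_apply, smul_eq_mul, hfr, hc]
    have : ∀ h ∈ range H, (∑ r ∈ range H, (u r : ℂ) * ee (-(r * ((h : ℝ) / H)))) / H * ee (n * ((h : ℝ) / H)) =
        ∑ r ∈ range H, (u r : ℂ) / H * ee (((n : ℤ) - (r : ℤ) : ℤ) * h / H) := by
      intro h _
      rw [sum_div, sum_mul]
      refine sum_congr rfl (fun r _ => ?_)
      have : ee ((((n : ℤ) - (r : ℤ) : ℤ) : ℝ) * h / H) = ee (-(r * ((h : ℝ) / H))) * ee (n * ((h : ℝ) / H)) := by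
        rw [← ee_add]; congr 1; push_cast; ring
      rw [this]; ring
    rw [sum_congr rfl this, sum_comm]
    simp_rw [← mul_sum, sum_ee_range H hHpos]
    rw [sum_eq_single (n % H)]
    · rw [if_pos, hper, div_mul_cancel₀]
      · exact_mod_cast hHpos.ne'
      · have := Nat.div_add_mod n H
        refine ⟨(n / H : ℕ), ?_⟩
        zify at this
        push_cast; linarith
    · intro r hr hne
      rw [if_neg, mul_zero]
      intro hd
      apply hne
      have h1 : (n : ℤ) % H = r % H := Int.ModEq.symm ((Int.modEq_iff_dvd).2 hd)
      have h2 : n % H = r % H := by exact_mod_cast h1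
      rw [h2, Nat.mod_eq_of_lt (mem_range.1 hr)]
    · intro h; exact absurd (mem_range.2 (Nat.mod_lt _ hHpos)) h
  rw [show (fun n => ((n / g ^ j % g : ℕ) : ℂ)) = (fun n => ((u n : ℕ) : ℂ)) from rfl, hexp]
  have hbd : ∀ h, ‖c h‖ ≤ g ^ 2 / H * Ker (g ^ j) ((h : ℝ) / H) := by
    intro h
    have hHe : H = g ^ j * g := by rw [hH, pow_succ]
    simp only [hc]
    have h1 : ∑ r ∈ range H, (u r : ℂ) * ee (-(r * ((h : ℝ) / H))) =
        ∑ d ∈ range g, (d : ℂ) * (ee (-(((g ^ j * d : ℕ) : ℝ) * ((h : ℝ) / H))) * ∑ r ∈ range (g ^ j), ee (r * (-((h : ℝ) / H)))) := by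
      conv_lhs => rw [show range H = range (g ^ j * g) from by rw [hHe], sum_range_mul']
      refine sum_congr rfl (fun d hd => ?_)
      rw [mul_sum, mul_sum]
      refine sum_congr rfl (fun r hr => ?_)
      have : u (g ^ j * d + r) = d := by
        simp only [hu]
        rw [Nat.mul_add_div (by positivity), Nat.div_eq_of_lt (mem_range.1 hr), add_zero, Nat.mod_eq_of_lt (mem_range.1 hd)]
      rw [this, ← ee_add]; congr 2; push_cast; ring
    have h2 : ‖∑ r ∈ range (g ^ j), ee (r * (-((h : ℝ) / H)))‖ ≤ Ker (g ^ j) ((h : ℝ) / H) := by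
      have e : ee (-((h : ℝ) / H)) * ∑ r ∈ range (g ^ j), ee (r * (-((h : ℝ) / H))) = ∑ m ∈ Ioc 0 (g ^ j), ee (m * (-((h : ℝ) / H))) := by
        rw [sum_Ioc_eq_range, mul_sum]
        refine sum_congr rfl (fun r _ => ?_)
        rw [← ee_add]; congr 1; push_cast; ring
      have := geom_sum_le (-((h : ℝ) / H)) 0 (g ^ j) (g ^ j) (by push_cast; linarith) (by positivity)
      rw [← e, norm_mul, norm_ee, one_mul, Ker_neg] at this
      exact this
    have hK : 0 ≤ Ker (g ^ j) ((h : ℝ) / H) := Ker_nonneg (by positivity) _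
    rw [h1, norm_div, Complex.norm_natCast, div_mul_eq_mul_div]
    apply div_le_div_of_nonneg_right _ hHr.le
    refine (norm_sum_le _ _).trans ?_
    calc _ ≤ ∑ d ∈ range g, (g : ℝ) * Ker (g ^ j) ((h : ℝ) / H) := by
          refine sum_le_sum (fun d hd => ?_)
          rw [norm_mul, norm_mul, norm_ee, one_mul, Complex.norm_natCast]
          have : (d : ℝ) ≤ g := by exact_mod_cast (mem_range.1 hd).le
          exact mul_le_mul this h2 (norm_nonneg _) (by positivity)
      _ = _ := by rw [sum_const, card_range, nsmul_eq_mul]; ring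
  refine WN_mono (WN_sum _ _ (fun h => ‖c h‖ * 1) (fun h _ => WN_smul _ (WN_ee _ _))) ?_
  simp only [mul_one]
  have h3 := block_sum_le H hHpos 1 isCoprime_one_left 0 (g ^ j) (by positivity)
  simp only [Int.cast_one, one_mul, add_zero] at h3
  have hgj : ((g : ℝ) ^ j) ≤ H := by
    rw [hH]; push_cast
    exact pow_le_pow_right₀ (by exact_mod_cast hgpos) (by omega)
  have hlog : log H ≤ b * g := by
    rw [hH]; push_cast; rw [Real.log_pow]
    have h1 : log g ≤ g := (Real.log_le_self (by positivity))
    have h2 : ((j + 1 : ℕ) : ℝ) ≤ b := by exact_mod_cast hj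
    exact mul_le_mul h2 h1 (Real.log_nonneg (by exact_mod_cast hgpos)) (by positivity)
  have hg1 : (1 : ℝ) ≤ g := by exact_mod_cast hgpos
  calc ∑ h ∈ range H, ‖c h‖ ≤ ∑ h ∈ range H, (g : ℝ) ^ 2 / H * Ker (g ^ j) ((h : ℝ) / H) := sum_le_sum fun h _ => hbd h
    _ = (g : ℝ) ^ 2 / H * ∑ h ∈ range H, Ker (g ^ j) ((h : ℝ) / H) := by rw [mul_sum]
    _ ≤ (g : ℝ) ^ 2 / H * (4 * H + 2 * H * (1 + b * g)) := by
        apply mul_le_mul_of_nonneg_left _ (by positivity)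
        refine h3.trans ?_
        gcongr
    _ = (g : ℝ) ^ 2 * (6 + 2 * (b * g)) := by field_simp; ring
    _ ≤ 6 * g ^ 3 * (1 + b) := by
        have hb0 : (0 : ℝ) ≤ b := by positivity
        have : (6 : ℝ) + 2 * (b * g) ≤ 6 * g * (1 + b) := by nlinarith [mul_nonneg hb0 (by positivity : (0:ℝ) ≤ g)]
        calc _ ≤ (g : ℝ) ^ 2 * (6 * g * (1 + b)) := mul_le_mul_of_nonneg_left this (by positivity)
          _ = _ := by ring

lemma sg_step (g : ℕ) (hg : 2 ≤ g) (n : ℕ) : sg g n = n % g + sg g (n / g) := by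
  conv_lhs => rw [← Nat.div_add_mod n g]
  exact sg_add g hg _ _ (Nat.mod_lt _ (by omega))

lemma sg_split (g : ℕ) (hg : 2 ≤ g) (k n : ℕ) : sg g n = sg g (n % g ^ k) + sg g (n / g ^ k) := by
  induction k generalizing n with
  | zero => simp [Nat.mod_one, sg]
  | succ k ih =>
    rw [sg_step g hg n, ih (n / g), sg_step g hg (n % g ^ (k + 1)), pow_succ', Nat.mod_mul_right_div_self,
      Nat.mod_mul_right_mod, Nat.div_div_eq_div_mul]
    ring

lemma sg_digits (g : ℕ) (hg : 2 ≤ g) (N n : ℕ) : sg g (n % g ^ N) = ∑ j ∈ range N, n / g ^ j % g := by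
  induction N with
  | zero => simp [Nat.mod_one, sg]
  | succ N ih =>
    rw [sum_range_succ, ← ih, sg_split g hg N (n % g ^ (N + 1)), pow_succ, Nat.mod_mul_right_mod,
      Nat.mod_mul_right_div_self, sg_lt g hg (n / g ^ N % g) (Nat.mod_lt _ (by omega))]

lemma sg_le (g : ℕ) (hg : 2 ≤ g) (N n : ℕ) (hn : n < g ^ N) : sg g n ≤ g * N := by
  rw [← Nat.mod_eq_of_lt hn, sg_digits g hg]
  calc _ ≤ ∑ j ∈ range N, g := sum_le_sum (fun j _ => (Nat.mod_lt _ (by omega)).le)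
    _ = _ := by simp [mul_comm]

/-- centred truncated digit sum -/
noncomputable def Xf (g a N n : ℕ) : ℝ := (sg g (n / g ^ a % g ^ N) : ℝ) - ((g : ℝ) - 1) / 2 * N

noncomputable def EX (g N : ℕ) (φ : ℝ → ℂ) : ℂ :=
  (∑ m ∈ range (g ^ N), φ ((sg g m : ℝ) - ((g : ℝ) - 1) / 2 * N)) / ((g ^ N : ℕ) : ℂ)

lemma WN_Xf (g : ℕ) (hg : 2 ≤ g) (a N : ℕ) :
    WN (g ^ (a + N)) (fun n => (Xf g a N n : ℂ)) (7 * g ^ 3 * (1 + (a + N : ℕ)) ^ 2) := by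
  have hg1 : (1 : ℝ) ≤ g := by exact_mod_cast (by omega : 1 ≤ g)
  have e : (fun n => (Xf g a N n : ℂ)) = ∑ j ∈ range N, (fun n => ((n / g ^ (a + j) % g : ℕ) : ℂ)) +
      (-((((g : ℝ) - 1) / 2 * N : ℝ) : ℂ)) • (1 : ℕ → ℂ) := by
    funext n
    simp only [Pi.add_apply, Finset.sum_apply, Pi.smul_apply, Pi.one_apply, smul_eq_mul, mul_one, Xf]
    rw [sg_digits g hg]
    simp_rw [Nat.div_div_eq_div_mul, ← pow_add]
    push_cast; ring
  rw [e]
  refine WN_mono (WN_add (WN_sum _ _ (fun _ => 6 * (g : ℝ) ^ 3 * (1 + (a + N : ℕ))) (fun j hj => WN_digit g hg _ _ ?_)) (WN_smul _ (WN_one _))) ?_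
  · have := mem_range.1 hj; omega
  · rw [sum_const, card_range, nsmul_eq_mul, norm_neg, Complex.norm_real, mul_one, norm_of_nonneg (by
      apply mul_nonneg _ (Nat.cast_nonneg _); linarith)]
    have hN : (N : ℝ) ≤ 1 + (a + N : ℕ) := by push_cast; linarith [(Nat.cast_nonneg a : (0:ℝ) ≤ a)]
    set y : ℝ := 1 + (a + N : ℕ) with hy
    have hy1 : 1 ≤ y := by rw [hy]; linarith [(Nat.cast_nonneg (a + N) : (0:ℝ) ≤ (a + N : ℕ))]
    have h1 : (N : ℝ) * (6 * g ^ 3 * y) ≤ y * (6 * g ^ 3 * y) := mul_le_mul_of_nonneg_right hN (by positivity)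
    have h2 : ((g : ℝ) - 1) / 2 * N ≤ g ^ 3 * y ^ 2 := by
      apply mul_le_mul _ _ (by positivity) (by positivity)
      · have : (g : ℝ) ≤ g ^ 3 := le_self_pow₀ hg1 (by norm_num)
        linarith
      · nlinarith
    nlinarith

lemma dvd_aux (g a b d : ℕ) (hg : 2 ≤ g) (hd : d ∣ g ^ b) (h : d < 2 ^ a) : d ∣ g ^ a := by
  rw [Nat.dvd_iff_prime_pow_dvd_dvd]
  intro p k hp hpk
  rcases Nat.eq_zero_or_pos k with rfl | hk
  · simp
  have hd0 : 0 < d := Nat.pos_of_dvd_of_pos hd (by positivity)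
  have hpg : p ∣ g := hp.dvd_of_dvd_pow (((dvd_pow_self p hk.ne').trans hpk).trans hd)
  have h1 : 2 ^ k < 2 ^ a := by
    calc 2 ^ k ≤ p ^ k := Nat.pow_le_pow_left hp.two_le k
      _ ≤ d := Nat.le_of_dvd hd0 hpk
      _ < _ := h
  have h2 : k < a := (Nat.pow_lt_pow_iff_right (by norm_num)).1 h1
  exact (pow_dvd_pow p h2.le).trans (pow_dvd_pow_of_dvd hpg a)

noncomputable def wt (q l n : ℕ) : ℝ := if n ≡ l [MOD q] then vonMangoldt n else 0

lemma wt_nonneg (q l n : ℕ) : 0 ≤ wt q l n := by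
  unfold wt; split_ifs
  · exact vonMangoldt_nonneg
  · exact le_rfl

lemma wt_le (q l n : ℕ) : wt q l n ≤ vonMangoldt n := by
  unfold wt; split_ifs
  · exact le_rfl
  · exact vonMangoldt_nonneg

/-- expansion of the weight against any character of `ℤ/q` -/
lemma wt_expand (q l : ℕ) (hq : 0 < q) (n s : ℕ) (hs : s ≡ n [MOD q]) :
    (wt q l n : ℂ) = (1 / q) * ∑ k ∈ range q, (vonMangoldt n : ℂ) * ee (((s : ℤ) - (l : ℤ) : ℤ) * (k : ℝ) / q) := by
  rw [← mul_sum, sum_ee_range q hq]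
  have hq' : (q : ℂ) ≠ 0 := by exact_mod_cast hq.ne'
  have : (q : ℤ) ∣ (s : ℤ) - l ↔ n ≡ l [MOD q] := by
    rw [← Int.natCast_modEq_iff.symm.trans (Int.modEq_iff_dvd (n := (q:ℤ)) (a := (l:ℤ)) (b := (s:ℤ)))]
    exact ⟨fun h => (h.trans hs).symm, fun h => (hs.trans h).symm⟩
  unfold wt
  by_cases h : n ≡ l [MOD q]
  · rw [if_pos h, if_pos (this.2 h)]; field_simp
  · rw [if_neg h, if_neg (fun h' => h (this.1 h'))]; simp

noncomputable def Bv (X u : ℕ) : ℝ := 60 * (1 + log X) ^ 10 * X * ((2 ^ u : ℕ) : ℝ) ^ (-(1/4) : ℝ)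

lemma exp_sum_ap (g : ℕ) (hg : 2 ≤ g) (u N M X l : ℕ) (hu : 1 ≤ u) (hM : 4 * u + N + 4 * u + 1 ≤ M) (hX : g ^ M ≤ X)
    (h : ℤ) (hh : ¬ ((g ^ N : ℕ) : ℤ) ∣ h) :
    ‖∑ n ∈ Ioc 0 X, (wt (g - 1) l n : ℂ) * ee (n * ((h : ℝ) / ((g ^ (4 * u + N) : ℕ) : ℝ)))‖ ≤ Bv X u := by
  set q := g - 1 with hq
  have hqpos : 0 < q := by omega
  set b := 4 * u + N with hb
  set G := g ^ b with hG
  have hGpos : 0 < G := by positivity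
  have hGr : (G : ℝ) ≠ 0 := by positivity
  have hqr : (q : ℝ) ≠ 0 := by positivity
  have key : ∀ k ∈ range q, ‖∑ n ∈ Ioc 0 X, (vonMangoldt n : ℂ) * ee (n * ((h : ℝ) / G + k / q))‖ ≤ Bv X u := by
    intro k _
    set r : ℚ := ((h * q + k * G : ℤ) : ℚ) / ((q * G : ℤ) : ℚ) with hr
    have hrr : (h : ℝ) / G + k / q = (r.num : ℝ) / (r.den : ℝ) := by
      have : ((r : ℚ) : ℝ) = (r.num : ℝ) / (r.den : ℝ) := Rat.cast_def r
      rw [← this, hr]; push_cast; field_simp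
    have hcop : IsCoprime r.num (r.den : ℤ) := by
      rw [Int.isCoprime_iff_gcd_eq_one]; exact r.reduced
    have hden : (r.den : ℤ) ∣ (q * G : ℤ) := by rw [hr, ← Rat.divInt_eq_div]; exact Rat.den_dvd _ _
    have hdenN : r.den ∣ q * G := by exact_mod_cast hden
    have hle : r.den ≤ q * G := Nat.le_of_dvd (by positivity) hdenN
    have hbig : 2 ^ (4 * u) ≤ r.den := by
      by_contra hlt
      push Not at hlt
      apply hh
      have h1 : (r.den : ℤ) * (h * q + k * G) = r.num * (q * G) := by
        have h2 : (r.num : ℚ) / (r.den : ℚ) = r := Rat.num_div_den r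
        have h3 : (r.den : ℚ) ≠ 0 := by exact_mod_cast r.den_nz
        have h4 : ((q * G : ℤ) : ℚ) ≠ 0 := by
          have : (q * G : ℤ) ≠ 0 := by positivity
          exact_mod_cast this
        have h5 : (r.num : ℚ) / (r.den : ℚ) = ((h * q + k * G : ℤ) : ℚ) / ((q * G : ℤ) : ℚ) := by rw [h2]
        rw [div_eq_div_iff h3 h4] at h5
        have h6 : r.num * (q * G) = (h * q + k * G) * (r.den : ℤ) := by exact_mod_cast h5
        linarith
      have hcq : IsCoprime (G : ℤ) (q : ℤ) := by
        have : Nat.Coprime G q := by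
          apply Nat.Coprime.pow_left
          rw [hq]
          have := (Nat.coprime_self_sub_right (m := 1) (n := g) (by omega)).2 (Nat.coprime_one_right g)
          exact this
        exact Nat.isCoprime_iff_coprime.2 this
      have h2 : (G : ℤ) ∣ r.den * h := by
        apply hcq.dvd_of_dvd_mul_right
        refine ⟨r.num * q - r.den * k, ?_⟩
        linarith
      set d := Nat.gcd r.den G with hd
      have hdG : d ∣ g ^ b := Nat.gcd_dvd_right _ _
      have hdl : d < 2 ^ (4 * u) := lt_of_le_of_lt (Nat.gcd_le_left _ r.den_pos) hlt
      have hda := dvd_aux g (4 * u) b d hg hdG hdl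
      have h3 : (G : ℤ) ∣ d * h := by
        have e : (d : ℤ) = r.den * Nat.gcdA r.den G + G * Nat.gcdB r.den G := Nat.gcd_eq_gcd_ab _ _
        rw [e, add_mul]
        apply dvd_add
        · rw [mul_right_comm]; exact Dvd.dvd.mul_right h2 _
        · rw [mul_assoc]; exact dvd_mul_right _ _
      have h4 : ((g ^ (4 * u) * g ^ N : ℕ) : ℤ) ∣ (g ^ (4 * u) : ℕ) * h := by
        rw [← pow_add, ← hb]
        exact h3.trans (mul_dvd_mul_right (by exact_mod_cast hda) h)
      rw [Nat.cast_mul] at h4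
      exact (mul_dvd_mul_iff_left (by positivity)).1 h4
    have hv := vinogradov X (2 ^ u) r.den r.num (by calc 2 = 2 ^ 1 := by norm_num
                                                      _ ≤ 2 ^ u := Nat.pow_le_pow_right (by norm_num) hu)
      (by rw [← pow_mul, mul_comm]; exact hbig) ?_ hcop
    · rw [hrr]; exact hv
    · calc (2 ^ u) ^ 4 * r.den ≤ g ^ (4 * u) * (g * G) := by
            apply Nat.mul_le_mul
            · rw [← pow_mul, mul_comm u 4]; exact Nat.pow_le_pow_left hg _
            · exact hle.trans (Nat.mul_le_mul_right _ (by omega))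
        _ = g ^ (4 * u + N + 4 * u + 1) := by rw [hG, hb]; ring
        _ ≤ g ^ M := Nat.pow_le_pow_right (by omega) hM
        _ ≤ X := hX
  have e : ∑ n ∈ Ioc 0 X, (wt q l n : ℂ) * ee (n * ((h : ℝ) / G)) =
      (1 / q) * ∑ k ∈ range q, ee (-(l * (k : ℝ) / q)) * ∑ n ∈ Ioc 0 X, (vonMangoldt n : ℂ) * ee (n * ((h : ℝ) / G + k / q)) := by
    simp_rw [mul_sum]
    rw [sum_comm]
    refine sum_congr rfl (fun n _ => ?_)
    rw [wt_expand q l hqpos n n rfl, mul_sum, sum_mul]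
    refine sum_congr rfl (fun k _ => ?_)
    have : ee ((((n : ℤ) - (l : ℤ) : ℤ) : ℝ) * k / q) * ee (n * ((h : ℝ) / G)) = ee (-(l * (k : ℝ) / q)) * ee (n * ((h : ℝ) / G + k / q)) := by
      rw [← ee_add, ← ee_add]; congr 1; push_cast; ring
    linear_combination (1 / (q:ℂ)) * (vonMangoldt n : ℂ) * this
  rw [e, norm_mul]
  have h1 : ‖∑ k ∈ range q, ee (-(l * (k : ℝ) / q)) * ∑ n ∈ Ioc 0 X, (vonMangoldt n : ℂ) * ee (n * ((h : ℝ) / G + k / q))‖ ≤ q * Bv X u := by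
    refine (norm_sum_le _ _).trans ?_
    calc _ ≤ ∑ k ∈ range q, Bv X u := sum_le_sum (fun k hk => by rw [norm_mul, norm_ee, one_mul]; exact key k hk)
      _ = _ := by simp
  have h2 : ‖(1 / q : ℂ)‖ = 1 / q := by simp
  rw [h2]
  calc _ ≤ (1 / (q:ℝ)) * (q * Bv X u) := mul_le_mul_of_nonneg_left h1 (by positivity)
    _ = _ := by field_simp

lemma sum_range_shift_mod (H : ℕ → ℂ) (Q c : ℕ) (hQ : 0 < Q) : ∑ m ∈ range Q, H ((c + m) % Q) = ∑ m ∈ range Q, H m := by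
  induction c with
  | zero => exact sum_congr rfl (fun m hm => by rw [zero_add, Nat.mod_eq_of_lt (mem_range.1 hm)])
  | succ c ih =>
    rw [← ih]
    have h1 := sum_range_succ (fun m => H ((c + m) % Q)) Q
    have h2 := sum_range_succ' (fun m => H ((c + m) % Q)) Q
    rw [h1] at h2
    simp only [Nat.add_mod_right, add_zero] at h2
    have h3 := add_right_cancel h2
    rw [h3]
    exact sum_congr rfl (fun m _ => by congr 2; ring)

lemma Bv_nonneg (X u : ℕ) : 0 ≤ Bv X u := by
  unfold Bv
  have := log_natCast_nonneg X
  positivity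

lemma moment_disc (g : ℕ) (hg : 2 ≤ g) (u N M X l : ℕ) (hu : 1 ≤ u) (hM : 4 * u + N + 4 * u + 1 ≤ M) (hX : g ^ M ≤ X) (k : ℕ) :
    ‖∑ n ∈ Ioc 0 X, (wt (g - 1) l n : ℂ) * ((Xf g (4 * u) N n : ℂ) ^ k - EX g N (fun y => (y : ℂ) ^ k))‖ ≤
      (7 * (g : ℝ) ^ 3 * (1 + (4 * u + N : ℕ)) ^ 2) ^ k * Bv X u := by
  set a := 4 * u with ha
  set Q := g ^ N with hQ
  have hQpos : 0 < Q := by positivity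
  let T : (ℕ → ℂ) →ₗ[ℂ] ℂ :=
    { toFun := fun F => ∑ n ∈ Ioc 0 X, (wt (g - 1) l n : ℂ) * (F n - (∑ m ∈ range Q, F (n + g ^ a * m)) / (Q : ℂ))
      map_add' := by
        intro F F'
        rw [← sum_add_distrib]
        refine sum_congr rfl (fun n _ => ?_)
        simp only [Pi.add_apply, sum_add_distrib]; ring
      map_smul' := by
        intro c F
        simp only [RingHom.id_apply, smul_eq_mul]
        rw [mul_sum]
        refine sum_congr rfl (fun n _ => ?_)
        simp only [Pi.smul_apply, smul_eq_mul, ← mul_sum]; ring }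
  have hT : ∀ F, T F = ∑ n ∈ Ioc 0 X, (wt (g - 1) l n : ℂ) * (F n - (∑ m ∈ range Q, F (n + g ^ a * m)) / (Q : ℂ)) := fun _ => rfl
  have := WN_pow (WN_Xf g hg a N) k T (Bv X u) (Bv_nonneg X u) ?_
  · rw [hT] at this
    convert this using 4 with n hn
    simp only [Pi.pow_apply]
    congr 1
    unfold EX
    congr 1
    have h1 : ∀ m, (Xf g a N (n + g ^ a * m) : ℂ) ^ k = (fun r => ((((sg g r : ℝ) - ((g : ℝ) - 1) / 2 * N : ℝ)) : ℂ) ^ k) ((n / g ^ a + m) % Q) := by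
      intro m
      simp only [Xf]
      rw [Nat.add_mul_div_left _ _ (by positivity)]
    simp_rw [h1]
    rw [sum_range_shift_mod (fun r => ((((sg g r : ℝ) - ((g : ℝ) - 1) / 2 * N : ℝ)) : ℂ) ^ k) Q _ hQpos]
  · intro h
    rw [hT]
    have hQc : (Q : ℂ) ≠ 0 := by exact_mod_cast hQpos.ne'
    have h1 : ∀ n : ℕ, (∑ m ∈ range Q, ee (((n + g ^ a * m : ℕ) : ℝ) * ((h : ℝ) / ((g ^ (a + N) : ℕ) : ℝ)))) =
        ee (n * ((h : ℝ) / ((g ^ (a + N) : ℕ) : ℝ))) * (if (Q : ℤ) ∣ h then (Q : ℂ) else 0) := by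
      intro n
      rw [← sum_ee_range Q hQpos h, mul_sum]
      refine sum_congr rfl (fun m _ => ?_)
      rw [← ee_add]; congr 1
      have : (g : ℝ) ≠ 0 := by positivity
      rw [hQ]; push_cast; rw [pow_add]; field_simp
    simp_rw [h1]
    by_cases hd : (Q : ℤ) ∣ h
    · simp only [if_pos hd]
      have : ∀ z : ℂ, z - z * Q / Q = 0 := by intro z; field_simp; ring
      simp [this, Bv_nonneg]
    · simp only [if_neg hd, mul_zero, zero_div, sub_zero]
      exact exp_sum_ap g hg u N M X l hu hM hX h hd

lemma taylor_aux (ζ : ℂ) (hre : ζ.re = 0) (hn : ‖ζ‖ = 1) (K : ℕ) : ∀ x : ℝ, 0 ≤ x →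
    ‖Complex.exp (ζ * x) - ∑ k ∈ range K, (ζ * x) ^ k / (k.factorial : ℂ)‖ ≤ x ^ K / K.factorial := by
  induction K with
  | zero =>
    intro x hx
    simp [Complex.norm_exp, hre]
  | succ K ih =>
    intro x hx
    have hd : ∀ t : ℝ, HasDerivAt (fun x : ℝ => Complex.exp (ζ * x) - ∑ k ∈ range (K + 1), (ζ * x) ^ k / (k.factorial : ℂ))
        (ζ * (Complex.exp (ζ * t) - ∑ k ∈ range K, (ζ * t) ^ k / (k.factorial : ℂ))) t := by
      intro t
      have hlin : HasDerivAt (fun x : ℝ => ζ * (x : ℂ)) ζ t := by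
        simpa using (Complex.ofRealCLM.hasDerivAt (x := t)).const_mul ζ
      have h1 := hlin.cexp
      have h2 : ∀ k ∈ range (K + 1), HasDerivAt (fun x : ℝ => (ζ * (x : ℂ)) ^ k / (k.factorial : ℂ))
          ((k : ℂ) * (ζ * t) ^ (k - 1) * ζ / (k.factorial : ℂ)) t := by
        intro k _; exact (hlin.pow k).div_const _
      have h3 := h1.sub (HasDerivAt.fun_sum h2)
      refine h3.congr_deriv (Eq.symm ?_)
      rw [sum_range_succ', mul_sub, mul_sum]
      simp only [Nat.cast_zero, zero_mul, zero_div, add_zero]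
      congr 1
      · ring
      · refine sum_congr rfl (fun k _ => ?_)
        rw [Nat.factorial_succ, Nat.add_sub_cancel]
        have : (k.factorial : ℂ) ≠ 0 := by exact_mod_cast k.factorial_ne_zero
        have : ((k : ℂ) + 1) ≠ 0 := by exact_mod_cast k.succ_ne_zero
        push_cast; field_simp
    have hB : ∀ t : ℝ, HasDerivAt (fun x : ℝ => x ^ (K + 1) / ((K + 1).factorial : ℝ)) (t ^ K / K.factorial) t := by
      intro t
      have := (hasDerivAt_pow (K + 1) t).div_const ((K + 1).factorial : ℝ)
      refine this.congr_deriv (Eq.symm ?_)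
      rw [Nat.factorial_succ, Nat.add_sub_cancel]
      have : (K.factorial : ℝ) ≠ 0 := by exact_mod_cast K.factorial_ne_zero
      have : ((K : ℝ) + 1) ≠ 0 := by positivity
      push_cast; field_simp
    refine image_norm_le_of_norm_deriv_right_le_deriv_boundary (a := 0) (b := x)
      (fun t _ => (hd t).continuousAt.continuousWithinAt) (fun t _ => (hd t).hasDerivWithinAt) ?_ hB ?_ ⟨hx, le_rfl⟩
    · simp [sum_range_succ']
    · intro t ht
      rw [norm_mul, hn, one_mul]; exact ih t ht.1

lemma taylor_ee (x : ℝ) (K : ℕ) :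
    ‖Complex.exp (Complex.I * x) - ∑ k ∈ range K, (Complex.I * x) ^ k / (k.factorial : ℂ)‖ ≤ |x| ^ K / K.factorial := by
  rcases le_total 0 x with h | h
  · rw [abs_of_nonneg h]; exact taylor_aux _ (by simp) (by simp) K x h
  · rw [abs_of_nonpos h]
    have := taylor_aux (-Complex.I) (by simp) (by simp) K (-x) (by linarith)
    simpa using this

lemma EX_exp (g : ℕ) (hg : 2 ≤ g) (N : ℕ) (z : ℂ) :
    EX g N (fun y => Complex.exp (z * y)) = ((∑ d ∈ range g, Complex.exp (z * ((d : ℝ) - ((g : ℝ) - 1) / 2 : ℝ))) / g) ^ N := by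
  have hg0 : (g : ℂ) ≠ 0 := by exact_mod_cast (by omega : g ≠ 0)
  unfold EX
  rw [div_pow]; push_cast
  congr 1
  induction N with
  | zero => simp [sg]
  | succ N ih =>
    rw [pow_succ', sum_range_mul', pow_succ, ← ih, sum_mul]
    refine sum_congr rfl (fun j _ => ?_)
    rw [mul_sum]
    refine sum_congr rfl (fun d hd => ?_)
    rw [sg_add g hg j d (mem_range.1 hd), ← Complex.exp_add]
    congr 1; push_cast; ring

/-- real model mean -/
noncomputable def ER (g N : ℕ) (φ : ℝ → ℝ) : ℝ :=
  (∑ m ∈ range (g ^ N), φ ((sg g m : ℝ) - ((g : ℝ) - 1) / 2 * N)) / ((g ^ N : ℕ) : ℝ)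

lemma EX_ofReal (g N : ℕ) (φ : ℝ → ℝ) : EX g N (fun y => (φ y : ℂ)) = (ER g N φ : ℂ) := by
  unfold EX ER; push_cast; rfl

lemma ER_mono (g N : ℕ) (φ ψ : ℝ → ℝ) (h : ∀ y, φ y ≤ ψ y) : ER g N φ ≤ ER g N ψ := by
  unfold ER
  exact div_le_div_of_nonneg_right (sum_le_sum fun m _ => h _) (by positivity)

lemma norm_EX_le (g N : ℕ) (φ : ℝ → ℂ) (ψ : ℝ → ℝ) (h : ∀ y, ‖φ y‖ ≤ ψ y) : ‖EX g N φ‖ ≤ ER g N ψ := by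
  unfold EX ER
  rw [norm_div, Complex.norm_natCast]
  exact div_le_div_of_nonneg_right ((norm_sum_le _ _).trans (sum_le_sum fun m _ => h _)) (by positivity)

lemma sum_centred (g : ℕ) : ∑ d ∈ range g, ((d : ℝ) - ((g : ℝ) - 1) / 2) = 0 := by
  induction g with
  | zero => simp
  | succ g ih =>
    have h : ∀ n : ℕ, ∑ d ∈ range n, (d : ℝ) = n * (n - 1) / 2 := by
      intro n; induction n with
      | zero => simp
      | succ n ih => rw [sum_range_succ, ih]; push_cast; ring
    rw [sum_sub_distrib, h, sum_const, card_range, nsmul_eq_mul]; push_cast; ring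

lemma sum_centred_sq (g : ℕ) : ∑ d ∈ range g, ((d : ℝ) - ((g : ℝ) - 1) / 2) ^ 2 = g * (((g : ℝ) ^ 2 - 1) / 12) := by
  have h : ∀ (n : ℕ) (c : ℝ), ∑ d ∈ range n, ((d : ℝ) - c) ^ 2 = n * (n - 1) * (2 * n - 1) / 6 - c * (n * (n - 1)) + n * c ^ 2 := by
    intro n c; induction n with
    | zero => simp
    | succ n ih => rw [sum_range_succ, ih]; push_cast; ring
  rw [h]; ring

lemma centred_abs (g d : ℕ) (hg : 2 ≤ g) (hd : d < g) : |(d : ℝ) - ((g : ℝ) - 1) / 2| ≤ g := by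
  have h1 : (d : ℝ) ≤ g := by exact_mod_cast hd.le
  have h2 : (0 : ℝ) ≤ d := by positivity
  have h3 : (2 : ℝ) ≤ g := by exact_mod_cast hg
  rw [abs_le]; constructor <;> linarith

lemma ER_exp_le (g : ℕ) (hg : 2 ≤ g) (N : ℕ) (t : ℝ) (ht : |t| * g ≤ 1) :
    ER g N (fun y => exp (t * y)) ≤ exp (t ^ 2 * g ^ 2 * N) := by
  have hgr : (0 : ℝ) < g := by positivity
  have h1 := EX_exp g hg N (t : ℂ)
  have h2 : EX g N (fun y => Complex.exp ((t : ℂ) * y)) = (ER g N (fun y => exp (t * y)) : ℂ) := by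
    rw [← EX_ofReal]; push_cast; rfl
  rw [h2] at h1
  have h3 : ER g N (fun y => exp (t * y)) = ((∑ d ∈ range g, exp (t * ((d : ℝ) - ((g : ℝ) - 1) / 2))) / g) ^ N := by
    exact_mod_cast h1
  rw [h3]
  have h4 : (∑ d ∈ range g, exp (t * ((d : ℝ) - ((g : ℝ) - 1) / 2))) / g ≤ exp (t ^ 2 * g ^ 2) := by
    rw [div_le_iff₀ hgr]
    calc _ ≤ ∑ d ∈ range g, (1 + t ^ 2 * g ^ 2 + t * ((d : ℝ) - ((g : ℝ) - 1) / 2)) := by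
          refine sum_le_sum (fun d hd => ?_)
          set z := (d : ℝ) - ((g : ℝ) - 1) / 2
          have hz : |z| ≤ g := centred_abs g d hg (mem_range.1 hd)
          have h5 : |t * z| ≤ 1 := by
            rw [abs_mul]; exact (mul_le_mul_of_nonneg_left hz (abs_nonneg _)).trans ht
          have h6 := (abs_le.1 (Real.abs_exp_sub_one_sub_id_le h5)).2
          have h7 : z ^ 2 ≤ (g : ℝ) ^ 2 := sq_le_sq' (by linarith [(abs_le.1 hz).1]) (abs_le.1 hz).2
          have h8 := mul_le_mul_of_nonneg_left h7 (sq_nonneg t)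
          rw [mul_pow] at h6
          linarith
      _ = (1 + t ^ 2 * g ^ 2) * g := by
          rw [sum_add_distrib, ← mul_sum, sum_centred, sum_const, card_range, nsmul_eq_mul]; ring
      _ ≤ _ := by
          apply mul_le_mul_of_nonneg_right _ hgr.le
          linarith [Real.add_one_le_exp (t ^ 2 * (g:ℝ) ^ 2)]
  calc _ ≤ exp (t ^ 2 * g ^ 2) ^ N := by
        apply pow_le_pow_left₀ _ h4
        exact div_nonneg (sum_nonneg fun _ _ => (exp_pos _).le) hgr.le
    _ = _ := by rw [← Real.exp_nat_mul]; congr 1; ring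

lemma EX_add (g N : ℕ) (φ ψ : ℝ → ℂ) : EX g N (fun y => φ y + ψ y) = EX g N φ + EX g N ψ := by
  unfold EX; rw [sum_add_distrib, add_div]

lemma EX_sum (g N : ℕ) {ι : Type} (s : Finset ι) (c : ι → ℂ) (φ : ι → ℝ → ℂ) :
    EX g N (fun y => ∑ i ∈ s, c i * φ i y) = ∑ i ∈ s, c i * EX g N (φ i) := by
  unfold EX; rw [sum_comm, sum_div]
  refine sum_congr rfl (fun i _ => ?_)
  rw [← mul_sum, mul_div_assoc]

set_option maxHeartbeats 800000 in
lemma major1 (g : ℕ) (hg : 2 ≤ g) (u N M X l : ℕ) (hu : 1 ≤ u) (hM : 4 * u + N + 4 * u + 1 ≤ M) (hX : g ^ M ≤ X)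
    (K : ℕ) (hK : Even K) (β t : ℝ) (ht : 0 < t) (htg : t * g ≤ 1) (hβ : 2 * π * |β| * exp 1 ≤ t) :
    ‖∑ n ∈ Ioc 0 X, (wt (g - 1) l n : ℂ) * ee (β * Xf g (4 * u) N n) -
      ((∑ n ∈ Ioc 0 X, wt (g - 1) l n : ℝ) : ℂ) * EX g N (fun y => ee (β * y))‖ ≤
    Bv X u * ((K + 1) * (1 + 2 * π * |β| * (7 * (g : ℝ) ^ 3 * (1 + (4 * u + N : ℕ)) ^ 2)) ^ K) +
      4 * (∑ n ∈ Ioc 0 X, wt (g - 1) l n) * (exp (-K) * exp (t ^ 2 * g ^ 2 * N)) := by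
  set A : ℝ := 7 * (g : ℝ) ^ 3 * (1 + (4 * u + N : ℕ)) ^ 2 with hA
  have hA0 : 0 ≤ A := by positivity
  set y : ℝ := 2 * π * |β| with hy
  have hy0 : 0 ≤ y := by positivity
  set W := ∑ n ∈ Ioc 0 X, wt (g - 1) l n with hW
  have hW0 : 0 ≤ W := sum_nonneg fun n _ => wt_nonneg _ _ _
  have hBv := Bv_nonneg X u
  have hmd := moment_disc g hg u N M X l hu hM hX
  rw [← hA] at hmd
  set F : ℕ → ℝ := Xf g (4 * u) N with hF
  set c : ℕ → ℂ := fun k => (Complex.I * ((2 * π * β : ℝ) : ℂ)) ^ k / (k.factorial : ℂ) with hc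
  have hcn : ∀ k, ‖c k‖ = y ^ k / k.factorial := by
    intro k
    simp only [hc, norm_div, norm_pow, norm_mul, Complex.norm_I, one_mul, Complex.norm_real, Complex.norm_natCast]
    rw [hy]; simp [abs_of_pos pi_pos]
  set R : ℝ → ℂ := fun x => ee (β * x) - ∑ k ∈ range K, c k * (x : ℂ) ^ k with hR
  have hRn : ∀ x, ‖R x‖ ≤ y ^ K / K.factorial * x ^ K := by
    intro x
    have h1 := taylor_ee (2 * π * β * x) K
    have h2 : R x = Complex.exp (Complex.I * ((2 * π * β * x : ℝ) : ℂ)) - ∑ k ∈ range K, (Complex.I * ((2 * π * β * x : ℝ) : ℂ)) ^ k / (k.factorial : ℂ) := by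
      simp only [hR, hc]
      congr 1
      · unfold ee; congr 1; push_cast; ring
      · refine sum_congr rfl (fun k _ => ?_)
        push_cast; rw [← mul_div_right_comm, ← mul_pow]; congr 2; ring
    rw [h2]
    refine h1.trans (le_of_eq ?_)
    have h3 : |2 * π * β * x| = y * |x| := by
      rw [hy, abs_mul, abs_mul (2 * π) β, abs_of_pos (by positivity : 0 < 2 * π)]
    rw [h3, mul_pow, hK.pow_abs]; ring
  have hdec : ∀ x, ee (β * x) = ∑ k ∈ range K, c k * (x : ℂ) ^ k + R x := by intro x; simp [hR]
  set m : ℝ := ER g N (fun x => x ^ K) with hm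
  have hEXK : EX g N (fun x => (x : ℂ) ^ K) = (m : ℂ) := by
    rw [hm, ← EX_ofReal]; push_cast; rfl
  have hEXR : ‖EX g N R‖ ≤ y ^ K / K.factorial * m := by
    refine (norm_EX_le g N R _ hRn).trans (le_of_eq ?_)
    rw [hm]; unfold ER; rw [← mul_sum, mul_div_assoc]
  have hEXe : EX g N (fun x => ee (β * x)) = ∑ k ∈ range K, c k * EX g N (fun x => (x : ℂ) ^ k) + EX g N R := by
    rw [← EX_sum, ← EX_add]; congr 1; funext x; exact hdec x
  have hmain : ∑ n ∈ Ioc 0 X, (wt (g - 1) l n : ℂ) * ee (β * F n) - (W : ℂ) * EX g N (fun y => ee (β * y)) =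
      ∑ k ∈ range K, c k * (∑ n ∈ Ioc 0 X, (wt (g - 1) l n : ℂ) * ((F n : ℂ) ^ k - EX g N (fun y => (y : ℂ) ^ k))) +
      ∑ n ∈ Ioc 0 X, (wt (g - 1) l n : ℂ) * R (F n) - (W : ℂ) * EX g N R := by
    rw [hEXe, hW]; push_cast
    simp_rw [hdec, mul_add, mul_sub, sum_add_distrib, sum_sub_distrib]
    have e1 : ∑ n ∈ Ioc 0 X, (wt (g - 1) l n : ℂ) * ∑ k ∈ range K, c k * (F n : ℂ) ^ k =
        ∑ k ∈ range K, c k * ∑ n ∈ Ioc 0 X, (wt (g - 1) l n : ℂ) * (F n : ℂ) ^ k := by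
      simp_rw [mul_sum]; rw [sum_comm]
      exact sum_congr rfl (fun k _ => sum_congr rfl (fun n _ => by ring))
    have e2 : (∑ n ∈ Ioc 0 X, (wt (g - 1) l n : ℂ)) * ∑ k ∈ range K, c k * EX g N (fun x => (x : ℂ) ^ k) =
        ∑ k ∈ range K, c k * ∑ n ∈ Ioc 0 X, (wt (g - 1) l n : ℂ) * EX g N (fun x => (x : ℂ) ^ k) := by
      rw [mul_sum]
      exact sum_congr rfl (fun k _ => by rw [← sum_mul]; ring)
    rw [e1, e2]; simp_rw [mul_sub, sum_sub_distrib]; ring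
  have hRs : ‖∑ n ∈ Ioc 0 X, (wt (g - 1) l n : ℂ) * R (F n)‖ ≤ y ^ K / K.factorial * (W * m + A ^ K * Bv X u) := by
    have h1 : ‖∑ n ∈ Ioc 0 X, (wt (g - 1) l n : ℂ) * R (F n)‖ ≤ y ^ K / K.factorial * ∑ n ∈ Ioc 0 X, wt (g - 1) l n * F n ^ K := by
      refine (norm_sum_le _ _).trans ?_
      rw [mul_sum]
      refine sum_le_sum (fun n _ => ?_)
      rw [norm_mul, Complex.norm_real, norm_of_nonneg (wt_nonneg _ _ _)]
      calc _ ≤ wt (g - 1) l n * (y ^ K / K.factorial * F n ^ K) := mul_le_mul_of_nonneg_left (hRn _) (wt_nonneg _ _ _)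
        _ = _ := by ring
    refine h1.trans (mul_le_mul_of_nonneg_left ?_ (by positivity))
    have h2 := hmd K
    rw [hEXK] at h2
    have h3 : ∑ n ∈ Ioc 0 X, (wt (g - 1) l n : ℂ) * ((F n : ℂ) ^ K - (m : ℂ)) = ((∑ n ∈ Ioc 0 X, wt (g - 1) l n * F n ^ K - W * m : ℝ) : ℂ) := by
      rw [hW]; push_cast; rw [sum_mul, ← sum_sub_distrib]
      exact sum_congr rfl (fun n _ => by ring)
    rw [h3, Complex.norm_real] at h2
    have := (abs_le.1 h2).2
    linarith
  have hmt : y ^ K / K.factorial * m ≤ 2 * (exp (-K) * exp (t ^ 2 * g ^ 2 * N)) := by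
    have h1 : t ^ K / K.factorial * m ≤ 2 * exp (t ^ 2 * g ^ 2 * N) := by
      have h2 : t ^ K / K.factorial * m = ER g N (fun x => t ^ K / K.factorial * x ^ K) := by
        rw [hm]; unfold ER; rw [← mul_sum, mul_div_assoc]
      have h3 : ER g N (fun x => t ^ K / K.factorial * x ^ K) ≤ ER g N (fun x => exp (t * x) + exp ((-t) * x)) := by
        apply ER_mono
        intro x
        have h4 := Real.pow_div_factorial_le_exp |t * x| (abs_nonneg _) K
        rw [hK.pow_abs, mul_pow] at h4
        have h5 : exp |t * x| ≤ exp (t * x) + exp ((-t) * x) := by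
          rcases abs_cases (t * x) with h | h
          · rw [h.1]; linarith [exp_pos ((-t) * x)]
          · rw [h.1, ← neg_mul]; linarith [exp_pos (t * x)]
        calc _ = t ^ K * x ^ K / K.factorial := by ring
          _ ≤ _ := h4.trans h5
      have h6 : ER g N (fun x => exp (t * x) + exp ((-t) * x)) = ER g N (fun x => exp (t * x)) + ER g N (fun x => exp ((-t) * x)) := by
        unfold ER; rw [sum_add_distrib, add_div]
      have h7 := ER_exp_le g hg N t (by rw [abs_of_pos ht]; exact htg)
      have h8 := ER_exp_le g hg N (-t) (by rw [abs_neg, abs_of_pos ht]; exact htg)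
      rw [neg_sq] at h8
      rw [h2]; linarith
    have hm0 : 0 ≤ m := by
      rw [hm]; unfold ER
      exact div_nonneg (sum_nonneg fun _ _ => hK.pow_nonneg _) (by positivity)
    have h9 : y ^ K ≤ exp (-K) * t ^ K := by
      have : y ≤ exp (-1) * t := by
        rw [Real.exp_neg, ← div_eq_inv_mul, le_div_iff₀ (exp_pos _)]; exact hβ
      calc y ^ K ≤ (exp (-1) * t) ^ K := pow_le_pow_left₀ hy0 this K
        _ = _ := by rw [mul_pow, ← Real.exp_nat_mul]; congr 2; ring
    calc y ^ K / K.factorial * m ≤ exp (-K) * t ^ K / K.factorial * m := by gcongr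
      _ = exp (-K) * (t ^ K / K.factorial * m) := by ring
      _ ≤ exp (-K) * (2 * exp (t ^ 2 * g ^ 2 * N)) := mul_le_mul_of_nonneg_left h1 (exp_pos _).le
      _ = _ := by ring
  have hterm : ∀ k ∈ range (K + 1), y ^ k / k.factorial * A ^ k ≤ (1 + y * A) ^ K := by
    intro k hk
    have h1 : (1 : ℝ) ≤ k.factorial := by exact_mod_cast Nat.factorial_pos k
    have hyA : 0 ≤ y * A := by positivity
    calc y ^ k / k.factorial * A ^ k ≤ y ^ k / 1 * A ^ k := by gcongr
      _ = (y * A) ^ k := by rw [div_one, ← mul_pow]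
      _ ≤ (1 + y * A) ^ k := pow_le_pow_left₀ hyA (by linarith) k
      _ ≤ (1 + y * A) ^ K := pow_le_pow_right₀ (by linarith) (by have := mem_range.1 hk; omega)
  have hsum1 : ‖∑ k ∈ range K, c k * (∑ n ∈ Ioc 0 X, (wt (g - 1) l n : ℂ) * ((F n : ℂ) ^ k - EX g N (fun y => (y : ℂ) ^ k)))‖ +
      y ^ K / K.factorial * (A ^ K * Bv X u) ≤ Bv X u * ((K + 1) * (1 + y * A) ^ K) := by
    have h1 : ‖∑ k ∈ range K, c k * (∑ n ∈ Ioc 0 X, (wt (g - 1) l n : ℂ) * ((F n : ℂ) ^ k - EX g N (fun y => (y : ℂ) ^ k)))‖ ≤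
        ∑ k ∈ range K, y ^ k / k.factorial * A ^ k * Bv X u := by
      refine (norm_sum_le _ _).trans (sum_le_sum fun k _ => ?_)
      rw [norm_mul, hcn, mul_assoc]
      exact mul_le_mul_of_nonneg_left (hmd k) (by positivity)
    calc _ ≤ ∑ k ∈ range K, y ^ k / k.factorial * A ^ k * Bv X u + y ^ K / K.factorial * A ^ K * Bv X u := by
          rw [← mul_assoc]; exact add_le_add h1 le_rfl
      _ = (∑ k ∈ range (K + 1), y ^ k / k.factorial * A ^ k) * Bv X u := by rw [sum_range_succ, add_mul, sum_mul]
      _ ≤ (∑ k ∈ range (K + 1), (1 + y * A) ^ K) * Bv X u := mul_le_mul_of_nonneg_right (sum_le_sum hterm) hBv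
      _ = _ := by rw [sum_const, card_range, nsmul_eq_mul]; push_cast; ring
  have hWR : ‖(W : ℂ) * EX g N R‖ ≤ W * (y ^ K / K.factorial * m) := by
    rw [norm_mul, Complex.norm_real, norm_of_nonneg hW0]
    exact mul_le_mul_of_nonneg_left hEXR hW0
  have hWm := mul_le_mul_of_nonneg_left hmt hW0
  rw [hmain]
  refine (norm_sub_le _ _).trans ?_
  have h10 := norm_add_le (∑ k ∈ range K, c k * (∑ n ∈ Ioc 0 X, (wt (g - 1) l n : ℂ) * ((F n : ℂ) ^ k - EX g N (fun y => (y : ℂ) ^ k))))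
      (∑ n ∈ Ioc 0 X, (wt (g - 1) l n : ℂ) * R (F n))
  have h11 : y ^ K / K.factorial * (W * m + A ^ K * Bv X u) = W * (y ^ K / K.factorial * m) + y ^ K / K.factorial * (A ^ K * Bv X u) := by ring
  rw [h11] at hRs
  have h12 : 4 * W * (exp (-K) * exp (t ^ 2 * g ^ 2 * N)) = 2 * (W * (2 * (exp (-K) * exp (t ^ 2 * g ^ 2 * N)))) := by ring
  rw [h12]
  linarith

lemma pow_sub_pow_norm (z w : ℂ) (hz : ‖z‖ ≤ 1) (hw : ‖w‖ ≤ 1) (N : ℕ) : ‖z ^ N - w ^ N‖ ≤ N * ‖z - w‖ := by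
  induction N with
  | zero => simp
  | succ N ih =>
    have e : z ^ (N + 1) - w ^ (N + 1) = z ^ N * (z - w) + (z ^ N - w ^ N) * w := by ring
    rw [e]
    refine (norm_add_le _ _).trans ?_
    rw [norm_mul, norm_mul, norm_pow]
    have h1 : ‖z‖ ^ N * ‖z - w‖ ≤ 1 * ‖z - w‖ := mul_le_mul_of_nonneg_right (pow_le_one₀ (norm_nonneg _) hz) (norm_nonneg _)
    have h2 : ‖z ^ N - w ^ N‖ * ‖w‖ ≤ ‖z ^ N - w ^ N‖ * 1 := mul_le_mul_of_nonneg_left hw (norm_nonneg _)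
    push_cast; linarith

lemma exp_neg_quad (v : ℝ) (hv : 0 ≤ v) : |exp (-v) - 1 + v| ≤ v ^ 2 := by
  have h0 := Real.add_one_le_exp (-v)
  rw [abs_of_nonneg (by linarith)]
  rcases le_total v 1 with h | h
  · have := (abs_le.1 (Real.abs_exp_sub_one_sub_id_le (x := -v) (by rw [abs_neg, abs_of_nonneg hv]; exact h))).2
    rw [neg_sq] at this; linarith
  · have : exp (-v) ≤ 1 := Real.exp_le_one_iff.2 (by linarith)
    nlinarith

noncomputable def sig2 (g : ℕ) : ℝ := ((g : ℝ) ^ 2 - 1) / 12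

lemma sig2_pos (g : ℕ) (hg : 2 ≤ g) : 0 < sig2 g := by
  unfold sig2
  have : (2 : ℝ) ≤ g := by exact_mod_cast hg
  nlinarith

noncomputable def cf (g : ℕ) (β : ℝ) : ℂ :=
  (∑ d ∈ range g, Complex.exp (((2 * π * β : ℝ) * Complex.I) * ((d : ℝ) - ((g : ℝ) - 1) / 2 : ℝ))) / g

lemma cf_norm (g : ℕ) (β : ℝ) : ‖cf g β‖ ≤ 1 := by
  unfold cf
  rw [norm_div, Complex.norm_natCast]
  apply div_le_one_of_le₀ _ (by positivity)
  refine (norm_sum_le _ _).trans ?_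
  calc _ ≤ ∑ d ∈ range g, (1 : ℝ) := sum_le_sum (fun d _ => by
        rw [mul_right_comm, ← Complex.ofReal_mul, Complex.norm_exp_ofReal_mul_I])
    _ = _ := by simp

lemma cf_approx (g : ℕ) (hg : 2 ≤ g) : ∃ C : ℝ, 0 < C ∧ ∀ β : ℝ, |β| ≤ 1 →
    ‖cf g β - ((exp (-(2 * π ^ 2 * sig2 g * β ^ 2)) : ℝ) : ℂ)‖ ≤ C * |β| ^ 3 := by
  have hs := sig2_pos g hg
  have hgr : (0 : ℝ) < g := by positivity
  refine ⟨(2 * π * g) ^ 3 / 6 + (2 * π ^ 2 * sig2 g) ^ 2, by positivity, ?_⟩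
  intro β hβ
  set v : ℝ := 2 * π ^ 2 * sig2 g * β ^ 2 with hv
  have hv0 : 0 ≤ v := by positivity
  have h1 := exp_neg_quad v hv0
  have h2 : ‖cf g β - ((1 - v : ℝ) : ℂ)‖ ≤ (2 * π * g) ^ 3 / 6 * |β| ^ 3 := by
    set z : ℕ → ℝ := fun d => (d : ℝ) - ((g : ℝ) - 1) / 2 with hz
    set f : ℕ → ℂ := fun d => ∑ k ∈ range 3, (Complex.I * ((2 * π * β * z d : ℝ) : ℂ)) ^ k / (k.factorial : ℂ) with hf
    have h3 : ((1 - v : ℝ) : ℂ) = (∑ d ∈ range g, f d) / g := by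
      have hg0 : (g : ℂ) ≠ 0 := by exact_mod_cast hgr.ne'
      rw [eq_div_iff hg0]
      have e : ∀ d, f d = ((1 - (2 * π * β) ^ 2 / 2 * z d ^ 2 : ℝ) : ℂ) + ((2 * π * β * z d : ℝ) : ℂ) * Complex.I := by
        intro d
        simp only [hf, sum_range_succ, sum_range_zero, Nat.factorial]
        push_cast
        have := Complex.I_sq
        linear_combination ((2 * π * β * z d) ^ 2 / 2 : ℂ) * this
      simp_rw [e, sum_add_distrib, ← sum_mul, ← Complex.ofReal_sum, ← mul_sum]
      rw [show ∑ d ∈ range g, z d = 0 from sum_centred g, sum_sub_distrib, ← mul_sum,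
        show ∑ d ∈ range g, z d ^ 2 = _ from sum_centred_sq g, sum_const, card_range, nsmul_eq_mul, hv, sig2]
      push_cast; ring
    rw [h3]; unfold cf
    rw [← sub_div, ← sum_sub_distrib, norm_div, Complex.norm_natCast, div_le_iff₀ hgr]
    refine (norm_sum_le _ _).trans ?_
    calc _ ≤ ∑ d ∈ range g, (2 * π * g) ^ 3 / 6 * |β| ^ 3 := by
          refine sum_le_sum (fun d hd => ?_)
          have h4 := taylor_ee (2 * π * β * z d) 3
          have h5 : Complex.exp (((2 * π * β : ℝ) * Complex.I) * ((d : ℝ) - ((g : ℝ) - 1) / 2 : ℝ)) =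
              Complex.exp (Complex.I * ((2 * π * β * z d : ℝ) : ℂ)) := by
            congr 1; simp only [hz]; push_cast; ring
          rw [h5]
          refine h4.trans ?_
          have h6 : |2 * π * β * z d| ≤ 2 * π * g * |β| := by
            rw [abs_mul, abs_mul, abs_of_pos (by positivity : 0 < 2 * π)]
            have := centred_abs g d hg (mem_range.1 hd)
            calc _ ≤ 2 * π * |β| * g := mul_le_mul_of_nonneg_left this (by positivity)
              _ = _ := by ring
          have h7 := pow_le_pow_left₀ (abs_nonneg _) h6 3
          have h8 : ((Nat.factorial 3 : ℕ) : ℝ) = 6 := by norm_num [Nat.factorial]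
          rw [h8]
          calc _ ≤ (2 * π * g * |β|) ^ 3 / 6 := by gcongr
            _ = _ := by ring
      _ = _ := by rw [sum_const, card_range, nsmul_eq_mul]; ring
  have h3 : ‖((1 - v : ℝ) : ℂ) - ((exp (-v) : ℝ) : ℂ)‖ ≤ (2 * π ^ 2 * sig2 g) ^ 2 * |β| ^ 3 := by
    rw [← Complex.ofReal_sub, Complex.norm_real, norm_eq_abs]
    have e : |1 - v - exp (-v)| = |exp (-v) - 1 + v| := by rw [← abs_neg]; congr 1; ring
    rw [e]
    refine h1.trans ?_
    have e2 : v ^ 2 = (2 * π ^ 2 * sig2 g) ^ 2 * |β| ^ 4 := by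
      rw [hv, mul_pow, show β ^ 2 = |β| ^ 2 from (sq_abs β).symm]; ring
    rw [e2]
    exact mul_le_mul_of_nonneg_left (pow_le_pow_of_le_one (abs_nonneg _) hβ (by norm_num)) (by positivity)
  calc _ = ‖(cf g β - ((1 - v : ℝ) : ℂ)) + (((1 - v : ℝ) : ℂ) - ((exp (-v) : ℝ) : ℂ))‖ := by congr 1; ring
    _ ≤ _ := (norm_add_le _ _).trans (by linarith)

lemma EX_ee (g : ℕ) (hg : 2 ≤ g) (N : ℕ) (β : ℝ) : EX g N (fun y => ee (β * y)) = cf g β ^ N := by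
  unfold cf
  rw [← EX_exp g hg]
  congr 1; funext y; unfold ee; congr 1; push_cast; ring

lemma exp_lip (a b : ℝ) (ha : 0 ≤ a) (hb : 0 ≤ b) : |exp (-a) - exp (-b)| ≤ |a - b| := by
  wlog h : a ≤ b generalizing a b
  · rw [abs_sub_comm, abs_sub_comm a b]; exact this b a hb ha (by linarith)
  have h1 : exp (-b) ≤ exp (-a) := exp_le_exp.2 (by linarith)
  have h2 : exp (-a) ≤ 1 := Real.exp_le_one_iff.2 (by linarith)
  have h3 := Real.add_one_le_exp (-(b - a))
  have h4 : exp (-b) = exp (-a) * exp (-(b - a)) := by rw [← exp_add]; congr 1; ring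
  rw [abs_of_nonneg (by linarith), abs_of_nonpos (by linarith), h4]
  nlinarith [exp_pos (-a)]

lemma ee_lip (s t : ℝ) : ‖ee s - ee t‖ ≤ 2 * π * |s - t| := by
  have e : ee s - ee t = -(ee t * (1 - ee (s - t))) := by
    rw [mul_sub, ← ee_add]; simp
  rw [e, norm_neg, norm_mul, norm_ee, one_mul]
  exact norm_one_sub_ee_le _

lemma wt_sum_le (q l X : ℕ) : ∑ n ∈ Ioc 0 X, wt q l n ≤ 6 * X :=
  (sum_le_sum fun n _ => wt_le q l n).trans (psi_sum X)

lemma sg_Xf_close (g : ℕ) (hg : 2 ≤ g) (u N M n : ℕ) (L : ℝ) (hu : 1 ≤ u) (hM : M = 4 * u + N + 4 * u + 1)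
    (hn : n < g ^ (M + 1)) (hL1 : (M : ℝ) ≤ L) (hL2 : L ≤ M + 1) :
    |((sg g n : ℝ) - ((g : ℝ) - 1) / 2 * L) - Xf g (4 * u) N n| ≤ 20 * g * u := by
  have h1 := sg_split g hg (4 * u) n
  have h2 := sg_split g hg N (n / g ^ (4 * u))
  have h3 : sg g (n % g ^ (4 * u)) ≤ g * (4 * u) := sg_le g hg _ _ (Nat.mod_lt _ (by positivity))
  have h4 : sg g (n / g ^ (4 * u) / g ^ N) ≤ g * (4 * u + 2) := by
    apply sg_le g hg
    rw [Nat.div_div_eq_div_mul, ← pow_add]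
    apply Nat.div_lt_of_lt_mul
    rw [← pow_add]
    convert hn using 2; omega
  have h5 : (sg g n : ℝ) = sg g (n % g ^ (4 * u)) + sg g (n / g ^ (4 * u) % g ^ N) + sg g (n / g ^ (4 * u) / g ^ N) := by
    exact_mod_cast (by omega : sg g n = sg g (n % g ^ (4 * u)) + sg g (n / g ^ (4 * u) % g ^ N) + sg g (n / g ^ (4 * u) / g ^ N))
  have h3' : (sg g (n % g ^ (4 * u)) : ℝ) ≤ g * (4 * u) := by exact_mod_cast h3
  have h4' : (sg g (n / g ^ (4 * u) / g ^ N) : ℝ) ≤ g * (4 * u + 2) := by exact_mod_cast h4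
  have h6 : (0 : ℝ) ≤ sg g (n % g ^ (4 * u)) := by positivity
  have h7 : (0 : ℝ) ≤ sg g (n / g ^ (4 * u) / g ^ N) := by positivity
  have hg1 : (2 : ℝ) ≤ g := by exact_mod_cast hg
  have hu1 : (1 : ℝ) ≤ u := by exact_mod_cast hu
  have hMr : (M : ℝ) = 8 * u + N + 1 := by rw [hM]; push_cast; ring
  have h8 : 0 ≤ L - N := by linarith
  have h9 : L - N ≤ 10 * u := by linarith
  have h10 : ((g : ℝ) - 1) / 2 * (L - N) ≤ g * (10 * u) := mul_le_mul (by linarith) h9 h8 (by positivity)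
  have h11 : 0 ≤ ((g : ℝ) - 1) / 2 * (L - N) := mul_nonneg (by linarith) h8
  have h12 : (g : ℝ) ≤ g * u := le_mul_of_one_le_right (by positivity) hu1
  unfold Xf
  rw [h5, abs_le]
  constructor <;> nlinarith

lemma major2 (g : ℕ) (hg : 2 ≤ g) : ∃ C : ℝ, 0 < C ∧ ∀ (u N M X l K : ℕ) (L β t : ℝ), 1 ≤ u → M = 4 * u + N + 4 * u + 1 →
    g ^ M ≤ X → X < g ^ (M + 1) → (M : ℝ) ≤ L → L ≤ M + 1 → Even K → 0 < t → t * g ≤ 1 → 2 * π * |β| * exp 1 ≤ t → |β| ≤ 1 →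
    ‖∑ n ∈ Ioc 0 X, (wt (g - 1) l n : ℂ) * ee (β * ((sg g n : ℝ) - ((g : ℝ) - 1) / 2 * L)) -
      ((∑ n ∈ Ioc 0 X, wt (g - 1) l n : ℝ) : ℂ) * ((exp (-(2 * π ^ 2 * sig2 g * β ^ 2 * L)) : ℝ) : ℂ)‖ ≤
    C * X * (u * |β| + N * |β| ^ 3 + exp (-K) * exp (t ^ 2 * g ^ 2 * N)) +
    Bv X u * ((K + 1) * (1 + 2 * π * |β| * (7 * (g : ℝ) ^ 3 * (1 + (4 * u + N : ℕ)) ^ 2)) ^ K) := by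
  obtain ⟨C1, hC1, hcf⟩ := cf_approx g hg
  have hs := sig2_pos g hg
  have hpi := pi_pos
  set D : ℝ := 40 * π * g + C1 + 20 * π ^ 2 * sig2 g + 4 with hD
  refine ⟨6 * D, by positivity, ?_⟩
  intro u N M X l K L β t hu hM hX hX2 hL1 hL2 hK ht htg hβ hβ1
  have hm := major1 g hg u N M X l hu hM.ge hX K hK β t ht htg hβ
  rw [EX_ee g hg] at hm
  set W := ∑ n ∈ Ioc 0 X, wt (g - 1) l n with hW
  have hW0 : 0 ≤ W := sum_nonneg fun n _ => wt_nonneg _ _ _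
  have hW6 : W ≤ 6 * X := wt_sum_le _ _ _
  set v : ℝ := 2 * π ^ 2 * sig2 g * β ^ 2 with hv
  have hv0 : 0 ≤ v := by positivity
  have hβ0 := abs_nonneg β
  have hMr : (M : ℝ) = 8 * u + N + 1 := by rw [hM]; push_cast; ring
  have hu1 : (1 : ℝ) ≤ u := by exact_mod_cast hu
  -- step 1
  have s1 : ‖∑ n ∈ Ioc 0 X, (wt (g - 1) l n : ℂ) * ee (β * ((sg g n : ℝ) - ((g : ℝ) - 1) / 2 * L)) -
      ∑ n ∈ Ioc 0 X, (wt (g - 1) l n : ℂ) * ee (β * Xf g (4 * u) N n)‖ ≤ W * (40 * π * g * (u * |β|)) := by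
    rw [← sum_sub_distrib, hW, sum_mul]
    refine (norm_sum_le _ _).trans (sum_le_sum fun n hn => ?_)
    rw [← mul_sub, norm_mul, Complex.norm_real, norm_of_nonneg (wt_nonneg _ _ _)]
    apply mul_le_mul_of_nonneg_left _ (wt_nonneg _ _ _)
    refine (ee_lip _ _).trans ?_
    rw [← mul_sub, abs_mul]
    have := sg_Xf_close g hg u N M n L hu hM (lt_of_le_of_lt (mem_Ioc.1 hn).2 hX2) hL1 hL2
    calc _ ≤ 2 * π * (|β| * (20 * g * u)) := by gcongr
      _ = _ := by ring
  have s2 : ‖(W : ℂ) * cf g β ^ N - (W : ℂ) * ((exp (-(v * L)) : ℝ) : ℂ)‖ ≤ W * (C1 * (N * |β| ^ 3) + 20 * π ^ 2 * sig2 g * (u * |β|)) := by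
    rw [← mul_sub, norm_mul, Complex.norm_real, norm_of_nonneg hW0]
    apply mul_le_mul_of_nonneg_left _ hW0
    have h1 : ‖cf g β ^ N - ((exp (-v) : ℝ) : ℂ) ^ N‖ ≤ C1 * (N * |β| ^ 3) := by
      refine (pow_sub_pow_norm _ _ (cf_norm g β) ?_ N).trans ?_
      · rw [Complex.norm_real, norm_of_nonneg (exp_pos _).le]; exact Real.exp_le_one_iff.2 (by linarith)
      · calc _ ≤ (N : ℝ) * (C1 * |β| ^ 3) := mul_le_mul_of_nonneg_left (hcf β hβ1) (by positivity)
          _ = _ := by ring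
    have h2 : ‖((exp (-v) : ℝ) : ℂ) ^ N - ((exp (-(v * L)) : ℝ) : ℂ)‖ ≤ 20 * π ^ 2 * sig2 g * (u * |β|) := by
      rw [← Complex.ofReal_pow, ← Complex.ofReal_sub, Complex.norm_real, ← Real.exp_nat_mul, mul_neg]
      have hL0 : 0 ≤ L := le_trans (by positivity) hL1
      refine (exp_lip _ _ (by positivity) (by positivity)).trans ?_
      rw [mul_comm (N : ℝ) v, ← mul_sub, abs_mul, abs_of_nonneg hv0]
      have h3 : |(N : ℝ) - L| ≤ 10 * u := by rw [abs_le]; constructor <;> linarith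
      have h4 : v ≤ 2 * π ^ 2 * sig2 g * |β| := by
        rw [hv]; apply mul_le_mul_of_nonneg_left _ (by positivity)
        rw [← sq_abs]; nlinarith
      calc _ ≤ 2 * π ^ 2 * sig2 g * |β| * (10 * u) := mul_le_mul h4 h3 (abs_nonneg _) (by positivity)
        _ = _ := by ring
    calc _ = ‖(cf g β ^ N - ((exp (-v) : ℝ) : ℂ) ^ N) + (((exp (-v) : ℝ) : ℂ) ^ N - ((exp (-(v * L)) : ℝ) : ℂ))‖ := by congr 1; ring
      _ ≤ _ := (norm_add_le _ _).trans (by linarith)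
  set P := ∑ n ∈ Ioc 0 X, (wt (g - 1) l n : ℂ) * ee (β * ((sg g n : ℝ) - ((g : ℝ) - 1) / 2 * L))
  set Q := ∑ n ∈ Ioc 0 X, (wt (g - 1) l n : ℂ) * ee (β * Xf g (4 * u) N n)
  set E1 := exp (-K) * exp (t ^ 2 * g ^ 2 * N) with hE1
  have hE10 : 0 ≤ E1 := by positivity
  set Z := Bv X u * ((K + 1) * (1 + 2 * π * |β| * (7 * (g : ℝ) ^ 3 * (1 + (4 * u + N : ℕ)) ^ 2)) ^ K)
  have key : W * (40 * π * g * (u * |β|)) + W * (C1 * (N * |β| ^ 3) + 20 * π ^ 2 * sig2 g * (u * |β|)) + 4 * W * E1 ≤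
      6 * D * X * (u * |β| + N * |β| ^ 3 + E1) := by
    set p := (u : ℝ) * |β|
    set r := (N : ℝ) * |β| ^ 3
    have hp : 0 ≤ p := by positivity
    have hr : 0 ≤ r := by positivity
    calc _ = W * ((40 * π * g + 20 * π ^ 2 * sig2 g) * p + C1 * r + 4 * E1) := by ring
      _ ≤ W * (D * p + D * r + D * E1) := by
          apply mul_le_mul_of_nonneg_left _ hW0
          have q1 : 0 ≤ 40 * π * g := by positivity
          have q2 : 0 ≤ 20 * π ^ 2 * sig2 g := by positivity
          have a1 : (40 * π * g + 20 * π ^ 2 * sig2 g) * p ≤ D * p := mul_le_mul_of_nonneg_right (by linarith) hp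
          have a2 : C1 * r ≤ D * r := mul_le_mul_of_nonneg_right (by linarith) hr
          have a3 : 4 * E1 ≤ D * E1 := mul_le_mul_of_nonneg_right (by linarith) hE10
          linarith
      _ ≤ (6 * X) * (D * p + D * r + D * E1) := mul_le_mul_of_nonneg_right hW6 (by positivity)
      _ = _ := by ring
  calc _ = ‖(P - Q) + (Q - (W : ℂ) * cf g β ^ N) + ((W : ℂ) * cf g β ^ N - (W : ℂ) * ((exp (-(v * L)) : ℝ) : ℂ))‖ := by
        congr 1; ring
    _ ≤ _ := by
        refine (norm_add_le _ _).trans ?_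
        have := norm_add_le (P - Q) (Q - (W : ℂ) * cf g β ^ N)
        linarith

end DMR

namespace DMR
open Finset Filter

lemma ev_exp (A c p : ℝ) (hc : 0 < c) (hp : 0 < p) : ∀ᶠ L : ℝ in atTop, L ^ A * exp (-(c * L ^ p)) ≤ 1 := by
  have h1 := (tendsto_rpow_mul_exp_neg_mul_atTop_nhds_zero (A / p) c hc).comp (tendsto_rpow_atTop hp)
  filter_upwards [h1.eventually (gt_mem_nhds (by norm_num : (0:ℝ) < 1)), eventually_gt_atTop 0] with L hL hL0
  simp only [Function.comp] at hL
  rw [← rpow_mul hL0.le, mul_div_cancel₀ _ hp.ne'] at hL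
  rw [← neg_mul]; exact hL.le

lemma ev_rpow_small (p c : ℝ) (hp : p < 0) (hc : 0 < c) : ∀ᶠ L : ℝ in atTop, L ^ p ≤ c := by
  have h := tendsto_rpow_neg_atTop (y := -p) (by linarith)
  rw [neg_neg] at h
  filter_upwards [h.eventually (gt_mem_nhds hc)] with L hL using hL.le

lemma log_scale (g : ℕ) (hg : 2 ≤ g) (x : ℝ) (hx : 1 ≤ x) :
    g ^ (Nat.log g ⌊x⌋₊) ≤ ⌊x⌋₊ ∧ ⌊x⌋₊ < g ^ (Nat.log g ⌊x⌋₊ + 1) ∧ (Nat.log g ⌊x⌋₊ : ℝ) ≤ log x / log g ∧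
      log x / log g ≤ Nat.log g ⌊x⌋₊ + 1 := by
  have hX : 1 ≤ ⌊x⌋₊ := Nat.one_le_floor_iff x |>.2 hx
  have hg1 : (1 : ℝ) < g := by exact_mod_cast (by omega : 1 < g)
  have hlg := log_pos hg1
  have h1 : g ^ (Nat.log g ⌊x⌋₊) ≤ ⌊x⌋₊ := Nat.pow_log_le_self g (by omega)
  have h2 : ⌊x⌋₊ < g ^ (Nat.log g ⌊x⌋₊ + 1) := Nat.lt_pow_succ_log_self (by omega) _
  refine ⟨h1, h2, ?_, ?_⟩
  · rw [le_div_iff₀ hlg, ← Real.log_pow]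
    apply log_le_log (by positivity)
    calc ((g : ℝ) ^ (Nat.log g ⌊x⌋₊)) ≤ (⌊x⌋₊ : ℝ) := by exact_mod_cast h1
      _ ≤ x := Nat.floor_le (by linarith)
  · rw [div_le_iff₀ hlg]
    have : (Nat.log g ⌊x⌋₊ : ℝ) + 1 = ((Nat.log g ⌊x⌋₊ + 1 : ℕ) : ℝ) := by push_cast; ring
    rw [this, ← Real.log_pow]
    apply log_le_log (by linarith)
    calc x ≤ ((⌊x⌋₊ + 1 : ℕ) : ℝ) := by push_cast; exact (Nat.lt_floor_add_one x).le
      _ ≤ _ := by exact_mod_cast h2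

set_option maxHeartbeats 1600000 in
lemma major3 (g : ℕ) (hg : 2 ≤ g) (η : ℝ) (hη : 0 < η) (hη2 : η ≤ 1 / 12) : ∃ C L0 : ℝ, 0 < C ∧ ∀ (x : ℝ) (l : ℕ) (β : ℝ),
    1 ≤ x → L0 ≤ log x / log g → |β| ≤ (log x / log g) ^ (-(1/2) + η : ℝ) →
    ‖∑ n ∈ Ioc 0 ⌊x⌋₊, (wt (g - 1) l n : ℂ) * ee (β * ((sg g n : ℝ) - ((g : ℝ) - 1) / 2 * (log x / log g))) -
      ((∑ n ∈ Ioc 0 ⌊x⌋₊, wt (g - 1) l n : ℝ) : ℂ) * ((exp (-(2 * π ^ 2 * sig2 g * β ^ 2 * (log x / log g))) : ℝ) : ℂ)‖ ≤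
    C * ⌊x⌋₊ * (log x / log g) ^ (-(1/2) + 4 * η : ℝ) := by
  obtain ⟨C, hC, hmaj⟩ := major2 g hg
  have hpi := pi_pos
  have hgr : (2 : ℝ) ≤ g := by exact_mod_cast hg
  have hl2 : 0 < log 2 := log_pos (by norm_num)
  set c0 : ℝ := 2 * π * exp 1 with hc0
  have hc0p : 0 < c0 := by positivity
  set c2 : ℝ := c0 ^ 2 * g ^ 2 with hc2
  have hc2p : 0 < c2 := by positivity
  set c3 : ℝ := 2 * (c2 + 2) with hc3
  have hc3p : 0 < c3 := by positivity
  set c4 : ℝ := 1 + 14 * π * g ^ 3 with hc4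
  set C5 : ℝ := 60 * (2 * g) ^ 10 * (c3 + 1) with hC5
  have hev : ∀ᶠ L : ℝ in atTop, 22 ≤ L ∧ c4 ≤ L ∧ L ^ (3 * η - 1) ≤ 1 / 16 ∧ L ^ (-(1/2) + η : ℝ) ≤ 1 / (c0 * g) ∧ L ^ (-(1/2) + η : ℝ) ≤ 1 ∧
      L ^ (1/2 : ℝ) * exp (-(1 * L ^ (2 * η))) ≤ 1 ∧ L ^ (23/2 : ℝ) * exp (-(log 2 / 8 * L ^ (3 * η))) ≤ 1 ∧
      ‖log L‖ ≤ (log 2 / (24 * c3)) * ‖L ^ η‖ := by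
    refine (eventually_ge_atTop 22).and ((eventually_ge_atTop c4).and ?_)
    refine (ev_rpow_small _ _ (by linarith) (by norm_num)).and ((ev_rpow_small _ _ (by linarith) (by positivity)).and ?_)
    refine (ev_rpow_small _ _ (by linarith) (by norm_num)).and ((ev_exp _ _ _ (by norm_num) (by positivity)).and ?_)
    exact (ev_exp _ _ _ (by positivity) (by positivity)).and ((isLittleO_log_rpow_atTop hη).bound (by positivity))
  obtain ⟨L0, hL0⟩ := eventually_atTop.1 hev
  refine ⟨C * 4 + C5, L0, by positivity, ?_⟩
  intro x l β hx hLx hβ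
  obtain ⟨e1, e2, e3, e4, e5, e6, e7, e8⟩ := hL0 _ hLx
  obtain ⟨hM1, hM2, hM3, hM4⟩ := log_scale g hg x hx
  set L := log x / log g with hL
  set M := Nat.log g ⌊x⌋₊
  set X := ⌊x⌋₊
  have hLpos : 0 < L := by linarith
  have hL1 : 1 ≤ L := by linarith
  set u := ⌊L ^ (3 * η)⌋₊ + 1 with hu
  have hu1 : 1 ≤ u := by omega
  have hr3 : 1 ≤ L ^ (3 * η) := Real.one_le_rpow hL1 (by positivity)
  have huL : L ^ (3 * η) ≤ u := by rw [hu]; push_cast; exact (Nat.lt_floor_add_one _).le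
  have huU : (u : ℝ) ≤ 2 * L ^ (3 * η) := by
    rw [hu]; push_cast; linarith [Nat.floor_le (by positivity : 0 ≤ L ^ (3 * η))]
  have hL3 : 16 * L ^ (3 * η) ≤ L := by
    have : L ^ (3 * η) = L ^ (3 * η - 1) * L := by
      rw [← rpow_add_one hLpos.ne']; congr 1; ring
    rw [this]; nlinarith
  have huU2 : (u : ℝ) ≤ L ^ (3 * η) + 1 := by
    rw [hu]; push_cast; linarith [Nat.floor_le (by positivity : 0 ≤ L ^ (3 * η))]
  have hMu : 8 * u + 1 ≤ M := by
    have : (8 * u + 1 : ℝ) ≤ M := by linarith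
    exact_mod_cast this
  obtain ⟨N, hN⟩ : ∃ N, M = 4 * u + N + 4 * u + 1 := ⟨M - (8 * u + 1), by omega⟩
  set y := L ^ (2 * η) with hy
  have hy1 : 1 ≤ y := Real.one_le_rpow hL1 (by positivity)
  have hyL : y ≤ L := by
    calc y ≤ L ^ (1 : ℝ) := rpow_le_rpow_of_exponent_le hL1 (by linarith)
      _ = L := rpow_one L
  set K := 2 * ⌈(c2 + 1) * y⌉₊ with hK
  have hKl : (c2 + 1) * y ≤ K := by
    have h1 := Nat.le_ceil ((c2 + 1) * y)
    have h2 : 0 ≤ (c2 + 1) * y := by positivity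
    rw [hK]; push_cast; linarith
  have hKu : (K : ℝ) ≤ c3 * y := by
    have h1 := Nat.ceil_lt_add_one (by positivity : 0 ≤ (c2 + 1) * y)
    rw [hK, hc3]; push_cast; linarith
  set δ := L ^ (-(1/2) + η : ℝ) with hδ
  have hδ0 : 0 < δ := by positivity
  have hNL : (N : ℝ) ≤ L := by
    have : N ≤ M := by omega
    have : (N : ℝ) ≤ M := by exact_mod_cast this
    linarith
  have hbL : (1 + (4 * u + N : ℕ) : ℝ) ≤ L := by
    have : 1 + (4 * u + N) ≤ M := by omega
    have h2 : ((1 + (4 * u + N) : ℕ) : ℝ) ≤ M := by exact_mod_cast this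
    push_cast at h2 ⊢; linarith
  have hm := hmaj u N M X l K L β (c0 * δ) hu1 hN hM1 hM2 hM3 hM4 ⟨_, by rw [hK]; ring⟩ (by positivity)
    (by
      rw [le_div_iff₀ (by positivity)] at e4
      linarith)
    (by
      rw [hc0]
      calc 2 * π * |β| * exp 1 ≤ 2 * π * δ * exp 1 := by gcongr
        _ = _ := by ring) (hβ.trans e5)
  refine hm.trans ?_
  have hβ0 := abs_nonneg β
  -- pieces
  set E := L ^ (-(1/2) + 4 * η : ℝ) with hE
  have hE0 : 0 < E := by positivity
  have hhalf : L ^ (-(1/2) : ℝ) ≤ E := rpow_le_rpow_of_exponent_le hL1 (by linarith)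
  have p1 : (u : ℝ) * |β| ≤ 2 * E := by
    calc _ ≤ 2 * L ^ (3 * η) * δ := mul_le_mul huU hβ hβ0 (by positivity)
      _ = 2 * E := by rw [hδ, hE, mul_assoc, ← rpow_add hLpos]; congr 2; ring
  have p2 : (N : ℝ) * |β| ^ 3 ≤ E := by
    calc _ ≤ L * δ ^ 3 := mul_le_mul hNL (pow_le_pow_left₀ hβ0 hβ 3) (by positivity) hLpos.le
      _ = L ^ (1 + 3 * (-(1/2) + η) : ℝ) := by
          rw [hδ, ← rpow_natCast, ← rpow_mul hLpos.le, mul_comm L, ← rpow_add_one hLpos.ne']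
          congr 1; push_cast; ring
      _ ≤ E := rpow_le_rpow_of_exponent_le hL1 (by linarith)
  have p3 : exp (-K) * exp ((c0 * δ) ^ 2 * g ^ 2 * N) ≤ E := by
    have h1 : (c0 * δ) ^ 2 * g ^ 2 * N ≤ c2 * y := by
      have h2 : δ ^ 2 * L = y := by
        rw [hδ, hy, ← rpow_natCast, ← rpow_mul hLpos.le, ← rpow_add_one hLpos.ne']; congr 1; push_cast; ring
      calc _ = c2 * (δ ^ 2 * N) := by rw [hc2]; ring
        _ ≤ c2 * (δ ^ 2 * L) := by gcongr
        _ = _ := by rw [h2]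
    rw [← exp_add]
    have h3 : exp (-K + (c0 * δ) ^ 2 * g ^ 2 * N) ≤ exp (-(1 * y)) := exp_le_exp.2 (by linarith)
    have h4 : exp (-(1 * y)) ≤ L ^ (-(1/2) : ℝ) := by
      rw [rpow_neg hLpos.le, le_inv_comm₀ (exp_pos _) (by positivity), ← one_div, le_div_iff₀ (exp_pos _)]
      exact e6
    linarith
  have p4 : Bv X u * ((K + 1) * (1 + 2 * π * |β| * (7 * (g : ℝ) ^ 3 * (1 + (4 * u + N : ℕ)) ^ 2)) ^ K) ≤ C5 * X * E := by
    have q1 : 1 + log X ≤ 2 * g * L := by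
      have hX1 : 1 ≤ X := Nat.one_le_floor_iff x |>.2 hx
      have a1 : log X ≤ log x := log_le_log (by exact_mod_cast hX1) (Nat.floor_le (by linarith))
      have hlg : 0 < log g := log_pos (by linarith)
      have a2 : log x = L * log g := by rw [hL]; field_simp
      have a3 : log g ≤ g := Real.log_le_self (by positivity)
      have a4 : L * log g ≤ L * g := mul_le_mul_of_nonneg_left a3 hLpos.le
      have := mul_le_mul_of_nonneg_left hgr hLpos.le
      linarith
    have q1' : 0 ≤ 1 + log X := by linarith [log_natCast_nonneg X]
    have q2 : ((2 ^ u : ℕ) : ℝ) ^ (-(1/4) : ℝ) ≤ exp (-(log 2 / 4 * L ^ (3 * η))) := by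
      push_cast
      rw [← rpow_natCast, ← rpow_mul (by norm_num), rpow_def_of_pos (by norm_num)]
      apply exp_le_exp.2
      have := mul_le_mul_of_nonneg_left huL hl2.le
      linarith
    have q3 : (1 + 2 * π * |β| * (7 * (g : ℝ) ^ 3 * (1 + (4 * u + N : ℕ)) ^ 2)) ≤ L ^ 3 := by
      have b1 : (1 + (4 * u + N : ℕ) : ℝ) ^ 2 ≤ L ^ 2 := pow_le_pow_left₀ (by positivity) hbL 2
      have b2 : |β| ≤ 1 := hβ.trans e5
      calc _ ≤ 1 + 2 * π * 1 * (7 * (g : ℝ) ^ 3 * L ^ 2) := by gcongr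
        _ ≤ c4 * L ^ 2 := by rw [hc4]; linarith [one_le_pow₀ hL1 (n := 2)]
        _ ≤ L * L ^ 2 := by gcongr
        _ = _ := by ring
    have q4 : (1 + 2 * π * |β| * (7 * (g : ℝ) ^ 3 * (1 + (4 * u + N : ℕ)) ^ 2)) ^ K ≤ exp (log 2 / 8 * L ^ (3 * η)) := by
      calc _ ≤ (L ^ 3) ^ K := pow_le_pow_left₀ (by positivity) q3 K
        _ = exp (K * (3 * log L)) := by
            rw [Real.exp_nat_mul]; congr 1
            rw [mul_comm, Real.exp_mul, Real.exp_log hLpos]; norm_cast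
        _ ≤ _ := by
            apply exp_le_exp.2
            have hlogL : 0 ≤ log L := Real.log_nonneg hL1
            rw [norm_of_nonneg hlogL, norm_of_nonneg (by positivity)] at e8
            calc (K : ℝ) * (3 * log L) ≤ c3 * y * (3 * (log 2 / (24 * c3) * L ^ η)) := by gcongr
              _ = log 2 / 8 * (y * L ^ η) := by field_simp; ring
              _ = _ := by rw [hy, ← rpow_add hLpos]; congr 2; ring
    have q5 : (K : ℝ) + 1 ≤ (c3 + 1) * L := by
      have := mul_le_mul_of_nonneg_left hyL hc3p.le
      linarith
    have hexp2 : exp (-(log 2 / 4 * L ^ (3 * η))) * exp (log 2 / 8 * L ^ (3 * η)) = exp (-(log 2 / 8 * L ^ (3 * η))) := by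
      rw [← exp_add]; congr 1; ring
    have q6 : L ^ 11 * exp (-(log 2 / 8 * L ^ (3 * η))) ≤ L ^ (-(1/2) : ℝ) := by
      have : L ^ (23/2 : ℝ) = L ^ 11 * L ^ (1/2 : ℝ) := by
        rw [← rpow_natCast, ← rpow_add hLpos]; norm_num
      rw [this] at e7
      rw [rpow_neg hLpos.le, ← one_div, le_div_iff₀ (by positivity)]
      linarith
    unfold Bv
    calc _ ≤ 60 * (2 * g * L) ^ 10 * X * exp (-(log 2 / 4 * L ^ (3 * η))) * (((c3 + 1) * L) * exp (log 2 / 8 * L ^ (3 * η))) := by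
          gcongr
      _ = C5 * X * (L ^ 11 * (exp (-(log 2 / 4 * L ^ (3 * η))) * exp (log 2 / 8 * L ^ (3 * η)))) := by rw [hC5]; ring
      _ = C5 * X * (L ^ 11 * exp (-(log 2 / 8 * L ^ (3 * η)))) := by rw [hexp2]
      _ ≤ C5 * X * E := by
          apply mul_le_mul_of_nonneg_left (q6.trans hhalf) (by positivity)
  calc _ ≤ C * X * (2 * E + E + E) + C5 * X * E := by
        apply add_le_add _ p4
        apply mul_le_mul_of_nonneg_left _ (by positivity)
        linarith
    _ = _ := by ring

end DMR

namespace DMR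
open Finset MeasureTheory

lemma ee_cont (y : ℝ) : Continuous fun α : ℝ => ee (α * y) := by
  unfold ee; fun_prop

lemma gauss_int (s : ℝ) (hs : 0 < s) (y : ℝ) :
    Integrable (fun α : ℝ => ee (α * y) * ((exp (-(2 * π ^ 2 * s * α ^ 2)) : ℝ) : ℂ)) := by
  have h := integrable_exp_neg_mul_sq (b := 2 * π ^ 2 * s) (by positivity)
  refine Integrable.mono' h ?_ ?_
  · apply Continuous.aestronglyMeasurable
    have := ee_cont y
    fun_prop
  · refine Filter.Eventually.of_forall fun α => ?_
    rw [norm_mul, norm_ee, one_mul, Complex.norm_real, norm_eq_abs, abs_of_pos (exp_pos _), neg_mul]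

lemma gauss_val (s : ℝ) (hs : 0 < s) (y : ℝ) :
    ∫ α : ℝ, ee (α * y) * ((exp (-(2 * π ^ 2 * s * α ^ 2)) : ℝ) : ℂ)
      = ((exp (-(y ^ 2 / (2 * s))) / √(2 * π * s) : ℝ) : ℂ) := by
  have hp := pi_pos
  have hb : 0 < ((2 * π ^ 2 * s : ℝ) : ℂ).re := by rw [Complex.ofReal_re]; positivity
  have h := fourierIntegral_gaussian hb ((2 * π * y : ℝ) : ℂ)
  have e1 : ((π : ℂ) / ((2 * π ^ 2 * s : ℝ) : ℂ)) ^ (1 / 2 : ℂ) = ((1 / √(2 * π * s) : ℝ) : ℂ) := by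
    have : (π : ℂ) / ((2 * π ^ 2 * s : ℝ) : ℂ) = (((2 * π * s)⁻¹ : ℝ) : ℂ) := by
      rw [← Complex.ofReal_div]; congr 1; field_simp
    rw [this, show (1 / 2 : ℂ) = ((1 / 2 : ℝ) : ℂ) by push_cast; rfl, ← Complex.ofReal_cpow (by positivity), ← Real.sqrt_eq_rpow,
      Real.sqrt_inv, one_div]
  rw [e1] at h
  have e2 : ∀ α : ℝ, ee (α * y) * ((exp (-(2 * π ^ 2 * s * α ^ 2)) : ℝ) : ℂ) =
      Complex.exp (Complex.I * ((2 * π * y : ℝ) : ℂ) * α) * Complex.exp (-((2 * π ^ 2 * s : ℝ) : ℂ) * α ^ 2) := by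
    intro α
    unfold ee
    push_cast
    congr 2 <;> ring
  simp_rw [e2]
  rw [h]
  push_cast
  have hs' : (s : ℂ) ≠ 0 := by exact_mod_cast hs.ne'
  have hp' : (π : ℂ) ≠ 0 := by exact_mod_cast hp.ne'
  rw [div_eq_mul_one_div (Complex.exp _), mul_comm]
  congr 2
  field_simp
  ring

lemma gauss_tail (s : ℝ) (hs : 0 < s) (y δ : ℝ) (hδ : 0 ≤ δ) :
    ‖(∫ α : ℝ, ee (α * y) * ((exp (-(2 * π ^ 2 * s * α ^ 2)) : ℝ) : ℂ)) -
      ∫ α in (-δ)..δ, ee (α * y) * ((exp (-(2 * π ^ 2 * s * α ^ 2)) : ℝ) : ℂ)‖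
      ≤ exp (-(π ^ 2 * s * δ ^ 2)) / √(π * s) := by
  have hp := pi_pos
  have hI := gauss_int s hs y
  rw [intervalIntegral.integral_of_le (by linarith), ← integral_add_compl (measurableSet_Ioc (a := -δ) (b := δ)) hI, add_sub_cancel_left]
  have hd : Integrable (fun α : ℝ => exp (-(π ^ 2 * s * δ ^ 2)) * exp (-(π ^ 2 * s) * α ^ 2)) :=
    (integrable_exp_neg_mul_sq (b := π ^ 2 * s) (by positivity)).const_mul _
  have hpt : ∀ α ∈ (Set.Ioc (-δ) δ)ᶜ, ‖ee (α * y) * ((exp (-(2 * π ^ 2 * s * α ^ 2)) : ℝ) : ℂ)‖ ≤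
      exp (-(π ^ 2 * s * δ ^ 2)) * exp (-(π ^ 2 * s) * α ^ 2) := by
    intro α hα
    rw [norm_mul, norm_ee, one_mul, Complex.norm_real, norm_eq_abs, abs_of_pos (exp_pos _), ← exp_add]
    apply exp_le_exp.2
    have h2 : δ ^ 2 ≤ α ^ 2 := by
      rw [Set.mem_compl_iff, Set.mem_Ioc, not_and_or, not_lt, not_le] at hα
      rcases hα with h | h <;> nlinarith
    have := mul_le_mul_of_nonneg_left h2 (by positivity : 0 ≤ π ^ 2 * s)
    linarith
  calc _ ≤ ∫ α in (Set.Ioc (-δ) δ)ᶜ, exp (-(π ^ 2 * s * δ ^ 2)) * exp (-(π ^ 2 * s) * α ^ 2) :=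
        norm_integral_le_of_norm_le hd.integrableOn (by
          filter_upwards [ae_restrict_mem measurableSet_Ioc.compl] with α hα using hpt α hα)
    _ ≤ ∫ α : ℝ, exp (-(π ^ 2 * s * δ ^ 2)) * exp (-(π ^ 2 * s) * α ^ 2) :=
        setIntegral_le_integral hd (Filter.Eventually.of_forall fun α => by positivity)
    _ = _ := by
        rw [integral_const_mul, integral_gaussian, div_eq_mul_one_div (exp _), one_div, ← Real.sqrt_inv]
        congr 2; field_simp

lemma orth (q : ℕ) (hq : 0 < q) (m : ℤ) :
    (q : ℂ) * ∫ α in (-(1 / (2 * q : ℝ)))..(1 / (2 * q : ℝ)), ee (α * ((q : ℝ) * m)) = if m = 0 then 1 else 0 := by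
  have hqr : (0 : ℝ) < q := by exact_mod_cast hq
  have hqc : (q : ℂ) ≠ 0 := by exact_mod_cast hq.ne'
  split_ifs with h
  · subst h
    simp only [Int.cast_zero, mul_zero, ee_zero]
    rw [intervalIntegral.integral_const]
    have : (1 / (2 * q : ℝ) - -(1 / (2 * q : ℝ))) = (q : ℝ)⁻¹ := by field_simp; norm_num
    rw [this]
    simp [hqc]
  · have hm : (m : ℂ) ≠ 0 := by exact_mod_cast h
    have hp' : (π : ℂ) ≠ 0 := by exact_mod_cast pi_pos.ne'
    set c : ℂ := 2 * π * q * m * Complex.I with hc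
    have hc0 : c ≠ 0 := by rw [hc]; simp [hqc, hm, hp', Complex.I_ne_zero]
    have e : ∀ α : ℝ, ee (α * ((q : ℝ) * m)) = Complex.exp (c * α) := by
      intro α; unfold ee; rw [hc]; push_cast; congr 1; ring
    simp_rw [e]
    rw [integral_exp_mul_complex hc0]
    have e3 : Complex.exp (c * ((1 / (2 * q : ℝ) : ℝ) : ℂ)) = Complex.exp (c * ((-(1 / (2 * q : ℝ)) : ℝ) : ℂ)) := by
      rw [← e, ← e]
      have := ee_add_int (-(1 / (2 * q : ℝ)) * ((q : ℝ) * m)) m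
      rw [← this]; congr 1; field_simp; ring
    rw [e3, sub_self, zero_div, mul_zero]

lemma sg_modEq (g : ℕ) (hg : 2 ≤ g) (n : ℕ) : sg g n ≡ n [MOD (g - 1)] := by
  rcases Nat.eq_or_lt_of_le hg with h | h
  · subst h; exact Nat.modEq_one
  · refine (Nat.modEq_digits_sum (g - 1) g ?_ n).symm
    have := Nat.add_mod_right 1 (g - 1)
    rwa [show 1 + (g - 1) = g by omega, Nat.mod_eq_of_lt (by omega : 1 < g - 1)] at this

/-- The exponential sum attached to the residue class of `l`. -/
noncomputable def Iα (g l X : ℕ) (α : ℝ) : ℂ :=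
  ∑ n ∈ Ioc 0 X, (wt (g - 1) l n : ℂ) * ee (α * ((sg g n : ℝ) - l))

lemma Iα_cont (g l X : ℕ) : Continuous (Iα g l X) := by
  unfold Iα
  refine continuous_finset_sum _ fun n _ => ?_
  exact continuous_const.mul (ee_cont _)

lemma E_int (g : ℕ) (hg : 2 ≤ g) (l X : ℕ) :
    ((g - 1 : ℕ) : ℂ) * ∫ α in (-(1 / (2 * (g - 1 : ℕ) : ℝ)))..(1 / (2 * (g - 1 : ℕ) : ℝ)), Iα g l X α
      = ((∑ n ∈ (Ioc 0 X).filter (fun n => sg g n = l), vonMangoldt n : ℝ) : ℂ) := by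
  unfold Iα
  have hc : ∀ n ∈ Ioc 0 X, IntervalIntegrable (fun α : ℝ => (wt (g - 1) l n : ℂ) * ee (α * ((sg g n : ℝ) - l))) volume
      (-(1 / (2 * (g - 1 : ℕ) : ℝ))) (1 / (2 * (g - 1 : ℕ) : ℝ)) :=
    fun n _ => Continuous.intervalIntegrable (continuous_const.mul (ee_cont _)) _ _
  rw [intervalIntegral.integral_finsetSum hc, mul_sum, sum_filter]
  push_cast
  refine sum_congr rfl fun n _ => ?_
  rw [intervalIntegral.integral_const_mul, mul_left_comm]
  have hs := sg_modEq g hg n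
  by_cases h : n ≡ l [MOD (g - 1)]
  · obtain ⟨m, hm⟩ := (Nat.modEq_iff_dvd.1 (hs.trans h).symm)
    have e : ((sg g n : ℝ) - l) = ((g - 1 : ℕ) : ℝ) * (m : ℝ) := by exact_mod_cast hm
    rw [e, orth (g - 1) (by omega) m, wt, if_pos h]
    have h0 : m = 0 ↔ sg g n = l := by
      constructor
      · intro h0; rw [h0] at hm; omega
      · intro h0; rw [h0, sub_self] at hm
        have : ((g - 1 : ℕ) : ℤ) ≠ 0 := by omega
        exact (mul_eq_zero.1 hm.symm).resolve_left this
    by_cases h1 : m = 0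
    · rw [if_pos h1, if_pos (h0.1 h1), mul_one]
    · rw [if_neg h1, if_neg (fun h2 => h1 (h0.2 h2)), mul_zero, Complex.ofReal_zero]
  · rw [wt, if_neg h, if_neg, Complex.ofReal_zero, zero_mul]
    rintro rfl
    exact h hs.symm

lemma nd_ge_abs (t : ℝ) (ht : |t| ≤ 1 / 2) : |t| ≤ nd t := by
  unfold nd
  by_cases h : round t = 0
  · simp [h]
  · have h1 : (1 : ℝ) ≤ |(round t : ℝ)| := by exact_mod_cast Int.one_le_abs h
    have := abs_sub_abs_le_abs_sub (round t : ℝ) t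
    rw [abs_sub_comm] at this
    linarith

lemma minor_Iα (g : ℕ) (hg : 2 ≤ g) : ∃ (C c : ℝ) (A : ℕ), 0 < C ∧ 0 < c ∧ ∀ (α : ℝ) (l X : ℕ), 1 ≤ X →
    |((g : ℝ) - 1) * α| ≤ 1 / 2 →
    ‖Iα g l X α‖ ≤ C * (1 + log X) ^ A * X * exp (-(c * (α ^ 2 * log X))) := by
  obtain ⟨C, c, A, hC, hc, h⟩ := mauduit_rivat g hg
  refine ⟨C, c, A, hC, hc, fun α l X hX hα => ?_⟩
  have hg1 : (1 : ℝ) ≤ (g : ℝ) - 1 := by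
    have : (2 : ℝ) ≤ g := by exact_mod_cast hg
    linarith
  have hq : ((g - 1 : ℕ) : ℝ) = (g : ℝ) - 1 := by push_cast [show 1 ≤ g by omega]; ring
  have hq0 : (0 : ℝ) < ((g - 1 : ℕ) : ℝ) := by rw [hq]; linarith
  set B := C * (1 + log X) ^ A * X * exp (-(c * (α ^ 2 * log X))) with hB
  have e1 : Iα g l X α = (1 / ((g - 1 : ℕ) : ℂ)) * ∑ k ∈ range (g - 1), ee (-(l : ℝ) * (α + k / (g - 1 : ℕ))) *
      ∑ n ∈ Ioc 0 X, (vonMangoldt n : ℂ) * fa g (α + k / (g - 1 : ℕ)) n := by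
    unfold Iα
    simp_rw [mul_sum]
    rw [sum_comm]
    refine sum_congr rfl fun n _ => ?_
    rw [wt_expand (g - 1) l (by omega) n (sg g n) (sg_modEq g hg n), mul_sum, sum_mul]
    refine sum_congr rfl fun k _ => ?_
    rw [mul_assoc, mul_assoc, ← ee_add]
    congr 1
    rw [mul_left_comm, fa, ← ee_add]
    congr 2
    push_cast
    field_simp
    ring
  have hk : ∀ k ∈ range (g - 1), ‖ee (-(l : ℝ) * (α + k / (g - 1 : ℕ))) *
      ∑ n ∈ Ioc 0 X, (vonMangoldt n : ℂ) * fa g (α + k / (g - 1 : ℕ)) n‖ ≤ B := by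
    intro k _
    rw [norm_mul, norm_ee, one_mul]
    refine (h _ X hX).trans ?_
    have e2 : ((g : ℝ) - 1) * (α + k / (g - 1 : ℕ)) = ((g : ℝ) - 1) * α + k := by rw [hq]; field_simp
    rw [e2, nd_add_nat, hB]
    have h3 := nd_ge_abs _ hα
    have h4 : α ^ 2 ≤ nd (((g : ℝ) - 1) * α) ^ 2 := by
      rw [← sq_abs α]
      refine pow_le_pow_left₀ (abs_nonneg _) (le_trans ?_ h3) 2
      rw [abs_mul, abs_of_pos (by linarith : 0 < (g : ℝ) - 1)]
      exact le_mul_of_one_le_left (abs_nonneg _) hg1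
    have h5 := log_natCast_nonneg X
    gcongr
  rw [e1, norm_mul]
  have h6 := norm_sum_le_of_le _ hk
  rw [sum_const, card_range, nsmul_eq_mul] at h6
  have h7 : ‖(1 / ((g - 1 : ℕ) : ℂ))‖ = 1 / ((g - 1 : ℕ) : ℝ) := by simp
  rw [h7]
  calc _ ≤ 1 / ((g - 1 : ℕ) : ℝ) * (((g - 1 : ℕ) : ℝ) * B) := by gcongr
    _ = B := by field_simp
end DMR

namespace DMR
open Finset MeasureTheory Filter

lemma split_int (I G : ℝ → ℂ) (hI : Continuous I) (hG : Continuous G) (T : ℂ) (δ b e1 e2 e3 : ℝ) (hδ : 0 ≤ δ) (hδb : δ ≤ b)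
    (hb : b ≤ 1 / 2) (he2 : 0 ≤ e2) (h1 : ∀ α, |α| ≤ δ → ‖I α - G α‖ ≤ e1)
    (h2 : ∀ α, δ ≤ |α| → |α| ≤ b → ‖I α‖ ≤ e2) (h3 : ‖T - ∫ α in (-δ)..δ, G α‖ ≤ e3) :
    ‖(∫ α in (-b)..b, I α) - T‖ ≤ 2 * δ * e1 + e2 + e3 := by
  have hi : ∀ u v : ℝ, IntervalIntegrable I volume u v := fun u v => hI.intervalIntegrable u v
  have hg : ∀ u v : ℝ, IntervalIntegrable G volume u v := fun u v => hG.intervalIntegrable u v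
  have e : (∫ α in (-b)..b, I α) - T = (∫ α in (-b)..(-δ), I α) + (∫ α in δ..b, I α) + (∫ α in (-δ)..δ, (I α - G α)) -
      (T - ∫ α in (-δ)..δ, G α) := by
    rw [intervalIntegral.integral_sub (hi _ _) (hg _ _),
      ← intervalIntegral.integral_add_adjacent_intervals (hi (-b) (-δ)) (hi (-δ) b),
      ← intervalIntegral.integral_add_adjacent_intervals (hi (-δ) δ) (hi δ b)]
    ring
  have k1 : ‖∫ α in (-b)..(-δ), I α‖ ≤ e2 * |(-δ) - (-b)| := by
    refine intervalIntegral.norm_integral_le_of_norm_le_const fun α hα => ?_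
    rw [Set.uIoc_of_le (by linarith)] at hα
    have : |α| = -α := abs_of_nonpos (by linarith [hα.2])
    exact h2 α (by rw [this]; linarith [hα.2]) (by rw [this]; linarith [hα.1])
  have k2 : ‖∫ α in δ..b, I α‖ ≤ e2 * |b - δ| := by
    refine intervalIntegral.norm_integral_le_of_norm_le_const fun α hα => ?_
    rw [Set.uIoc_of_le (by linarith)] at hα
    have : |α| = α := abs_of_nonneg (by linarith [hα.1])
    exact h2 α (by rw [this]; linarith [hα.1]) (by rw [this]; linarith [hα.2])
  have k3 : ‖∫ α in (-δ)..δ, (I α - G α)‖ ≤ e1 * |δ - -δ| := by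
    refine intervalIntegral.norm_integral_le_of_norm_le_const fun α hα => ?_
    rw [Set.uIoc_of_le (by linarith)] at hα
    exact h1 α (abs_le.2 ⟨hα.1.le, hα.2⟩)
  rw [abs_of_nonneg (by linarith)] at k1 k2 k3
  rw [e]
  refine (norm_sub_le _ _).trans ((add_le_add ((norm_add_le _ _).trans (add_le_add (norm_add_le _ _) le_rfl)) h3).trans ?_)
  have : e2 * (b - δ) ≤ e2 * (1 / 2) := mul_le_mul_of_nonneg_left (by linarith) he2
  linarith

/-- Gaussian density factor. -/
noncomputable def gd (g l : ℕ) (L : ℝ) : ℝ :=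
  exp (-((((g : ℝ) - 1) / 2 * L - l) ^ 2 / (2 * (sig2 g * L)))) / √(2 * π * (sig2 g * L))

lemma logX_bounds (g : ℕ) (hg : 2 ≤ g) (x : ℝ) (hx : 1 ≤ x) (hL : 2 ≤ log x / log g) :
    1 + log ⌊x⌋₊ ≤ 2 * g * (log x / log g) ∧
      log g / 2 * (log x / log g) ≤ log ⌊x⌋₊ := by
  obtain ⟨hM1, hM2, hM3, hM4⟩ := log_scale g hg x hx
  have hgr : (2 : ℝ) ≤ g := by exact_mod_cast hg
  have hlg : 0 < log g := log_pos (by linarith)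
  have hX1 : 1 ≤ ⌊x⌋₊ := Nat.one_le_floor_iff x |>.2 hx
  set L := log x / log g with hLd
  constructor
  · have a1 : log ⌊x⌋₊ ≤ log x := log_le_log (by exact_mod_cast hX1) (Nat.floor_le (by linarith))
    have a2 : log x = L * log g := by rw [hLd]; field_simp
    have a3 : log g ≤ g := Real.log_le_self (by positivity)
    have a4 : L * log g ≤ L * g := mul_le_mul_of_nonneg_left a3 (by linarith)
    nlinarith
  · have h1 : log ((g : ℝ) ^ Nat.log g ⌊x⌋₊) ≤ log ⌊x⌋₊ :=
      log_le_log (by positivity) (by exact_mod_cast hM1)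
    rw [Real.log_pow] at h1
    have h2 : L / 2 ≤ Nat.log g ⌊x⌋₊ := by linarith
    have := mul_le_mul_of_nonneg_right h2 hlg.le
    linarith

lemma minor_L (g : ℕ) (hg : 2 ≤ g) (η : ℝ) (hη : 0 < η) : ∃ C L0 : ℝ, 0 < C ∧ ∀ (x : ℝ) (l : ℕ) (α : ℝ),
    1 ≤ x → L0 ≤ log x / log g → (log x / log g) ^ (-(1/2) + η : ℝ) ≤ |α| →
    |((g : ℝ) - 1) * α| ≤ 1 / 2 → ‖Iα g l ⌊x⌋₊ α‖ ≤ C * ⌊x⌋₊ * (log x / log g) ^ (-1 : ℝ) := by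
  obtain ⟨C, c, A, hC, hc, h⟩ := minor_Iα g hg
  have hgr : (2 : ℝ) ≤ g := by exact_mod_cast hg
  have hlg : 0 < log g := log_pos (by linarith)
  obtain ⟨L0, hL0⟩ := eventually_atTop.1 ((eventually_ge_atTop 2).and
    (ev_exp (A + 1) (c * (log g / 2)) (2 * η) (by positivity) (by positivity)))
  refine ⟨C * (2 * g) ^ A, L0, by positivity, fun x l α hx hL hα hα2 => ?_⟩
  obtain ⟨e1, e2⟩ := hL0 _ hL
  obtain ⟨b1, b2⟩ := logX_bounds g hg x hx e1
  refine (h α l _ (Nat.one_le_floor_iff x |>.2 hx) hα2).trans ?_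
  set L := log x / log g with hLd
  have hLp : 0 < L := by linarith
  have h0 := log_natCast_nonneg ⌊x⌋₊
  have h1 : L ^ (2 * η) ≤ α ^ 2 * L := by
    have : (L ^ (-(1/2) + η : ℝ)) ^ 2 ≤ α ^ 2 := by
      rw [← sq_abs α]; exact pow_le_pow_left₀ (by positivity) hα 2
    calc L ^ (2 * η) = (L ^ (-(1/2) + η : ℝ)) ^ 2 * L := by
          rw [← rpow_natCast, ← rpow_mul hLp.le, ← rpow_add_one hLp.ne']; congr 1; push_cast; ring
      _ ≤ _ := by gcongr
  have h2 : exp (-(c * (α ^ 2 * log ⌊x⌋₊))) ≤ exp (-(c * (log g / 2) * L ^ (2 * η))) := by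
    apply exp_le_exp.2
    have h3 : log g / 2 * L ^ (2 * η) ≤ α ^ 2 * log ⌊x⌋₊ := by
      calc _ ≤ log g / 2 * (α ^ 2 * L) := by gcongr
        _ = α ^ 2 * (log g / 2 * L) := by ring
        _ ≤ _ := by gcongr
    have := mul_le_mul_of_nonneg_left h3 hc.le
    linarith
  have h4 : L ^ A * exp (-(c * (log g / 2) * L ^ (2 * η))) ≤ L ^ (-1 : ℝ) := by
    rw [rpow_neg_one, ← one_div, le_div_iff₀ hLp]
    rw [rpow_add_one hLp.ne', rpow_natCast] at e2
    linarith
  calc _ ≤ C * (2 * g * L) ^ A * ⌊x⌋₊ * exp (-(c * (log g / 2) * L ^ (2 * η))) := by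
        have := pow_le_pow_left₀ (by linarith) b1 A
        gcongr
    _ = C * (2 * g) ^ A * ⌊x⌋₊ * (L ^ A * exp (-(c * (log g / 2) * L ^ (2 * η)))) := by rw [mul_pow]; ring
    _ ≤ _ := by gcongr

lemma core (g : ℕ) (hg : 2 ≤ g) (η : ℝ) (hη : 0 < η) (hη2 : η ≤ 1 / 12) : ∃ C L0 : ℝ, 0 < C ∧ ∀ (x : ℝ) (l : ℕ),
    1 ≤ x → L0 ≤ log x / log g →
    |∑ n ∈ (Ioc 0 ⌊x⌋₊).filter (fun n => sg g n = l), vonMangoldt n -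
      ((g : ℝ) - 1) * ((∑ n ∈ Ioc 0 ⌊x⌋₊, wt (g - 1) l n) * gd g l (log x / log g))| ≤
    C * ⌊x⌋₊ * (log x / log g) ^ (-1 + 5 * η : ℝ) := by
  obtain ⟨C1, L1, hC1, hmaj⟩ := major3 g hg η hη hη2
  obtain ⟨C2, L2, hC2, hmin⟩ := minor_L g hg η hη
  have hs := sig2_pos g hg
  have hpi := pi_pos
  have hgr : (2 : ℝ) ≤ g := by exact_mod_cast hg
  have hq : ((g - 1 : ℕ) : ℝ) = (g : ℝ) - 1 := by push_cast [show 1 ≤ g by omega]; ring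
  have hq1 : (1 : ℝ) ≤ (g : ℝ) - 1 := by linarith
  obtain ⟨L0, hL0⟩ := eventually_atTop.1 ((eventually_ge_atTop 2).and ((eventually_ge_atTop L1).and
    ((eventually_ge_atTop L2).and ((eventually_ge_atTop (1 / (sig2 g))).and
    ((ev_exp 1 (π ^ 2 * sig2 g) (2 * η) (by positivity) (by positivity)).and
    (ev_rpow_small (-(1/2) + η) (1 / (2 * ((g : ℝ) - 1))) (by linarith) (by positivity)))))))
  refine ⟨((g : ℝ) - 1) * (2 * C1 + C2 + 6), L0, by positivity, fun x l hx hL => ?_⟩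
  obtain ⟨e1, e2, e3, e4, e5, e6⟩ := hL0 _ hL
  have hI := E_int g hg l ⌊x⌋₊
  replace hmaj := hmaj x l
  replace hmin := hmin x l
  set L := log x / log g with hLd
  set X := ⌊x⌋₊
  set W := ∑ n ∈ Ioc 0 X, wt (g - 1) l n with hW
  have hLp : 0 < L := by linarith
  have hL1 : 1 ≤ L := by linarith
  set δ := L ^ (-(1/2) + η : ℝ) with hδ
  have hδ0 : 0 < δ := by positivity
  set s := sig2 g * L with hsd
  have hs1 : 1 ≤ s := by rwa [div_le_iff₀ hs, mul_comm] at e4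
  set y := ((g : ℝ) - 1) / 2 * L - l with hy
  have hW0 : 0 ≤ W := sum_nonneg fun n _ => wt_nonneg _ _ _
  have hW6 : W ≤ 6 * X := wt_sum_le _ _ _
  set G : ℝ → ℂ := fun α => ee (α * y) * ((exp (-(2 * π ^ 2 * s * α ^ 2)) : ℝ) : ℂ) with hG
  have hGc : Continuous G := by
    have := ee_cont y
    rw [hG]; fun_prop
  have hE0 : (0 : ℝ) ≤ L ^ (-1 + 5 * η : ℝ) := by positivity
  have hL1E : L ^ (-1 : ℝ) ≤ L ^ (-1 + 5 * η : ℝ) := rpow_le_rpow_of_exponent_le hL1 (by linarith)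
  have key := split_int (Iα g l X) (fun α => (W : ℂ) * G α) (Iα_cont g l X) (continuous_const.mul hGc)
    ((W : ℂ) * ((gd g l L : ℝ) : ℂ)) δ (1 / (2 * (g - 1 : ℕ) : ℝ)) (C1 * X * L ^ (-(1/2) + 4 * η : ℝ)) (C2 * X * L ^ (-1 : ℝ))
    (6 * X * L ^ (-1 : ℝ)) hδ0.le (by rw [hq]; exact e6) (by
      rw [hq]; exact one_div_le_one_div_of_le (by norm_num) (by linarith)) (by positivity) ?_ ?_ ?_
  · have hfin : ‖((∑ n ∈ (Ioc 0 X).filter (fun n => sg g n = l), vonMangoldt n : ℝ) : ℂ) -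
        (((g : ℝ) - 1) * (W * gd g l L) : ℝ)‖ ≤ ((g : ℝ) - 1) * (2 * δ * (C1 * X * L ^ (-(1/2) + 4 * η : ℝ)) + C2 * X * L ^ (-1 : ℝ) + 6 * X * L ^ (-1 : ℝ)) := by
      rw [← hI, ← hq, Complex.ofReal_mul, Complex.ofReal_natCast, Complex.ofReal_mul, ← mul_sub, norm_mul, Complex.norm_natCast]
      gcongr
    rw [← Complex.ofReal_sub, Complex.norm_real, norm_eq_abs] at hfin
    refine hfin.trans ?_
    have hd : δ * L ^ (-(1/2) + 4 * η : ℝ) = L ^ (-1 + 5 * η : ℝ) := by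
      rw [hδ, ← rpow_add hLp]; congr 1; ring
    have hX0 : (0 : ℝ) ≤ X := Nat.cast_nonneg X
    calc _ = ((g : ℝ) - 1) * (2 * C1 * X * (δ * L ^ (-(1/2) + 4 * η : ℝ)) + (C2 + 6) * X * L ^ (-1 : ℝ)) := by ring
      _ ≤ ((g : ℝ) - 1) * (2 * C1 * X * L ^ (-1 + 5 * η : ℝ) + (C2 + 6) * X * L ^ (-1 + 5 * η : ℝ)) := by
          rw [hd]; gcongr
      _ = _ := by ring
  · intro α hα
    have hm := hmaj α hx e2 hα
    have e : Iα g l X α - (W : ℂ) * G α = ee (α * y) * (∑ n ∈ Ioc 0 X, (wt (g - 1) l n : ℂ) *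
        ee (α * ((sg g n : ℝ) - ((g : ℝ) - 1) / 2 * L)) -
        (W : ℂ) * ((exp (-(2 * π ^ 2 * sig2 g * α ^ 2 * L)) : ℝ) : ℂ)) := by
      rw [mul_sub, mul_sum, Iα, hG]
      congr 1
      · refine sum_congr rfl fun n _ => ?_
        rw [mul_left_comm, ← ee_add]; congr 2; rw [hy]; ring
      · beta_reduce
        rw [mul_left_comm]; congr 5; rw [hsd]; ring
    rw [e, norm_mul, norm_ee, one_mul]
    exact hm
  · intro α h1 h2
    refine hmin α hx e3 h1 ?_
    rw [hq, le_div_iff₀ (by positivity)] at h2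
    rw [abs_mul, abs_of_pos (by linarith : 0 < (g : ℝ) - 1)]
    linarith
  · have ht := gauss_tail s (by linarith) y δ hδ0.le
    rw [gauss_val s (by linarith) y] at ht
    rw [intervalIntegral.integral_const_mul, ← mul_sub, norm_mul, Complex.norm_real, norm_eq_abs, abs_of_nonneg hW0]
    have hd : δ ^ 2 * L = L ^ (2 * η) := by
      rw [hδ, ← rpow_natCast, ← rpow_mul hLp.le, ← rpow_add_one hLp.ne']; congr 1; push_cast; ring
    have h5 : exp (-(π ^ 2 * s * δ ^ 2)) / √(π * s) ≤ L ^ (-1 : ℝ) := by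
      refine (div_le_self (exp_pos _).le ?_).trans ?_
      · rw [Real.one_le_sqrt]; nlinarith [Real.pi_gt_three]
      · rw [rpow_neg_one, ← one_div, le_div_iff₀ hLp]
        rw [rpow_one] at e5
        have : π ^ 2 * s * δ ^ 2 = π ^ 2 * sig2 g * L ^ (2 * η) := by rw [← hd, hsd]; ring
        rw [this, mul_comm]; exact e5
    exact mul_le_mul hW6 (ht.trans h5) (norm_nonneg _) (by positivity)

lemma gd_le (g : ℕ) (hg : 2 ≤ g) (l : ℕ) (L : ℝ) (hL : 0 < L) : gd g l L ≤ L ^ (-(1/2) : ℝ) := by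
  have hgr : (2 : ℝ) ≤ g := by exact_mod_cast hg
  have hs : 1 / 4 ≤ sig2 g := by unfold sig2; nlinarith
  have h1 : L ≤ 2 * π * (sig2 g * L) := by nlinarith [Real.pi_gt_three, mul_le_mul_of_nonneg_right hs hL.le]
  rw [rpow_neg hL.le, ← Real.sqrt_eq_rpow, gd, ← one_div]
  refine div_le_div₀ zero_le_one (Real.exp_le_one_iff.2 ?_) (Real.sqrt_pos.2 hL) (Real.sqrt_le_sqrt h1)
  have : 0 < sig2 g := by linarith
  have : 0 ≤ (((g : ℝ) - 1) / 2 * L - l) ^ 2 / (2 * (sig2 g * L)) := by positivity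
  linarith

lemma gd_nonneg (g l : ℕ) (L : ℝ) : 0 ≤ gd g l L := by unfold gd; positivity

lemma psi_core (g : ℕ) (hg : 2 ≤ g) (η : ℝ) (hη : 0 < η) (hη2 : η ≤ 1 / 12) : ∃ C L0 : ℝ, 0 < C ∧ ∀ (x : ℝ) (l : ℕ),
    Nat.Coprime l (g - 1) → 3 ≤ x → L0 ≤ log x / log g →
    |∑ n ∈ (Ioc 0 ⌊x⌋₊).filter (fun n => sg g n = l), vonMangoldt n -
      ((g : ℝ) - 1) / (Nat.totient (g - 1)) * ((∑ n ∈ Ioc 0 ⌊x⌋₊, vonMangoldt n) * gd g l (log x / log g))| ≤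
    C * ⌊x⌋₊ * (log x / log g) ^ (-1 + 5 * η : ℝ) := by
  obtain ⟨C1, L1, hC1, h1⟩ := core g hg η hη hη2
  obtain ⟨C2, hC2, h2⟩ := pnt_ap (g - 1) (by omega)
  have hgr : (2 : ℝ) ≤ g := by exact_mod_cast hg
  have hlg : 0 < log g := log_pos (by linarith)
  have hφ : (0 : ℝ) < Nat.totient (g - 1) := by exact_mod_cast Nat.totient_pos.2 (by omega)
  have hφ1 : (1 : ℝ) ≤ Nat.totient (g - 1) := by exact_mod_cast Nat.totient_pos.2 (by omega : 0 < g - 1)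
  set D := (log g / 2) ^ (-(1/2) : ℝ) with hD
  have hD0 : 0 < D := by positivity
  refine ⟨C1 + g * C2 * D, max L1 2, by positivity, fun x l hl hx hL => ?_⟩
  have hL2 := (le_max_right _ _).trans hL
  have k1 := h1 x l (by linarith) ((le_max_left _ _).trans hL)
  have k2 := h2 l ⌊x⌋₊ hl (Nat.le_floor (by exact_mod_cast hx))
  obtain ⟨-, b2⟩ := logX_bounds g hg x (by linarith) hL2
  have k3 : ∑ n ∈ (Ioc 0 ⌊x⌋₊).filter (fun n => n ≡ l [MOD (g - 1)]), vonMangoldt n =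
      ∑ n ∈ Ioc 0 ⌊x⌋₊, wt (g - 1) l n := by rw [sum_filter]; rfl
  rw [k3] at k2
  set L := log x / log g with hLd
  set X := ⌊x⌋₊
  set W := ∑ n ∈ Ioc 0 X, wt (g - 1) l n
  set ψ := ∑ n ∈ Ioc 0 X, vonMangoldt n
  set E := ∑ n ∈ (Ioc 0 X).filter (fun n => sg g n = l), vonMangoldt n
  have hLp : 0 < L := by linarith
  have k4 := gd_le g hg l L hLp
  have k5 := gd_nonneg g l L
  have k6 : log X ^ (-(1/2) : ℝ) ≤ D * L ^ (-(1/2) : ℝ) := by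
    rw [hD, ← Real.mul_rpow (by positivity) hLp.le]
    exact rpow_le_rpow_of_nonpos (by positivity) b2 (by norm_num)
  set φ : ℝ := ((Nat.totient (g - 1) : ℕ) : ℝ)
  set G := gd g l L
  have e : E - ((g : ℝ) - 1) / φ * (ψ * G) = (E - ((g : ℝ) - 1) * (W * G)) + ((g : ℝ) - 1) / φ * ((φ * W - ψ) * G) := by
    field_simp; ring
  have hX0 : (0 : ℝ) ≤ X := Nat.cast_nonneg X
  have k7 : |((g : ℝ) - 1) / φ * ((φ * W - ψ) * G)| ≤ g * (C2 * (X * (D * L ^ (-(1/2) : ℝ))) * L ^ (-(1/2) : ℝ)) := by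
    rw [abs_mul, abs_mul, abs_of_nonneg k5, abs_of_nonneg (div_nonneg (by linarith) hφ.le)]
    have : ((g : ℝ) - 1) / φ ≤ g := (div_le_self (by linarith) hφ1).trans (by linarith)
    have : |φ * W - ψ| ≤ C2 * (X * (D * L ^ (-(1/2) : ℝ))) := k2.trans (by gcongr)
    gcongr
  have k8 : L ^ (-(1/2) : ℝ) * L ^ (-(1/2) : ℝ) ≤ L ^ (-1 + 5 * η : ℝ) := by
    rw [← rpow_add hLp]
    exact rpow_le_rpow_of_exponent_le (by linarith) (by linarith)
  rw [e]
  calc _ ≤ C1 * X * L ^ (-1 + 5 * η : ℝ) + g * (C2 * (X * (D * L ^ (-(1/2) : ℝ))) * L ^ (-(1/2) : ℝ)) :=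
        (abs_add_le _ _).trans (add_le_add k1 k7)
    _ = C1 * X * L ^ (-1 + 5 * η : ℝ) + g * C2 * D * X * (L ^ (-(1/2) : ℝ) * L ^ (-(1/2) : ℝ)) := by ring
    _ ≤ C1 * X * L ^ (-1 + 5 * η : ℝ) + g * C2 * D * X * L ^ (-1 + 5 * η : ℝ) := by gcongr
    _ = _ := by ring

lemma sqrt_log_le2 (X : ℕ) (hX : 3 ≤ X) : √X * log X ≤ 16 * (X / log X) := by
  have hX0 : (0 : ℝ) < X := by exact_mod_cast (by omega : 0 < X)
  have hl := log_ge_one X hX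
  have h1 : log X ≤ 4 * √(√X) := by
    have h := Real.log_le_self (sqrt_nonneg √(X : ℝ))
    rw [Real.log_sqrt (sqrt_nonneg _), Real.log_sqrt hX0.le] at h
    linarith
  have h2 : log X * log X ≤ 16 * √X := by
    have h3 := mul_le_mul h1 h1 (by linarith) (by positivity)
    have h4 := Real.mul_self_sqrt (sqrt_nonneg (X : ℝ))
    linarith
  have h3 := mul_le_mul_of_nonneg_left h2 (sqrt_nonneg (X : ℝ))
  have h4 := Real.mul_self_sqrt hX0.le
  rw [← mul_div_assoc, le_div_iff₀ (by linarith)]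
  linarith

lemma prime_def (X : ℕ) (hX : 3 ≤ X) :
    ∑ p ∈ (Ioc 0 X).filter Nat.Prime, (log X - log p) ≤ 28 * (X / log X) := by
  have hl := log_ge_one X hX
  have h0 : ∀ n ∈ Ioc 0 X, 0 ≤ log X - log n := by
    intro n hn
    rw [mem_Ioc] at hn
    have : log n ≤ log X := log_le_log (by exact_mod_cast hn.1) (by exact_mod_cast hn.2)
    linarith
  have h1 : ∀ n ∈ Ioc 0 X, (if n.Prime then log X - log n else 0) ≤
      (if n ≤ Nat.sqrt X then log X else 0) +
        2 / log X * (vonMangoldt n * (log X - log n)) := by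
    intro n hn
    have hn0 := h0 n hn
    have hΛ := vonMangoldt_nonneg (n := n)
    have h2 : 0 ≤ 2 / log X * (vonMangoldt n * (log X - log n)) := by positivity
    rw [mem_Ioc] at hn
    have hnl := log_natCast_nonneg n
    by_cases hp : n.Prime
    · rw [if_pos hp]
      by_cases hs : n ≤ Nat.sqrt X
      · rw [if_pos hs]; linarith
      · rw [if_neg hs, zero_add, vonMangoldt_apply_prime hp]
        have h3 : X < n * n := Nat.sqrt_lt.1 (by omega)
        have h4 : log X ≤ 2 * log n := by
          have h5 : log X ≤ log ((n : ℝ) * n) := log_le_log (by exact_mod_cast (by omega : 0 < X)) (by exact_mod_cast h3.le)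
          rw [Real.log_mul (by exact_mod_cast hn.1.ne') (by exact_mod_cast hn.1.ne')] at h5
          linarith
        rw [← mul_assoc]
        refine le_mul_of_one_le_left hn0 ?_
        rw [div_mul_eq_mul_div, le_div_iff₀ (by linarith), one_mul]; exact h4
    · rw [if_neg hp]
      split_ifs <;> linarith
  rw [sum_filter]
  refine (sum_le_sum h1).trans ?_
  rw [sum_add_distrib, ← mul_sum, ← sum_filter, sum_const, nsmul_eq_mul]
  have h6 := sum_lambda_log X
  have h7 : (((Ioc 0 X).filter (fun n => n ≤ Nat.sqrt X)).card : ℝ) ≤ √X := by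
    refine le_trans ?_ (Real.nat_sqrt_le_real_sqrt)
    have : ((Ioc 0 X).filter (fun n => n ≤ Nat.sqrt X)) ⊆ Ioc 0 (Nat.sqrt X) := by
      intro n; simp only [mem_filter, mem_Ioc]; omega
    have := card_le_card this
    rw [Nat.card_Ioc] at this
    exact_mod_cast this
  have h8 := sqrt_log_le2 X hX
  have h9 : 2 / log X * ∑ n ∈ Ioc 0 X, vonMangoldt n * (log X - log n) ≤ 2 / log X * (6 * X) := by
    gcongr
  have h10 : 2 / log X * (6 * X) = 12 * (X / log X) := by ring
  have h11 := mul_le_mul_of_nonneg_right h7 (by linarith : 0 ≤ log X)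
  linarith

lemma red (X : ℕ) (hX : 3 ≤ X) (S : ℕ → Prop) [DecidablePred S] :
    |log X * (((range (X + 1)).filter (fun p => p.Prime ∧ S p)).card : ℝ) -
      ∑ n ∈ (Ioc 0 X).filter S, vonMangoldt n| ≤ 60 * (X / log X) := by
  have e1 : (range (X + 1)).filter (fun p => p.Prime ∧ S p) = ((Ioc 0 X).filter Nat.Prime).filter S := by
    ext p
    simp only [mem_filter, mem_range, mem_Ioc]
    constructor
    · rintro ⟨h1, h2, h3⟩; exact ⟨⟨⟨h2.pos, by omega⟩, h2⟩, h3⟩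
    · rintro ⟨⟨⟨h0, h1⟩, h2⟩, h3⟩; exact ⟨by omega, h2, h3⟩
  have e2 : ∑ n ∈ (Ioc 0 X).filter S, vonMangoldt n =
      ∑ n ∈ ((Ioc 0 X).filter Nat.Prime).filter S, log n +
      ∑ n ∈ ((Ioc 0 X).filter (fun n => ¬ n.Prime)).filter S, vonMangoldt n := by
    rw [← sum_filter_add_sum_filter_not ((Ioc 0 X).filter S) Nat.Prime, filter_comm, filter_comm (fun n => ¬ n.Prime) S]
    congr 1
    refine sum_congr rfl fun n hn => ?_
    rw [mem_filter, mem_filter] at hn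
    exact vonMangoldt_apply_prime hn.1.2
  have e3 : log X * ((((Ioc 0 X).filter Nat.Prime).filter S).card : ℝ) - ∑ n ∈ ((Ioc 0 X).filter Nat.Prime).filter S, log n
      = ∑ n ∈ ((Ioc 0 X).filter Nat.Prime).filter S, (log X - log n) := by
    rw [sum_sub_distrib, sum_const, nsmul_eq_mul]; ring
  have h0 : ∀ n ∈ (Ioc 0 X).filter Nat.Prime, 0 ≤ log X - log n := by
    intro n hn
    rw [mem_filter, mem_Ioc] at hn
    have : log n ≤ log X := log_le_log (by exact_mod_cast hn.1.1) (by exact_mod_cast hn.1.2)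
    linarith
  have a1 := (sum_le_sum_of_subset_of_nonneg (filter_subset S _) (fun n hn _ => h0 n hn)).trans (prime_def X hX)
  have a2 : 0 ≤ ∑ n ∈ ((Ioc 0 X).filter Nat.Prime).filter S, (log X - log n) :=
    sum_nonneg fun n hn => h0 n (filter_subset _ _ hn)
  have a3 := (sum_le_sum_of_subset_of_nonneg (filter_subset S ((Ioc 0 X).filter (fun n => ¬ n.Prime)))
    (fun n _ _ => vonMangoldt_nonneg (n := n))).trans (nonprime_mass X (by omega))
  have a4 : 0 ≤ ∑ n ∈ ((Ioc 0 X).filter (fun n => ¬ n.Prime)).filter S, vonMangoldt n :=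
    sum_nonneg fun n _ => vonMangoldt_nonneg
  have a5 := sqrt_log_le2 X hX
  have a6 : 0 ≤ (X : ℝ) / log X := div_nonneg (Nat.cast_nonneg _) (log_natCast_nonneg _)
  rw [e1, e2, abs_le]
  constructor <;> linarith

lemma pi_low (X : ℕ) (hX : 3 ≤ X) : (X : ℝ) ≤ 10 * ((((range (X + 1)).filter Nat.Prime).card : ℝ) * log X) := by
  have hXr : (3 : ℝ) ≤ X := by exact_mod_cast hX
  have h := Chebyshev.pi_ge X
  have hl := log_ge_one X hX
  have e : Nat.primeCounting X = ((range (X + 1)).filter Nat.Prime).card := by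
    rw [Nat.primeCounting, Nat.primeCounting', Nat.count_eq_card_filter_range]
  rw [e, div_le_iff₀ (by linarith)] at h
  have h1 : log ((X : ℝ) + 1) ≤ ((X : ℝ) + 1) / 8 - 1 + 3 * log 2 := by
    have h2 := Real.log_le_sub_one_of_pos (by positivity : 0 < ((X : ℝ) + 1) / 8)
    rw [Real.log_div (by positivity) (by norm_num), show (8 : ℝ) = 2 ^ 3 by norm_num, Real.log_pow] at h2
    push_cast at h2
    linarith
  have h3 := Real.log_two_gt_d9
  have h4 := Real.log_two_lt_d9
  have h5 : (X : ℝ) * 0.69 ≤ X * log 2 := by gcongr; linarith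
  linarith

lemma large (g : ℕ) (hg : 2 ≤ g) (η : ℝ) (hη : 0 < η) (hη2 : η ≤ 1 / 12) : ∃ C L0 : ℝ, 0 < C ∧ ∀ (x : ℝ) (l : ℕ),
    Nat.Coprime l (g - 1) → 3 ≤ x → L0 ≤ log x / log g →
    |(((range (⌊x⌋₊ + 1)).filter (fun p => p.Prime ∧ sg g p = l)).card : ℝ) -
      ((g : ℝ) - 1) / (Nat.totient (g - 1)) * ((((range (⌊x⌋₊ + 1)).filter Nat.Prime).card : ℝ) * gd g l (log x / log g))| ≤
    C * (((range (⌊x⌋₊ + 1)).filter Nat.Prime).card : ℝ) * (log x / log g) ^ (-1 + 5 * η : ℝ) := by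
  obtain ⟨C1, L1, hC1, h1⟩ := psi_core g hg η hη hη2
  have hgr : (2 : ℝ) ≤ g := by exact_mod_cast hg
  have hlg : 0 < log g := log_pos (by linarith)
  have hφ1 : (1 : ℝ) ≤ Nat.totient (g - 1) := by exact_mod_cast Nat.totient_pos.2 (by omega : 0 < g - 1)
  set D := 60 * (1 + g) * (2 / log g) with hD
  have hD0 : 0 < D := by positivity
  refine ⟨10 * (C1 + D), max L1 2, by positivity, fun x l hl hx hL => ?_⟩
  have hL2 := (le_max_right _ _).trans hL
  have hX3 : 3 ≤ ⌊x⌋₊ := Nat.le_floor (by exact_mod_cast hx)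
  have k1 := h1 x l hl hx ((le_max_left _ _).trans hL)
  have k2 := red ⌊x⌋₊ hX3 (fun p => sg g p = l)
  have k3 := red ⌊x⌋₊ hX3 (fun p => True)
  simp only [and_true, filter_true] at k3
  have k4 := pi_low ⌊x⌋₊ hX3
  have hl1 := log_ge_one ⌊x⌋₊ hX3
  obtain ⟨-, b2⟩ := logX_bounds g hg x (by linarith) hL2
  set L := log x / log g with hLd
  set X := ⌊x⌋₊
  have hLp : 0 < L := by linarith
  have k5 := gd_nonneg g l L
  have k6 : gd g l L ≤ 1 := (gd_le g hg l L hLp).trans (rpow_le_one_of_one_le_of_nonpos (by linarith) (by norm_num))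
  have k7 : L ^ (-1 : ℝ) ≤ L ^ (-1 + 5 * η : ℝ) := rpow_le_rpow_of_exponent_le (by linarith) (by linarith)
  have k8 : (X : ℝ) / log X ≤ 2 / log g * X * L ^ (-1 + 5 * η : ℝ) := by
    calc (X : ℝ) / log X ≤ X / (log g / 2 * L) := by gcongr
      _ = 2 / log g * X * L ^ (-1 : ℝ) := by rw [rpow_neg_one]; field_simp
      _ ≤ _ := by gcongr
  set ψ := ∑ n ∈ Ioc 0 X, vonMangoldt n
  set E := ∑ n ∈ (Ioc 0 X).filter (fun n => sg g n = l), vonMangoldt n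
  set P := (((range (X + 1)).filter (fun p => p.Prime ∧ sg g p = l)).card : ℝ)
  set Q := (((range (X + 1)).filter Nat.Prime).card : ℝ)
  set R := ((g : ℝ) - 1) / (Nat.totient (g - 1))
  have hR0 : 0 ≤ R := div_nonneg (by linarith) (by linarith)
  have hRg : R ≤ g := (div_le_self (by linarith) hφ1).trans (by linarith)
  set G := gd g l L
  set T := L ^ (-1 + 5 * η : ℝ)
  have hT : 0 < T := by positivity
  have hY : 0 ≤ (X : ℝ) / log X := by positivity
  have e : log X * (P - R * (Q * G)) = (log X * P - E) + (E - R * (ψ * G)) - R * G * (log X * Q - ψ) := by ring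
  have m1 : |R * G * (log X * Q - ψ)| ≤ g * 1 * (60 * (X / log X)) := by
    rw [abs_mul, abs_mul, abs_of_nonneg hR0, abs_of_nonneg k5]
    gcongr
  have m2 : log X * |P - R * (Q * G)| ≤ 60 * (X / log X) + C1 * X * T + g * 1 * (60 * (X / log X)) := by
    rw [← abs_of_pos (by linarith : 0 < log X), ← abs_mul, e, abs_of_pos (by linarith : 0 < log X)]
    exact (abs_sub _ _).trans (add_le_add ((abs_add_le _ _).trans (add_le_add k2 k1)) m1)
  have m3 : log X * |P - R * (Q * G)| ≤ log X * (10 * (C1 + D) * Q * T) := by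
    calc _ ≤ 60 * (1 + g) * (X / log X) + C1 * X * T := by linarith
      _ ≤ 60 * (1 + g) * (2 / log g * X * T) + C1 * X * T := by gcongr
      _ = (C1 + D) * X * T := by rw [hD]; ring
      _ ≤ (C1 + D) * (10 * (Q * log X)) * T := by gcongr
      _ = _ := by ring
  exact le_of_mul_le_mul_left m3 (by linarith)

lemma small (P Q F S V R L L0 lg ε : ℝ) (hP0 : 0 ≤ P) (hPQ : P ≤ Q) (hF0 : 0 ≤ F) (hF : F ≤ 1) (hV : 0 < V)
    (hR : 1 ≤ R) (hL : 0 < L) (hL0 : L ≤ L0) (hlg : 1 ≤ lg) (hlgL : lg ≤ V * L0) (hS : 0 < S) (hε : 0 < ε) :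
    |P - R * (Q / √(S * L)) * F| ≤
      ((1 + √(S * L0)) * (V * L0) ^ (1/2 : ℝ)) * R * (Q / √(S * L)) * lg ^ (-(1:ℝ) / 2 + ε) := by
  have hs : 0 < √(S * L) := by positivity
  have hQ : 0 ≤ Q := hP0.trans hPQ
  set K := R * (Q / √(S * L)) with hK
  have hK0 : 0 ≤ K := by positivity
  have h1 : Q ≤ K * √(S * L0) := by
    calc Q = 1 * (Q / √(S * L)) * √(S * L) := by field_simp
      _ ≤ R * (Q / √(S * L)) * √(S * L0) := by gcongr
  have h2 : |P - K * F| ≤ K * (1 + √(S * L0)) := by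
    have : K * F ≤ K := mul_le_of_le_one_right hK0 hF
    have : 0 ≤ K * F := by positivity
    have : 0 ≤ K * √(S * L0) := by positivity
    rw [abs_le]; constructor <;> linarith
  have h3 : 1 ≤ (V * L0) ^ (1/2 : ℝ) * lg ^ (-(1:ℝ) / 2 + ε) := by
    calc (1 : ℝ) = lg ^ (1/2 : ℝ) * lg ^ (-(1/2) : ℝ) := by rw [← rpow_add (by linarith)]; norm_num
      _ ≤ _ := mul_le_mul (rpow_le_rpow (by linarith) hlgL (by norm_num))
          (rpow_le_rpow_of_exponent_le hlg (by linarith)) (by positivity) (rpow_nonneg (by linarith) _)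
  refine h2.trans ((le_mul_of_one_le_right (by positivity) h3).trans (le_of_eq ?_))
  ring
end DMR

theorem drmota_mauduit_rivat (g : ℕ) (hg : 2 ≤ g) (ε : ℝ) (hε : 0 < ε) :
    ∃ C : ℝ, ∀ x : ℝ, 3 ≤ x → ∀ ℓ : ℕ, Nat.Coprime ℓ (g - 1) →
      |(((Finset.range (⌊x⌋₊ + 1)).filter
            (fun p => Nat.Prime p ∧ (Nat.digits g p).sum = ℓ)).card : ℝ) -
          ((g - 1 : ℝ) / (Nat.totient (g - 1) : ℝ)) *
            ((((Finset.range (⌊x⌋₊ + 1)).filter Nat.Prime).card : ℝ) /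
              Real.sqrt (2 * π * ((g ^ 2 - 1 : ℝ) / 12) * (Real.log x / Real.log g))) *
            Real.exp (-((ℓ : ℝ) - ((g - 1 : ℝ) / 2) * Real.log x / Real.log g) ^ 2 /
              (2 * ((g ^ 2 - 1 : ℝ) / 12) * (Real.log x / Real.log g)))| ≤
        C * ((g - 1 : ℝ) / (Nat.totient (g - 1) : ℝ)) *
          ((((Finset.range (⌊x⌋₊ + 1)).filter Nat.Prime).card : ℝ) /
            Real.sqrt (2 * π * ((g ^ 2 - 1 : ℝ) / 12) * (Real.log x / Real.log g))) *
          Real.log x ^ (-(1 : ℝ) / 2 + ε) := by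
  set η := min (ε / 5) (1 / 12) with hηd
  have hη : 0 < η := by rw [hηd]; positivity
  have hη5 : 5 * η ≤ ε := by have := min_le_left (ε / 5) (1 / 12); rw [hηd]; linarith
  obtain ⟨C1, L0, hC1, h1⟩ := DMR.large g hg η hη (min_le_right _ _)
  have hgr : (2 : ℝ) ≤ g := by exact_mod_cast hg
  have hlg : 0 < log g := log_pos (by linarith)
  have hs : 0 < (g ^ 2 - 1 : ℝ) / 12 := DMR.sig2_pos g hg
  have hφ0 : (0 : ℝ) < Nat.totient (g - 1) := by exact_mod_cast Nat.totient_pos.2 (by omega : 0 < g - 1)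
  have hR1 : 1 ≤ (g - 1 : ℝ) / (Nat.totient (g - 1) : ℝ) := by
    rw [one_le_div hφ0]
    have : ((Nat.totient (g - 1) : ℕ) : ℝ) ≤ ((g - 1 : ℕ) : ℝ) := by exact_mod_cast Nat.totient_le (g - 1)
    rwa [Nat.cast_sub (by omega), Nat.cast_one] at this
  set S := 2 * π * ((g ^ 2 - 1 : ℝ) / 12) with hS
  have hS0 : 0 < S := by positivity
  set C2 := (1 + √(S * L0)) * (log g * L0) ^ (1/2 : ℝ)
  set C3 := C1 * √S * log g ^ (-(-1 / 2 + 5 * η) : ℝ) with hC3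
  refine ⟨max C2 C3, fun x hx l hl => ?_⟩
  have hlx : 1 ≤ log x := by
    rw [Real.le_log_iff_exp_le (by linarith)]
    linarith [Real.exp_one_lt_d9]
  have h1 := h1 x l hl hx
  set L := log x / log g with hLd
  have hLp : 0 < L := div_pos (by linarith) hlg
  set F := exp (-((l : ℝ) - ((g - 1 : ℝ) / 2) * log x / log g) ^ 2 / (2 * ((g ^ 2 - 1 : ℝ) / 12) * L)) with hF
  set P := (((Finset.range (⌊x⌋₊ + 1)).filter (fun p => Nat.Prime p ∧ (Nat.digits g p).sum = l)).card : ℝ) with hP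
  set Q := (((Finset.range (⌊x⌋₊ + 1)).filter Nat.Prime).card : ℝ) with hQ
  set R := (g - 1 : ℝ) / (Nat.totient (g - 1) : ℝ)
  have hT : 0 ≤ R * (Q / √(S * L)) * log x ^ (-(1:ℝ) / 2 + ε) := by positivity
  suffices h : ∃ C, C ≤ max C2 C3 ∧ |P - R * (Q / √(S * L)) * F| ≤ C * R * (Q / √(S * L)) * log x ^ (-(1:ℝ) / 2 + ε) by
    obtain ⟨C, hC, h⟩ := h
    refine h.trans ?_
    have := mul_le_mul_of_nonneg_right hC hT
    linarith
  rcases le_or_gt L0 L with hc | hc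
  · refine ⟨C3, le_max_right _ _, ?_⟩
    have h2 := h1 hc
    have eG : DMR.gd g l L = F / √(S * L) := by
      rw [DMR.gd, hF, DMR.sig2, hS]
      congr 2
      · rw [hLd]; field_simp; ring
      · ring
    have e1 : R * (Q * DMR.gd g l L) = R * (Q / √(S * L)) * F := by rw [eG]; ring
    rw [e1] at h2
    refine le_trans h2 ?_
    have a1 : L ^ (-1 + 5 * η : ℝ) = (√L)⁻¹ * L ^ (-1 / 2 + 5 * η : ℝ) := by
      rw [Real.sqrt_eq_rpow, ← rpow_neg hLp.le, ← rpow_add hLp]; congr 1; ring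
    have a2 : L ^ (-1 / 2 + 5 * η : ℝ) = log x ^ (-1 / 2 + 5 * η : ℝ) * log g ^ (-(-1 / 2 + 5 * η) : ℝ) := by
      rw [hLd, Real.div_rpow (by linarith) hlg.le, rpow_neg hlg.le, div_eq_mul_inv]
    have a3 : log x ^ (-1 / 2 + 5 * η : ℝ) ≤ log x ^ (-(1:ℝ) / 2 + ε) :=
      rpow_le_rpow_of_exponent_le hlx (by linarith)
    have hSs : 0 < √S := Real.sqrt_pos.2 hS0
    have hLs : 0 < √L := Real.sqrt_pos.2 hLp
    rw [Real.sqrt_mul hS0.le]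
    calc C1 * Q * L ^ (-1 + 5 * η : ℝ) = C3 * 1 * (Q / (√S * √L)) * log x ^ (-1 / 2 + 5 * η : ℝ) := by
          rw [a1, a2, hC3]; field_simp
      _ ≤ _ := by
          have : 0 ≤ C3 := by positivity
          gcongr
  · refine ⟨C2, le_max_left _ _, ?_⟩
    refine DMR.small P Q F S (log g) R L L0 (log x) ε (by positivity) ?_ (by positivity) ?_ hlg hR1 hLp hc.le hlx ?_ hS0 hε
    · rw [hP, hQ]
      exact_mod_cast Finset.card_le_card (fun p hp => by
        rw [Finset.mem_filter] at hp ⊢; exact ⟨hp.1, hp.2.1⟩)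
    · rw [hF, Real.exp_le_one_iff, neg_div]
      have : 0 ≤ ((l : ℝ) - ((g - 1 : ℝ) / 2) * log x / log g) ^ 2 / (2 * ((g ^ 2 - 1 : ℝ) / 12) * L) := by positivity
      linarith
    · have : log x = log g * L := by rw [hLd]; field_simp
      rw [this]; gcongr
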